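/- Let d ≥ 2 be an integer. There exists a constant C > 0 such that for all Schwartz functions f, g on ℝ and every 0 < ε < 1: ‖x ↦ ∫_{ε<|t|<1} f(x−t) g(x−t^d) t^{−1} dt‖_{L¹(ℝ)} ≤ C ‖f‖_{L²(ℝ)} ‖g‖_{L²(ℝ)}. That is, the truncated bilinear Hilbert transform along the curve (t, t^d) is bounded from L²(ℝ)×L²(ℝ) to L¹(ℝ). -/

import Mathlib

open MeasureTheory Real Set

/-- Bounded measurable functions with bounded support. -/
def Nice {E : Type*} [NormedAddCommGroup E] [MeasurableSpace E] (f : E → ℝ) : Prop :=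
  Measurable f ∧ (∃ C, ∀ x, |f x| ≤ C) ∧ ∃ R, ∀ x, R < ‖x‖ → f x = 0

/-- The `L²` norm of a real function, as a real number. -/
noncomputable def l2 {E : Type*} [MeasureSpace E] (f : E → ℝ) : ℝ := √(∫ x, f x ^ 2)

namespace Nice

section general
variable {E F : Type*} [NormedAddCommGroup E] [MeasurableSpace E]
  [NormedAddCommGroup F] [MeasurableSpace F]

theorem integrable [OpensMeasurableSpace E] [ProperSpace E] {f : E → ℝ} (hf : Nice f)
    (μ : Measure E) [IsFiniteMeasureOnCompacts μ] : Integrable f μ := by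
  obtain ⟨hm, ⟨C, hC⟩, R, hR⟩ := hf
  have h1 : IntegrableOn f (Metric.closedBall 0 R) μ := by
    refine Measure.integrableOn_of_bounded (M := C) ?_ hm.aestronglyMeasurable ?_
    · exact (isCompact_closedBall 0 R).measure_lt_top.ne
    · exact Filter.Eventually.of_forall fun x => by simpa using hC x
  refine (integrableOn_iff_integrable_of_support_subset ?_).1 h1
  intro x hx
  by_contra h
  simp only [Metric.mem_closedBall, dist_zero_right, not_le] at h
  exact hx (hR x h)

theorem mul_bdd {f g : E → ℝ} (hf : Nice f) (hg : Measurable g) (hb : ∃ C, ∀ x, |g x| ≤ C) :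
    Nice (fun x => f x * g x) := by
  obtain ⟨hm, ⟨C, hC⟩, R, hR⟩ := hf
  obtain ⟨D, hD⟩ := hb
  refine ⟨hm.mul hg, ⟨C * D, fun x => ?_⟩, R, fun x hx => by simp [hR x hx]⟩
  rw [abs_mul]
  exact mul_le_mul (hC x) (hD x) (abs_nonneg _) ((abs_nonneg _).trans (hC x))

theorem mul {f g : E → ℝ} (hf : Nice f) (hg : Nice g) : Nice (fun x => f x * g x) :=
  hf.mul_bdd hg.1 hg.2.1

theorem bdd_mul {f g : E → ℝ} (hf : Nice f) (hg : Measurable g) (hb : ∃ C, ∀ x, |g x| ≤ C) :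
    Nice (fun x => g x * f x) := by
  simpa only [mul_comm] using hf.mul_bdd hg hb

theorem const_mul {f : E → ℝ} (hf : Nice f) (c : ℝ) : Nice (fun x => c * f x) :=
  hf.bdd_mul measurable_const ⟨|c|, fun _ => le_rfl⟩

theorem zero : Nice (fun _ : E => (0 : ℝ)) :=
  ⟨measurable_const, ⟨0, by simp⟩, 0, by simp⟩

theorem add {f g : E → ℝ} (hf : Nice f) (hg : Nice g) : Nice (fun x => f x + g x) := by
  obtain ⟨hm, ⟨C, hC⟩, R, hR⟩ := hf
  obtain ⟨hm', ⟨D, hD⟩, S, hS⟩ := hg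
  refine ⟨hm.add hm', ⟨C + D, fun x => (abs_add_le _ _).trans (add_le_add (hC x) (hD x))⟩,
    max R S, fun x hx => ?_⟩
  rw [max_lt_iff] at hx
  simp [hR x hx.1, hS x hx.2]

theorem neg {f : E → ℝ} (hf : Nice f) : Nice (fun x => - f x) := by
  simpa using hf.const_mul (-1)

theorem sub {f g : E → ℝ} (hf : Nice f) (hg : Nice g) : Nice (fun x => f x - g x) := by
  simpa [sub_eq_add_neg] using hf.add hg.neg

theorem abs {f : E → ℝ} (hf : Nice f) : Nice (fun x => |f x|) := by
  obtain ⟨hm, ⟨C, hC⟩, R, hR⟩ := hf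
  exact ⟨hm.abs, ⟨C, fun x => by simpa using hC x⟩, R, fun x hx => by simp [hR x hx]⟩

theorem sq {f : E → ℝ} (hf : Nice f) : Nice (fun x => f x ^ 2) := by
  simpa only [pow_two] using hf.mul hf

theorem sum {ι : Type*} (s : Finset ι) {f : ι → E → ℝ} (hf : ∀ i ∈ s, Nice (f i)) :
    Nice (fun x => ∑ i ∈ s, f i x) := by
  classical
  induction s using Finset.induction_on with
  | empty => simpa using zero
  | insert a s ha ih =>
    simp only [Finset.sum_insert ha]
    exact (hf a (by simp)).add (ih fun i hi => hf i (by simp [hi]))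

/-- A measurable function dominated by a nice function is nice. -/
theorem of_le {f g : E → ℝ} (hg : Nice g) (hf : Measurable f) (h : ∀ x, |f x| ≤ |g x|) :
    Nice f := by
  obtain ⟨_, ⟨C, hC⟩, R, hR⟩ := hg
  refine ⟨hf, ⟨C, fun x => (h x).trans (hC x)⟩, R, fun x hx => ?_⟩
  have := h x
  rw [hR x hx, abs_zero] at this
  exact abs_nonpos_iff.1 this

theorem integral_right [OpensMeasurableSpace F] [ProperSpace F] {μ : Measure F}
    [IsFiniteMeasureOnCompacts μ] [SFinite μ] {K : E × F → ℝ} (hK : Nice K) :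
    Nice (fun x => ∫ y, K (x, y) ∂μ) := by
  obtain ⟨hm, ⟨C, hC⟩, R, hR⟩ := hK
  refine ⟨(hm.stronglyMeasurable.integral_prod_right' (ν := μ)).measurable,
    ⟨C * μ.real (Metric.closedBall 0 R), fun x => ?_⟩, R, fun x hx => ?_⟩
  · have h1 : ∫ y, K (x, y) ∂μ = ∫ y in Metric.closedBall 0 R, K (x, y) ∂μ := by
      refine (setIntegral_eq_integral_of_forall_compl_eq_zero fun y hy => hR _ ?_).symm
      simp only [Metric.mem_closedBall, dist_zero_right, not_le] at hy
      exact hy.trans_le (le_max_right _ _)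
    show |∫ y, K (x, y) ∂μ| ≤ _
    rw [h1]
    have := norm_setIntegral_le_of_norm_le_const (μ := μ) (s := Metric.closedBall (0:F) R)
      (f := fun y => K (x, y)) (C := C) (isCompact_closedBall 0 R).measure_lt_top
      (fun y _ => by simpa using hC (x, y))
    simpa using this
  · have : ∀ y, K (x, y) = 0 := fun y => hR _ (hx.trans_le (le_max_left _ _))
    simp [this]

end general

theorem swap {E F : Type*} [NormedAddCommGroup E] [MeasureSpace E] [NormedAddCommGroup F]
    [MeasureSpace F] [ProperSpace E] [ProperSpace F] [OpensMeasurableSpace (E × F)]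
    [SFinite (volume : Measure E)] [SFinite (volume : Measure F)]
    [IsFiniteMeasureOnCompacts ((volume : Measure E).prod (volume : Measure F))]
    {K : E → F → ℝ} (hK : Nice (fun p : E × F => K p.1 p.2)) :
    ∫ x, ∫ y, K x y = ∫ y, ∫ x, K x y :=
  integral_integral_swap (hK.integrable _)

/-- Composition with a shear `x - c τ`, multiplied by a kernel in `τ`. -/
theorem shear {F : Type*} [NormedAddCommGroup F] [MeasurableSpace F] {f : ℝ → ℝ} {k : F → ℝ}
    {c : F → ℝ} (hf : Nice f) (hk : Nice k) (hc : Measurable c) {B : ℝ}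
    (hB : ∀ τ, k τ ≠ 0 → |c τ| ≤ B) : Nice (fun p : ℝ × F => f (p.1 - c p.2) * k p.2) := by
  obtain ⟨hm, ⟨C, hC⟩, R, hR⟩ := hf
  obtain ⟨hm', ⟨D, hD⟩, S, hS⟩ := hk
  refine ⟨(hm.comp (measurable_fst.sub (hc.comp measurable_snd))).mul (hm'.comp measurable_snd),
    ⟨C * D, fun x => ?_⟩, max (R + B) S, fun p hp => ?_⟩
  · rw [abs_mul]
    exact mul_le_mul (hC _) (hD _) (abs_nonneg _) ((abs_nonneg _).trans (hC 0))
  · by_cases h0 : k p.2 = 0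
    · simp [h0]
    · have h2 : ‖p.2‖ ≤ S := by
        by_contra h; exact h0 (hS _ (not_le.1 h))
      have h1 : R + B < |p.1| := by
        rcases lt_max_iff.1 (show max (R + B) S < max ‖p.1‖ ‖p.2‖ from hp) with h | h
        · exact (le_max_left _ _).trans_lt h
        · exact absurd ((le_max_right _ _).trans_lt h) (not_lt.2 h2)
      have h3 := hB _ h0
      have : f (p.1 - c p.2) = 0 := by
        apply hR
        rw [Real.norm_eq_abs]
        have := abs_sub_abs_le_abs_sub p.1 (c p.2)
        linarith
      simp [this]

theorem comp_sub {f : ℝ → ℝ} (hf : Nice f) (a : ℝ) : Nice (fun x => f (x - a)) := by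
  obtain ⟨hm, ⟨C, hC⟩, R, hR⟩ := hf
  refine ⟨hm.comp (measurable_id.sub_const a), ⟨C, fun x => hC _⟩, R + |a|, fun x hx => hR _ ?_⟩
  rw [Real.norm_eq_abs] at hx ⊢
  have := abs_sub_abs_le_abs_sub x a
  linarith

theorem comp_mul {f : ℝ → ℝ} (hf : Nice f) {a : ℝ} (ha : a ≠ 0) : Nice (fun x => f (a * x)) := by
  obtain ⟨hm, ⟨C, hC⟩, R, hR⟩ := hf
  refine ⟨hm.comp (measurable_id.const_mul a), ⟨C, fun x => hC _⟩, R / |a|, fun x hx => hR _ ?_⟩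
  rw [Real.norm_eq_abs] at hx ⊢
  rw [div_lt_iff₀ (abs_pos.2 ha)] at hx
  rw [abs_mul]
  linarith

theorem indicator {E : Type*} [NormedAddCommGroup E] [MeasurableSpace E] {f : E → ℝ}
    (hf : Nice f) {s : Set E} (hs : MeasurableSet s) : Nice (s.indicator f) := by
  refine hf.of_le (hf.1.indicator hs) fun x => ?_
  by_cases h : x ∈ s <;> simp [h]

end Nice

section l2
variable {E : Type*} [NormedAddCommGroup E] [MeasureSpace E] [OpensMeasurableSpace E]
  [ProperSpace E] [IsFiniteMeasureOnCompacts (volume : Measure E)]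

theorem l2_nonneg {E : Type*} [MeasureSpace E] (f : E → ℝ) : 0 ≤ l2 f := Real.sqrt_nonneg _

theorem l2_sq {E : Type*} [MeasureSpace E] (f : E → ℝ) : l2 f ^ 2 = ∫ x, f x ^ 2 :=
  Real.sq_sqrt (integral_nonneg fun _ => sq_nonneg _)

theorem abs_integral_mul_le {f g : E → ℝ} (hf : Nice f) (hg : Nice g) :
    |∫ x, f x * g x| ≤ l2 f * l2 g := by
  have hff := hf.sq.integrable (volume : Measure E)
  have hgg := hg.sq.integrable (volume : Measure E)
  have hfg := (hf.mul hg).integrable (volume : Measure E)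
  have key : ∀ t : ℝ, 0 ≤ (∫ x, g x ^ 2) * (t * t) + (2 * ∫ x, f x * g x) * t + ∫ x, f x ^ 2 := by
    intro t
    have h0 : 0 ≤ ∫ x, (f x + t * g x) ^ 2 := integral_nonneg fun _ => sq_nonneg _
    have h1 : ∫ x, (f x + t * g x) ^ 2
        = ∫ x, ((t * t) * g x ^ 2 + (2 * t) * (f x * g x) + f x ^ 2) := by
      congr 1; ext x; ring
    have h2 : Integrable (fun x => (t * t) * g x ^ 2 + (2 * t) * (f x * g x)) :=
      (hgg.const_mul _).add (hfg.const_mul _)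
    rw [h1, integral_add h2 hff,
      integral_add (hgg.const_mul _) (hfg.const_mul _), integral_const_mul,
      integral_const_mul] at h0
    linarith
  have hd := discrim_le_zero key
  rw [discrim, ← l2_sq, ← l2_sq] at hd
  have h2 : (∫ x, f x * g x) ^ 2 ≤ (l2 f * l2 g) ^ 2 := by nlinarith
  exact abs_le_of_sq_le_sq h2 (mul_nonneg (l2_nonneg _) (l2_nonneg _))

theorem integral_abs_mul_le {f g : E → ℝ} (hf : Nice f) (hg : Nice g) :
    ∫ x, |f x * g x| ≤ l2 f * l2 g := by
  have h := abs_integral_mul_le hf.abs hg.abs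
  have e : ∀ u : E → ℝ, l2 (fun x => |u x|) = l2 u := fun u => by simp [l2]
  rw [e, e] at h
  simp only [abs_mul]
  exact (le_abs_self _).trans h

theorem l2_mono {f g : E → ℝ} (hg : Nice g) (h : ∀ x, |f x| ≤ |g x|) : l2 f ≤ l2 g := by
  refine Real.sqrt_le_sqrt ?_
  refine integral_mono_of_nonneg (Filter.Eventually.of_forall fun _ => sq_nonneg _)
    (hg.sq.integrable _) (Filter.Eventually.of_forall fun x => sq_le_sq.2 (h x))

theorem l2_le_of_dual {E : Type*} [MeasureSpace E] {f : E → ℝ} {C : ℝ} (hC : 0 ≤ C) (h : |∫ x, f x * f x| ≤ C * l2 f) :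
    l2 f ≤ C := by
  have h1 : l2 f ^ 2 ≤ C * l2 f := by
    rw [l2_sq]; simpa only [pow_two] using (le_abs_self _).trans h
  by_contra hlt
  push Not at hlt
  nlinarith [l2_nonneg f]

theorem l2_add_le {f g : E → ℝ} (hf : Nice f) (hg : Nice g) :
    l2 (fun x => f x + g x) ≤ l2 f + l2 g := by
  refine l2_le_of_dual (add_nonneg (l2_nonneg _) (l2_nonneg _)) ?_
  have hs := hf.add hg
  have e : ∫ x, (f x + g x) * (f x + g x)
      = (∫ x, f x * (f x + g x)) + ∫ x, g x * (f x + g x) := by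
    rw [← integral_add ((hf.mul hs).integrable _) ((hg.mul hs).integrable _)]
    congr 1; ext x; ring
  rw [e, add_mul]
  exact (abs_add_le _ _).trans (add_le_add (abs_integral_mul_le hf hs) (abs_integral_mul_le hg hs))

theorem l2_const_mul {E : Type*} [MeasureSpace E] (c : ℝ) (f : E → ℝ) :
    l2 (fun x => c * f x) = |c| * l2 f := by
  simp only [l2, mul_pow, integral_const_mul]
  rw [Real.sqrt_mul (sq_nonneg c), Real.sqrt_sq_eq_abs]

theorem l2_sub_le {f g : E → ℝ} (hf : Nice f) (hg : Nice g) :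
    l2 (fun x => f x - g x) ≤ l2 f + l2 g := by
  have := l2_add_le hf hg.neg
  have e : l2 (fun x => - g x) = l2 g := by simp [l2]
  rw [e] at this
  simpa only [sub_eq_add_neg] using this

theorem l2_sum_le {ι : Type*} (s : Finset ι) {f : ι → E → ℝ} (hf : ∀ i ∈ s, Nice (f i)) :
    l2 (fun x => ∑ i ∈ s, f i x) ≤ ∑ i ∈ s, l2 (f i) := by
  classical
  induction s using Finset.induction_on with
  | empty => simp [l2]
  | insert a s ha ih =>
    simp only [Finset.sum_insert ha]
    have h2 : ∀ i ∈ s, Nice (f i) := fun i hi => hf i (by simp [hi])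
    exact (l2_add_le (hf a (by simp)) (Nice.sum s h2)).trans (add_le_add le_rfl (ih h2))

theorem l2_comp_sub (f : ℝ → ℝ) (a : ℝ) : l2 (fun x => f (x - a)) = l2 f := by
  simp only [l2]
  rw [integral_sub_right_eq_self (fun x => f x ^ 2) a]

theorem l2_comp_mul (f : ℝ → ℝ) (a : ℝ) : l2 (fun x => f (a * x)) = √(|a|⁻¹) * l2 f := by
  simp only [l2]
  rw [Measure.integral_comp_mul_left (fun x => f x ^ 2) a, smul_eq_mul, abs_inv,
    Real.sqrt_mul (by positivity)]

end l2

/-- The dyadic averaging kernel at scale `2⁻ⁱ`. -/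
noncomputable def dyKer (i : ℕ) (x y : ℝ) : ℝ :=
  if ⌊(2:ℝ) ^ i * x⌋ = ⌊(2:ℝ) ^ i * y⌋ then (2:ℝ) ^ i else 0

/-- The dyadic conditional expectation at scale `2⁻ⁱ`. -/
noncomputable def dyE (i : ℕ) (f : ℝ → ℝ) (x : ℝ) : ℝ := ∫ y, dyKer i x y * f y

/-- Functions constant on dyadic intervals of length `2⁻ⁱ`. -/
def Lvl (i : ℕ) (f : ℝ → ℝ) : Prop := ∀ x y, ⌊(2:ℝ) ^ i * x⌋ = ⌊(2:ℝ) ^ i * y⌋ → f x = f y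

/-- Dyadic martingale differences. -/
noncomputable def dyD : ℕ → (ℝ → ℝ) → ℝ → ℝ
  | 0, f => dyE 0 f
  | i + 1, f => fun x => dyE (i + 1) f x - dyE i f x

theorem dyKer_symm (i : ℕ) (x y : ℝ) : dyKer i x y = dyKer i y x := by
  simp only [dyKer, eq_comm]

theorem dyKer_nonneg (i : ℕ) (x y : ℝ) : 0 ≤ dyKer i x y := by
  unfold dyKer; split_ifs <;> positivity

theorem dyKer_le (i : ℕ) (x y : ℝ) : dyKer i x y ≤ 2 ^ i := by
  unfold dyKer; split_ifs
  · exact le_rfl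
  · positivity

theorem abs_sub_lt_of_floor_eq {i : ℕ} {x y : ℝ} (h : ⌊(2:ℝ) ^ i * x⌋ = ⌊(2:ℝ) ^ i * y⌋) :
    |x - y| * 2 ^ i < 1 := by
  have h2 : (0:ℝ) < 2 ^ i := by positivity
  have := Int.abs_sub_lt_one_of_floor_eq_floor h
  rwa [← mul_sub, abs_mul, abs_of_pos h2, mul_comm] at this

theorem abs_sub_le_one_of_floor_eq {i : ℕ} {x y : ℝ} (h : ⌊(2:ℝ) ^ i * x⌋ = ⌊(2:ℝ) ^ i * y⌋) :
    |x - y| ≤ 1 := by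
  have h2 : (1:ℝ) ≤ 2 ^ i := one_le_pow₀ (by norm_num)
  have := abs_sub_lt_of_floor_eq h
  nlinarith [abs_nonneg (x - y)]

theorem measurable_dyKer (i : ℕ) : Measurable (fun p : ℝ × ℝ => dyKer i p.1 p.2) := by
  refine Measurable.ite (measurableSet_eq_fun ?_ ?_) measurable_const measurable_const
  · exact Int.measurable_floor.comp (measurable_fst.const_mul _)
  · exact Int.measurable_floor.comp (measurable_snd.const_mul _)

theorem floor_eq_of_le {i k : ℕ} (hik : i ≤ k) {x y : ℝ}
    (h : ⌊(2:ℝ) ^ k * x⌋ = ⌊(2:ℝ) ^ k * y⌋) : ⌊(2:ℝ) ^ i * x⌋ = ⌊(2:ℝ) ^ i * y⌋ := by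
  have key : ∀ z : ℝ, (2:ℝ) ^ i * z = (2 ^ k * z) / ((2 ^ (k - i) : ℕ) : ℝ) := by
    intro z
    have : (2:ℝ) ^ k = 2 ^ i * 2 ^ (k - i) := by rw [← pow_add]; congr 1; omega
    rw [this]; push_cast; field_simp
  rw [key, key, Int.floor_div_natCast, Int.floor_div_natCast, h]

theorem Lvl.mono {i k : ℕ} (hik : i ≤ k) {f : ℝ → ℝ} (hf : Lvl i f) : Lvl k f :=
  fun _ _ h => hf _ _ (floor_eq_of_le hik h)

theorem lvl_dyKer (i : ℕ) (x : ℝ) : Lvl i (dyKer i x) := by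
  intro y z h
  simp only [dyKer, h]

theorem dyKer_lvl_left {i : ℕ} {x x' : ℝ} (h : ⌊(2:ℝ) ^ i * x⌋ = ⌊(2:ℝ) ^ i * x'⌋) (y : ℝ) :
    dyKer i x y = dyKer i x' y := by
  simp only [dyKer, h]

theorem lvl_dyE (i : ℕ) (f : ℝ → ℝ) : Lvl i (dyE i f) := by
  intro x y h
  simp only [dyE, dyKer_lvl_left h]

theorem nice_dyKer (i : ℕ) (x : ℝ) : Nice (dyKer i x) := by
  refine ⟨(measurable_dyKer i).comp measurable_prodMk_left, ⟨2 ^ i, fun y => ?_⟩, |x| + 1,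
    fun y hy => ?_⟩
  · rw [abs_of_nonneg (dyKer_nonneg ..)]; exact dyKer_le ..
  · unfold dyKer
    rw [if_neg]
    intro h
    have h1 := abs_sub_le_one_of_floor_eq h
    have h2 := abs_sub_abs_le_abs_sub y x
    rw [abs_sub_comm] at h2
    rw [Real.norm_eq_abs] at hy
    linarith

theorem integral_dyKer (i : ℕ) (x : ℝ) : ∫ y, dyKer i x y = 1 := by
  have h2 : (0:ℝ) < 2 ^ i := by positivity
  have hset : {y : ℝ | ⌊(2:ℝ) ^ i * x⌋ = ⌊(2:ℝ) ^ i * y⌋}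
      = Ico (⌊(2:ℝ) ^ i * x⌋ / 2 ^ i : ℝ) ((⌊(2:ℝ) ^ i * x⌋ + 1) / 2 ^ i : ℝ) := by
    ext y
    rw [mem_ofPred_eq, eq_comm, Int.floor_eq_iff, mem_Ico, div_le_iff₀ h2, lt_div_iff₀ h2,
      mul_comm y]
  have : dyKer i x = indicator {y : ℝ | ⌊(2:ℝ) ^ i * x⌋ = ⌊(2:ℝ) ^ i * y⌋} fun _ => (2:ℝ) ^ i := by
    ext y; simp [dyKer, indicator_apply]
  rw [this, hset, integral_indicator measurableSet_Ico, setIntegral_const, smul_eq_mul,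
    Real.volume_real_Ico_of_le (by gcongr; linarith)]
  field_simp
  ring

theorem nice_dyKer_mul (i : ℕ) {f : ℝ → ℝ} (hf : Nice f) :
    Nice (fun p : ℝ × ℝ => dyKer i p.1 p.2 * f p.2) := by
  obtain ⟨hm, ⟨C, hC⟩, R, hR⟩ := hf
  refine ⟨(measurable_dyKer i).mul (hm.comp measurable_snd), ⟨2 ^ i * C, fun p => ?_⟩, R + 1,
    fun p hp => ?_⟩
  · rw [abs_mul, abs_of_nonneg (dyKer_nonneg ..)]
    exact mul_le_mul (dyKer_le ..) (hC _) (abs_nonneg _) (by positivity)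
  · by_cases h0 : f p.2 = 0
    · simp [h0]
    · have h1 : |p.2| ≤ R := by by_contra h; exact h0 (hR _ (not_le.1 h))
      have h3 : R + 1 < |p.1| := by
        rcases lt_max_iff.1 (show R + 1 < max ‖p.1‖ ‖p.2‖ from hp) with h | h
        · exact h
        · rw [Real.norm_eq_abs] at h; linarith
      have : dyKer i p.1 p.2 = 0 := by
        unfold dyKer
        rw [if_neg]
        intro h
        have := abs_sub_le_one_of_floor_eq h
        have := abs_sub_abs_le_abs_sub p.1 p.2
        linarith
      simp [this]

theorem Nice.dyE {f : ℝ → ℝ} (hf : Nice f) (i : ℕ) : Nice (dyE i f) :=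
  (nice_dyKer_mul i hf).integral_right

theorem dyE_eq_of_lvl {i : ℕ} {f : ℝ → ℝ} (hf : Lvl i f) : dyE i f = f := by
  ext x
  have : ∀ y, dyKer i x y * f y = dyKer i x y * f x := by
    intro y
    unfold dyKer
    split_ifs with h
    · rw [hf _ _ h]
    · simp
  simp only [dyE, this]
  rw [integral_mul_const, integral_dyKer, one_mul]

theorem dyE_mul_of_lvl {i : ℕ} {f : ℝ → ℝ} (hf : Lvl i f) (u : ℝ → ℝ) (x : ℝ) :
    dyE i (fun y => f y * u y) x = f x * dyE i u x := by
  have : ∀ y, dyKer i x y * (f y * u y) = f x * (dyKer i x y * u y) := by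
    intro y
    unfold dyKer
    split_ifs with h
    · rw [hf _ _ h]; ring
    · simp
  simp only [dyE, this]
  rw [integral_const_mul]

theorem dyE_sub {i : ℕ} {f g : ℝ → ℝ} (hf : Nice f) (hg : Nice g) (x : ℝ) :
    dyE i (fun y => f y - g y) x = dyE i f x - dyE i g x := by
  simp only [dyE, mul_sub]
  exact integral_sub (((nice_dyKer i x).mul hf).integrable _)
    (((nice_dyKer i x).mul hg).integrable _)

theorem dyE_sum {ι : Type*} (s : Finset ι) {i : ℕ} {f : ι → ℝ → ℝ} (hf : ∀ a ∈ s, Nice (f a))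
    (x : ℝ) : dyE i (fun y => ∑ a ∈ s, f a y) x = ∑ a ∈ s, dyE i (f a) x := by
  simp only [dyE, Finset.mul_sum]
  exact integral_finsetSum _ fun a ha => ((nice_dyKer i x).mul (hf a ha)).integrable _

theorem abs_dyE_le (i : ℕ) (f : ℝ → ℝ) (x : ℝ) : |dyE i f x| ≤ dyE i (fun y => |f y|) x := by
  refine abs_integral_le_integral_abs.trans (le_of_eq ?_)
  simp only [dyE, abs_mul, abs_of_nonneg (dyKer_nonneg ..)]

theorem abs_dyE_le_const (i : ℕ) {f : ℝ → ℝ} {C : ℝ} (hC : ∀ x, |f x| ≤ C) (x : ℝ) :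
    |dyE i f x| ≤ C := by
  refine abs_integral_le_integral_abs.trans ?_
  have h1 : ∫ y, |dyKer i x y * f y| ≤ ∫ y, dyKer i x y * C := by
    refine integral_mono_of_nonneg (Filter.Eventually.of_forall fun _ => abs_nonneg _)
      (((nice_dyKer i x).integrable _).mul_const _) (Filter.Eventually.of_forall fun y => ?_)
    simp only [abs_mul, abs_of_nonneg (dyKer_nonneg ..)]
    exact mul_le_mul_of_nonneg_left (hC y) (dyKer_nonneg ..)
  rwa [integral_mul_const, integral_dyKer, one_mul] at h1

theorem dyE_selfadj {f g : ℝ → ℝ} (hf : Nice f) (hg : Nice g) (i : ℕ) :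
    ∫ x, dyE i f x * g x = ∫ x, f x * dyE i g x := by
  simp only [dyE, ← integral_mul_const, ← integral_const_mul]
  have hn : Nice (fun p : ℝ × ℝ => dyKer i p.1 p.2 * f p.2 * g p.1) :=
    (nice_dyKer_mul i hf).mul_bdd (hg.1.comp measurable_fst)
      (hg.2.1.imp fun C hC p => hC p.1)
  rw [Nice.swap (K := fun x y => dyKer i x y * f y * g x) hn]
  congr 1; ext y; congr 1; ext x
  rw [dyKer_symm]; ring

theorem dyE_dyE_of_ge {i k : ℕ} (h : i ≤ k) (f : ℝ → ℝ) : dyE k (dyE i f) = dyE i f :=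
  dyE_eq_of_lvl ((lvl_dyE i f).mono h)

theorem dyE_dyE_of_le {i k : ℕ} (h : i ≤ k) {f : ℝ → ℝ} (hf : Nice f) :
    dyE i (dyE k f) = dyE i f := by
  ext x
  show ∫ y, dyKer i x y * dyE k f y = ∫ y, dyKer i x y * f y
  rw [← dyE_selfadj (nice_dyKer i x) hf, dyE_eq_of_lvl ((lvl_dyKer i x).mono h)]

theorem l2_dyE_le {f : ℝ → ℝ} (hf : Nice f) (i : ℕ) : l2 (dyE i f) ≤ l2 f := by
  refine l2_le_of_dual (l2_nonneg _) ?_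
  rw [dyE_selfadj hf (hf.dyE i), dyE_dyE_of_ge le_rfl]
  exact abs_integral_mul_le hf (hf.dyE i)

theorem integral_dyE {f : ℝ → ℝ} (hf : Nice f) (i : ℕ) : ∫ x, dyE i f x = ∫ x, f x := by
  have h : ∫ x, dyE i f x = ∫ x, ∫ y, dyKer i x y * f y := rfl
  rw [h, Nice.swap (K := fun x y => dyKer i x y * f y) (nice_dyKer_mul i hf)]
  congr 1; ext y
  rw [integral_mul_const]
  simp only [fun x => dyKer_symm i x y]
  rw [integral_dyKer, one_mul]

theorem Nice.dyD {f : ℝ → ℝ} (hf : Nice f) (i : ℕ) : Nice (dyD i f) := by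
  cases i with
  | zero => exact hf.dyE 0
  | succ i => exact (hf.dyE _).sub (hf.dyE _)

theorem lvl_dyD (i : ℕ) (f : ℝ → ℝ) : Lvl i (dyD i f) := by
  cases i with
  | zero => exact lvl_dyE 0 f
  | succ i =>
    intro x y h
    simp only [dyD]
    rw [lvl_dyE _ f x y h, (lvl_dyE i f).mono (Nat.le_succ i) x y h]

theorem sum_dyD (f : ℝ → ℝ) (n : ℕ) (x : ℝ) : ∑ r ∈ Finset.range (n + 1), dyD r f x = dyE n f x := by
  induction n with
  | zero => simp [dyD]
  | succ n ih => rw [Finset.sum_range_succ, ih]; simp [dyD]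

theorem dyE_dyD_of_lt {i k : ℕ} (h : i < k) {f : ℝ → ℝ} (hf : Nice f) :
    dyE i (dyD k f) = fun _ => 0 := by
  cases k with
  | zero => omega
  | succ k =>
    ext x
    simp only [dyD]
    rw [dyE_sub (hf.dyE _) (hf.dyE _), dyE_dyE_of_le (by omega) hf, dyE_dyE_of_le (by omega) hf,
      sub_self]

theorem dyE_dyD_of_ge {i k : ℕ} (h : k ≤ i) (f : ℝ → ℝ) : dyE i (dyD k f) = dyD k f :=
  dyE_eq_of_lvl ((lvl_dyD k f).mono h)

theorem dyD_selfadj {f g : ℝ → ℝ} (hf : Nice f) (hg : Nice g) (i : ℕ) :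
    ∫ x, dyD i f x * g x = ∫ x, f x * dyD i g x := by
  cases i with
  | zero => exact dyE_selfadj hf hg 0
  | succ i =>
    simp only [dyD, sub_mul, mul_sub]
    rw [integral_sub (((hf.dyE _).mul hg).integrable _) (((hf.dyE _).mul hg).integrable _),
      integral_sub ((hf.mul (hg.dyE _)).integrable _) ((hf.mul (hg.dyE _)).integrable _),
      dyE_selfadj hf hg, dyE_selfadj hf hg]

theorem dyD_mul_of_lvl {i : ℕ} {f : ℝ → ℝ} (hf : Lvl i f) (u : ℝ → ℝ) (x : ℝ) :
    dyD (i + 1) (fun y => f y * u y) x = f x * dyD (i + 1) u x := by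
  simp only [dyD]
  rw [dyE_mul_of_lvl hf, dyE_mul_of_lvl (hf.mono (Nat.le_succ i))]; ring

theorem dyD_dyD {f : ℝ → ℝ} (hf : Nice f) (i : ℕ) : dyD i (dyD i f) = dyD i f := by
  cases i with
  | zero => exact dyE_dyE_of_ge le_rfl f
  | succ i =>
    ext x
    show dyE (i + 1) (dyD (i + 1) f) x - dyE i (dyD (i + 1) f) x = _
    rw [dyE_dyD_of_ge le_rfl, dyE_dyD_of_lt (Nat.lt_succ_self i) hf, sub_zero]

/-- Pythagoras for conditional expectations. -/
theorem l2_dyE_sub_sq {f : ℝ → ℝ} (hf : Nice f) {i k : ℕ} (h : i ≤ k) :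
    l2 (fun x => dyE k f x - dyE i f x) ^ 2 = l2 (dyE k f) ^ 2 - l2 (dyE i f) ^ 2 := by
  have hi := hf.dyE i
  have hk := hf.dyE k
  have e1 : ∫ x, dyE k f x * dyE i f x = ∫ x, dyE i f x ^ 2 := by
    rw [dyE_selfadj hf hi, dyE_dyE_of_ge h]
    simp only [pow_two]
    rw [dyE_selfadj hf hi, dyE_dyE_of_ge le_rfl]
  rw [l2_sq, l2_sq, l2_sq]
  have e2 : ∀ x, (dyE k f x - dyE i f x) ^ 2
      = dyE k f x ^ 2 - (2 * (dyE k f x * dyE i f x) - dyE i f x ^ 2) := fun x => by ring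
  simp only [e2]
  have n1 : Nice (fun x => 2 * (dyE k f x * dyE i f x) - dyE i f x ^ 2) :=
    ((hk.mul hi).const_mul 2).sub hi.sq
  rw [integral_sub (hk.sq.integrable _) (n1.integrable _),
    integral_sub (((hk.mul hi).const_mul 2).integrable _) (hi.sq.integrable _),
    integral_const_mul, e1]
  ring

theorem sum_l2_dyD_sq {f : ℝ → ℝ} (hf : Nice f) (n : ℕ) :
    ∑ r ∈ Finset.range (n + 1), l2 (dyD r f) ^ 2 = l2 (dyE n f) ^ 2 := by
  induction n with
  | zero => simp [dyD]
  | succ n ih =>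
    rw [Finset.sum_range_succ, ih]
    simp only [dyD]
    rw [l2_dyE_sub_sq hf (Nat.le_succ n)]; ring

theorem l2_dyD_le {f : ℝ → ℝ} (hf : Nice f) (i : ℕ) : l2 (dyD i f) ≤ l2 f := by
  have h1 := sum_l2_dyD_sq hf i
  have h2 : l2 (dyD i f) ^ 2 ≤ ∑ r ∈ Finset.range (i + 1), l2 (dyD r f) ^ 2 :=
    Finset.single_le_sum (f := fun r => l2 (dyD r f) ^ 2) (fun _ _ => sq_nonneg _) (by simp)
  have h3 := l2_dyE_le hf i
  have := abs_le_of_sq_le_sq (h2.trans h1.le) (l2_nonneg _)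
  exact ((le_abs_self _).trans this).trans h3

theorem l2_sub_dyE_le {f : ℝ → ℝ} (hf : Nice f) (i : ℕ) :
    l2 (fun x => f x - dyE i f x) ≤ l2 f := by
  have hn := hf.sub (hf.dyE i)
  refine l2_le_of_dual (l2_nonneg _) ?_
  have : ∫ x, (f x - dyE i f x) * (f x - dyE i f x) = ∫ x, f x * (f x - dyE i f x) := by
    have e : ∫ x, dyE i f x * (f x - dyE i f x) = 0 := by
      rw [dyE_selfadj hf hn]
      have : dyE i (fun x => f x - dyE i f x) = fun _ => 0 := by
        ext x; rw [dyE_sub hf (hf.dyE i), dyE_dyE_of_ge le_rfl, sub_self]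
      simp [this]
    have e2 : ∫ x, (f x - dyE i f x) * (f x - dyE i f x)
        = ∫ x, (f x * (f x - dyE i f x) - dyE i f x * (f x - dyE i f x)) := by
      congr 1; ext x; ring
    rw [e2, integral_sub ((hf.mul hn).integrable _) (((hf.dyE i).mul hn).integrable _), e, sub_zero]
  rw [this]
  exact abs_integral_mul_le hf hn

/-- The dyadic maximal function over scales up to `r`. -/
noncomputable def dyM (f : ℝ → ℝ) : ℕ → ℝ → ℝ
  | 0, x => |dyE 0 f x|
  | r + 1, x => max (dyM f r x) |dyE (r + 1) f x|

theorem dyM_nonneg (f : ℝ → ℝ) (r : ℕ) (x : ℝ) : 0 ≤ dyM f r x := by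
  cases r with
  | zero => exact abs_nonneg _
  | succ r => exact (abs_nonneg _).trans (le_max_right _ _)

theorem dyM_mono (f : ℝ → ℝ) {r s : ℕ} (h : r ≤ s) (x : ℝ) : dyM f r x ≤ dyM f s x := by
  induction s, h using Nat.le_induction with
  | base => exact le_rfl
  | succ s _ ih => exact ih.trans (le_max_left _ _)

theorem abs_dyE_le_dyM (f : ℝ → ℝ) {r s : ℕ} (h : r ≤ s) (x : ℝ) : |dyE r f x| ≤ dyM f s x := by
  refine le_trans ?_ (dyM_mono f h x)
  cases r with
  | zero => exact le_rfl
  | succ r => exact le_max_right _ _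

theorem lvl_dyM (f : ℝ → ℝ) (r : ℕ) : Lvl r (dyM f r) := by
  induction r with
  | zero => intro x y h; simp only [dyM, lvl_dyE 0 f x y h]
  | succ r ih =>
    intro x y h
    simp only [dyM]
    rw [lvl_dyE (r + 1) f x y h, ih.mono (Nat.le_succ r) x y h]

theorem Nice.dyM {f : ℝ → ℝ} (hf : Nice f) (r : ℕ) : Nice (dyM f r) := by
  induction r with
  | zero => exact (hf.dyE 0).abs
  | succ r ih =>
    refine (ih.add (hf.dyE (r + 1)).abs).of_le (ih.1.max (hf.dyE (r + 1)).1.abs) fun x => ?_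
    have h1 := dyM_nonneg f r x
    have h2 := abs_nonneg (_root_.dyE (r + 1) f x)
    rw [abs_of_nonneg (dyM_nonneg f (r + 1) x), abs_of_nonneg (add_nonneg h1 h2)]
    exact max_le (by linarith) (by linarith)

theorem integral_dyM_sq_le {f : ℝ → ℝ} (hf : Nice f) (r : ℕ) :
    ∫ x, dyM f r x ^ 2 ≤ 2 * ∫ x, |f x| * dyM f r x := by
  have hloc : ∀ (i : ℕ) (u : ℝ → ℝ), Nice u → Lvl i u →
      ∫ x, dyE i (fun y => |f y|) x * u x = ∫ x, |f x| * u x := by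
    intro i u hu hl
    rw [dyE_selfadj hf.abs hu, dyE_eq_of_lvl hl]
  induction r with
  | zero =>
    have h1 : ∫ x, dyM f 0 x ^ 2 ≤ ∫ x, dyE 0 (fun y => |f y|) x * dyM f 0 x := by
      refine integral_mono ((hf.dyM 0).sq.integrable _)
        (((hf.abs.dyE 0).mul (hf.dyM 0)).integrable _) fun x => ?_
      rw [pow_two]
      exact mul_le_mul_of_nonneg_right (abs_dyE_le 0 f x) (dyM_nonneg f 0 x)
    rw [hloc 0 _ (hf.dyM 0) (lvl_dyM f 0)] at h1
    have h2 : 0 ≤ ∫ x, |f x| * dyM f 0 x :=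
      integral_nonneg fun x => mul_nonneg (abs_nonneg _) (dyM_nonneg f 0 x)
    linarith
  | succ r ih =>
    set u : ℝ → ℝ := fun x => dyM f (r + 1) x - dyM f r x with hu
    have nu : Nice u := (hf.dyM _).sub (hf.dyM _)
    have lu : Lvl (r + 1) u := by
      intro x y h
      simp only [hu]
      rw [lvl_dyM f (r + 1) x y h, (lvl_dyM f r).mono (Nat.le_succ r) x y h]
    have h1 : ∫ x, dyM f (r + 1) x ^ 2
        ≤ ∫ x, (dyM f r x ^ 2 + 2 * (dyE (r + 1) (fun y => |f y|) x * u x)) := by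
      refine integral_mono ((hf.dyM _).sq.integrable _)
        (((hf.dyM r).sq.add (((hf.abs.dyE _).mul nu).const_mul 2)).integrable _) fun x => ?_
      have e := abs_dyE_le (r + 1) f x
      have hn := dyM_nonneg f r x
      simp only [hu, dyM]
      rcases le_total (dyM f r x) |dyE (r + 1) f x| with h | h
      · rw [max_eq_right h]
        nlinarith
      · rw [max_eq_left h]; simp
    rw [integral_add ((hf.dyM r).sq.integrable _)
      ((((hf.abs.dyE _).mul nu).const_mul 2).integrable _), integral_const_mul,
      hloc _ _ nu lu] at h1
    have h2 : ∫ x, |f x| * u x = (∫ x, |f x| * dyM f (r + 1) x) - ∫ x, |f x| * dyM f r x := by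
      rw [← integral_sub ((hf.abs.mul (hf.dyM _)).integrable _)
        ((hf.abs.mul (hf.dyM _)).integrable _)]
      congr 1; ext x; simp only [hu]; ring
    linarith

theorem l2_abs {E : Type*} [MeasureSpace E] (f : E → ℝ) : l2 (fun x => |f x|) = l2 f := by
  simp [l2]

/-- Doob's maximal inequality. -/
theorem l2_dyM_le {f : ℝ → ℝ} (hf : Nice f) (r : ℕ) : l2 (dyM f r) ≤ 2 * l2 f := by
  refine l2_le_of_dual (mul_nonneg zero_le_two (l2_nonneg _)) ?_
  have h1 := integral_dyM_sq_le hf r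
  have h2 := (le_abs_self _).trans (abs_integral_mul_le hf.abs (hf.dyM r))
  rw [l2_abs] at h2
  simp only [← pow_two]
  rw [abs_of_nonneg (integral_nonneg fun x => sq_nonneg _)]
  linarith

/-- A Carleson embedding for martingale differences of a bounded function. -/
theorem sum_l2_mul_dyD_sq_le {h : ℝ → ℝ} (hh : Nice h) (hb : ∀ x, |h x| ≤ 1) {M : ℕ → ℝ → ℝ}
    (hM : ∀ r, Nice (M r)) (hl : ∀ r, Lvl r (M r)) (h0 : ∀ r x, 0 ≤ M r x)
    (hmono : ∀ r x, M r x ≤ M (r + 1) x) (R : ℕ) :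
    ∑ r ∈ Finset.range R, l2 (fun x => M r x * dyD (r + 1) h x) ^ 2 ≤ l2 (M R) ^ 2 := by
  have step : ∀ r, l2 (fun x => M r x * dyD (r + 1) h x) ^ 2
      = l2 (fun x => M r x * dyE (r + 1) h x) ^ 2 - l2 (fun x => M r x * dyE r h x) ^ 2 := by
    intro r
    have e1 : ∀ i, r ≤ i → dyE i (fun x => M r x * h x) = fun x => M r x * dyE i h x := by
      intro i hi; ext x; exact dyE_mul_of_lvl ((hl r).mono hi) h x
    have := l2_dyE_sub_sq ((hM r).mul hh) (Nat.le_succ r)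
    rw [e1 _ (Nat.le_succ r), e1 _ le_rfl] at this
    rw [← this]
    simp only [dyD, mul_sub]
  have main : ∑ r ∈ Finset.range R, l2 (fun x => M r x * dyD (r + 1) h x) ^ 2
      ≤ l2 (fun x => M R x * dyE R h x) ^ 2 := by
    induction R with
    | zero => simpa using sq_nonneg _
    | succ R ih =>
      rw [Finset.sum_range_succ, step]
      have : l2 (fun x => M R x * dyE (R + 1) h x) ≤ l2 (fun x => M (R + 1) x * dyE (R + 1) h x) := by
        refine l2_mono ((hM _).mul (hh.dyE _)) fun x => ?_
        rw [abs_mul, abs_mul, abs_of_nonneg (h0 _ _), abs_of_nonneg (h0 _ _)]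
        exact mul_le_mul_of_nonneg_right (hmono R x) (abs_nonneg _)
      have := pow_le_pow_left₀ (l2_nonneg _) this 2
      linarith
  refine main.trans (pow_le_pow_left₀ (l2_nonneg _) (l2_mono (hM R) fun x => ?_) 2)
  rw [abs_mul]
  exact mul_le_of_le_one_right (abs_nonneg _) (abs_dyE_le_const R hb x)

theorem dyE_indicator_crossing_le (l : ℕ) (u x : ℝ) :
    dyE l ({y | ⌊(2:ℝ) ^ l * (y - u)⌋ ≠ ⌊(2:ℝ) ^ l * y⌋}.indicator fun _ => 1) x ≤ 2 ^ l * |u| := by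
  have h2 : (0:ℝ) < 2 ^ l := by positivity
  set n := ⌊(2:ℝ) ^ l * x⌋ with hn
  obtain ⟨a, b, hab, hI⟩ : ∃ a b : ℝ, b - a = |u| ∧ ∀ y, ⌊(2:ℝ) ^ l * y⌋ = n →
      ⌊(2:ℝ) ^ l * (y - u)⌋ ≠ n → y ∈ Icc a b := by
    rcases le_total 0 u with hu | hu
    · refine ⟨n / 2 ^ l, n / 2 ^ l + u, by rw [abs_of_nonneg hu]; ring, fun y h1 h3 => ?_⟩
      rw [Int.floor_eq_iff] at h1
      rw [Ne, Int.floor_eq_iff, not_and_or, not_le, not_lt] at h3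
      have h4 : n / 2 ^ l ≤ y := by rw [div_le_iff₀ h2]; linarith
      refine ⟨h4, ?_⟩
      rcases h3 with h3 | h3
      · have : y - u < n / 2 ^ l := by rw [lt_div_iff₀ h2]; linarith
        linarith
      · nlinarith
    · refine ⟨(n + 1) / 2 ^ l + u, (n + 1) / 2 ^ l, by rw [abs_of_nonpos hu]; ring,
        fun y h1 h3 => ?_⟩
      rw [Int.floor_eq_iff] at h1
      rw [Ne, Int.floor_eq_iff, not_and_or, not_le, not_lt] at h3
      have h4 : y ≤ (n + 1) / 2 ^ l := by rw [le_div_iff₀ h2]; linarith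
      refine ⟨?_, h4⟩
      rcases h3 with h3 | h3
      · nlinarith
      · have : (n + 1) / 2 ^ l ≤ y - u := by rw [div_le_iff₀ h2]; linarith
        linarith
  have hle : a ≤ b := by linarith [abs_nonneg u]
  calc _ ≤ ∫ y, (Icc a b).indicator (fun _ => (2:ℝ) ^ l) y := by
        refine integral_mono_of_nonneg (Filter.Eventually.of_forall fun y => ?_)
          ((integrable_indicator_iff measurableSet_Icc).2 (integrableOn_const (by simp)))
          (Filter.Eventually.of_forall fun y => ?_)
        · exact mul_nonneg (dyKer_nonneg ..) (indicator_nonneg (fun _ _ => zero_le_one) _)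
        · simp only [indicator_apply, mem_ofPred_eq, dyKer]
          by_cases e1 : ⌊(2:ℝ) ^ l * x⌋ = ⌊(2:ℝ) ^ l * y⌋
          · by_cases e2 : ⌊(2:ℝ) ^ l * (y - u)⌋ ≠ ⌊(2:ℝ) ^ l * y⌋
            · rw [if_pos (hI y (by rw [hn, e1]) (by rw [hn, e1]; exact e2))]
              simp [e1, e2]
            · rw [if_neg e2, mul_zero]; split_ifs <;> positivity
          · rw [if_neg e1, zero_mul]; split_ifs <;> positivity
    _ = 2 ^ l * |u| := by
        rw [integral_indicator measurableSet_Icc, setIntegral_const, smul_eq_mul,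
          Real.volume_real_Icc_of_le hle, hab, mul_comm]

theorem integral_crossing_sq_le {l : ℕ} {F : ℝ → ℝ} (hF : Nice F) (hl : Lvl l F) (u : ℝ) :
    ∫ x, F x ^ 2 * ({y | ⌊(2:ℝ) ^ l * (y - u)⌋ ≠ ⌊(2:ℝ) ^ l * y⌋}.indicator (fun _ => 1) x : ℝ)
      ≤ 2 ^ l * |u| * l2 F ^ 2 := by
  set S := {y : ℝ | ⌊(2:ℝ) ^ l * (y - u)⌋ ≠ ⌊(2:ℝ) ^ l * y⌋} with hS
  have mS : MeasurableSet S := by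
    refine (measurableSet_eq_fun ?_ ?_).compl
    · exact Int.measurable_floor.comp ((measurable_id.sub_const u).const_mul _)
    · exact Int.measurable_floor.comp (measurable_id.const_mul _)
  have m1 : Measurable (S.indicator fun _ => (1:ℝ)) := measurable_const.indicator mS
  have nF : Nice (fun x => F x ^ 2 * S.indicator (fun _ => (1:ℝ)) x) :=
    hF.sq.mul_bdd m1 ⟨1, fun x => by by_cases h : x ∈ S <;> simp [h]⟩
  have lF : Lvl l (fun x => F x ^ 2) := fun x y h => by simp only [hl x y h]
  have e : dyE l (fun x => F x ^ 2 * S.indicator (fun _ => (1:ℝ)) x)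
      = fun x => F x ^ 2 * dyE l (S.indicator fun _ => (1:ℝ)) x := by
    ext x; exact dyE_mul_of_lvl lF _ x
  rw [← integral_dyE nF l, l2_sq, ← integral_const_mul]
  refine integral_mono ((nF.dyE l).integrable _) ((hF.sq.const_mul _).integrable _) fun x => ?_
  rw [e]
  simp only
  rw [mul_comm]
  exact mul_le_mul_of_nonneg_right (dyE_indicator_crossing_le l u x) (sq_nonneg _)

/-- Translating a step function by less than a step length changes it little in `L²`. -/
theorem l2_translate_sub_sq_le {l : ℕ} {F : ℝ → ℝ} (hF : Nice F) (hl : Lvl l F) (u : ℝ) :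
    l2 (fun x => F (x - u) - F x) ^ 2 ≤ 4 * (2 ^ l * |u|) * l2 F ^ 2 := by
  set S := fun u : ℝ => {y : ℝ | ⌊(2:ℝ) ^ l * (y - u)⌋ ≠ ⌊(2:ℝ) ^ l * y⌋} with hS
  have mS : ∀ u, MeasurableSet (S u) := by
    intro u
    refine (measurableSet_eq_fun ?_ ?_).compl
    · exact Int.measurable_floor.comp ((measurable_id.sub_const u).const_mul _)
    · exact Int.measurable_floor.comp (measurable_id.const_mul _)
  have nF : ∀ u, Nice (fun x => F x ^ 2 * (S u).indicator (fun _ => (1:ℝ)) x) := fun u =>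
    hF.sq.mul_bdd (measurable_const.indicator (mS u))
      ⟨1, fun x => by by_cases h : x ∈ S u <;> simp [h]⟩
  have n2 := (nF (-u)).comp_sub u
  have h1 : l2 (fun x => F (x - u) - F x) ^ 2
      ≤ ∫ x, (2 * (F (x - u) ^ 2 * (S (-u)).indicator (fun _ => (1:ℝ)) (x - u))
        + 2 * (F x ^ 2 * (S u).indicator (fun _ => (1:ℝ)) x)) := by
    rw [l2_sq]
    refine integral_mono (((hF.comp_sub u).sub hF).sq.integrable _)
      (((n2.const_mul 2).add ((nF u).const_mul 2)).integrable _) fun x => ?_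
    by_cases hx : ⌊(2:ℝ) ^ l * (x - u)⌋ = ⌊(2:ℝ) ^ l * x⌋
    · have a1 : x ∉ S u := by simp only [hS, mem_ofPred_eq, not_not]; exact hx
      have a2 : x - u ∉ S (-u) := by
        simp only [hS, mem_ofPred_eq, not_not, sub_neg_eq_add, sub_add_cancel]; exact hx.symm
      simp [a1, a2, hl _ _ hx]
    · have a1 : x ∈ S u := hx
      have a2 : x - u ∈ S (-u) := by
        simp only [hS, mem_ofPred_eq, sub_neg_eq_add, sub_add_cancel]; exact fun h => hx h.symm
      simp only [indicator_of_mem a1, indicator_of_mem a2]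
      nlinarith [sq_nonneg (F (x - u) + F x)]
  rw [integral_add ((n2.const_mul 2).integrable _) (((nF u).const_mul 2).integrable _),
    integral_const_mul, integral_const_mul,
    integral_sub_right_eq_self (fun x => F x ^ 2 * (S (-u)).indicator (fun _ => (1:ℝ)) x) u] at h1
  have h2 := integral_crossing_sq_le hF hl u
  have h3 := integral_crossing_sq_le hF hl (-u)
  rw [abs_neg] at h3
  simp only [hS] at h1
  linarith

section schur

/-- Distance of natural numbers. -/
def dd (i j : ℕ) : ℕ := (i - j) + (j - i)

theorem dd_comm (i j : ℕ) : dd i j = dd j i := by unfold dd; omega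

theorem sum_pow_le_of_injOn {θ : ℝ} (h0 : 0 ≤ θ) (h1 : θ < 1) {ι : Type*} (s : Finset ι)
    (φ : ι → ℕ) (hφ : Set.InjOn φ s) : ∑ i ∈ s, θ ^ φ i ≤ (1 - θ)⁻¹ := by
  classical
  rw [← Finset.sum_image (f := fun n => θ ^ n) (g := φ) hφ, ← tsum_geometric_of_lt_one h0 h1]
  exact (summable_geometric_of_lt_one h0 h1).sum_le_tsum _ fun _ _ => by positivity

theorem sum_pow_dd_le {θ : ℝ} (h0 : 0 ≤ θ) (h1 : θ < 1) {ι : Type*} (s : Finset ι)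
    (p : ι → ℕ) (hp : Set.InjOn p s) (m : ℕ) : ∑ i ∈ s, θ ^ dd (p i) m ≤ 2 / (1 - θ) := by
  classical
  rw [← Finset.sum_filter_add_sum_filter_not s (fun i => p i < m)]
  have a := sum_pow_le_of_injOn h0 h1 (s.filter fun i => p i < m) (fun i => dd (p i) m) (by
    intro i hi j hj h
    simp only [Finset.coe_filter, mem_ofPred_eq] at hi hj
    refine hp hi.1 hj.1 ?_
    simp only [dd] at h; omega)
  have b := sum_pow_le_of_injOn h0 h1 (s.filter fun i => ¬ p i < m) (fun i => dd (p i) m) (by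
    intro i hi j hj h
    simp only [Finset.coe_filter, mem_ofPred_eq] at hi hj
    refine hp hi.1 hj.1 ?_
    simp only [dd] at h; omega)
  have : 2 / (1 - θ) = (1 - θ)⁻¹ + (1 - θ)⁻¹ := by ring
  linarith

/-- Schur's test for exponentially decaying matrices. -/
theorem schur_dd {θ : ℝ} (h0 : 0 ≤ θ) (h1 : θ < 1) {ι κ : Type*} (s : Finset ι) (t : Finset κ)
    (p : ι → ℕ) (q : κ → ℕ) (hp : Set.InjOn p s) (hq : Set.InjOn q t) (a : ι → ℝ) :
    ∑ j ∈ t, (∑ i ∈ s, θ ^ dd (p i) (q j) * a i) ^ 2 ≤ (2 / (1 - θ)) ^ 2 * ∑ i ∈ s, a i ^ 2 := by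
  have hA : 0 ≤ 2 / (1 - θ) := div_nonneg zero_le_two (by linarith)
  have key : ∀ j, (∑ i ∈ s, θ ^ dd (p i) (q j) * a i) ^ 2
      ≤ 2 / (1 - θ) * ∑ i ∈ s, θ ^ dd (p i) (q j) * a i ^ 2 := by
    intro j
    have := Finset.sum_sq_le_sum_mul_sum_of_sq_le_mul s
      (r := fun i => θ ^ dd (p i) (q j) * a i) (f := fun i => θ ^ dd (p i) (q j))
      (g := fun i => θ ^ dd (p i) (q j) * a i ^ 2) (fun _ _ => by positivity)
      (fun _ _ => by positivity) (fun i _ => le_of_eq (by ring))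
    refine this.trans (mul_le_mul_of_nonneg_right (sum_pow_dd_le h0 h1 s p hp _)
      (Finset.sum_nonneg fun _ _ => by positivity))
  calc _ ≤ ∑ j ∈ t, 2 / (1 - θ) * ∑ i ∈ s, θ ^ dd (p i) (q j) * a i ^ 2 :=
        Finset.sum_le_sum fun j _ => key j
    _ = 2 / (1 - θ) * ∑ i ∈ s, (∑ j ∈ t, θ ^ dd (q j) (p i)) * a i ^ 2 := by
        rw [← Finset.mul_sum, Finset.sum_comm]
        simp only [Finset.sum_mul, dd_comm]
    _ ≤ 2 / (1 - θ) * ∑ i ∈ s, (2 / (1 - θ)) * a i ^ 2 := by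
        gcongr with i hi
        exact sum_pow_dd_le h0 h1 t q hq _
    _ = _ := by rw [← Finset.mul_sum]; ring

end schur

/-- Minkowski's integral inequality for nice kernels. -/
theorem l2_integral_le {K : ℝ → ℝ → ℝ} (hK : Nice (fun p : ℝ × ℝ => K p.1 p.2)) {w : ℝ → ℝ}
    (hw : Integrable w) (h : ∀ τ, l2 (fun x => K x τ) ≤ w τ) :
    l2 (fun x => ∫ τ, K x τ) ≤ ∫ τ, w τ := by
  have hw0 : ∀ τ, 0 ≤ w τ := fun τ => (l2_nonneg _).trans (h τ)
  have hG : Nice (fun x => ∫ τ, K x τ) := hK.integral_right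
  set G := fun x => ∫ τ, K x τ with hGdef
  have hKG : Nice (fun p : ℝ × ℝ => K p.1 p.2 * G p.1) :=
    hK.mul_bdd (hG.1.comp measurable_fst) (hG.2.1.imp fun C hC p => hC p.1)
  refine l2_le_of_dual (integral_nonneg hw0) ?_
  have e : ∫ x, G x * G x = ∫ τ, ∫ x, K x τ * G x := by
    rw [← Nice.swap (K := fun x τ => K x τ * G x) hKG]
    congr 1; ext x
    rw [integral_mul_const]
  rw [e, ← integral_mul_const]
  refine abs_integral_le_integral_abs.trans ?_
  refine integral_mono_of_nonneg (Filter.Eventually.of_forall fun _ => abs_nonneg _)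
    (hw.mul_const _) (Filter.Eventually.of_forall fun τ => ?_)
  have hKτ : Nice (fun x => K x τ) := by
    obtain ⟨hm, ⟨C, hC⟩, R, hR⟩ := hK
    exact ⟨hm.comp measurable_prodMk_right, ⟨C, fun x => hC (x, τ)⟩, R,
      fun x hx => hR (x, τ) (hx.trans_le (le_max_left _ _))⟩
  exact (abs_integral_mul_le hKτ hG).trans (mul_le_mul_of_nonneg_right (h τ) (l2_nonneg _))

/-- Averages of translates: convolution with the dilate by `c` of the kernel `k`. -/
noncomputable def cnv (c : ℝ) (k F : ℝ → ℝ) (x : ℝ) : ℝ := ∫ τ, F (x - c * τ) * k τ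

/-- Bounded kernels on `[-1, 1]` with an `L¹` modulus of continuity. -/
structure Ker (A : ℝ) (k : ℝ → ℝ) : Prop where
  meas : Measurable k
  bdd : ∀ τ, |k τ| ≤ A
  supp : ∀ τ, 1 < |τ| → k τ = 0
  var : ∀ v, ∫ τ, |k (τ + v) - k τ| ≤ A * |v|

namespace Ker
variable {A : ℝ} {k : ℝ → ℝ}

theorem nonneg (hk : Ker A k) : 0 ≤ A := (abs_nonneg _).trans (hk.bdd 0)

theorem nice (hk : Ker A k) : Nice k := ⟨hk.meas, ⟨A, hk.bdd⟩, 1, fun x hx => hk.supp x hx⟩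

theorem integral_abs_le (hk : Ker A k) : ∫ τ, |k τ| ≤ 2 * A := by
  have h1 : ∫ τ, |k τ| ≤ ∫ τ, (Icc (-1:ℝ) 1).indicator (fun _ => A) τ := by
    refine integral_mono (hk.nice.abs.integrable _)
      ((integrable_indicator_iff measurableSet_Icc).2 (integrableOn_const (by simp))) fun τ => ?_
    by_cases h : τ ∈ Icc (-1:ℝ) 1
    · simpa [h] using hk.bdd τ
    · have : k τ = 0 := hk.supp τ (by
        by_contra h'; exact h (abs_le.1 (not_lt.1 h')))
      simp [h, this]
  rwa [integral_indicator measurableSet_Icc, setIntegral_const, smul_eq_mul,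
    Real.volume_real_Icc_of_le (by norm_num), sub_neg_eq_add, one_add_one_eq_two] at h1

end Ker

section cnv
variable {A c : ℝ} {k F G : ℝ → ℝ}

theorem nice_shear_ker (hk : Nice k) (hF : Nice F) (c : ℝ) :
    Nice (fun p : ℝ × ℝ => F (p.1 - c * p.2) * k p.2) := by
  obtain ⟨R, hR⟩ := hk.2.2
  refine hF.shear (c := fun τ => c * τ) hk (measurable_id.const_mul c) (B := |c| * R)
    fun τ hτ => ?_
  rw [abs_mul]
  refine mul_le_mul_of_nonneg_left ?_ (abs_nonneg c)
  by_contra h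
  exact hτ (hR τ (not_le.1 h))

theorem Nice.cnv (hF : Nice F) (hk : Nice k) (c : ℝ) : Nice (cnv c k F) :=
  (nice_shear_ker hk hF c).integral_right

theorem integrable_cnv (hk : Nice k) (hF : Nice F) (c x : ℝ) :
    Integrable (fun τ => F (x - c * τ) * k τ) := by
  obtain ⟨hm, ⟨C, hC⟩, R, hR⟩ := hF
  refine Nice.integrable (hk.bdd_mul (g := fun τ => F (x - c * τ)) ?_ ⟨C, fun τ => hC _⟩) volume
  exact hm.comp ((measurable_id.const_mul c).const_sub x)

theorem cnv_sum (hk : Nice k) {ι : Type*} (s : Finset ι) {F : ι → ℝ → ℝ}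
    (hF : ∀ i ∈ s, Nice (F i)) (c x : ℝ) :
    cnv c k (fun y => ∑ i ∈ s, F i y) x = ∑ i ∈ s, cnv c k (F i) x := by
  simp only [cnv, Finset.sum_mul]
  exact integral_finsetSum _ fun i hi => integrable_cnv hk (hF i hi) c x

theorem cnv_adj (hk : Nice k) (hF : Nice F) (hG : Nice G) (c : ℝ) :
    ∫ x, cnv c k F x * G x = ∫ x, F x * cnv (-c) k G x := by
  have h1 : Nice (fun p : ℝ × ℝ => F (p.1 - c * p.2) * k p.2 * G p.1) :=
    (nice_shear_ker hk hF c).mul_bdd (hG.1.comp measurable_fst) (hG.2.1.imp fun C hC p => hC p.1)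
  have h2 : Nice (fun p : ℝ × ℝ => F p.1 * (G (p.1 - (-c) * p.2) * k p.2)) :=
    (nice_shear_ker hk hG (-c)).bdd_mul (hF.1.comp measurable_fst)
      (hF.2.1.imp fun C hC p => hC p.1)
  simp only [cnv, ← integral_mul_const, ← integral_const_mul]
  rw [Nice.swap (K := fun x τ => F (x - c * τ) * k τ * G x) h1,
    Nice.swap (K := fun x τ => F x * (G (x - (-c) * τ) * k τ)) h2]
  congr 1; ext τ
  rw [← integral_sub_right_eq_self (fun x => F x * (G (x - -c * τ) * k τ)) (c * τ)]
  congr 1; ext x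
  have : x - c * τ - -c * τ = x := by ring
  rw [this]; ring

theorem l2_cnv_le_of (hk : Nice k) (hF : Nice F) (c : ℝ) :
    l2 (cnv c k F) ≤ (∫ τ, |k τ|) * l2 F := by
  rw [← integral_mul_const]
  refine l2_integral_le (K := fun x τ => F (x - c * τ) * k τ) (nice_shear_ker hk hF c)
    ((hk.abs.integrable _).mul_const _) fun τ => le_of_eq ?_
  simp only [mul_comm _ (k τ)]
  rw [l2_const_mul, l2_comp_sub]

/-- Convolutions are smooth at the scale of the kernel. -/
theorem l2_cnv_translate_sub_le (hk : Ker A k) (hF : Nice F) (hc : c ≠ 0) (v : ℝ) :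
    l2 (fun x => cnv c k F (x - v) - cnv c k F x) ≤ A * (|v| / |c|) * l2 F := by
  have e : (fun x => cnv c k F (x - v) - cnv c k F x)
      = cnv c (fun τ => k (τ + - (v / c)) - k τ) F := by
    ext x
    have n1 : Nice (fun τ => k (τ + -(v / c))) := by
      simpa only [sub_eq_add_neg] using hk.nice.comp_sub (v / c)
    simp only [cnv, mul_sub]
    rw [integral_sub (integrable_cnv n1 hF c x) (integrable_cnv hk.nice hF c x)]
    congr 1
    rw [← integral_add_right_eq_self (fun τ => F (x - c * τ) * k (τ + -(v / c))) (v / c)]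
    congr 1; ext τ
    have : x - c * (τ + v / c) = x - v - c * τ := by field_simp; ring
    rw [this]; simp
  have n : Nice (fun τ => k (τ + - (v / c)) - k τ) := by
    refine Nice.sub ?_ hk.nice
    simpa only [sub_eq_add_neg] using hk.nice.comp_sub (v / c)
  rw [e]
  refine (l2_cnv_le_of n hF c).trans (mul_le_mul_of_nonneg_right ?_ (l2_nonneg _))
  refine (hk.var _).trans (le_of_eq ?_)
  rw [abs_neg, abs_div]

theorem l2_sub_dyE_le_of_translate (hG : Nice G) (r : ℕ) {D : ℝ}
    (hD : ∀ v, |v| ≤ (2 ^ r : ℝ)⁻¹ → l2 (fun x => G (x - v) - G x) ≤ D) :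
    l2 (fun x => G x - dyE r G x) ≤ 2 * D := by
  have h2 : (0:ℝ) < 2 ^ r := by positivity
  set I := Icc (-(2 ^ r : ℝ)⁻¹) ((2 ^ r : ℝ)⁻¹) with hI
  have nI : Nice (I.indicator fun _ => (2:ℝ) ^ r) := by
    refine ⟨measurable_const.indicator measurableSet_Icc, ⟨2 ^ r, fun x => ?_⟩, (2 ^ r : ℝ)⁻¹,
      fun x hx => indicator_of_notMem ?_ _⟩
    · by_cases h : x ∈ I <;> simp [h]
    · intro h; exact absurd (abs_le.2 h) (not_le.2 hx)
  have n0 : Nice (fun p : ℝ × ℝ => G p.1 * I.indicator (fun _ => (2:ℝ) ^ r) p.2) := by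
    simpa using nice_shear_ker nI hG 0
  have n1 : Nice (fun p : ℝ × ℝ => (G (p.1 - p.2) - G p.1) * I.indicator (fun _ => (2:ℝ) ^ r) p.2) := by
    have := (nice_shear_ker nI hG 1).sub n0
    simpa only [one_mul, ← sub_mul] using this
  have hle : ∀ x v, dyKer r x (x - v) ≤ I.indicator (fun _ => (2:ℝ) ^ r) v := by
    intro x v
    by_cases h : v ∈ I
    · rw [indicator_of_mem h]; exact dyKer_le ..
    · rw [indicator_of_notMem h]
      unfold dyKer
      rw [if_neg]
      intro hf
      have := abs_sub_lt_of_floor_eq hf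
      rw [sub_sub_cancel] at this
      refine h (abs_le.1 ?_)
      rw [← one_div, le_div_iff₀ h2]
      exact this.le
  have nK : Nice (fun p : ℝ × ℝ => (G (p.1 - p.2) - G p.1) * dyKer r p.1 (p.1 - p.2)) := by
    refine n1.of_le ?_ fun p => ?_
    · exact ((hG.1.comp (measurable_fst.sub measurable_snd)).sub (hG.1.comp measurable_fst)).mul
        ((measurable_dyKer r).comp (measurable_fst.prodMk (measurable_fst.sub measurable_snd)))
    · rw [abs_mul, abs_mul]
      refine mul_le_mul_of_nonneg_left ?_ (abs_nonneg _)
      rw [abs_of_nonneg (dyKer_nonneg ..), abs_of_nonneg (indicator_nonneg (fun _ _ => h2.le) _)]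
      exact hle _ _
  have e : ∀ x, ∫ v, (G (x - v) - G x) * dyKer r x (x - v) = -(G x - dyE r G x) := by
    intro x
    rw [integral_sub_left_eq_self (fun y => (G y - G x) * dyKer r x y) volume x]
    simp only [sub_mul]
    rw [integral_sub ((hG.mul (nice_dyKer r x)).integrable _)
      (((nice_dyKer r x).const_mul _).integrable _), integral_const_mul, integral_dyKer]
    simp only [dyE, mul_comm (G _)]
    ring
  have hD0 : 0 ≤ D := (l2_nonneg _).trans (hD 0 (by simp))
  have hw : ∫ v, D * I.indicator (fun _ => (2:ℝ) ^ r) v = 2 * D := by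
    rw [integral_const_mul, integral_indicator measurableSet_Icc, setIntegral_const, smul_eq_mul,
      Real.volume_real_Icc_of_le (by have : (0:ℝ) < (2 ^ r)⁻¹ := by positivity
                                     linarith)]
    field_simp; ring
  have main := l2_integral_le (K := fun x v => (G (x - v) - G x) * dyKer r x (x - v)) nK
    ((nI.const_mul D).integrable _) fun v => ?_
  · rw [hw] at main
    simp only [e] at main
    have e3 : l2 (fun x => -(G x - dyE r G x)) = l2 (fun x => G x - dyE r G x) := by
      simp only [l2, neg_sq]
    rwa [e3] at main
  · by_cases h : v ∈ I
    · have nv := (hG.comp_sub v).sub hG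
      have h3 := hD v (abs_le.2 h)
      calc _ ≤ l2 (fun x => 2 ^ r * (G (x - v) - G x)) := by
            refine l2_mono (nv.const_mul _) fun x => ?_
            rw [abs_mul, abs_mul, mul_comm, abs_of_pos h2]
            refine mul_le_mul_of_nonneg_right ?_ (abs_nonneg _)
            rw [abs_of_nonneg (dyKer_nonneg ..)]
            exact dyKer_le ..
        _ ≤ _ := by
            rw [l2_const_mul, abs_of_pos h2, indicator_of_mem h, mul_comm]
            exact mul_le_mul_of_nonneg_right h3 h2.le
    · have : ∀ x, dyKer r x (x - v) = 0 := fun x => le_antisymm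
        ((hle x v).trans_eq (indicator_of_notMem h _)) (dyKer_nonneg ..)
      simp [this, l2, h]

/-- High-frequency part of a convolution. -/
theorem l2_cnv_sub_dyE_le (hk : Ker A k) (hF : Nice F) (hc : c ≠ 0) (r : ℕ) :
    l2 (fun x => cnv c k F x - dyE r (cnv c k F) x) ≤ 2 * (A * ((2 ^ r)⁻¹ / |c|) * l2 F) := by
  refine l2_sub_dyE_le_of_translate (hF.cnv hk.nice c) r fun v hv => ?_
  refine (l2_cnv_translate_sub_le hk hF hc v).trans ?_
  have := hk.nonneg
  have := l2_nonneg F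
  gcongr

/-- Convolution of a function with vanishing averages. -/
theorem l2_cnv_le_of_dyE_eq_zero (hk : Ker A k) (hF : Nice F) (hc : c ≠ 0) {r : ℕ}
    (h0 : dyE r F = fun _ => 0) :
    l2 (cnv c k F) ≤ 2 * (A * ((2 ^ r)⁻¹ / |c|)) * l2 F := by
  have hn := hF.cnv hk.nice c
  have hA := hk.nonneg
  have hF0 := l2_nonneg F
  refine l2_le_of_dual (by positivity) ?_
  have hn2 := hn.cnv hk.nice (-c)
  rw [cnv_adj hk.nice hF hn]
  have e : ∫ x, F x * cnv (-c) k (cnv c k F) x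
      = ∫ x, F x * (cnv (-c) k (cnv c k F) x - dyE r (cnv (-c) k (cnv c k F)) x) := by
    simp only [mul_sub]
    rw [integral_sub ((hF.mul hn2).integrable _) ((hF.mul (hn2.dyE r)).integrable _),
      ← dyE_selfadj hF hn2, h0]
    simp
  rw [e]
  refine (abs_integral_mul_le hF (hn2.sub (hn2.dyE r))).trans ?_
  have := l2_cnv_sub_dyE_le hk hn (neg_ne_zero.2 hc) r
  rw [abs_neg] at this
  calc _ ≤ l2 F * (2 * (A * ((2 ^ r)⁻¹ / |c|) * l2 (cnv c k F))) := by gcongr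
    _ = _ := by ring

/-- Difference of two averaging operators. -/
noncomputable def dif (c c' : ℝ) (k F : ℝ → ℝ) (x : ℝ) : ℝ := cnv c k F x - cnv c' k F x

theorem Nice.dif (hF : Nice F) (hk : Nice k) (c c' : ℝ) : Nice (dif c c' k F) :=
  (hF.cnv hk c).sub (hF.cnv hk c')

theorem dif_sum (hk : Nice k) {ι : Type*} (s : Finset ι) {F : ι → ℝ → ℝ}
    (hF : ∀ i ∈ s, Nice (F i)) (c c' x : ℝ) :
    dif c c' k (fun y => ∑ i ∈ s, F i y) x = ∑ i ∈ s, dif c c' k (F i) x := by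
  simp only [dif, cnv_sum hk s hF, Finset.sum_sub_distrib]

theorem dif_adj (hk : Nice k) (hF : Nice F) (hG : Nice G) (c c' : ℝ) :
    ∫ x, dif c c' k F x * G x = ∫ x, F x * dif (-c) (-c') k G x := by
  simp only [dif, sub_mul, mul_sub]
  rw [integral_sub (((hF.cnv hk _).mul hG).integrable _) (((hF.cnv hk _).mul hG).integrable _),
    integral_sub ((hF.mul (hG.cnv hk _)).integrable _) ((hF.mul (hG.cnv hk _)).integrable _),
    cnv_adj hk hF hG, cnv_adj hk hF hG]

/-- The decay base `2^(-1/2)`. -/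
noncomputable def rho : ℝ := √(1 / 2)

theorem rho_sq : rho ^ 2 = 1 / 2 := Real.sq_sqrt (by norm_num)
theorem rho_pos : 0 < rho := Real.sqrt_pos.2 (by norm_num)
theorem rho_lt_one : rho < 1 := by
  have := rho_sq; have := rho_pos; nlinarith

theorem half_pow_le_rho_pow (n : ℕ) : (1 / 2 : ℝ) ^ n ≤ rho ^ n := by
  refine pow_le_pow_left₀ (by norm_num) ?_ n
  have := rho_sq; have := rho_lt_one; have := rho_pos
  nlinarith

theorem l2_translate_sub_le {l j : ℕ} (hlj : l ≤ j) (hF : Nice F) (hl : Lvl l F) {u : ℝ}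
    (hu : |u| ≤ (2 ^ j)⁻¹) : l2 (fun x => F (x - u) - F x) ≤ 2 * rho ^ (j - l) * l2 F := by
  have hF0 := l2_nonneg F
  have hr := rho_pos
  have h := l2_translate_sub_sq_le hF hl u
  have h1 : (2:ℝ) ^ l * |u| ≤ (rho ^ (j - l)) ^ 2 := by
    rw [← pow_mul, mul_comm (j - l), pow_mul, rho_sq]
    have e : (2:ℝ) ^ j = 2 ^ l * 2 ^ (j - l) := by rw [← pow_add]; congr 1; omega
    calc (2:ℝ) ^ l * |u| ≤ 2 ^ l * (2 ^ j)⁻¹ := by gcongr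
      _ = _ := by rw [e, one_div, inv_pow]; field_simp
  refine (le_abs_self _).trans (abs_le_of_sq_le_sq (h.trans ?_) (by positivity))
  calc _ ≤ 4 * (rho ^ (j - l)) ^ 2 * l2 F ^ 2 := by gcongr
    _ = _ := by ring

variable {c' : ℝ}

/-- Differences of averages are small on low-frequency functions. -/
theorem l2_dif_le_of_lvl (hk : Ker A k) {l j : ℕ} (hlj : l ≤ j) (hF : Nice F) (hl : Lvl l F)
    (hc : |c| = (2 ^ j)⁻¹) (hc' : |c'| = (2 ^ j)⁻¹) :
    l2 (dif c c' k F) ≤ 8 * A * rho ^ (j - l) * l2 F := by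
  have hr := rho_pos
  have hF0 := l2_nonneg F
  have e : dif c c' k F = fun x => ∫ τ, (F (x - c * τ) * k τ - F (x - c' * τ) * k τ) := by
    ext x
    simp only [dif, cnv]
    rw [integral_sub (integrable_cnv hk.nice hF c x) (integrable_cnv hk.nice hF c' x)]
  rw [e]
  have main := l2_integral_le (K := fun x τ => F (x - c * τ) * k τ - F (x - c' * τ) * k τ)
    (w := fun τ => |k τ| * (4 * rho ^ (j - l) * l2 F))
    ((nice_shear_ker hk.nice hF c).sub (nice_shear_ker hk.nice hF c'))
    ((hk.nice.abs.integrable _).mul_const _) fun τ => ?_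
  · refine main.trans ?_
    rw [integral_mul_const]
    calc _ ≤ 2 * A * (4 * rho ^ (j - l) * l2 F) := by
          gcongr; exact hk.integral_abs_le
      _ = _ := by ring
  · have e2 : (fun x => F (x - c * τ) * k τ - F (x - c' * τ) * k τ)
        = fun x => k τ * ((F (x - c * τ) - F x) - (F (x - c' * τ) - F x)) := by ext x; ring
    by_cases hτ : 1 < |τ|
    · simp [hk.supp τ hτ, l2]
    · rw [e2, l2_const_mul]
      refine mul_le_mul_of_nonneg_left ?_ (abs_nonneg _)
      have b : ∀ a : ℝ, |a| = (2 ^ j)⁻¹ → |a * τ| ≤ (2 ^ j)⁻¹ := by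
        intro a ha
        rw [abs_mul, ha]
        exact mul_le_of_le_one_right (by positivity) (not_lt.1 hτ)
      have h1 := l2_translate_sub_le hlj hF hl (b c hc)
      have h2 := l2_translate_sub_le hlj hF hl (b c' hc')
      refine (l2_sub_le ((hF.comp_sub _).sub hF) ((hF.comp_sub _).sub hF)).trans ?_
      linarith

/-- Differences of averages have small low-frequency part. -/
theorem l2_dyE_dif_le (hk : Ker A k) {r j : ℕ} (hrj : r ≤ j) (hF : Nice F)
    (hc : |c| = (2 ^ j)⁻¹) (hc' : |c'| = (2 ^ j)⁻¹) :
    l2 (dyE r (dif c c' k F)) ≤ 8 * A * rho ^ (j - r) * l2 F := by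
  have hA := hk.nonneg
  have hr := rho_pos
  have hF0 := l2_nonneg F
  have hn := hF.dif hk.nice c c'
  refine l2_le_of_dual (by positivity) ?_
  rw [dyE_selfadj hn (hn.dyE r), dyE_dyE_of_ge le_rfl, dif_adj hk.nice hF (hn.dyE r)]
  refine (abs_integral_mul_le hF ((hn.dyE r).dif hk.nice _ _)).trans ?_
  have := l2_dif_le_of_lvl (c := -c) (c' := -c') hk hrj (hn.dyE r) (lvl_dyE r _) (by rwa [abs_neg])
    (by rwa [abs_neg])
  calc _ ≤ l2 F * (8 * A * rho ^ (j - r) * l2 (dyE r (dif c c' k F))) := by gcongr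
    _ = _ := by ring

theorem inv_two_pow_div {r j : ℕ} (h : j ≤ r) (hc : |c| = (2 ^ j)⁻¹) :
    ((2:ℝ) ^ r)⁻¹ / |c| = (1 / 2) ^ (r - j) := by
  have e : (2:ℝ) ^ r = 2 ^ j * 2 ^ (r - j) := by rw [← pow_add]; congr 1; omega
  rw [hc, e, one_div, inv_pow]; field_simp

theorem ne_zero_of_abs {j : ℕ} (hc : |c| = ((2:ℝ) ^ j)⁻¹) : c ≠ 0 := by
  rintro rfl
  rw [abs_zero] at hc
  have : (0:ℝ) < (2 ^ j)⁻¹ := by positivity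
  linarith

theorem l2_dif_sub_dyE_le (hk : Ker A k) {r j : ℕ} (hrj : j ≤ r) (hF : Nice F)
    (hc : |c| = (2 ^ j)⁻¹) (hc' : |c'| = (2 ^ j)⁻¹) :
    l2 (fun x => dif c c' k F x - dyE r (dif c c' k F) x) ≤ 4 * A * (1 / 2) ^ (r - j) * l2 F := by
  have n1 := hF.cnv hk.nice c
  have n2 := hF.cnv hk.nice c'
  have h1 := l2_cnv_sub_dyE_le hk hF (ne_zero_of_abs hc) r
  have h2 := l2_cnv_sub_dyE_le hk hF (ne_zero_of_abs hc') r
  rw [inv_two_pow_div hrj hc] at h1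
  rw [inv_two_pow_div hrj hc'] at h2
  have e : (fun x => dif c c' k F x - dyE r (dif c c' k F) x) = fun x =>
      (cnv c k F x - dyE r (cnv c k F) x) - (cnv c' k F x - dyE r (cnv c' k F) x) := by
    ext x
    have : dyE r (dif c c' k F) x = dyE r (cnv c k F) x - dyE r (cnv c' k F) x := dyE_sub n1 n2 x
    rw [this]; simp only [dif]; ring
  rw [e]
  refine (l2_sub_le (n1.sub (n1.dyE r)) (n2.sub (n2.dyE r))).trans ?_
  linarith

theorem l2_dif_le_of_dyE_eq_zero (hk : Ker A k) {r j : ℕ} (hrj : j ≤ r) (hF : Nice F)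
    (h0 : dyE r F = fun _ => 0) (hc : |c| = (2 ^ j)⁻¹) (hc' : |c'| = (2 ^ j)⁻¹) :
    l2 (dif c c' k F) ≤ 4 * A * (1 / 2) ^ (r - j) * l2 F := by
  have h1 := l2_cnv_le_of_dyE_eq_zero hk hF (ne_zero_of_abs hc) h0
  have h2 := l2_cnv_le_of_dyE_eq_zero hk hF (ne_zero_of_abs hc') h0
  rw [inv_two_pow_div hrj hc] at h1
  rw [inv_two_pow_div hrj hc'] at h2
  refine (l2_sub_le (hF.cnv hk.nice c) (hF.cnv hk.nice c')).trans ?_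
  linarith

theorem half_pow_pred_le {n : ℕ} (hn : 1 ≤ n) : (1 / 2 : ℝ) ^ (n - 1) ≤ 2 * rho ^ n := by
  have h := half_pow_le_rho_pow n
  have : (1 / 2 : ℝ) ^ (n - 1) = 2 * (1 / 2) ^ n := by
    obtain ⟨m, rfl⟩ := Nat.exists_eq_add_of_le hn
    rw [Nat.add_sub_cancel_left, pow_add]; ring
  linarith

theorem dyE_eq_zero_of_dyD {f : ℝ → ℝ} (hf : Nice f) {r j : ℕ} (h : j < r) :
    dyE (r - 1) (dyD r f) = fun _ => 0 := dyE_dyD_of_lt (by omega) hf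

theorem l2_dyD_le_sub {G : ℝ → ℝ} (hG : Nice G) {r j : ℕ} (h : j < r) :
    l2 (dyD r G) ≤ l2 (fun x => G x - dyE (r - 1) G x) := by
  obtain ⟨s, rfl⟩ : ∃ s, r = s + 1 := ⟨r - 1, by omega⟩
  rw [Nat.add_sub_cancel]
  have hn := hG.sub (hG.dyE s)
  have e : dyD (s + 1) G = dyE (s + 1) (fun x => G x - dyE s G x) := by
    ext x
    rw [dyE_sub hG (hG.dyE s), dyE_dyE_of_ge (Nat.le_succ s)]
    rfl
  rw [e]
  exact l2_dyE_le hn _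

theorem l2_dyD_le_dyE {G : ℝ → ℝ} (hG : Nice G) (r : ℕ) : l2 (dyD r G) ≤ l2 (dyE r G) := by
  have e : dyD r G = dyD r (dyE r G) := by
    cases r with
    | zero => exact (dyE_dyE_of_ge le_rfl G).symm
    | succ r =>
      ext x
      simp only [dyD]
      rw [dyE_dyE_of_ge le_rfl, dyE_dyE_of_le (Nat.le_succ r) hG]
  rw [e]
  exact l2_dyD_le (hG.dyE r) r

theorem l2_dyD_dif_le (hk : Ker A k) (r j : ℕ) (hF : Nice F)
    (hc : |c| = (2 ^ j)⁻¹) (hc' : |c'| = (2 ^ j)⁻¹) :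
    l2 (dyD r (dif c c' k F)) ≤ 8 * A * rho ^ dd r j * l2 F := by
  have hA := hk.nonneg
  have hF0 := l2_nonneg F
  have hn := hF.dif hk.nice c c'
  rcases le_or_gt r j with h | h
  · have : dd r j = j - r := by unfold dd; omega
    rw [this]
    exact (l2_dyD_le_dyE hn r).trans (l2_dyE_dif_le hk h hF hc hc')
  · have : dd r j = r - j := by unfold dd; omega
    rw [this]
    refine (l2_dyD_le_sub hn h).trans ((l2_dif_sub_dyE_le hk (by omega) hF hc hc').trans ?_)
    have h2 := half_pow_pred_le (n := r - j) (by omega)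
    have e : r - 1 - j = r - j - 1 := by omega
    rw [e]
    calc _ ≤ 4 * A * (2 * rho ^ (r - j)) * l2 F := by gcongr
      _ = _ := by ring

theorem l2_dif_dyD_le (hk : Ker A k) (l j : ℕ) (hF : Nice F)
    (hc : |c| = (2 ^ j)⁻¹) (hc' : |c'| = (2 ^ j)⁻¹) :
    l2 (dif c c' k (dyD l F)) ≤ 8 * A * rho ^ dd l j * l2 (dyD l F) := by
  have hA := hk.nonneg
  have hF0 := l2_nonneg (dyD l F)
  rcases le_or_gt l j with h | h
  · have : dd l j = j - l := by unfold dd; omega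
    rw [this]
    exact l2_dif_le_of_lvl hk h (hF.dyD l) (lvl_dyD l F) hc hc'
  · have : dd l j = l - j := by unfold dd; omega
    rw [this]
    refine (l2_dif_le_of_dyE_eq_zero hk (r := l - 1) (by omega) (hF.dyD l)
      (dyE_eq_zero_of_dyD hF h) hc hc').trans ?_
    have h2 := half_pow_pred_le (n := l - j) (by omega)
    have e : l - 1 - j = l - j - 1 := by omega
    rw [e]
    calc _ ≤ 4 * A * (2 * rho ^ (l - j)) * l2 (dyD l F) := by gcongr
      _ = _ := by ring

/-- The decay base `2^(-1/4)`. -/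
noncomputable def vth : ℝ := √rho

theorem vth_sq : vth ^ 2 = rho := Real.sq_sqrt rho_pos.le
theorem vth_pos : 0 < vth := Real.sqrt_pos.2 rho_pos
theorem vth_lt_one : vth < 1 := by
  have := vth_sq; have := vth_pos; have := rho_lt_one; nlinarith

theorem le_mul_of_le_sq {x a b C : ℝ} (hC : 0 ≤ C) (ha : 0 ≤ a) (hb : 0 ≤ b) (h1 : x ≤ C * a ^ 2)
    (h2 : x ≤ C * b ^ 2) : x ≤ C * (a * b) := by
  rcases le_total a b with h | h
  · exact h1.trans (mul_le_mul_of_nonneg_left (by nlinarith) hC)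
  · exact h2.trans (mul_le_mul_of_nonneg_left (by nlinarith) hC)

/-- Almost orthogonality of differences of averages and martingale differences. -/
theorem l2_dyD_dif_dyD_le (hk : Ker A k) (r l j : ℕ) (hF : Nice F)
    (hc : |c| = (2 ^ j)⁻¹) (hc' : |c'| = (2 ^ j)⁻¹) :
    l2 (dyD r (dif c c' k (dyD l F)))
      ≤ 8 * A * l2 (dyD l F) * (vth ^ dd r j * vth ^ dd l j) := by
  have hA := hk.nonneg
  have hF0 := l2_nonneg (dyD l F)
  have hv := vth_pos
  have e : ∀ n, (vth ^ n) ^ 2 = rho ^ n := fun n => by rw [← pow_mul, mul_comm, pow_mul, vth_sq]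
  refine le_mul_of_le_sq (by positivity) (by positivity) (by positivity) ?_ ?_
  · rw [e]
    refine (l2_dyD_dif_le hk r j (hF.dyD l) hc hc').trans (le_of_eq (by ring))
  · rw [e]
    refine (l2_dyD_le ((hF.dyD l).dif hk.nice c c') r).trans
      ((l2_dif_dyD_le hk l j hF hc hc').trans (le_of_eq (by ring)))

end cnv

/-- Expanding continuous maps of the line have continuous global inverses. -/
theorem exists_inverse_of_expanding {θ : ℝ → ℝ} (hθ : Continuous θ) {c : ℝ} (hc : 0 < c)
    (hexp : ∀ x y, x ≤ y → c * (y - x) ≤ θ y - θ x) :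
    ∃ ψ : ℝ → ℝ, Continuous ψ ∧ Monotone ψ ∧ (∀ x, ψ (θ x) = x) ∧ (∀ y, θ (ψ y) = y) ∧
      ∀ b D, D ≠ 0 → HasDerivAt θ D b → HasDerivAt ψ D⁻¹ (θ b) := by
  have hmono : StrictMono θ := fun x y hxy => by
    have := hexp x y hxy.le
    nlinarith [mul_pos hc (sub_pos.2 hxy)]
  have htop : Filter.Tendsto θ Filter.atTop Filter.atTop := by
    refine Filter.tendsto_atTop_mono' _ (f₁ := fun x => c * x + θ 0) ?_ ?_
    · filter_upwards [Filter.eventually_ge_atTop 0] with x hx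
      have := hexp 0 x hx
      linarith
    · exact Filter.tendsto_atTop_add_const_right _ _ (Filter.tendsto_id.const_mul_atTop hc)
  have hbot : Filter.Tendsto θ Filter.atBot Filter.atBot := by
    refine Filter.tendsto_atBot_mono' _ (f₂ := θ) (f₁ := fun x => c * x + θ 0) ?_ ?_
    · filter_upwards [Filter.eventually_le_atBot 0] with x hx
      have := hexp x 0 hx
      linarith
    · exact Filter.tendsto_atBot_add_const_right _ _ (Filter.tendsto_id.const_mul_atBot hc)
  have hsurj : Function.Surjective θ := hθ.surjective htop hbot
  let e := hmono.orderIsoOfSurjective θ hsurj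
  have h1 : ∀ x, e.symm (θ x) = x := fun x => e.symm_apply_apply x
  have h2 : ∀ y, θ (e.symm y) = y := fun y => e.apply_symm_apply y
  refine ⟨e.symm, e.symm.continuous, e.symm.monotone, h1, h2, fun b D hD hd => ?_⟩
  refine HasDerivAt.of_local_left_inverse (f := θ) e.symm.continuous.continuousAt ?_ hD
    (Filter.Eventually.of_forall h2)
  rwa [h1]

/-- Change of variables through an expanding map. -/
theorem integral_indicator_eq_comp_inverse {θ ψ D : ℝ → ℝ} {p q : ℝ}
    (h1 : ∀ x, ψ (θ x) = x) (h2 : ∀ y, θ (ψ y) = y)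
    (hD : ∀ b ∈ Icc p q, HasDerivAt θ (D b) b) (hpos : ∀ b ∈ Icc p q, 0 < D b) (H : ℝ → ℝ) (c : ℝ) :
    ∫ b, (Icc p q).indicator H b
      = ∫ y, (Icc p q).indicator (fun b => H b / D b) (ψ (c - y)) := by
  rw [integral_sub_left_eq_self (fun z => (Icc p q).indicator (fun b => H b / D b) (ψ z)) volume c]
  have hinj : InjOn θ (Icc p q) := fun x _ y _ h => by rw [← h1 x, h, h1]
  have e : (fun z => (Icc p q).indicator (fun b => H b / D b) (ψ z))
      = (θ '' Icc p q).indicator (fun z => H (ψ z) / D (ψ z)) := by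
    ext z
    have : z ∈ θ '' Icc p q ↔ ψ z ∈ Icc p q := by
      constructor
      · rintro ⟨x, hx, rfl⟩; rwa [h1]
      · intro h; exact ⟨ψ z, h, h2 z⟩
    by_cases hz : ψ z ∈ Icc p q
    · rw [indicator_of_mem hz, indicator_of_mem (this.2 hz)]
    · rw [indicator_of_notMem hz, indicator_of_notMem fun h => hz (this.1 h)]
  have hcont : ContinuousOn θ (Icc p q) := fun b hb => (hD b hb).continuousAt.continuousWithinAt
  have hm : MeasurableSet (θ '' Icc p q) := (isCompact_Icc.image_of_continuousOn hcont).measurableSet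
  rw [e, integral_indicator hm, integral_indicator measurableSet_Icc,
    integral_image_eq_integral_abs_deriv_smul measurableSet_Icc
      (fun b hb => (hD b hb).hasDerivWithinAt) hinj]
  refine setIntegral_congr_fun measurableSet_Icc fun b hb => ?_
  have := hpos b hb
  simp only [h1, smul_eq_mul, abs_of_pos this]
  field_simp

theorem integral_comp_indicator_le {θ ψ D : ℝ → ℝ} {p q M : ℝ} (hM : 0 < M)
    (h1 : ∀ x, ψ (θ x) = x) (h2 : ∀ y, θ (ψ y) = y)
    (hD : ∀ b ∈ Icc p q, HasDerivAt θ (D b) b) (hlow : ∀ b ∈ Icc p q, M⁻¹ ≤ D b)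
    {u : ℝ → ℝ} (hu : Nice u) (h0 : ∀ x, 0 ≤ u x) (c : ℝ) :
    ∫ b, (Icc p q).indicator (fun b => u (c - θ b)) b ≤ M * ∫ x, u x := by
  have hMi : 0 < M⁻¹ := by positivity
  rw [integral_indicator_eq_comp_inverse h1 h2 hD (fun b hb => hMi.trans_le (hlow b hb)) _ c,
    ← integral_const_mul]
  refine integral_mono_of_nonneg (Filter.Eventually.of_forall fun y => ?_)
    ((hu.const_mul M).integrable _) (Filter.Eventually.of_forall fun y => ?_)
  · exact indicator_nonneg (fun b hb => div_nonneg (h0 _) (hMi.trans_le (hlow b hb)).le) _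
  · by_cases h : ψ (c - y) ∈ Icc p q
    · simp only [indicator_of_mem h, h2, sub_sub_cancel]
      rw [div_le_iff₀ (hMi.trans_le (hlow _ h))]
      have := hlow _ h
      calc u y = M * u y * M⁻¹ := by field_simp
        _ ≤ _ := by
          have := h0 y
          gcongr
    · simp only [indicator_of_notMem h]
      exact mul_nonneg hM.le (h0 y)

/-- Integration by parts against a primitive with a countable exceptional set. -/
theorem abs_integral_comp_mul_deriv_le {f P : ℝ → ℝ} (hf : Nice f) (hP : Continuous P)
    {Z : Set ℝ} (hZ : Z.Countable) (hd : ∀ y, y ∉ Z → HasDerivAt P (f y) y) {Bd : ℝ}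
    (hB : ∀ y, |P y| ≤ Bd) {a c : ℝ} (hac : a ≤ c) {Y Y' N N' : ℝ → ℝ}
    (hY : ∀ t ∈ Icc a c, HasDerivAt Y (Y' t) t) (hN : ∀ t ∈ Icc a c, HasDerivAt N (N' t) t)
    (hY0 : ∀ t ∈ Icc a c, Y' t ≠ 0) {n0 n1 y1 : ℝ} (hYb : ∀ t ∈ Icc a c, |Y' t| ≤ y1)
    (hn0 : ∀ t ∈ Icc a c, |N t| ≤ n0) (hn1 : ∀ t ∈ Icc a c, |N' t| ≤ n1) :
    |∫ t in Icc a c, f (Y t) * (Y' t * N t)| ≤ Bd * (2 * n0 + (c - a) * n1) := by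
  have hYc : ContinuousOn Y (Icc a c) := fun t ht => (hY t ht).continuousAt.continuousWithinAt
  have hNc : ContinuousOn N (Icc a c) := fun t ht => (hN t ht).continuousAt.continuousWithinAt
  have hinj : InjOn Y (Icc a c) := by
    have key : ∀ x ∈ Icc a c, ∀ y ∈ Icc a c, x < y → Y x ≠ Y y := by
      intro x hx y hy hxy h
      obtain ⟨z, hz, hz0⟩ := exists_hasDerivAt_eq_zero hxy
        (hYc.mono (Icc_subset_Icc hx.1 hy.2)) h
        (fun t ht => hY t ⟨hx.1.trans ht.1.le, ht.2.le.trans hy.2⟩)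
      exact hY0 z ⟨hx.1.trans hz.1.le, hz.2.le.trans hy.2⟩ hz0
    intro x hx y hy h
    rcases lt_trichotomy x y with hl | hl | hl
    · exact absurd h (key x hx y hy hl)
    · exact hl
    · exact absurd h.symm (key y hy x hx hl)
  have hZ' : (Icc a c ∩ Y ⁻¹' Z).Countable :=
    Set.MapsTo.countable_of_injOn (f := Y) (fun x hx => hx.2) (hinj.mono inter_subset_left) hZ
  obtain ⟨hfm, ⟨Cf, hCf⟩, _⟩ := hf
  have mY' : AEStronglyMeasurable Y' (volume.restrict (Icc a c)) := by
    refine (measurable_deriv Y).aestronglyMeasurable.congr ?_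
    filter_upwards [ae_restrict_mem measurableSet_Icc] with t ht using (hY t ht).deriv
  have mN' : AEStronglyMeasurable N' (volume.restrict (Icc a c)) := by
    refine (measurable_deriv N).aestronglyMeasurable.congr ?_
    filter_upwards [ae_restrict_mem measurableSet_Icc] with t ht using (hN t ht).deriv
  have mY : AEMeasurable Y (volume.restrict (Icc a c)) := hYc.aemeasurable measurableSet_Icc
  have mN : AEStronglyMeasurable N (volume.restrict (Icc a c)) :=
    hNc.aestronglyMeasurable measurableSet_Icc
  have mfY : AEStronglyMeasurable (fun t => f (Y t)) (volume.restrict (Icc a c)) :=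
    (hfm.comp_aemeasurable mY).aestronglyMeasurable
  have mPY : AEStronglyMeasurable (fun t => P (Y t)) (volume.restrict (Icc a c)) :=
    (hP.measurable.comp_aemeasurable mY).aestronglyMeasurable
  have i1 : IntegrableOn (fun t => f (Y t) * (Y' t * N t)) (Icc a c) := by
    refine Integrable.of_bound (C := Cf * (y1 * n0)) ?_ ?_
    · exact mfY.mul (mY'.mul mN)
    · filter_upwards [ae_restrict_mem measurableSet_Icc] with t ht
      rw [Real.norm_eq_abs, abs_mul, abs_mul]
      have a1 := hYb t ht
      have a2 := hn0 t ht
      have a3 := hCf (Y t)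
      have : 0 ≤ y1 := (abs_nonneg _).trans a1
      have : 0 ≤ Cf := (abs_nonneg _).trans a3
      gcongr
  have i2 : IntegrableOn (fun t => P (Y t) * N' t) (Icc a c) := by
    refine Integrable.of_bound (C := Bd * n1) ?_ ?_
    · exact mPY.mul mN'
    · filter_upwards [ae_restrict_mem measurableSet_Icc] with t ht
      rw [Real.norm_eq_abs, abs_mul]
      have a1 := hB (Y t)
      have a2 := hn1 t ht
      have : 0 ≤ Bd := (abs_nonneg _).trans a1
      gcongr
  have ftc := integral_eq_of_hasDerivAt_off_countable (fun t => P (Y t) * N t)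
    (fun t => f (Y t) * (Y' t * N t) + P (Y t) * N' t) (a := a) (b := c) hZ'
    (by rw [uIcc_of_le hac]; exact (hP.comp_continuousOn hYc).mul hNc)
    (by
      intro t ht
      rw [min_eq_left hac, max_eq_right hac] at ht
      have htI : t ∈ Icc a c := Ioo_subset_Icc_self ht.1
      have hz : Y t ∉ Z := fun h => ht.2 ⟨htI, h⟩
      have := ((hd _ hz).comp t (hY t htI)).mul (hN t htI)
      refine this.congr_deriv ?_
      simp only [Function.comp]; ring)
    (by
      rw [intervalIntegrable_iff_integrableOn_Icc_of_le hac]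
      exact i1.add i2)
  rw [intervalIntegral.integral_of_le hac, ← integral_Icc_eq_integral_Ioc, integral_add i1 i2] at ftc
  have hBd : 0 ≤ Bd := (abs_nonneg _).trans (hB 0)
  have b1 : |P (Y c) * N c| ≤ Bd * n0 := by
    rw [abs_mul]
    exact mul_le_mul (hB _) (hn0 c (right_mem_Icc.2 hac)) (abs_nonneg _) hBd
  have b2 : |P (Y a) * N a| ≤ Bd * n0 := by
    rw [abs_mul]
    exact mul_le_mul (hB _) (hn0 a (left_mem_Icc.2 hac)) (abs_nonneg _) hBd
  have b3 : |∫ t in Icc a c, P (Y t) * N' t| ≤ Bd * n1 * (c - a) := by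
    have := norm_setIntegral_le_of_norm_le_const (μ := volume) (s := Icc a c)
      (f := fun t => P (Y t) * N' t) (C := Bd * n1) (by simp) (fun t ht => by
        rw [Real.norm_eq_abs, abs_mul]
        exact mul_le_mul (hB _) (hn1 t ht) (abs_nonneg _) hBd)
    rwa [Real.volume_real_Icc_of_le hac] at this
  have e : ∫ t in Icc a c, f (Y t) * (Y' t * N t)
      = P (Y c) * N c - P (Y a) * N a - ∫ t in Icc a c, P (Y t) * N' t := by linarith
  rw [e]
  rw [abs_le] at *
  constructor <;> nlinarith

/-- `ψ` is a global inverse of the increasing map `θ`, differentiable where `θ` is. -/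
structure SmoothInv (θ ψ : ℝ → ℝ) : Prop where
  cont : Continuous ψ
  mono : Monotone ψ
  left : ∀ x, ψ (θ x) = x
  right : ∀ y, θ (ψ y) = y
  deriv : ∀ b D, D ≠ 0 → HasDerivAt θ D b → HasDerivAt ψ D⁻¹ (θ b)

theorem exists_smoothInv {θ : ℝ → ℝ} (hθ : Continuous θ) {c : ℝ} (hc : 0 < c)
    (hexp : ∀ x y, x ≤ y → c * (y - x) ≤ θ y - θ x) : ∃ ψ, SmoothInv θ ψ := by
  obtain ⟨ψ, h1, h2, h3, h4, h5⟩ := exists_inverse_of_expanding hθ hc hexp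
  exact ⟨ψ, h1, h2, h3, h4, h5⟩

/-- `u` is differentiable at `t` with `|u t| ≤ a` and `|u' t| ≤ b`. -/
def DBound (u : ℝ → ℝ) (t a b : ℝ) : Prop :=
  DifferentiableAt ℝ u t ∧ |u t| ≤ a ∧ |deriv u t| ≤ b

theorem DBound.mul {u v : ℝ → ℝ} {t a b a' b' : ℝ} (hu : DBound u t a b) (hv : DBound v t a' b') :
    DBound (fun x => u x * v x) t (a * a') (b * a' + a * b') := by
  have ha : 0 ≤ a := (abs_nonneg _).trans hu.2.1
  have hb : 0 ≤ b := (abs_nonneg _).trans hu.2.2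
  refine ⟨hu.1.mul hv.1, ?_, ?_⟩
  · rw [abs_mul]; exact mul_le_mul hu.2.1 hv.2.1 (abs_nonneg _) ha
  · have : deriv (fun x => u x * v x) t = deriv u t * v t + u t * deriv v t :=
      (hu.1.hasDerivAt.mul hv.1.hasDerivAt).deriv
    rw [this]
    refine (abs_add_le _ _).trans (add_le_add ?_ ?_)
    · rw [abs_mul]; exact mul_le_mul hu.2.2 hv.2.1 (abs_nonneg _) hb
    · rw [abs_mul]; exact mul_le_mul hu.2.1 hv.2.2 (abs_nonneg _) ha

theorem DBound.sub {u v : ℝ → ℝ} {t a b a' b' : ℝ} (hu : DBound u t a b) (hv : DBound v t a' b') :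
    DBound (fun x => u x - v x) t (a + a') (b + b') := by
  refine ⟨hu.1.sub hv.1, (abs_sub _ _).trans (add_le_add hu.2.1 hv.2.1), ?_⟩
  have : deriv (fun x => u x - v x) t = deriv u t - deriv v t :=
    (hu.1.hasDerivAt.sub hv.1.hasDerivAt).deriv
  rw [this]
  exact (abs_sub _ _).trans (add_le_add hu.2.2 hv.2.2)

theorem DBound.const_mul {u : ℝ → ℝ} {t a b : ℝ} (hu : DBound u t a b) (c : ℝ) :
    DBound (fun x => c * u x) t (|c| * a) (|c| * b) := by
  refine ⟨hu.1.const_mul c, ?_, ?_⟩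
  · rw [abs_mul]; exact mul_le_mul_of_nonneg_left hu.2.1 (abs_nonneg _)
  · have : deriv (fun x => c * u x) t = c * deriv u t := (hu.1.hasDerivAt.const_mul c).deriv
    rw [this, abs_mul]; exact mul_le_mul_of_nonneg_left hu.2.2 (abs_nonneg _)

theorem DBound.mul_inv {u v : ℝ → ℝ} {t a b a' b' δ : ℝ} (hu : DBound u t a b)
    (hv : DBound v t a' b') (hδ : 0 < δ) (hl : δ ≤ |v t|) :
    DBound (fun x => u x / v x) t (a / δ) (b / δ + a * b' / δ ^ 2) := by
  have hv0 : v t ≠ 0 := fun h => by rw [h, abs_zero] at hl; linarith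
  have ha : 0 ≤ a := (abs_nonneg _).trans hu.2.1
  have hb : 0 ≤ b := (abs_nonneg _).trans hu.2.2
  have hb' : 0 ≤ b' := (abs_nonneg _).trans hv.2.2
  refine ⟨hu.1.div hv.1 hv0, ?_, ?_⟩
  · rw [abs_div]; exact div_le_div₀ ha hu.2.1 hδ hl
  · have : deriv (fun x => u x / v x) t = deriv u t / v t - u t * deriv v t / v t ^ 2 := by
      refine (hu.1.hasDerivAt.div hv.1.hasDerivAt hv0).deriv.trans ?_
      field_simp
    rw [this]
    refine (abs_sub _ _).trans (add_le_add ?_ ?_)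
    · rw [abs_div]; exact div_le_div₀ hb hu.2.2 hδ hl
    · rw [abs_div, abs_mul, abs_pow]
      exact div_le_div₀ (mul_nonneg ha hb')
        (mul_le_mul hu.2.1 hv.2.2 (abs_nonneg _) ha) (by positivity) (by gcongr)

theorem DBound.comp {u v : ℝ → ℝ} {t a b L v' : ℝ} (hu : DBound u (v t) a b)
    (hv : HasDerivAt v v' t) (hL : |v'| ≤ L) : DBound (fun x => u (v x)) t a (b * L) := by
  refine ⟨hu.1.comp t hv.differentiableAt, hu.2.1, ?_⟩
  have hb : 0 ≤ b := (abs_nonneg _).trans hu.2.2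
  have : deriv (fun x => u (v x)) t = deriv u (v t) * v' := (hu.1.hasDerivAt.comp t hv).deriv
  rw [this, abs_mul]
  exact mul_le_mul hu.2.2 hL (abs_nonneg _) hb

/-- Quantitative hypotheses on a curve `b ↦ α b` with `α' = 1 / B`. -/
structure Crv (α B B' B'' κ κ' : ℝ → ℝ) (m M lo hi : ℝ) : Prop where
  m_pos : 0 < m
  m_le : m ≤ 1
  le_M : 1 ≤ M
  cont : Continuous α
  expand : ∀ x y, x ≤ y → M⁻¹ * (y - x) ≤ α y - α x
  meas_B : Measurable B
  meas_κ : Measurable κ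
  dα : ∀ b ∈ Ioo lo hi, HasDerivAt α (B b)⁻¹ b
  dB : ∀ b ∈ Ioo lo hi, HasDerivAt B (B' b) b
  dB' : ∀ b ∈ Ioo lo hi, HasDerivAt B' (B'' b) b
  dκ : ∀ b ∈ Ioo lo hi, HasDerivAt κ (κ' b) b
  B_ge : ∀ b ∈ Ioo lo hi, m ≤ B b
  B_le : ∀ b ∈ Ioo lo hi, B b ≤ M
  B'_le : ∀ b ∈ Ioo lo hi, |B' b| ≤ M
  B''_le : ∀ b ∈ Ioo lo hi, B'' b ≤ -m
  κ_le : ∀ b ∈ Ioo lo hi, |κ b| ≤ M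
  κ'_le : ∀ b ∈ Ioo lo hi, |κ' b| ≤ M

section
variable {α B B' B'' κ κ' : ℝ → ℝ} {m M lo hi : ℝ}

theorem abs_sub_le_of_hasDerivAt {u u' : ℝ → ℝ} {C : ℝ} (hu : ∀ b ∈ Ioo lo hi, HasDerivAt u (u' b) b)
    (hb : ∀ b ∈ Ioo lo hi, |u' b| ≤ C) {x y : ℝ} (hx : x ∈ Ioo lo hi) (hy : y ∈ Ioo lo hi) :
    |u x - u y| ≤ C * |x - y| := by
  have := (convex_Ioo lo hi).norm_image_sub_le_of_norm_hasDerivWithin_le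
    (fun b hb => (hu b hb).hasDerivWithinAt) hb hy hx
  simpa [Real.norm_eq_abs] using this

theorem Crv.α_lip (hc : Crv α B B' B'' κ κ' m M lo hi) {x y : ℝ} (hx : x ∈ Ioo lo hi)
    (hy : y ∈ Ioo lo hi) : |α x - α y| ≤ m⁻¹ * |x - y| := by
  refine abs_sub_le_of_hasDerivAt hc.dα (fun b hb => ?_) hx hy
  have := hc.B_ge b hb
  have hm := hc.m_pos
  rw [abs_of_pos (inv_pos.2 (hm.trans_le this))]
  exact inv_anti₀ hm this

theorem Crv.B_lip (hc : Crv α B B' B'' κ κ' m M lo hi) {x y : ℝ} (hx : x ∈ Ioo lo hi)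
    (hy : y ∈ Ioo lo hi) : |B x - B y| ≤ M * |x - y| :=
  abs_sub_le_of_hasDerivAt hc.dB hc.B'_le hx hy

theorem Crv.B'_gap (hc : Crv α B B' B'' κ κ' m M lo hi) {x y : ℝ} (hx : x ∈ Ioo lo hi)
    (hy : y ∈ Ioo lo hi) (hxy : x ≤ y) : m * (y - x) ≤ B' x - B' y := by
  rcases hxy.eq_or_lt with rfl | h
  · simp
  have hsub : ∀ z ∈ Icc x y, z ∈ Ioo lo hi := fun z hz => ⟨hx.1.trans_le hz.1, hz.2.trans_lt hy.2⟩
  obtain ⟨z, hz, e⟩ := exists_hasDerivAt_eq_slope B' B'' h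
    (fun z hz => (hc.dB' z (hsub z hz)).continuousAt.continuousWithinAt)
    (fun z hz => hc.dB' z (hsub z (Ioo_subset_Icc_self hz)))
  have h0 : 0 < y - x := sub_pos.2 h
  rw [eq_div_iff h0.ne'] at e
  have := hc.B''_le z (hsub z (Ioo_subset_Icc_self hz))
  nlinarith

theorem Crv.second_difference (hc : Crv α B B' B'' κ κ' m M lo hi) {x y w : ℝ}
    (hx : x ∈ Ioo lo hi) (hy : y ∈ Ioo lo hi) (hxw : x + w ∈ Ioo lo hi) (hyw : y + w ∈ Ioo lo hi) :
    m * (|x - y| * |w|) ≤ |(B (x + w) - B x) - (B (y + w) - B y)| := by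
  have main : ∀ x y, x ∈ Ioo lo hi → y ∈ Ioo lo hi → x + w ∈ Ioo lo hi → y + w ∈ Ioo lo hi →
      x < y → m * (|x - y| * |w|) ≤ |(B (x + w) - B x) - (B (y + w) - B y)| := by
    intro x y hx hy hxw hyw h
    have hsub : ∀ z ∈ Icc x y, z ∈ Ioo lo hi :=
      fun z hz => ⟨hx.1.trans_le hz.1, hz.2.trans_lt hy.2⟩
    have hsubw : ∀ z ∈ Icc x y, z + w ∈ Ioo lo hi :=
      fun z hz => ⟨hxw.1.trans_le (by linarith [hz.1]), lt_of_le_of_lt (by linarith [hz.2]) hyw.2⟩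
    have hder : ∀ z ∈ Icc x y, HasDerivAt (fun z => B (z + w) - B z) (B' (z + w) - B' z) z :=
      fun z hz => ((hc.dB _ (hsubw z hz)).comp_add_const z w).sub (hc.dB z (hsub z hz))
    obtain ⟨z, hz, e⟩ := exists_hasDerivAt_eq_slope (fun z => B (z + w) - B z) _ h
      (fun z hz => (hder z hz).continuousAt.continuousWithinAt)
      (fun z hz => hder z (Ioo_subset_Icc_self hz))
    have h0 : 0 < y - x := sub_pos.2 h
    rw [eq_div_iff h0.ne'] at e
    have hz' := Ioo_subset_Icc_self hz
    have key : m * |w| ≤ |B' (z + w) - B' z| := by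
      rcases le_total 0 w with hw | hw
      · have := hc.B'_gap (hsub z hz') (hsubw z hz') (by linarith)
        rw [abs_of_nonneg hw, abs_sub_comm]
        exact le_trans (by linarith) (le_abs_self _)
      · have := hc.B'_gap (hsubw z hz') (hsub z hz') (by linarith)
        rw [abs_of_nonpos hw]
        exact le_trans (by linarith) (le_abs_self _)
    rw [abs_sub_comm (B (x + w) - B x), ← e, abs_mul, abs_sub_comm x y, abs_of_pos h0]
    nlinarith
  rcases lt_trichotomy x y with h | h | h
  · exact main x y hx hy hxw hyw h
  · simp [h]
  · rw [abs_sub_comm x, abs_sub_comm (B (x + w) - B x)]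
    exact main y x hy hx hyw hxw h

/-- Non-degeneracy of the perturbed second difference. -/
theorem Crv.perturbed_second_difference (hc : Crv α B B' B'' κ κ' m M lo hi) {x y w s : ℝ}
    (hx : x ∈ Ioo lo hi) (hy : y ∈ Ioo lo hi) (hxw : x + w ∈ Ioo lo hi) (hyw : y + w ∈ Ioo lo hi)
    (hs : |s| * (M + M ^ 2 / m) ≤ 1 / 2) :
    m / 2 * (|x - y| * |w|) ≤ |B y - B x - B (y + w) + B (x + w)
      - s * (B y * B (x + w) - B x * B (y + w))| := by
  have hm := hc.m_pos
  have hM : 0 < M := lt_of_lt_of_le one_pos hc.le_M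
  set Dl := B y - B x - B (y + w) + B (x + w) with hDl
  have h1 : m * (|x - y| * |w|) ≤ |Dl| := by
    have := hc.second_difference hx hy hxw hyw
    have e : (B (x + w) - B x) - (B (y + w) - B y) = Dl := by rw [hDl]; ring
    rwa [e] at this
  have e : B y * B (x + w) - B x * B (y + w)
      = B y * Dl - (B (y + w) - B y) * (B x - B y) := by rw [hDl]; ring
  have b1 : |B y * Dl| ≤ M * |Dl| := by
    rw [abs_mul, abs_of_pos (hm.trans_le (hc.B_ge y hy))]
    exact mul_le_mul_of_nonneg_right (hc.B_le y hy) (abs_nonneg _)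
  have b2 : |(B (y + w) - B y) * (B x - B y)| ≤ M ^ 2 / m * |Dl| := by
    rw [abs_mul]
    have c1 := hc.B_lip hyw hy
    have c2 := hc.B_lip hx hy
    rw [add_sub_cancel_left] at c1
    calc |B (y + w) - B y| * |B x - B y| ≤ (M * |w|) * (M * |x - y|) := by gcongr
      _ = M ^ 2 / m * (m * (|x - y| * |w|)) := by field_simp
      _ ≤ _ := by gcongr
  have b3 : |s * (B y * B (x + w) - B x * B (y + w))| ≤ 1 / 2 * |Dl| := by
    rw [e, abs_mul]
    calc _ ≤ |s| * (M * |Dl| + M ^ 2 / m * |Dl|) := by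
          gcongr
          exact (abs_sub _ _).trans (add_le_add b1 b2)
      _ = |s| * (M + M ^ 2 / m) * |Dl| := by ring
      _ ≤ _ := by gcongr
  have := abs_sub_abs_le_abs_sub Dl (s * (B y * B (x + w) - B x * B (y + w)))
  nlinarith

end

theorem mem_Icc_of_mem_Icc_of_monotoneOn {S : Set ℝ} (hS : S.OrdConnected) {u : ℝ → ℝ}
    (hu : MonotoneOn u S) (p q : ℝ) : {t | t ∈ S ∧ u t ∈ Icc p q}.OrdConnected :=
  ⟨fun _ hx _ hy z hz => by
    have hz' : z ∈ S := hS.out hx.1 hy.1 hz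
    exact ⟨hz', hx.2.1.trans (hu hx.1 hz' hz.1), (hu hz' hy.1 hz.2).trans hy.2.2⟩⟩

section
variable {α B B' B'' κ κ' : ℝ → ℝ} {m M lo hi s p q : ℝ} {ψ β : ℝ → ℝ}

/-- The standing hypotheses: a short piece `[p, q]` of a curve, a small parameter `s`, and the
inverses of `b ↦ α b - s b` and of `α`. -/
structure CrvPiece (α B B' B'' κ κ' : ℝ → ℝ) (m M lo hi s p q : ℝ) (ψ β : ℝ → ℝ) : Prop
    extends Crv α B B' B'' κ κ' m M lo hi where
  s_le : |s| * (M + M ^ 2 / m) ≤ 1 / 2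
  lo_lt : lo < p
  lt_hi : q < hi
  short : q - p ≤ m / (6 * M)
  invψ : SmoothInv (fun b => α b - s * b) ψ
  invβ : SmoothInv α β

theorem CrvPiece.mem (hc : CrvPiece α B B' B'' κ κ' m M lo hi s p q ψ β) {b : ℝ}
    (hb : b ∈ Icc p q) : b ∈ Ioo lo hi := ⟨hc.lo_lt.trans_le hb.1, hb.2.trans_lt hc.lt_hi⟩

theorem CrvPiece.M_pos (hc : CrvPiece α B B' B'' κ κ' m M lo hi s p q ψ β) : 0 < M :=
  lt_of_lt_of_le one_pos hc.le_M

theorem CrvPiece.abs_s_mul (hc : CrvPiece α B B' B'' κ κ' m M lo hi s p q ψ β) :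
    |s| * M ≤ 1 / 2 := by
  have hm := hc.m_pos
  have hM := hc.M_pos
  refine le_trans ?_ hc.s_le
  gcongr
  have : 0 ≤ M ^ 2 / m := by positivity
  linarith

theorem CrvPiece.one_sub_ge (hc : CrvPiece α B B' B'' κ κ' m M lo hi s p q ψ β) {b : ℝ}
    (hb : b ∈ Icc p q) : 1 / 2 ≤ 1 - s * B b ∧ 1 - s * B b ≤ 3 / 2 := by
  have h1 := hc.B_ge b (hc.mem hb)
  have h2 := hc.B_le b (hc.mem hb)
  have hm := hc.m_pos
  have h : |s * B b| ≤ 1 / 2 := by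
    rw [abs_mul, abs_of_pos (hm.trans_le h1)]
    exact (mul_le_mul_of_nonneg_left h2 (abs_nonneg _)).trans hc.abs_s_mul
  rw [abs_le] at h
  constructor <;> linarith

theorem CrvPiece.dφ (hc : CrvPiece α B B' B'' κ κ' m M lo hi s p q ψ β) {b : ℝ}
    (hb : b ∈ Icc p q) : HasDerivAt (fun b => α b - s * b) ((1 - s * B b) / B b) b := by
  have h := (hc.dα b (hc.mem hb)).sub ((hasDerivAt_id b).const_mul s)
  have h1 := (hc.m_pos.trans_le (hc.B_ge b (hc.mem hb))).ne'
  refine h.congr_deriv ?_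
  field_simp

theorem CrvPiece.φ_mono (hc : CrvPiece α B B' B'' κ κ' m M lo hi s p q ψ β) {x y : ℝ}
    (h : x ≤ y) : (2 * M)⁻¹ * (y - x) ≤ (α y - s * y) - (α x - s * x) := by
  have h1 := hc.expand x y h
  have hM := hc.M_pos
  have h2 : s ≤ (2 * M)⁻¹ := by
    have := hc.abs_s_mul
    rw [mul_inv, ← div_eq_mul_inv, le_div_iff₀ hM]
    nlinarith [le_abs_self s]
  have h3 : M⁻¹ = (2 * M)⁻¹ + (2 * M)⁻¹ := by field_simp; norm_num
  nlinarith

/-- The fourth point determined by the parameter `t`. -/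
def pt4 (α : ℝ → ℝ) (s : ℝ) (ψ : ℝ → ℝ) (e t : ℝ) : ℝ := ψ (α t - s * t + e)

/-- The third point determined by the parameter `t`. -/
def pt3 (α : ℝ → ℝ) (s : ℝ) (ψ β : ℝ → ℝ) (e e₂ t : ℝ) : ℝ := β (α (pt4 α s ψ e t) + e₂)

/-- The first point determined by the parameter `t`. -/
def pt0 (α : ℝ → ℝ) (s : ℝ) (ψ β : ℝ → ℝ) (e e' t : ℝ) : ℝ :=
  t + pt3 α s ψ β e e' t - pt4 α s ψ e t

/-- Parameters for which three points lie on the piece. -/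
def threePts (α : ℝ → ℝ) (s : ℝ) (ψ β : ℝ → ℝ) (p q e e' : ℝ) : Set ℝ :=
  {t | (t ∈ Icc p q ∧ pt4 α s ψ e t ∈ Icc p q) ∧ pt3 α s ψ β e e' t ∈ Icc p q}

/-- Parameters for which all four points lie on the piece. -/
def fourPts (α : ℝ → ℝ) (s : ℝ) (ψ β : ℝ → ℝ) (p q e e' : ℝ) : Set ℝ :=
  {t | t ∈ threePts α s ψ β p q e e' ∧ pt0 α s ψ β e e' t ∈ Icc p q}

variable {e e' : ℝ}

theorem CrvPiece.φ_strictMono (hc : CrvPiece α B B' B'' κ κ' m M lo hi s p q ψ β) :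
    StrictMono (fun b => α b - s * b) := fun x y h => by
  have h1 := hc.φ_mono h.le
  have hM := hc.M_pos
  have : 0 < (2 * M)⁻¹ * (y - x) := mul_pos (by positivity) (sub_pos.2 h)
  simp only
  linarith

theorem CrvPiece.α_mono (hc : CrvPiece α B B' B'' κ κ' m M lo hi s p q ψ β) : Monotone α :=
  fun x y h => by
    have h1 := hc.expand x y h
    have hM := hc.M_pos
    have : 0 ≤ M⁻¹ * (y - x) := mul_nonneg (by positivity) (sub_nonneg.2 h)
    linarith

theorem CrvPiece.pt4_mono (hc : CrvPiece α B B' B'' κ κ' m M lo hi s p q ψ β) :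
    Monotone (pt4 α s ψ e) := fun x y h => by
  have := hc.φ_strictMono.monotone h
  exact hc.invψ.mono (by linarith)

theorem CrvPiece.pt3_mono (hc : CrvPiece α B B' B'' κ κ' m M lo hi s p q ψ β) :
    Monotone (pt3 α s ψ β e e') := fun x y h => by
  have := hc.α_mono (hc.pt4_mono (e := e) h)
  exact hc.invβ.mono (by linarith)

theorem CrvPiece.pt4_cont (hc : CrvPiece α B B' B'' κ κ' m M lo hi s p q ψ β) :
    Continuous (pt4 α s ψ e) := by
  have h1 := hc.invψ.cont
  have h2 := hc.cont
  unfold pt4; fun_prop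

theorem CrvPiece.pt3_cont (hc : CrvPiece α B B' B'' κ κ' m M lo hi s p q ψ β) :
    Continuous (pt3 α s ψ β e e') := by
  have h1 := hc.invβ.cont
  have h2 := hc.cont
  have h3 := hc.pt4_cont (e := e)
  unfold pt3; fun_prop

theorem CrvPiece.pt0_cont (hc : CrvPiece α B B' B'' κ κ' m M lo hi s p q ψ β) :
    Continuous (pt0 α s ψ β e e') := by
  have h1 := hc.pt3_cont (e := e) (e' := e')
  have h3 := hc.pt4_cont (e := e)
  unfold pt0; fun_prop

theorem CrvPiece.B_pos (hc : CrvPiece α B B' B'' κ κ' m M lo hi s p q ψ β) {b : ℝ}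
    (hb : b ∈ Icc p q) : 0 < B b := hc.m_pos.trans_le (hc.B_ge b (hc.mem hb))

/-- Derivative of `pt4`. -/
noncomputable def dpt4 (B : ℝ → ℝ) (s x y : ℝ) : ℝ := B y / (1 - s * B y) * ((1 - s * B x) / B x)

theorem CrvPiece.dpt4_le (hc : CrvPiece α B B' B'' κ κ' m M lo hi s p q ψ β) {x y : ℝ}
    (hx : x ∈ Icc p q) (hy : y ∈ Icc p q) :
    0 ≤ dpt4 B s x y ∧ dpt4 B s x y ≤ B y * (3 / m) := by
  have h1 := hc.B_pos hx
  have h2 := hc.B_pos hy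
  have h3 := hc.B_ge x (hc.mem hx)
  obtain ⟨h5, h6⟩ := hc.one_sub_ge hx
  obtain ⟨h7, h8⟩ := hc.one_sub_ge hy
  have hm := hc.m_pos
  unfold dpt4
  refine ⟨by apply mul_nonneg <;> apply div_nonneg <;> linarith, ?_⟩
  calc B y / (1 - s * B y) * ((1 - s * B x) / B x) ≤ B y / (1 / 2) * ((3 / 2) / m) := by
        apply mul_le_mul
        · exact div_le_div_of_nonneg_left h2.le (by norm_num) h7
        · exact div_le_div₀ (by norm_num) h6 hm h3
        · apply div_nonneg <;> linarith
        · positivity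
    _ = _ := by ring

theorem CrvPiece.hasDerivAt_pt4 (hc : CrvPiece α B B' B'' κ κ' m M lo hi s p q ψ β) {t : ℝ}
    (ht : t ∈ Icc p q) (h4 : pt4 α s ψ e t ∈ Icc p q) :
    HasDerivAt (pt4 α s ψ e) (dpt4 B s t (pt4 α s ψ e t)) t := by
  have h1 := hc.dφ h4
  have h2 := (hc.one_sub_ge h4).1
  have h3 := hc.B_pos h4
  have h5 := hc.invψ.deriv _ _ (div_pos (by linarith) h3).ne' h1
  have h6 : α (pt4 α s ψ e t) - s * pt4 α s ψ e t = α t - s * t + e := hc.invψ.right _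
  rw [h6] at h5
  have h7 : HasDerivAt (fun t => α t - s * t + e) ((1 - s * B t) / B t) t :=
    (hc.dφ ht).add_const e
  refine (h5.comp t h7).congr_deriv ?_
  rw [inv_div]; rfl

theorem CrvPiece.hasDerivAt_pt3 (hc : CrvPiece α B B' B'' κ κ' m M lo hi s p q ψ β) {t : ℝ}
    (ht : t ∈ threePts α s ψ β p q e e') :
    HasDerivAt (pt3 α s ψ β e e')
      (B (pt3 α s ψ β e e' t) / B (pt4 α s ψ e t) * dpt4 B s t (pt4 α s ψ e t)) t := by
  obtain ⟨⟨h1, h4⟩, h3⟩ := ht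
  have d4 := hc.hasDerivAt_pt4 h1 h4
  have b3 := hc.B_pos h3
  have h5 := hc.invβ.deriv _ _ (inv_pos.2 b3).ne' (hc.dα _ (hc.mem h3))
  have h6 : α (pt3 α s ψ β e e' t) = α (pt4 α s ψ e t) + e' := hc.invβ.right _
  rw [h6] at h5
  have h7 : HasDerivAt (fun t => α (pt4 α s ψ e t) + e') _ t :=
    ((hc.dα _ (hc.mem h4)).comp t d4).add_const e'
  refine (h5.comp t h7).congr_deriv ?_
  rw [inv_inv]; ring

theorem CrvPiece.hasDerivAt_pt0 (hc : CrvPiece α B B' B'' κ κ' m M lo hi s p q ψ β) {t : ℝ}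
    (ht : t ∈ threePts α s ψ β p q e e') :
    HasDerivAt (pt0 α s ψ β e e')
      (1 + B (pt3 α s ψ β e e' t) / B (pt4 α s ψ e t) * dpt4 B s t (pt4 α s ψ e t)
        - dpt4 B s t (pt4 α s ψ e t)) t :=
  ((hasDerivAt_id t).add (hc.hasDerivAt_pt3 ht)).sub (hc.hasDerivAt_pt4 ht.1.1 ht.1.2)

theorem CrvPiece.threePts_ordConnected (hc : CrvPiece α B B' B'' κ κ' m M lo hi s p q ψ β) :
    (threePts α s ψ β p q e e').OrdConnected :=
  mem_Icc_of_mem_Icc_of_monotoneOn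
    (mem_Icc_of_mem_Icc_of_monotoneOn ordConnected_Icc (hc.pt4_mono.monotoneOn _) p q)
    (hc.pt3_mono.monotoneOn _) p q

theorem CrvPiece.fourPts_ordConnected (hc : CrvPiece α B B' B'' κ κ' m M lo hi s p q ψ β) :
    (fourPts α s ψ β p q e e').OrdConnected := by
  refine mem_Icc_of_mem_Icc_of_monotoneOn hc.threePts_ordConnected ?_ p q
  refine monotoneOn_of_hasDerivWithinAt_nonneg (f' := fun t =>
    1 + B (pt3 α s ψ β e e' t) / B (pt4 α s ψ e t) * dpt4 B s t (pt4 α s ψ e t)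
        - dpt4 B s t (pt4 α s ψ e t)) hc.threePts_ordConnected.convex
    hc.pt0_cont.continuousOn
    (fun t ht => (hc.hasDerivAt_pt0 (interior_subset ht)).hasDerivWithinAt) ?_
  intro t ht
  obtain ⟨⟨h1, h4⟩, h3⟩ := interior_subset ht
  have b4 := hc.B_pos h4
  obtain ⟨c1, c2⟩ := hc.dpt4_le h1 h4
  have l := hc.B_lip (hc.mem h3) (hc.mem h4)
  have hm := hc.m_pos
  have hM := hc.M_pos
  have l2 : |pt3 α s ψ β e e' t - pt4 α s ψ e t| ≤ q - p := by
    rw [abs_le]; constructor <;> linarith [h3.1, h3.2, h4.1, h4.2]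
  have l3 : |B (pt3 α s ψ β e e' t) - B (pt4 α s ψ e t)| ≤ m / 6 := by
    calc _ ≤ M * (m / (6 * M)) := l.trans (by gcongr; exact l2.trans hc.short)
      _ = m / 6 := by field_simp
  have e1 : 1 + B (pt3 α s ψ β e e' t) / B (pt4 α s ψ e t) * dpt4 B s t (pt4 α s ψ e t)
        - dpt4 B s t (pt4 α s ψ e t) = 1 + (B (pt3 α s ψ β e e' t) - B (pt4 α s ψ e t))
          * (dpt4 B s t (pt4 α s ψ e t) / B (pt4 α s ψ e t)) := by field_simp; ring
  rw [e1]
  have c3 : dpt4 B s t (pt4 α s ψ e t) / B (pt4 α s ψ e t) ≤ 3 / m := by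
    rw [div_le_iff₀ b4]; linarith
  have c4 : 0 ≤ dpt4 B s t (pt4 α s ψ e t) / B (pt4 α s ψ e t) := div_nonneg c1 b4.le
  have : |(B (pt3 α s ψ β e e' t) - B (pt4 α s ψ e t))
          * (dpt4 B s t (pt4 α s ψ e t) / B (pt4 α s ψ e t))| ≤ m / 6 * (3 / m) := by
    rw [abs_mul, abs_of_nonneg c4]
    gcongr
  have e2 : m / 6 * (3 / m) = 1 / 2 := by field_simp; norm_num
  rw [e2, abs_le] at this
  linarith [this.1]

theorem CrvPiece.fourPts_compact (hc : CrvPiece α B B' B'' κ κ' m M lo hi s p q ψ β) :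
    IsCompact (fourPts α s ψ β p q e e') := by
  have h3 := hc.pt3_cont (e := e) (e' := e')
  have h4 := hc.pt4_cont (e := e)
  have h0 := hc.pt0_cont (e := e) (e' := e')
  refine isCompact_Icc.of_isClosed_subset (s := Icc p q) ?_ (fun t ht => ht.1.1.1)
  exact (((isClosed_Icc.inter (isClosed_Icc.preimage h4)).inter
    (isClosed_Icc.preimage h3))).inter (isClosed_Icc.preimage h0)

end

section
variable {α B B' B'' κ κ' : ℝ → ℝ} {m M lo hi s p q : ℝ} {ψ β : ℝ → ℝ} {e e' : ℝ}

theorem CrvPiece.B_dbound (hc : CrvPiece α B B' B'' κ κ' m M lo hi s p q ψ β) {b : ℝ}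
    (hb : b ∈ Icc p q) : DBound B b M M :=
  ⟨(hc.dB b (hc.mem hb)).differentiableAt, by
    rw [abs_of_pos (hc.B_pos hb)]; exact hc.B_le b (hc.mem hb), by
    rw [(hc.dB b (hc.mem hb)).deriv]; exact hc.B'_le b (hc.mem hb)⟩

theorem CrvPiece.κ_dbound (hc : CrvPiece α B B' B'' κ κ' m M lo hi s p q ψ β) {b : ℝ}
    (hb : b ∈ Icc p q) : DBound κ b M M :=
  ⟨(hc.dκ b (hc.mem hb)).differentiableAt, hc.κ_le b (hc.mem hb), by
    rw [(hc.dκ b (hc.mem hb)).deriv]; exact hc.κ'_le b (hc.mem hb)⟩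

theorem CrvPiece.speeds (hc : CrvPiece α B B' B'' κ κ' m M lo hi s p q ψ β) {t : ℝ}
    (ht : t ∈ threePts α s ψ β p q e e') :
    |dpt4 B s t (pt4 α s ψ e t)| ≤ 7 * M / m ∧
    |B (pt3 α s ψ β e e' t) / B (pt4 α s ψ e t) * dpt4 B s t (pt4 α s ψ e t)| ≤ 7 * M / m ∧
    |1 + B (pt3 α s ψ β e e' t) / B (pt4 α s ψ e t) * dpt4 B s t (pt4 α s ψ e t)
        - dpt4 B s t (pt4 α s ψ e t)| ≤ 7 * M / m := by
  obtain ⟨⟨h1, h4⟩, h3⟩ := ht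
  have b4 := hc.B_pos h4
  have b3 := hc.B_pos h3
  have u4 := hc.B_le _ (hc.mem h4)
  have u3 := hc.B_le _ (hc.mem h3)
  obtain ⟨c1, c2⟩ := hc.dpt4_le h1 h4
  have hm := hc.m_pos
  have hm1 := hc.m_le
  have hM1 := hc.le_M
  have hM := hc.M_pos
  have r : 1 ≤ M / m := by rw [le_div_iff₀ hm]; linarith
  have a1 : dpt4 B s t (pt4 α s ψ e t) ≤ 3 * (M / m) := by
    refine c2.trans ?_
    calc _ ≤ M * (3 / m) := by gcongr
      _ = _ := by ring
  have a2 : B (pt3 α s ψ β e e' t) / B (pt4 α s ψ e t) * dpt4 B s t (pt4 α s ψ e t)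
      ≤ 3 * (M / m) := by
    calc _ ≤ B (pt3 α s ψ β e e' t) / B (pt4 α s ψ e t) * (B (pt4 α s ψ e t) * (3 / m)) := by
          gcongr
      _ = B (pt3 α s ψ β e e' t) * (3 / m) := by field_simp
      _ ≤ M * (3 / m) := by gcongr
      _ = _ := by ring
  have a3 : 0 ≤ B (pt3 α s ψ β e e' t) / B (pt4 α s ψ e t) * dpt4 B s t (pt4 α s ψ e t) := by
    positivity
  rw [mul_div_assoc]
  refine ⟨?_, ?_, ?_⟩ <;> rw [abs_le] <;> constructor <;> linarith

theorem core_derivative_identity {b0 b1 b3 b4 s : ℝ} (h0 : b0 ≠ 0) (h1 : b1 ≠ 0) (h4 : b4 ≠ 0)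
    (h5 : 1 - s * b4 ≠ 0) :
    b1⁻¹ - b0⁻¹ * (1 + b3 / b4 * (b4 / (1 - s * b4) * ((1 - s * b1) / b1))
        - b4 / (1 - s * b4) * ((1 - s * b1) / b1))
      = (b0 - b1 - b3 + b4 - s * (b0 * b4 - b1 * b3)) / (b0 * b1 * (1 - s * b4)) := by
  obtain ⟨u, hu⟩ : ∃ u, u = 1 - s * b4 := ⟨_, rfl⟩
  rw [← hu] at h5 ⊢
  field_simp
  linear_combination (b0 - b1) * hu

theorem core_constant_le {m M η δ L : ℝ} (hm : 0 < m) (hm1 : m ≤ 1) (hM1 : 1 ≤ M) (hη : 0 < η)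
    (hη1 : η ≤ 1) (hδ : δ = m ^ 3 * η ^ 2 / 4) (hL : L ≤ 1) :
    2 * (M ^ 4 / δ) + L * (28 * M ^ 5 / m / δ + M ^ 4 * (42 * M ^ 2 / m) / δ ^ 2)
      ≤ 1000 * M ^ 6 / m ^ 7 / η ^ 4 := by
  have hδ0 : 0 < δ := by rw [hδ]; positivity
  have n1 : 0 ≤ 28 * M ^ 5 / m / δ + M ^ 4 * (42 * M ^ 2 / m) / δ ^ 2 := by positivity
  have x1 : 1 ≤ M ^ 2 := one_le_pow₀ hM1
  have hηδ : δ * 4 ≤ 1 := by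
    rw [hδ]
    have : m ^ 3 ≤ 1 := pow_le_one₀ hm.le hm1
    have : η ^ 2 ≤ 1 := pow_le_one₀ hη.le hη1
    have : 0 < η ^ 2 := by positivity
    nlinarith
  have e1 : 1 / δ ≤ 1 / 4 / δ ^ 2 := by
    rw [div_le_div_iff₀ hδ0 (by positivity)]; nlinarith
  have e2 : 1 ≤ 1 / m := (one_le_div hm).2 hm1
  have t1 : M ^ 4 / δ ≤ M ^ 6 / m * (1 / 4 / δ ^ 2) := by
    calc M ^ 4 / δ = M ^ 4 * 1 * (1 / δ) := by ring
      _ ≤ M ^ 4 * (M ^ 2 * (1 / m)) * (1 / 4 / δ ^ 2) := by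
          gcongr
          nlinarith
      _ = _ := by ring
  have t2 : 28 * M ^ 5 / m / δ ≤ 28 * (M ^ 6 / m * (1 / 4 / δ ^ 2)) := by
    calc 28 * M ^ 5 / m / δ = 28 * (M ^ 5 * 1 / m * (1 / δ)) := by ring
      _ ≤ 28 * (M ^ 5 * M / m * (1 / 4 / δ ^ 2)) := by gcongr
      _ = _ := by ring
  have t3 : M ^ 4 * (42 * M ^ 2 / m) / δ ^ 2 = 168 * (M ^ 6 / m * (1 / 4 / δ ^ 2)) := by
    field_simp; ring
  have t4 : M ^ 6 / m * (1 / 4 / δ ^ 2) = 4 * M ^ 6 / m ^ 7 / η ^ 4 := by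
    rw [hδ]; field_simp
  have t5 : 1000 * M ^ 6 / m ^ 7 / η ^ 4 = 250 * (M ^ 6 / m * (1 / 4 / δ ^ 2)) := by
    rw [t4]; ring
  rw [t5]
  have t6 : L * (28 * M ^ 5 / m / δ + M ^ 4 * (42 * M ^ 2 / m) / δ ^ 2)
      ≤ 28 * M ^ 5 / m / δ + M ^ 4 * (42 * M ^ 2 / m) / δ ^ 2 := by nlinarith
  have t7 : 0 ≤ M ^ 6 / m * (1 / 4 / δ ^ 2) := by positivity
  linarith
/-- The oscillatory one-dimensional integral at the core of the argument. -/
theorem CrvPiece.core_integral (hc : CrvPiece α B B' B'' κ κ' m M lo hi s p q ψ β)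
    {f P : ℝ → ℝ} (hf : Nice f) (hP : Continuous P) {Z : Set ℝ} (hZ : Z.Countable)
    (hd : ∀ y, y ∉ Z → HasDerivAt P (f y) y) {Bd : ℝ} (hB : ∀ y, |P y| ≤ Bd)
    {η : ℝ} (hη : 0 < η) (hη1 : η ≤ 1) (he : η ≤ |e|) (he' : η ≤ |e'|) (y : ℝ) :
    |∫ t in fourPts α s ψ β p q e e', f (y + α t - α (pt0 α s ψ β e e' t)) *
      (κ (pt0 α s ψ β e e' t) * κ t * κ (pt3 α s ψ β e e' t) * κ (pt4 α s ψ e t) /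
        (B (pt0 α s ψ β e e' t) * B t * (1 - s * B (pt4 α s ψ e t))))|
      ≤ Bd * (1000 * M ^ 6 / m ^ 7 / η ^ 4) := by
  have hm := hc.m_pos
  have hm1 := hc.m_le
  have hM1 := hc.le_M
  have hM := hc.M_pos
  have hBd : 0 ≤ Bd := (abs_nonneg _).trans (hB 0)
  rcases (fourPts α s ψ β p q e e').eq_empty_or_nonempty with h0 | hne
  · rw [h0]; simp only [Measure.restrict_empty, integral_zero_measure, abs_zero]
    positivity
  have hcomp := hc.fourPts_compact (e := e) (e' := e')
  have hS := eq_Icc_of_connected_compact ⟨hne, hc.fourPts_ordConnected.isPreconnected⟩ hcomp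
  set a := sInf (fourPts α s ψ β p q e e')
  set c := sSup (fourPts α s ψ β p q e e')
  have hac : a ≤ c := by
    rw [hS] at hne; exact nonempty_Icc.1 hne
  have hmem : ∀ t ∈ Icc a c, t ∈ fourPts α s ψ β p q e e' := fun t ht => by rw [hS]; exact ht
  have hlen : c - a ≤ 1 := by
    have h1 := (hmem a (left_mem_Icc.2 hac)).1.1.1
    have h2 := (hmem c (right_mem_Icc.2 hac)).1.1.1
    have h3 : m / (6 * M) ≤ 1 := by rw [div_le_one (by positivity)]; linarith
    linarith [h1.1, h2.2, hc.short]
  rw [hS]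
  set b3 := pt3 α s ψ β e e' with hb3
  set b4 := pt4 α s ψ e with hb4
  set b0 := pt0 α s ψ β e e' with hb0
  set Dl : ℝ → ℝ := fun t => B (b0 t) - B t - B (b3 t) + B (b4 t)
    - s * (B (b0 t) * B (b4 t) - B t * B (b3 t)) with hDl
  set K : ℝ → ℝ := fun t => κ (b0 t) * κ t * κ (b3 t) * κ (b4 t) with hK
  set δ := m ^ 3 * η ^ 2 / 4 with hδ
  have hδ0 : 0 < δ := by positivity
  have lower : ∀ t ∈ Icc a c, δ ≤ |Dl t| := by
    intro t ht
    obtain ⟨⟨⟨h1, h4⟩, h3⟩, h0⟩ := hmem t ht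
    have hw3 : b0 t + (b4 t - t) = b3 t := by rw [hb0, pt0]; ring
    have hw4 : t + (b4 t - t) = b4 t := by ring
    have := hc.perturbed_second_difference (x := t) (y := b0 t) (w := b4 t - t) (hc.mem h1)
      (hc.mem h0) (by rw [hw4]; exact hc.mem h4) (by rw [hw3]; exact hc.mem h3) hc.s_le
    rw [hw3, hw4] at this
    refine le_trans ?_ this
    have ew : η * (m / 2) ≤ |b4 t - t| := by
      have h6 : α (b4 t) - s * b4 t = α t - s * t + e := hc.invψ.right _
      have h7 : e = (α (b4 t) - α t) - s * (b4 t - t) := by linarith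
      have h8 : |e| ≤ 2 * m⁻¹ * |b4 t - t| := by
        rw [h7]
        have i1 := hc.α_lip (hc.mem h4) (hc.mem h1)
        have i2 : |s| ≤ m⁻¹ := by
          have : |s| * 1 ≤ |s| * M := by gcongr
          have : 1 ≤ m⁻¹ := (one_le_inv₀ hm).2 hm1
          linarith [hc.abs_s_mul]
        calc _ ≤ |α (b4 t) - α t| + |s| * |b4 t - t| := by
              rw [← abs_mul]; exact abs_sub _ _
          _ ≤ m⁻¹ * |b4 t - t| + m⁻¹ * |b4 t - t| := by gcongr
          _ = _ := by ring
      have h9 := he.trans h8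
      calc η * (m / 2) ≤ 2 * m⁻¹ * |b4 t - t| * (m / 2) := by gcongr
        _ = _ := by field_simp
    have ep : η * m ≤ |t - b0 t| := by
      have h6 : α (b3 t) = α (b4 t) + e' := hc.invβ.right _
      have h7 : e' = α (b3 t) - α (b4 t) := by linarith
      have i1 := hc.α_lip (hc.mem h3) (hc.mem h4)
      rw [← h7] at i1
      have h8 : t - b0 t = -(b3 t - b4 t) := by rw [hb0, pt0]; ring
      rw [h8, abs_neg]
      calc η * m ≤ m⁻¹ * |b3 t - b4 t| * m := by gcongr; exact he'.trans i1
        _ = _ := by field_simp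
    calc δ = m / 2 * ((η * m) * (η * (m / 2))) := by rw [hδ]; ring
      _ ≤ _ := by gcongr
  have bounds : ∀ t ∈ Icc a c, DBound K t (M ^ 4) (28 * M ^ 5 / m) ∧
      DBound Dl t (6 * M) (42 * M ^ 2 / m) := by
    intro t ht
    obtain ⟨ht3, h0⟩ := hmem t ht
    have ⟨⟨h1, h4⟩, h3⟩ := ht3
    obtain ⟨s4, s3, s0⟩ := hc.speeds ht3
    have d4 := hc.hasDerivAt_pt4 h1 h4
    have d3 := hc.hasDerivAt_pt3 ht3
    have d0 := hc.hasDerivAt_pt0 ht3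
    have s1 : |(1 : ℝ)| ≤ 7 * M / m := by
      rw [abs_one, le_div_iff₀ hm]; linarith
    have d1 : HasDerivAt (fun t : ℝ => t) 1 t := hasDerivAt_id t
    have k0 := (hc.κ_dbound h0).comp d0 s0
    have k1 := DBound.comp (v := fun t : ℝ => t) (hc.κ_dbound h1) d1 s1
    have k3 := (hc.κ_dbound h3).comp d3 s3
    have k4 := (hc.κ_dbound h4).comp d4 s4
    have B0 := (hc.B_dbound h0).comp d0 s0
    have B1 := DBound.comp (v := fun t : ℝ => t) (hc.B_dbound h1) d1 s1
    have B3 := (hc.B_dbound h3).comp d3 s3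
    have B4 := (hc.B_dbound h4).comp d4 s4
    have kk := ((k0.mul k1).mul k3).mul k4
    have DD := (((B0.sub B1).sub (B3.sub B4))).sub (((B0.mul B4).sub (B1.mul B3)).const_mul s)
    have hsM := hc.abs_s_mul
    constructor
    · refine ⟨kk.1, kk.2.1.trans (le_of_eq (by ring)), kk.2.2.trans (le_of_eq (by ring))⟩
    · have eD : Dl = fun x => B (b0 x) - B x - (B (b3 x) - B (b4 x))
          - s * (B (b0 x) * B (b4 x) - B x * B (b3 x)) := by ext x; rw [hDl]; ring
      rw [eD]
      refine ⟨DD.1, DD.2.1.trans ?_, DD.2.2.trans ?_⟩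
      · nlinarith
      · have : M * (7 * M / m) + M * (7 * M / m) + (M * (7 * M / m) + M * (7 * M / m))
          + |s| * (M * (7 * M / m) * M + M * (M * (7 * M / m)) + (M * (7 * M / m) * M
          + M * (M * (7 * M / m)))) = (7 * M ^ 2 / m) * (4 + 4 * (|s| * M)) := by ring
        rw [this]
        calc _ ≤ (7 * M ^ 2 / m) * (4 + 4 * (1 / 2)) := by gcongr
          _ = _ := by ring
  have hN : ∀ t ∈ Icc a c, DBound (fun t => K t / Dl t) t _ _ := fun t ht =>
    (bounds t ht).1.mul_inv (bounds t ht).2 hδ0 (lower t ht)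
  set Y' : ℝ → ℝ := fun t => Dl t / (B (b0 t) * B t * (1 - s * B (b4 t))) with hY'
  have hY : ∀ t ∈ Icc a c, HasDerivAt (fun t => y + α t - α (b0 t)) (Y' t) t := by
    intro t ht
    obtain ⟨ht3, h0⟩ := hmem t ht
    have ⟨⟨h1, h4⟩, h3⟩ := ht3
    have d0 := hc.hasDerivAt_pt0 ht3
    have := ((hc.dα t (hc.mem h1)).const_add y).sub ((hc.dα _ (hc.mem h0)).comp t d0)
    refine this.congr_deriv ?_
    have z0 := (hc.B_pos h0).ne'
    have z1 := (hc.B_pos h1).ne'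
    have z4 := (hc.B_pos h4).ne'
    have z5 : 1 - s * B (pt4 α s ψ e t) ≠ 0 := by linarith [(hc.one_sub_ge h4).1]
    rw [hY', hDl, dpt4]
    exact core_derivative_identity z0 z1 z4 z5
  have hden : ∀ t ∈ Icc a c, m ^ 2 / 2 ≤ B (b0 t) * B t * (1 - s * B (b4 t)) := by
    intro t ht
    obtain ⟨ht3, h0⟩ := hmem t ht
    have ⟨⟨h1, h4⟩, h3⟩ := ht3
    have := hc.B_ge _ (hc.mem h0)
    have := hc.B_ge _ (hc.mem h1)
    have := (hc.one_sub_ge h4).1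
    calc m ^ 2 / 2 = m * m * (1 / 2) := by ring
      _ ≤ _ := by 
        have := (hc.B_pos h0).le
        have := (hc.B_pos h1).le
        gcongr
  have hden0 : ∀ t ∈ Icc a c, 0 < B (b0 t) * B t * (1 - s * B (b4 t)) := fun t ht =>
    lt_of_lt_of_le (by positivity) (hden t ht)
  have main := abs_integral_comp_mul_deriv_le hf hP hZ hd hB hac hY
    (fun t ht => (hN t ht).1.hasDerivAt)
    (fun t ht => div_ne_zero (fun h => by
      have := lower t ht; rw [h, abs_zero] at this; linarith) (hden0 t ht).ne')
    (y1 := 6 * M / (m ^ 2 / 2))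
    (fun t ht => by
      rw [hY', abs_div, abs_of_pos (hden0 t ht)]
      exact div_le_div₀ (by positivity) (bounds t ht).2.2.1 (by positivity) (hden t ht))
    (fun t ht => (hN t ht).2.1) (fun t ht => (hN t ht).2.2)
  have eI : ∫ t in Icc a c, f (y + α t - α (b0 t)) * (κ (b0 t) * κ t * κ (b3 t) * κ (b4 t) /
        (B (b0 t) * B t * (1 - s * B (b4 t))))
      = ∫ t in Icc a c, f (y + α t - α (b0 t)) * (Y' t * (K t / Dl t)) := by
    refine setIntegral_congr_fun measurableSet_Icc fun t ht => ?_
    have h1 : Dl t ≠ 0 := fun h => by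
      have := lower t ht; rw [h, abs_zero] at this; linarith
    have h2 := (hden0 t ht).ne'
    simp only [hY', hK]
    field_simp
  rw [eI]
  refine main.trans (mul_le_mul_of_nonneg_left ?_ hBd)
  exact core_constant_le hm hm1 hM1 hη hη1 hδ hlen

end

theorem Nice.comp_of_norm_le {E F : Type*} [NormedAddCommGroup E] [MeasurableSpace E]
    [NormedAddCommGroup F] [MeasurableSpace F] {f : F → ℝ} (hf : Nice f) {L : E → F}
    (hL : Measurable L) (h : ∀ x, ‖x‖ ≤ ‖L x‖) : Nice (fun x => f (L x)) := by
  obtain ⟨hm, ⟨C, hC⟩, R, hR⟩ := hf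
  exact ⟨hm.comp hL, ⟨C, fun x => hC _⟩, R, fun x hx => hR _ (hx.trans_le (h x))⟩

/-- `Nice` for functions of two variables. -/
def Nice2 (T : ℝ → ℝ → ℝ) : Prop := Nice (fun p : ℝ × ℝ => T p.1 p.2)

/-- `Nice` for functions of three variables. -/
def Nice3 (T : ℝ → ℝ → ℝ → ℝ) : Prop := Nice (fun p : ℝ × ℝ × ℝ => T p.1 p.2.1 p.2.2)

/-- `Nice` for functions of four variables. -/
def Nice4 (T : ℝ → ℝ → ℝ → ℝ → ℝ) : Prop :=
  Nice (fun p : ℝ × ℝ × ℝ × ℝ => T p.1 p.2.1 p.2.2.1 p.2.2.2)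

theorem Nice2.mk {T : ℝ → ℝ → ℝ} (hm : Measurable (fun p : ℝ × ℝ => T p.1 p.2)) {C R : ℝ}
    (hC : ∀ a b, |T a b| ≤ C) (hR : ∀ a b, T a b ≠ 0 → |a| ≤ R ∧ |b| ≤ R) : Nice2 T := by
  refine ⟨hm, ⟨C, fun p => hC _ _⟩, R, fun p hp => ?_⟩
  by_contra h
  obtain ⟨h1, h2⟩ := hR _ _ h
  simp only [Prod.norm_def, Real.norm_eq_abs, lt_sup_iff] at hp
  rcases hp with hp | hp <;> linarith

theorem Nice3.mk {T : ℝ → ℝ → ℝ → ℝ} (hm : Measurable (fun p : ℝ × ℝ × ℝ => T p.1 p.2.1 p.2.2))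
    {C R : ℝ} (hC : ∀ a b c, |T a b c| ≤ C)
    (hR : ∀ a b c, T a b c ≠ 0 → |a| ≤ R ∧ |b| ≤ R ∧ |c| ≤ R) : Nice3 T := by
  refine ⟨hm, ⟨C, fun p => hC _ _ _⟩, R, fun p hp => ?_⟩
  by_contra h
  obtain ⟨h1, h2, h3⟩ := hR _ _ _ h
  simp only [Prod.norm_def, Real.norm_eq_abs, lt_sup_iff] at hp
  rcases hp with hp | hp | hp <;> linarith

theorem Nice4.mk {T : ℝ → ℝ → ℝ → ℝ → ℝ}
    (hm : Measurable (fun p : ℝ × ℝ × ℝ × ℝ => T p.1 p.2.1 p.2.2.1 p.2.2.2)) {C R : ℝ}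
    (hC : ∀ a b c d, |T a b c d| ≤ C)
    (hR : ∀ a b c d, T a b c d ≠ 0 → |a| ≤ R ∧ |b| ≤ R ∧ |c| ≤ R ∧ |d| ≤ R) : Nice4 T := by
  refine ⟨hm, ⟨C, fun p => hC _ _ _ _⟩, R, fun p hp => ?_⟩
  by_contra h
  obtain ⟨h1, h2, h3, h4⟩ := hR _ _ _ _ h
  simp only [Prod.norm_def, Real.norm_eq_abs, lt_sup_iff] at hp
  rcases hp with hp | hp | hp | hp <;> linarith

theorem Nice2.slice {T : ℝ → ℝ → ℝ} (h : Nice2 T) (a : ℝ) : Nice (T a) :=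
  Nice.comp_of_norm_le h (L := fun p => (a, p)) (by fun_prop) fun x => le_max_right _ _

theorem Nice3.slice {T : ℝ → ℝ → ℝ → ℝ} (h : Nice3 T) (a : ℝ) : Nice2 (T a) :=
  Nice.comp_of_norm_le h (L := fun p => (a, p)) (by fun_prop) fun x => le_max_right _ _

theorem Nice4.slice {T : ℝ → ℝ → ℝ → ℝ → ℝ} (h : Nice4 T) (a : ℝ) : Nice3 (T a) :=
  Nice.comp_of_norm_le h (L := fun p => (a, p)) (by fun_prop) fun x => le_max_right _ _

theorem Nice2.int {T : ℝ → ℝ → ℝ} (h : Nice2 T) : Nice (fun a => ∫ b, T a b) :=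
  Nice.integral_right h

theorem Nice3.int {T : ℝ → ℝ → ℝ → ℝ} (h : Nice3 T) : Nice2 (fun a b => ∫ c, T a b c) := by
  have : Nice (fun p : (ℝ × ℝ) × ℝ => T p.1.1 p.1.2 p.2) :=
    Nice.comp_of_norm_le h (L := fun p : (ℝ × ℝ) × ℝ => (p.1.1, p.1.2, p.2)) (by fun_prop) fun x => by
      simp only [Prod.norm_def]; exact le_of_eq (by ac_rfl)
  exact Nice.integral_right this

theorem Nice4.int {T : ℝ → ℝ → ℝ → ℝ → ℝ} (h : Nice4 T) :
    Nice3 (fun a b c => ∫ d, T a b c d) := by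
  have : Nice (fun p : (ℝ × ℝ × ℝ) × ℝ => T p.1.1 p.1.2.1 p.1.2.2 p.2) :=
    Nice.comp_of_norm_le h (L := fun p : (ℝ × ℝ × ℝ) × ℝ => (p.1.1, p.1.2.1, p.1.2.2, p.2))
      (by fun_prop) fun x => by
      simp only [Prod.norm_def]; exact le_of_eq (by ac_rfl)
  exact Nice.integral_right this

theorem Nice2.swap {T : ℝ → ℝ → ℝ} (h : Nice2 T) : ∫ a, ∫ b, T a b = ∫ b, ∫ a, T a b :=
  Nice.swap h

theorem Nice3.swap {T : ℝ → ℝ → ℝ → ℝ} (h : Nice3 T) :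
    ∫ a, ∫ b, ∫ c, T a b c = ∫ b, ∫ a, ∫ c, T a b c := Nice2.swap h.int

theorem Nice4.swap {T : ℝ → ℝ → ℝ → ℝ → ℝ} (h : Nice4 T) :
    ∫ a, ∫ b, ∫ c, ∫ d, T a b c d = ∫ b, ∫ a, ∫ c, ∫ d, T a b c d := Nice3.swap h.int

theorem Nice3.comm {T : ℝ → ℝ → ℝ → ℝ} (h : Nice3 T) : Nice3 (fun b a c => T a b c) :=
  Nice.comp_of_norm_le h (L := fun p : ℝ × ℝ × ℝ => (p.2.1, p.1, p.2.2)) (by fun_prop) fun x => by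
    simp only [Prod.norm_def]; exact le_of_eq (by ac_rfl)

theorem Nice4.comm_mid {T : ℝ → ℝ → ℝ → ℝ → ℝ} (h : Nice4 T) :
    Nice4 (fun a c b d => T a b c d) :=
  Nice.comp_of_norm_le h (L := fun p : ℝ × ℝ × ℝ × ℝ => (p.1, p.2.2.1, p.2.1, p.2.2.2))
    (by fun_prop) fun x => by
    simp only [Prod.norm_def]; exact le_of_eq (by ac_rfl)

/-- Move the last variable to the front, for three variables. -/
theorem Nice3.rotate {T : ℝ → ℝ → ℝ → ℝ} (h : Nice3 T) :
    ∫ a, ∫ b, ∫ c, T a b c = ∫ b, ∫ c, ∫ a, T a b c := by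
  rw [h.swap]
  congr 1; ext b
  exact (h.comm.slice b).swap

theorem abs_integral_le_of_support {u : ℝ → ℝ} {K a b : ℝ} (hab : a ≤ b) (hK : ∀ x, |u x| ≤ K)
    (hs : ∀ x, u x ≠ 0 → x ∈ Icc a b) : |∫ x, u x| ≤ K * (b - a) := by
  have h1 : ∫ x, u x = ∫ x in Icc a b, u x := by
    refine (setIntegral_eq_integral_of_forall_compl_eq_zero fun y hy => ?_).symm
    by_contra h; exact hy (hs y h)
  rw [h1]
  have := norm_setIntegral_le_of_norm_le_const (μ := volume) (s := Icc a b)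
      (f := u) (C := K) (by simp) (fun t _ => hK t)
  rwa [Real.volume_real_Icc_of_le hab] at this

theorem abs_integral_le_mul_integral {u v : ℝ → ℝ} {K : ℝ} (hv : Nice v)
    (h : ∀ x, |u x| ≤ K * v x) : |∫ x, u x| ≤ K * ∫ x, v x := by
  rw [← integral_const_mul]
  exact norm_integral_le_of_norm_le (f := u) ((hv.const_mul K).integrable _)
    (Filter.Eventually.of_forall h)

theorem integral_abs_le_l2 {f : ℝ → ℝ} (hf : Nice f) {a : ℝ}
    (hs : ∀ x, f x ≠ 0 → x ∈ Icc a (a + 1)) : ∫ x, |f x| ≤ l2 f := by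
  have h1 : Nice ((Icc a (a + 1)).indicator (fun _ : ℝ => (1 : ℝ))) := by
    refine ⟨measurable_const.indicator measurableSet_Icc, ⟨1, fun x => ?_⟩, |a| + 1, fun x hx => ?_⟩
    · by_cases h : x ∈ Icc a (a + 1) <;> simp [h]
    · rw [indicator_of_notMem]
      intro h
      rw [Real.norm_eq_abs] at hx
      have h2 := h.1; have h3 := h.2
      rcases abs_cases x with h4 | h4 <;> linarith [neg_abs_le a, le_abs_self a]
  have h2 := integral_abs_mul_le hf h1
  have h3 : l2 ((Icc a (a + 1)).indicator (fun _ : ℝ => (1 : ℝ))) = 1 := by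
    have : ∀ x, (Icc a (a + 1)).indicator (fun _ : ℝ => (1 : ℝ)) x ^ 2
        = (Icc a (a + 1)).indicator (fun _ : ℝ => (1 : ℝ)) x := fun x => by
      by_cases h : x ∈ Icc a (a + 1) <;> simp [h]
    simp only [l2, this]
    rw [integral_indicator measurableSet_Icc]
    simp
  rw [h3, mul_one] at h2
  refine le_trans (le_of_eq ?_) h2
  congr 1; ext x
  by_cases h : f x = 0
  · simp [h]
  · rw [indicator_of_mem (hs x h), mul_one]

/-- The indicator of `{x | η ≤ |x|}`. -/
noncomputable def farInd (η x : ℝ) : ℝ := {x : ℝ | η ≤ |x|}.indicator (fun _ => 1) x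

theorem measurable_farInd (η : ℝ) : Measurable (farInd η) :=
  measurable_const.indicator (measurableSet_le measurable_const measurable_id.abs)

theorem farInd_of_le {η x : ℝ} (h : η ≤ |x|) : farInd η x = 1 := indicator_of_mem (by exact h) _

theorem farInd_of_lt {η x : ℝ} (h : |x| < η) : farInd η x = 0 :=
  indicator_of_notMem (by simpa using h) _

theorem farInd_mem (η x : ℝ) : 0 ≤ farInd η x ∧ farInd η x ≤ 1 := by
  by_cases h : η ≤ |x|
  · rw [farInd_of_le h]; norm_num
  · rw [farInd_of_lt (not_le.1 h)]; norm_num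

/-- Cauchy–Schwarz for a function along two translated curves. -/
theorem integral_curve_mul_le {θ ψ D : ℝ → ℝ} {p q M : ℝ} (hM : 0 < M) (hθ : Measurable θ)
    (h1 : ∀ x, ψ (θ x) = x) (h2 : ∀ y, θ (ψ y) = y)
    (hD : ∀ b ∈ Icc p q, HasDerivAt θ (D b) b) (hlow : ∀ b ∈ Icc p q, M⁻¹ ≤ D b)
    {f : ℝ → ℝ} (hf : Nice f) (c c' v v' : ℝ) {u : ℝ → ℝ} {K : ℝ}
    (hu : ∀ b, |u b| ≤ K * |(Icc p q).indicator (fun b => f (c - θ b)) (b + v)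
      * (Icc p q).indicator (fun b => f (c' - θ b)) (b + v')|) (hK : 0 ≤ K) :
    |∫ b, u b| ≤ K * (M * l2 f ^ 2) := by
  have hn : ∀ c, Nice ((Icc p q).indicator (fun b => f (c - θ b))) := fun c => by
    obtain ⟨hm, ⟨C, hC⟩, R, hR⟩ := hf
    have hC0 : 0 ≤ C := (abs_nonneg _).trans (hC 0)
    refine ⟨(hm.comp (measurable_const.sub hθ)).indicator measurableSet_Icc, ⟨C, fun x => ?_⟩,
      |p| + |q|, fun x hx => ?_⟩
    · by_cases h : x ∈ Icc p q <;> simp [h, hC, hC0]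
    · rw [indicator_of_notMem]
      intro h
      rw [Real.norm_eq_abs] at hx
      have := h.1; have := h.2
      rcases abs_cases x with h4 | h4 <;>
        linarith [neg_abs_le p, le_abs_self q, abs_nonneg p, abs_nonneg q]
  have hl : ∀ c v, l2 (fun b => (Icc p q).indicator (fun b => f (c - θ b)) (b + v))
      ≤ √(M * l2 f ^ 2) := fun c v => by
    have e := l2_comp_sub ((Icc p q).indicator (fun b => f (c - θ b))) (-v)
    simp only [sub_neg_eq_add] at e
    rw [e, l2]
    refine Real.sqrt_le_sqrt ?_
    rw [l2_sq]
    refine le_trans (le_of_eq ?_)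
      (integral_comp_indicator_le hM h1 h2 hD hlow hf.sq (fun x => sq_nonneg _) c)
    congr 1; ext b
    by_cases h : b ∈ Icc p q <;> simp [h]
  have hn' : ∀ c v, Nice (fun b => (Icc p q).indicator (fun b => f (c - θ b)) (b + v)) :=
    fun c v => by simpa using (hn c).comp_sub (-v)
  have key := integral_abs_mul_le (hn' c v) (hn' c' v')
  have := abs_integral_le_mul_integral ((hn' c v).mul (hn' c' v')).abs hu
  refine this.trans (mul_le_mul_of_nonneg_left (key.trans ?_) hK)
  have h0 : 0 ≤ M * l2 f ^ 2 := by positivity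
  calc _ ≤ √(M * l2 f ^ 2) * √(M * l2 f ^ 2) :=
        mul_le_mul (hl _ _) (hl _ _) (l2_nonneg _) (Real.sqrt_nonneg _)
    _ = _ := Real.mul_self_sqrt h0

/-- The weight of a curve piece. -/
noncomputable def pieceW (κ B : ℝ → ℝ) (p q : ℝ) : ℝ → ℝ :=
  (Icc p q).indicator (fun b => κ b / B b)

/-- The four-point integrand. -/
noncomputable def quadT (f α om : ℝ → ℝ) (s b1 b4 y r : ℝ) : ℝ :=
  f (y + α b1 - α (b1 + r)) * f y * f (y + (α b1 - s * b1) + s * b4 - α (b4 + r)) *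
    f (y + (α b1 - s * b1) - (α b4 - s * b4)) * (om b1 * om (b1 + r) * om b4 * om (b4 + r))

section
variable {α B B' B'' κ κ' : ℝ → ℝ} {m M lo hi s p q : ℝ} {ψ β : ℝ → ℝ}

theorem CrvPiece.measurable_pieceW (hc : CrvPiece α B B' B'' κ κ' m M lo hi s p q ψ β) :
    Measurable (pieceW κ B p q) := (hc.meas_κ.div hc.meas_B).indicator measurableSet_Icc

theorem CrvPiece.pieceW_le (hc : CrvPiece α B B' B'' κ κ' m M lo hi s p q ψ β) (b : ℝ) :
    |pieceW κ B p q b| ≤ M / m := by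
  have hm := hc.m_pos
  have hM := hc.M_pos
  unfold pieceW
  by_cases h : b ∈ Icc p q
  · rw [indicator_of_mem h, abs_div, abs_of_pos (hc.B_pos h)]
    exact div_le_div₀ hM.le (hc.κ_le b (hc.mem h)) hm (hc.B_ge b (hc.mem h))
  · rw [indicator_of_notMem h, abs_zero]; positivity

theorem pieceW_ne_zero {b : ℝ} (h : pieceW κ B p q b ≠ 0) : b ∈ Icc p q := by
  by_contra hb; exact h (indicator_of_notMem hb _)

theorem abs_le_of_mem_Icc {x : ℝ} (h : x ∈ Icc p q) : |x| ≤ |p| + |q| := by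
  have := h.1; have := h.2
  rcases abs_cases x with h4 | h4 <;>
    linarith [neg_abs_le p, le_abs_self q, abs_nonneg p, abs_nonneg q]

theorem CrvPiece.nice_quadT (hc : CrvPiece α B B' B'' κ κ' m M lo hi s p q ψ β) {f : ℝ → ℝ}
    (hf : Nice f) : Nice4 (quadT f α (pieceW κ B p q) s) := by
  have hα := hc.cont.measurable
  have hw := hc.measurable_pieceW
  have hwb := hc.pieceW_le
  obtain ⟨hfm, ⟨C, hC⟩, R, hR⟩ := hf
  have hC0 : 0 ≤ C := (abs_nonneg _).trans (hC 0)
  refine Nice4.mk (C := C * C * C * C * (M / m * (M / m) * (M / m) * (M / m)))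
    (R := max R (2 * (|p| + |q|))) ?_ ?_ ?_
  · unfold quadT; fun_prop
  · intro a b c d
    unfold quadT
    have := (abs_nonneg _).trans (hwb 0)
    simp only [abs_mul]
    gcongr <;> first | exact hC _ | exact hwb _
  · intro a b c d h
    simp only [quadT, ne_eq, mul_eq_zero, not_or] at h
    obtain ⟨⟨⟨⟨-, h1⟩, -⟩, -⟩, ⟨⟨h2, h3⟩, h4⟩, h5⟩ := h
    have e1 := pieceW_ne_zero h2
    have e2 := pieceW_ne_zero h3
    have e3 := pieceW_ne_zero h4
    have i1 := abs_le_of_mem_Icc e1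
    have i2 := abs_le_of_mem_Icc e2
    have i3 := abs_le_of_mem_Icc e3
    have i4 : |c| ≤ R := by
      by_contra hh; exact h1 (hR c (by rw [Real.norm_eq_abs]; linarith))
    have i5 : |d| ≤ |a + d| + |a| := by
      have := abs_sub (a + d) a; simpa using this
    have := abs_nonneg p
    have := abs_nonneg q
    refine ⟨le_max_of_le_right ?_, le_max_of_le_right ?_, le_max_of_le_left i4,
      le_max_of_le_right ?_⟩ <;> linarith

theorem Nice4.bdd_mul {T χ : ℝ → ℝ → ℝ → ℝ → ℝ} (hT : Nice4 T)
    (hm : Measurable (fun p : ℝ × ℝ × ℝ × ℝ => χ p.1 p.2.1 p.2.2.1 p.2.2.2)) {C : ℝ}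
    (hC : ∀ a b c d, |χ a b c d| ≤ C) : Nice4 (fun a b c d => χ a b c d * T a b c d) :=
  Nice.bdd_mul hT hm ⟨C, fun _ => hC _ _ _ _⟩

end

section
variable {α B B' B'' κ κ' : ℝ → ℝ} {m M lo hi s p q : ℝ} {ψ β : ℝ → ℝ}

theorem CrvPiece.inv_M_le (hc : CrvPiece α B B' B'' κ κ' m M lo hi s p q ψ β) {b : ℝ}
    (hb : b ∈ Icc p q) : M⁻¹ ≤ (B b)⁻¹ :=
  inv_anti₀ (hc.B_pos hb) (hc.B_le b (hc.mem hb))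

theorem CrvPiece.inv_two_M_le (hc : CrvPiece α B B' B'' κ κ' m M lo hi s p q ψ β) {b : ℝ}
    (hb : b ∈ Icc p q) : (2 * M)⁻¹ ≤ (1 - s * B b) / B b := by
  have h1 := hc.B_pos hb
  have h2 := hc.B_le b (hc.mem hb)
  have h3 := (hc.one_sub_ge hb).1
  have hM := hc.M_pos
  calc (2 * M)⁻¹ = 1 / 2 / M := by field_simp
    _ ≤ _ := div_le_div₀ (by linarith) h3 h1 h2

theorem CrvPiece.abs_pieceW_mul (hc : CrvPiece α B B' B'' κ κ' m M lo hi s p q ψ β) (b x : ℝ) :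
    |pieceW κ B p q b * x| ≤ M / m * |(Icc p q).indicator (fun _ => x) b| := by
  by_cases h : b ∈ Icc p q
  · rw [indicator_of_mem h, abs_mul]
    exact mul_le_mul_of_nonneg_right (hc.pieceW_le b) (abs_nonneg _)
  · rw [pieceW, indicator_of_notMem h]; simp [h]

/-- Nearby points `b1`, `b4` contribute little. -/
theorem CrvPiece.near_left (hc : CrvPiece α B B' B'' κ κ' m M lo hi s p q ψ β) (hpq : p ≤ q)
    {f : ℝ → ℝ} (hf : Nice f) {η : ℝ} (hη : 0 < η) {χ : ℝ → ℝ → ℝ → ℝ → ℝ}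
    (hχ : ∀ b1 b4 y r, |χ b1 b4 y r| ≤ 1)
    (hχ0 : ∀ b1 b4 y r, η ≤ |(α b4 - s * b4) - (α b1 - s * b1)| → χ b1 b4 y r = 0) :
    |∫ b1, ∫ b4, ∫ y, ∫ r, χ b1 b4 y r * quadT f α (pieceW κ B p q) s b1 b4 y r|
      ≤ 4 * (M / m) ^ 4 * M ^ 2 * l2 f ^ 4 * η := by
  have hm := hc.m_pos
  have hM := hc.M_pos
  set W := M / m with hW
  have hW0 : 0 ≤ W := by positivity
  set om := pieceW κ B p q with hom
  have inner : ∀ b1 b4, |∫ y, ∫ r, χ b1 b4 y r * quadT f α om s b1 b4 y r|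
      ≤ W ^ 4 * M * l2 f ^ 4 := by
    intro b1 b4
    have h1 : ∀ y, |∫ r, χ b1 b4 y r * quadT f α om s b1 b4 y r|
        ≤ W ^ 4 * M * l2 f ^ 2 * |f y * f (y - -((α b1 - s * b1) - (α b4 - s * b4)))| := by
      intro y
      have := integral_curve_mul_le hM hc.cont.measurable hc.invβ.left hc.invβ.right
        (fun b hb => hc.dα b (hc.mem hb)) (fun b hb => hc.inv_M_le hb) hf
        (y + α b1) (y + (α b1 - s * b1) + s * b4) b1 b4
        (u := fun r => χ b1 b4 y r * quadT f α om s b1 b4 y r)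
        (K := W ^ 4 * |f y * f (y - -((α b1 - s * b1) - (α b4 - s * b4)))|)
        (fun r => by
          have e1 := hc.abs_pieceW_mul (b1 + r) (f (y + α b1 - α (b1 + r)))
          have e2 := hc.abs_pieceW_mul (b4 + r)
            (f (y + (α b1 - s * b1) + s * b4 - α (b4 + r)))
          have e3 := hc.pieceW_le b1
          have e4 := hc.pieceW_le b4
          have e5 := hχ b1 b4 y r
          rw [← hom] at e1 e2 e3 e4
          rw [← hW] at e1 e2 e3 e4
          have eq : χ b1 b4 y r * quadT f α om s b1 b4 y r
            = χ b1 b4 y r * (om b1 * om b4) * ((om (b1 + r) * f (y + α b1 - α (b1 + r))) *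
              (om (b4 + r) * f (y + (α b1 - s * b1) + s * b4 - α (b4 + r)))) *
              (f y * f (y - -((α b1 - s * b1) - (α b4 - s * b4)))) := by
            rw [quadT, sub_neg_eq_add, ← add_sub_assoc]; ring_nf
          rw [eq, abs_mul]
          have i1 : (Icc p q).indicator (fun _ => f (y + α b1 - α (b1 + r))) (b1 + r)
              = (Icc p q).indicator (fun b => f (y + α b1 - α b)) (r + b1) := by
            rw [add_comm r b1]
            by_cases h : b1 + r ∈ Icc p q <;> simp [h]
          have i2 : (Icc p q).indicator
              (fun _ => f (y + (α b1 - s * b1) + s * b4 - α (b4 + r))) (b4 + r)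
              = (Icc p q).indicator (fun b => f (y + (α b1 - s * b1) + s * b4 - α b)) (r + b4) := by
            rw [add_comm r b4]
            by_cases h : b4 + r ∈ Icc p q <;> simp [h]
          rw [i1] at e1
          rw [i2] at e2
          calc _ ≤ 1 * (W * W) * ((W * _) * (W * _)) *
                |f y * f (y - -((α b1 - s * b1) - (α b4 - s * b4)))| := by
                refine mul_le_mul_of_nonneg_right ?_ (abs_nonneg _)
                rw [abs_mul, abs_mul (χ b1 b4 y r), abs_mul (om b1), abs_mul (om (b1 + r) * _)]
                gcongr
                exact mul_nonneg hW0 (abs_nonneg _)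
            _ = _ := by rw [abs_mul ((Icc p q).indicator _ _)]; ring)
        (by positivity)
      refine this.trans (le_of_eq (by ring))
    have n2 := hf.comp_sub (-((α b1 - s * b1) - (α b4 - s * b4)))
    have h2 := abs_integral_le_mul_integral (hf.mul n2).abs h1
    refine h2.trans ?_
    have h3 := integral_abs_mul_le hf n2
    rw [l2_comp_sub] at h3
    calc _ ≤ W ^ 4 * M * l2 f ^ 2 * (l2 f * l2 f) := by gcongr
      _ = _ := by ring
  have mid : ∀ b1, |∫ b4, ∫ y, ∫ r, χ b1 b4 y r * quadT f α om s b1 b4 y r|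
      ≤ W ^ 4 * M * l2 f ^ 4 * (4 * M * η) := by
    intro b1
    have := abs_integral_le_of_support (a := b1 - 2 * M * η) (b := b1 + 2 * M * η)
      (by nlinarith [mul_pos hM hη]) (inner b1) (fun b4 h => by
        by_contra hb
        apply h
        have hfar : η ≤ |(α b4 - s * b4) - (α b1 - s * b1)| := by
          simp only [mem_Icc, not_and_or, not_le] at hb
          rcases hb with hb | hb
          · have h1 := hc.φ_mono (x := b4) (y := b1) (by nlinarith [mul_pos hM hη])
            have h2 : η ≤ (2 * M)⁻¹ * (b1 - b4) := by
              rw [inv_mul_eq_div, le_div_iff₀ (by positivity)]; linarith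
            rw [abs_sub_comm]
            exact (h2.trans h1).trans (le_abs_self _)
          · have h1 := hc.φ_mono (x := b1) (y := b4) (by nlinarith [mul_pos hM hη])
            have h2 : η ≤ (2 * M)⁻¹ * (b4 - b1) := by
              rw [inv_mul_eq_div, le_div_iff₀ (by positivity)]; linarith
            exact (h2.trans h1).trans (le_abs_self _)
        simp [hχ0 b1 b4 _ _ hfar])
    exact this.trans (le_of_eq (by ring))
  have outer := abs_integral_le_of_support hpq mid (fun b1 h => by
    by_contra hb
    apply h
    have : om b1 = 0 := indicator_of_notMem hb _
    simp [quadT, this])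
  refine outer.trans ?_
  have h1 : q - p ≤ 1 := by
    have h3 : m / (6 * M) ≤ 1 := by
      rw [div_le_one (by positivity)]; linarith [hc.m_le, hc.le_M]
    linarith [hc.short]
  calc _ ≤ W ^ 4 * M * l2 f ^ 4 * (4 * M * η) * 1 := by gcongr
    _ = _ := by ring

/-- A small shift `r` contributes little. -/
theorem CrvPiece.near_right (hc : CrvPiece α B B' B'' κ κ' m M lo hi s p q ψ β) (hpq : p ≤ q)
    {f : ℝ → ℝ} (hf : Nice f) {η : ℝ} (hη : 0 < η) {χ : ℝ → ℝ → ℝ → ℝ → ℝ}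
    (hχm : Measurable (fun p : ℝ × ℝ × ℝ × ℝ => χ p.1 p.2.1 p.2.2.1 p.2.2.2))
    (hχ : ∀ b1 b4 y r, |χ b1 b4 y r| ≤ 1)
    (hχ0 : ∀ b1 b4 y r, η ≤ |α (b4 + r) - α b4| → χ b1 b4 y r = 0) :
    |∫ b1, ∫ b4, ∫ y, ∫ r, χ b1 b4 y r * quadT f α (pieceW κ B p q) s b1 b4 y r|
      ≤ 4 * (M / m) ^ 4 * M ^ 2 * l2 f ^ 4 * η := by
  have hm := hc.m_pos
  have hM := hc.M_pos
  set W := M / m with hW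
  have hW0 : 0 ≤ W := by positivity
  set om := pieceW κ B p q with hom
  have hN := (hc.nice_quadT hf).bdd_mul hχm hχ
  have hφm : Measurable (fun b => α b - s * b) := by
    have := hc.cont.measurable; fun_prop
  have reorder : ∀ b1, ∫ b4, ∫ y, ∫ r, χ b1 b4 y r * quadT f α om s b1 b4 y r
      = ∫ r, ∫ y, ∫ b4, χ b1 b4 y r * quadT f α om s b1 b4 y r := by
    intro b1
    rw [(hN.slice b1).rotate]
    refine Nice2.swap (T := fun y r => ∫ b4, χ b1 b4 y r * quadT f α om s b1 b4 y r) ?_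
    refine Nice3.int (T := fun y r b4 => χ b1 b4 y r * quadT f α om s b1 b4 y r) ?_
    exact Nice.comp_of_norm_le (hN.slice b1) (L := fun p : ℝ × ℝ × ℝ => (p.2.2, p.1, p.2.1))
      (by fun_prop) fun x => by simp only [Prod.norm_def]; exact le_of_eq (by ac_rfl)
  simp only [reorder]
  have inner : ∀ b1 r, |∫ y, ∫ b4, χ b1 b4 y r * quadT f α om s b1 b4 y r|
      ≤ W ^ 4 * (2 * M) * l2 f ^ 4 := by
    intro b1 r
    have h1 : ∀ y, |∫ b4, χ b1 b4 y r * quadT f α om s b1 b4 y r|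
        ≤ W ^ 4 * (2 * M) * l2 f ^ 2 * |f y * f (y - (α (b1 + r) - α b1))| := by
      intro y
      have := integral_curve_mul_le (M := 2 * M) (by positivity) hφm hc.invψ.left hc.invψ.right
        (fun b hb => hc.dφ hb) (fun b hb => hc.inv_two_M_le hb) hf
        (y + (α b1 - s * b1)) (y + (α b1 - s * b1) - s * r) 0 r
        (u := fun b4 => χ b1 b4 y r * quadT f α om s b1 b4 y r)
        (K := W ^ 4 * |f y * f (y - (α (b1 + r) - α b1))|)
        (fun b4 => by
          have e1 := hc.abs_pieceW_mul b4 (f (y + (α b1 - s * b1) - (α b4 - s * b4)))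
          have e2 := hc.abs_pieceW_mul (b4 + r)
            (f (y + (α b1 - s * b1) + s * b4 - α (b4 + r)))
          have e3 := hc.pieceW_le b1
          have e4 := hc.pieceW_le (b1 + r)
          have e5 := hχ b1 b4 y r
          rw [← hom] at e1 e2 e3 e4
          rw [← hW] at e1 e2 e3 e4
          have eq : χ b1 b4 y r * quadT f α om s b1 b4 y r
            = χ b1 b4 y r * (om b1 * om (b1 + r)) * ((om b4
              * f (y + (α b1 - s * b1) - (α b4 - s * b4))) *
              (om (b4 + r) * f (y + (α b1 - s * b1) + s * b4 - α (b4 + r)))) *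
              (f y * f (y - (α (b1 + r) - α b1))) := by
            rw [quadT, ← sub_add, sub_add_eq_add_sub]; ring_nf
          rw [eq, abs_mul]
          have i1 : (Icc p q).indicator
              (fun _ => f (y + (α b1 - s * b1) - (α b4 - s * b4))) b4
              = (Icc p q).indicator (fun b => f (y + (α b1 - s * b1) - (α b - s * b)))
                (b4 + 0) := by
            rw [add_zero]
            by_cases h : b4 ∈ Icc p q <;> simp [h]
          have i2 : (Icc p q).indicator
              (fun _ => f (y + (α b1 - s * b1) + s * b4 - α (b4 + r))) (b4 + r)
              = (Icc p q).indicator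
                (fun b => f (y + (α b1 - s * b1) - s * r - (α b - s * b))) (b4 + r) := by
            by_cases h : b4 + r ∈ Icc p q
            · rw [indicator_of_mem h, indicator_of_mem h]; congr 1; ring
            · simp [h]
          rw [i1] at e1
          rw [i2] at e2
          calc _ ≤ 1 * (W * W) * ((W * _) * (W * _)) *
                |f y * f (y - (α (b1 + r) - α b1))| := by
                refine mul_le_mul_of_nonneg_right ?_ (abs_nonneg _)
                rw [abs_mul, abs_mul (χ b1 b4 y r), abs_mul (om b1), abs_mul (om b4 * _)]
                gcongr
                exact mul_nonneg hW0 (abs_nonneg _)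
            _ = _ := by rw [abs_mul ((Icc p q).indicator _ _)]; ring)
        (by positivity)
      refine this.trans (le_of_eq (by ring))
    have n2 := hf.comp_sub (α (b1 + r) - α b1)
    have h2 := abs_integral_le_mul_integral (hf.mul n2).abs h1
    refine h2.trans ?_
    have h3 := integral_abs_mul_le hf n2
    rw [l2_comp_sub] at h3
    calc _ ≤ W ^ 4 * (2 * M) * l2 f ^ 2 * (l2 f * l2 f) := by gcongr
      _ = _ := by ring
  have mid : ∀ b1, |∫ r, ∫ y, ∫ b4, χ b1 b4 y r * quadT f α om s b1 b4 y r|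
      ≤ W ^ 4 * M * l2 f ^ 4 * (4 * M * η) := by
    intro b1
    have := abs_integral_le_of_support (a := -(M * η)) (b := M * η)
      (by nlinarith [mul_pos hM hη]) (inner b1) (fun r h => by
        by_contra hb
        apply h
        have hfar : ∀ b4, η ≤ |α (b4 + r) - α b4| := fun b4 => by
          simp only [mem_Icc, not_and_or, not_le] at hb
          rcases hb with hb | hb
          · have h1 := hc.expand (b4 + r) b4 (by nlinarith [mul_pos hM hη])
            have h2 : η ≤ M⁻¹ * (b4 - (b4 + r)) := by
              rw [inv_mul_eq_div, le_div_iff₀ (by positivity)]; linarith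
            rw [abs_sub_comm]
            exact (h2.trans h1).trans (le_abs_self _)
          · have h1 := hc.expand b4 (b4 + r) (by nlinarith [mul_pos hM hη])
            have h2 : η ≤ M⁻¹ * (b4 + r - b4) := by
              rw [inv_mul_eq_div, le_div_iff₀ (by positivity)]; linarith
            exact (h2.trans h1).trans (le_abs_self _)
        simp [fun b4 y => hχ0 b1 b4 y r (hfar b4)])
    exact this.trans (le_of_eq (by ring))
  have outer := abs_integral_le_of_support hpq mid (fun b1 h => by
    by_contra hb
    apply h
    have : om b1 = 0 := indicator_of_notMem hb _
    simp [quadT, this])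
  refine outer.trans ?_
  have h1 : q - p ≤ 1 := by
    have h3 : m / (6 * M) ≤ 1 := by
      rw [div_le_one (by positivity)]; linarith [hc.m_le, hc.le_M]
    linarith [hc.short]
  calc _ ≤ W ^ 4 * M * l2 f ^ 4 * (4 * M * η) * 1 := by gcongr
    _ = _ := by ring

end

section
variable {α B B' B'' κ κ' : ℝ → ℝ} {m M lo hi s p q : ℝ} {ψ β : ℝ → ℝ}

/-- The four-point integrand after the substitution for the third point. -/
noncomputable def farTwo (f α B κ : ℝ → ℝ) (s p q : ℝ) (β : ℝ → ℝ) (η y b1 y3 b4 : ℝ) : ℝ :=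
  let b3 := β (y + (α b1 - s * b1) + s * b4 - y3)
  farInd η ((α b4 - s * b4) - (α b1 - s * b1)) * farInd η (α b3 - α b4) *
    (f (y + α b1 - α (b1 + (b3 - b4))) * f y * f y3 *
      f (y + (α b1 - s * b1) - (α b4 - s * b4))) *
    (pieceW κ B p q b1 * pieceW κ B p q (b1 + (b3 - b4)) * (Icc p q).indicator κ b3)

/-- The four-point integrand after both substitutions. -/
noncomputable def farThree (f α B κ : ℝ → ℝ) (s p q : ℝ) (ψ β : ℝ → ℝ) (η y b1 y3 y4 : ℝ) : ℝ :=
  f y * f y3 * f y4 * farInd η (y - y4) * farInd η (y4 - y3) *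
    (f (y + α b1 - α (pt0 α s ψ β (y - y4) (y4 - y3) b1)) *
    (pieceW κ B p q b1 * pieceW κ B p q (pt0 α s ψ β (y - y4) (y4 - y3) b1) *
      (Icc p q).indicator κ (pt3 α s ψ β (y - y4) (y4 - y3) b1) *
      (Icc p q).indicator (fun b => κ b / (1 - s * B b)) (pt4 α s ψ (y - y4) b1)))

theorem CrvPiece.integral_far_shift (hc : CrvPiece α B B' B'' κ κ' m M lo hi s p q ψ β)
    {f : ℝ → ℝ} (η y b1 b4 : ℝ) :
    ∫ r, farInd η ((α b4 - s * b4) - (α b1 - s * b1)) * farInd η (α (b4 + r) - α b4) *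
      quadT f α (pieceW κ B p q) s b1 b4 y r
      = ∫ y3, farTwo f α B κ s p q β η y b1 y3 b4 * pieceW κ B p q b4 := by
  rw [← integral_sub_right_eq_self _ b4]
  set c := y + (α b1 - s * b1) + s * b4 with hcdef
  have e := integral_indicator_eq_comp_inverse hc.invβ.left hc.invβ.right
    (fun b hb => hc.dα b (hc.mem hb)) (fun b hb => inv_pos.2 (hc.B_pos hb))
    (fun b3 => farInd η ((α b4 - s * b4) - (α b1 - s * b1)) * farInd η (α b3 - α b4) *
      (f (y + α b1 - α (b1 + (b3 - b4))) * f y * f (c - α b3) *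
      f (y + (α b1 - s * b1) - (α b4 - s * b4))) *
      (pieceW κ B p q b1 * pieceW κ B p q (b1 + (b3 - b4)) * (κ b3 / B b3) * pieceW κ B p q b4)) c
  refine Eq.trans ?_ (e.trans ?_)
  · congr 1; ext b3
    rw [add_sub_cancel]
    simp only [quadT, add_sub_cancel]
    by_cases h : b3 ∈ Icc p q
    · rw [indicator_of_mem h]
      simp only [pieceW, indicator_of_mem h]
      ring
    · simp [pieceW, indicator_of_notMem h]
  · congr 1; ext y3
    simp only [farTwo, ← hcdef]
    by_cases h : β (c - y3) ∈ Icc p q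
    · rw [indicator_of_mem h, indicator_of_mem h, hc.invβ.right, sub_sub_cancel]
      have := (hc.B_pos h).ne'
      field_simp
    · simp [indicator_of_notMem h]

theorem CrvPiece.integral_farTwo (hc : CrvPiece α B B' B'' κ κ' m M lo hi s p q ψ β)
    {f : ℝ → ℝ} (η y b1 y3 : ℝ) :
    ∫ b4, farTwo f α B κ s p q β η y b1 y3 b4 * pieceW κ B p q b4
      = ∫ y4, farThree f α B κ s p q ψ β η y b1 y3 y4 := by
  have e := integral_indicator_eq_comp_inverse hc.invψ.left hc.invψ.right
    (fun b hb => hc.dφ hb) (fun b hb => div_pos (by linarith [(hc.one_sub_ge hb).1]) (hc.B_pos hb))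
    (fun b4 => farTwo f α B κ s p q β η y b1 y3 b4 * (κ b4 / B b4)) (y + (α b1 - s * b1))
  refine Eq.trans ?_ (e.trans ?_)
  · congr 1; ext b4
    by_cases h : b4 ∈ Icc p q
    · simp only [pieceW, indicator_of_mem h]
    · simp [pieceW, indicator_of_notMem h]
  · congr 1; ext y4
    have e1 : y + (α b1 - s * b1) - y4 = α b1 - s * b1 + (y - y4) := by ring
    have e4 : ψ (y + (α b1 - s * b1) - y4) = pt4 α s ψ (y - y4) b1 := by rw [e1, pt4]
    have e5 : α (pt4 α s ψ (y - y4) b1) - s * pt4 α s ψ (y - y4) b1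
        = y + (α b1 - s * b1) - y4 := by rw [← e4]; exact hc.invψ.right _
    rw [e4]
    by_cases h : pt4 α s ψ (y - y4) b1 ∈ Icc p q
    · have hB := (hc.B_pos h).ne'
      have e3 : β (y + (α b1 - s * b1) + s * pt4 α s ψ (y - y4) b1 - y3)
          = pt3 α s ψ β (y - y4) (y4 - y3) b1 := by
        rw [pt3]; congr 1; linarith
      have e6 : α (pt3 α s ψ β (y - y4) (y4 - y3) b1) - α (pt4 α s ψ (y - y4) b1) = y4 - y3 := by
        rw [pt3, hc.invβ.right]; ring
      have e0 : b1 + (pt3 α s ψ β (y - y4) (y4 - y3) b1 - pt4 α s ψ (y - y4) b1)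
          = pt0 α s ψ β (y - y4) (y4 - y3) b1 := by rw [pt0]; ring
      simp only [farTwo, farThree]
      rw [indicator_of_mem h, indicator_of_mem h, e3, e6, e0, e5,
        show y + (α b1 - s * b1) - y4 - (α b1 - s * b1) = y - y4 by ring, sub_sub_cancel]
      have : ∀ A k b c : ℝ, b ≠ 0 → A * (k / b) / (c / b) = A * (k / c) := fun A k b c hb => by
        rcases eq_or_ne c 0 with rfl | hc0
        · simp
        · field_simp
      rw [this _ _ _ _ hB]
      ring
    · simp [farThree, indicator_of_notMem h]

theorem CrvPiece.indicator_κ_le (hc : CrvPiece α B B' B'' κ κ' m M lo hi s p q ψ β) (b : ℝ) :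
    |(Icc p q).indicator κ b| ≤ M := by
  by_cases h : b ∈ Icc p q
  · rw [indicator_of_mem h]; exact hc.κ_le b (hc.mem h)
  · rw [indicator_of_notMem h, abs_zero]; exact hc.M_pos.le

theorem CrvPiece.indicator_κ_div_le (hc : CrvPiece α B B' B'' κ κ' m M lo hi s p q ψ β) (b : ℝ) :
    |(Icc p q).indicator (fun b => κ b / (1 - s * B b)) b| ≤ 2 * M := by
  have hM := hc.M_pos
  by_cases h : b ∈ Icc p q
  · have h1 := (hc.one_sub_ge h).1
    rw [indicator_of_mem h, abs_div, abs_of_pos (by linarith : 0 < 1 - s * B b),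
      div_le_iff₀ (by linarith)]
    nlinarith [hc.κ_le b (hc.mem h)]
  · rw [indicator_of_notMem h, abs_zero]; positivity

theorem abs_farInd_le (η x : ℝ) : |farInd η x| ≤ 1 := by
  have := farInd_mem η x
  rw [abs_of_nonneg this.1]; exact this.2

theorem CrvPiece.nice_farTwo (hc : CrvPiece α B B' B'' κ κ' m M lo hi s p q ψ β)
    {f : ℝ → ℝ} (hf : Nice f) (η y b1 : ℝ) :
    Nice2 (fun b4 y3 => farTwo f α B κ s p q β η y b1 y3 b4 * pieceW κ B p q b4) := by
  have hα := hc.cont.measurable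
  have hβ := hc.invβ.cont.measurable
  have hw := hc.measurable_pieceW
  have hwb := hc.pieceW_le
  have hF := measurable_farInd η
  have hκm : Measurable ((Icc p q).indicator κ) := hc.meas_κ.indicator measurableSet_Icc
  obtain ⟨hfm, ⟨C, hC⟩, R, hR⟩ := hf
  have hC0 : 0 ≤ C := (abs_nonneg _).trans (hC 0)
  have hM := hc.M_pos
  have hm := hc.m_pos
  refine Nice2.mk (C := 1 * 1 * (C * C * C * C) * (M / m * (M / m) * M) * (M / m))
    (R := max R (|p| + |q|)) ?_ ?_ ?_
  · unfold farTwo; fun_prop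
  · intro a b
    simp only [farTwo, abs_mul]
    gcongr <;> first | exact hC _ | exact hwb _ | exact abs_farInd_le _ _ | exact hc.indicator_κ_le _
  · intro a b h
    simp only [farTwo, ne_eq, mul_eq_zero, not_or] at h
    obtain ⟨⟨⟨-, ⟨-, h1⟩, -⟩, -⟩, h2⟩ := h
    refine ⟨le_max_of_le_right (abs_le_of_mem_Icc (pieceW_ne_zero h2)), le_max_of_le_left ?_⟩
    by_contra hh; exact h1 (hR _ (by rw [Real.norm_eq_abs]; linarith))

theorem CrvPiece.nice_farThree (hc : CrvPiece α B B' B'' κ κ' m M lo hi s p q ψ β)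
    {f : ℝ → ℝ} (hf : Nice f) (η y : ℝ) : Nice3 (farThree f α B κ s p q ψ β η y) := by
  have hα := hc.cont.measurable
  have hβ := hc.invβ.cont.measurable
  have hψ := hc.invψ.cont.measurable
  have hw := hc.measurable_pieceW
  have hwb := hc.pieceW_le
  have hF := measurable_farInd η
  have hκm : Measurable ((Icc p q).indicator κ) := hc.meas_κ.indicator measurableSet_Icc
  have hκm' : Measurable ((Icc p q).indicator (fun b => κ b / (1 - s * B b))) :=
    (hc.meas_κ.div ((hc.meas_B.const_mul s).const_sub 1)).indicator measurableSet_Icc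
  obtain ⟨hfm, ⟨C, hC⟩, R, hR⟩ := hf
  have hC0 : 0 ≤ C := (abs_nonneg _).trans (hC 0)
  have hM := hc.M_pos
  have hm := hc.m_pos
  refine Nice3.mk (C := C * C * C * 1 * 1 * (C * (M / m * (M / m) * M * (2 * M))))
    (R := max R (|p| + |q|)) ?_ ?_ ?_
  · unfold farThree pt0 pt3 pt4; fun_prop
  · intro a b c
    simp only [farThree, abs_mul]
    gcongr <;> first | exact hC _ | exact hwb _ | exact abs_farInd_le _ _ |
      exact hc.indicator_κ_le _ | exact hc.indicator_κ_div_le _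
  · intro a b c h
    simp only [farThree, ne_eq, mul_eq_zero, not_or] at h
    obtain ⟨⟨⟨⟨⟨-, h1⟩, h3⟩, -⟩, -⟩, -, ⟨⟨h2, -⟩, -⟩, -⟩ := h
    refine ⟨le_max_of_le_right (abs_le_of_mem_Icc (pieceW_ne_zero h2)), le_max_of_le_left ?_,
      le_max_of_le_left ?_⟩
    · by_contra hh; exact h1 (hR _ (by rw [Real.norm_eq_abs]; linarith))
    · by_contra hh; exact h3 (hR _ (by rw [Real.norm_eq_abs]; linarith))

theorem CrvPiece.integral_far (hc : CrvPiece α B B' B'' κ κ' m M lo hi s p q ψ β)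
    {f : ℝ → ℝ} (hf : Nice f) (η y : ℝ) :
    ∫ b1, ∫ b4, ∫ r, farInd η ((α b4 - s * b4) - (α b1 - s * b1)) *
      farInd η (α (b4 + r) - α b4) * quadT f α (pieceW κ B p q) s b1 b4 y r
      = ∫ y3, ∫ y4, ∫ b1, farThree f α B κ s p q ψ β η y b1 y3 y4 := by
  rw [← (hc.nice_farThree hf η y).rotate]
  congr 1; ext b1
  simp only [hc.integral_far_shift, ← hc.integral_farTwo]
  exact (hc.nice_farTwo hf η y b1).swap

theorem CrvPiece.abs_integral_farThree_le (hc : CrvPiece α B B' B'' κ κ' m M lo hi s p q ψ β)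
    {f P : ℝ → ℝ} (hf : Nice f) (hP : Continuous P) {Z : Set ℝ} (hZ : Z.Countable)
    (hd : ∀ y, y ∉ Z → HasDerivAt P (f y) y) {Bd : ℝ} (hB : ∀ y, |P y| ≤ Bd)
    {η : ℝ} (hη : 0 < η) (hη1 : η ≤ 1) (y y3 y4 : ℝ) :
    |∫ b1, farThree f α B κ s p q ψ β η y b1 y3 y4|
      ≤ Bd * (1000 * M ^ 6 / m ^ 7 / η ^ 4) * |f y| * |f y3| * |f y4| := by
  have hm := hc.m_pos
  have hM := hc.M_pos
  have hBd : 0 ≤ Bd := (abs_nonneg _).trans (hB 0)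
  by_cases h1 : η ≤ |y - y4|
  swap
  · simp only [farThree, farInd_of_lt (not_le.1 h1)]
    simp only [mul_zero, zero_mul, integral_zero, abs_zero]
    positivity
  by_cases h2 : η ≤ |y4 - y3|
  swap
  · simp only [farThree, farInd_of_lt (not_le.1 h2)]
    simp only [mul_zero, zero_mul, integral_zero, abs_zero]
    positivity
  simp only [farThree, farInd_of_le h1, farInd_of_le h2, mul_one, integral_const_mul]
  have key := hc.core_integral hf hP hZ hd hB hη hη1 h1 h2 y
  rw [← integral_indicator hc.fourPts_compact.measurableSet] at key
  have e : ∀ b1, f (y + α b1 - α (pt0 α s ψ β (y - y4) (y4 - y3) b1)) *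
    (pieceW κ B p q b1 * pieceW κ B p q (pt0 α s ψ β (y - y4) (y4 - y3) b1) *
      (Icc p q).indicator κ (pt3 α s ψ β (y - y4) (y4 - y3) b1) *
      (Icc p q).indicator (fun b => κ b / (1 - s * B b)) (pt4 α s ψ (y - y4) b1))
      = (fourPts α s ψ β p q (y - y4) (y4 - y3)).indicator (fun t =>
        f (y + α t - α (pt0 α s ψ β (y - y4) (y4 - y3) t)) *
        (κ (pt0 α s ψ β (y - y4) (y4 - y3) t) * κ t * κ (pt3 α s ψ β (y - y4) (y4 - y3) t) *
          κ (pt4 α s ψ (y - y4) t) / (B (pt0 α s ψ β (y - y4) (y4 - y3) t) * B t *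
          (1 - s * B (pt4 α s ψ (y - y4) t))))) b1 := by
    intro b1
    by_cases h : b1 ∈ fourPts α s ψ β p q (y - y4) (y4 - y3)
    · rw [indicator_of_mem h]
      obtain ⟨⟨⟨g1, g4⟩, g3⟩, g0⟩ := h
      have i0 := (hc.B_pos g0).ne'
      have i1 := (hc.B_pos g1).ne'
      have i2 : 1 - s * B (pt4 α s ψ (y - y4) b1) ≠ 0 := by linarith [(hc.one_sub_ge g4).1]
      simp only [pieceW, indicator_of_mem g0, indicator_of_mem g1, indicator_of_mem g3,
        indicator_of_mem g4]
      field_simp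
    · rw [indicator_of_notMem h]
      simp only [fourPts, threePts, mem_ofPred_eq, not_and_or] at h
      rcases h with ((h | h) | h) | h <;> simp [pieceW, indicator_of_notMem h]
  simp only [e, abs_mul]
  calc _ ≤ |f y| * |f y3| * |f y4| * (Bd * (1000 * M ^ 6 / m ^ 7 / η ^ 4)) := by gcongr
    _ = _ := by ring

/-- The main part of the four-point integral. -/
theorem CrvPiece.far_le (hc : CrvPiece α B B' B'' κ κ' m M lo hi s p q ψ β)
    {f P : ℝ → ℝ} (hf : Nice f) {a : ℝ} (hs : ∀ x, f x ≠ 0 → x ∈ Icc a (a + 1))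
    (hP : Continuous P) {Z : Set ℝ} (hZ : Z.Countable)
    (hd : ∀ y, y ∉ Z → HasDerivAt P (f y) y) {Bd : ℝ} (hB : ∀ y, |P y| ≤ Bd)
    {η : ℝ} (hη : 0 < η) (hη1 : η ≤ 1) :
    |∫ b1, ∫ b4, ∫ y, ∫ r, farInd η ((α b4 - s * b4) - (α b1 - s * b1)) *
      farInd η (α (b4 + r) - α b4) * quadT f α (pieceW κ B p q) s b1 b4 y r|
      ≤ Bd * (1000 * M ^ 6 / m ^ 7 / η ^ 4) * l2 f ^ 3 := by
  have hm := hc.m_pos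
  have hM := hc.M_pos
  have hα := hc.cont.measurable
  have hF := measurable_farInd η
  have hBd : 0 ≤ Bd := (abs_nonneg _).trans (hB 0)
  have hN : Nice4 (fun b1 b4 y r => farInd η ((α b4 - s * b4) - (α b1 - s * b1)) *
      farInd η (α (b4 + r) - α b4) * quadT f α (pieceW κ B p q) s b1 b4 y r) := by
    refine (hc.nice_quadT hf).bdd_mul (C := 1 * 1) (by fun_prop) fun b1 b4 y r => ?_
    rw [abs_mul]
    gcongr <;> exact abs_farInd_le _ _
  have h1 : ∀ b1, ∫ b4, ∫ y, ∫ r, farInd η ((α b4 - s * b4) - (α b1 - s * b1)) *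
      farInd η (α (b4 + r) - α b4) * quadT f α (pieceW κ B p q) s b1 b4 y r
      = ∫ y, ∫ b4, ∫ r, farInd η ((α b4 - s * b4) - (α b1 - s * b1)) *
      farInd η (α (b4 + r) - α b4) * quadT f α (pieceW κ B p q) s b1 b4 y r :=
    fun b1 => (hN.slice b1).swap
  simp only [h1]
  rw [hN.comm_mid.swap]
  simp only [hc.integral_far hf]
  set K := Bd * (1000 * M ^ 6 / m ^ 7 / η ^ 4) with hK
  have hK0 : 0 ≤ K := by positivity
  have hl := integral_abs_le_l2 hf hs
  have hl0 := l2_nonneg f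
  have i1 : ∀ y y3, |∫ y4, ∫ b1, farThree f α B κ s p q ψ β η y b1 y3 y4|
      ≤ K * |f y| * l2 f * |f y3| := fun y y3 => by
    refine (abs_integral_le_mul_integral hf.abs
      (fun y4 => hc.abs_integral_farThree_le hf hP hZ hd hB hη hη1 y y3 y4)).trans ?_
    calc _ ≤ K * |f y| * |f y3| * l2 f := by gcongr
      _ = _ := by ring
  have i2 : ∀ y, |∫ y3, ∫ y4, ∫ b1, farThree f α B κ s p q ψ β η y b1 y3 y4|
      ≤ K * l2 f ^ 2 * |f y| := fun y => by
    refine (abs_integral_le_mul_integral hf.abs (i1 y)).trans ?_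
    calc _ ≤ K * |f y| * l2 f * l2 f := by gcongr
      _ = _ := by ring
  refine (abs_integral_le_mul_integral hf.abs i2).trans ?_
  calc _ ≤ K * l2 f ^ 2 * l2 f := by gcongr
    _ = _ := by ring

/-- The four-point integral. -/
noncomputable def quadI (f α om : ℝ → ℝ) (s : ℝ) : ℝ := ∫ b1, ∫ b4, ∫ y, ∫ r, quadT f α om s b1 b4 y r

theorem Nice4.integral_add {S T : ℝ → ℝ → ℝ → ℝ → ℝ} (hS : Nice4 S) (hT : Nice4 T) :
    ∫ a, ∫ b, ∫ c, ∫ d, (S a b c d + T a b c d)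
      = (∫ a, ∫ b, ∫ c, ∫ d, S a b c d) + ∫ a, ∫ b, ∫ c, ∫ d, T a b c d := by
  rw [← MeasureTheory.integral_add (hS.int.int.int.integrable _) (hT.int.int.int.integrable _)]
  congr 1; ext a
  rw [← MeasureTheory.integral_add ((hS.slice a).int.int.integrable _)
    ((hT.slice a).int.int.integrable _)]
  congr 1; ext b
  rw [← MeasureTheory.integral_add (((hS.slice a).slice b).int.integrable _)
    (((hT.slice a).slice b).int.integrable _)]
  congr 1; ext c
  exact MeasureTheory.integral_add ((((hS.slice a).slice b).slice c).integrable _)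
    ((((hT.slice a).slice b).slice c).integrable _)

theorem CrvPiece.quadI_le (hc : CrvPiece α B B' B'' κ κ' m M lo hi s p q ψ β) (hpq : p ≤ q)
    {f P : ℝ → ℝ} (hf : Nice f) {a : ℝ} (hs : ∀ x, f x ≠ 0 → x ∈ Icc a (a + 1))
    (hP : Continuous P) {Z : Set ℝ} (hZ : Z.Countable)
    (hd : ∀ y, y ∉ Z → HasDerivAt P (f y) y) {Bd : ℝ} (hB : ∀ y, |P y| ≤ Bd)
    {η : ℝ} (hη : 0 < η) (hη1 : η ≤ 1) :
    |quadI f α (pieceW κ B p q) s|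
      ≤ Bd * (1000 * M ^ 6 / m ^ 7 / η ^ 4) * l2 f ^ 3
        + 8 * (M / m) ^ 4 * M ^ 2 * l2 f ^ 4 * η := by
  have hα := hc.cont.measurable
  have hF := measurable_farInd η
  have hQ := hc.nice_quadT hf
  set T := quadT f α (pieceW κ B p q) s with hT
  have g1 := hc.far_le hf hs hP hZ hd hB hη hη1
  have mem := farInd_mem η
  have bd : ∀ x y, |(1 - farInd η x) * farInd η y| ≤ 1 := fun x y => by
    have h1 := mem x; have h2 := mem y
    rw [abs_le]; constructor <;> nlinarith
  have bd' : ∀ x, |1 - farInd η x| ≤ 1 := fun x => by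
    have h1 := mem x
    rw [abs_le]; constructor <;> linarith
  have n1 : Nice4 (fun b1 b4 y r => farInd η ((α b4 - s * b4) - (α b1 - s * b1)) *
      farInd η (α (b4 + r) - α b4) * T b1 b4 y r) := by
    refine hQ.bdd_mul (C := 1 * 1) (by fun_prop) fun b1 b4 y r => ?_
    rw [abs_mul]
    gcongr <;> exact abs_farInd_le _ _
  have n2 : Nice4 (fun b1 b4 y r => (1 - farInd η ((α b4 - s * b4) - (α b1 - s * b1))) *
      T b1 b4 y r) := hQ.bdd_mul (C := 1) (by fun_prop) fun b1 b4 y r => bd' _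
  have m3 : Measurable (fun p : ℝ × ℝ × ℝ × ℝ => (1 - farInd η (α (p.2.1 + p.2.2.2) - α p.2.1)) *
      farInd η ((α p.2.1 - s * p.2.1) - (α p.1 - s * p.1))) := by fun_prop
  have n3 : Nice4 (fun b1 b4 y r => (1 - farInd η (α (b4 + r) - α b4)) *
      farInd η ((α b4 - s * b4) - (α b1 - s * b1)) * T b1 b4 y r) :=
    hQ.bdd_mul (C := 1) m3 fun b1 b4 y r => bd _ _
  have g2 := hc.near_left hpq hf hη (χ := fun b1 b4 y r =>
      1 - farInd η ((α b4 - s * b4) - (α b1 - s * b1))) (fun _ _ _ _ => bd' _)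
      (fun _ _ _ _ h => by simp [farInd_of_le h])
  have g3 := hc.near_right hpq hf hη (χ := fun b1 b4 y r =>
      (1 - farInd η (α (b4 + r) - α b4)) * farInd η ((α b4 - s * b4) - (α b1 - s * b1)))
      m3 (fun _ _ _ _ => bd _ _) (fun _ _ _ _ h => by simp [farInd_of_le h])
  have e : quadI f α (pieceW κ B p q) s = ∫ b1, ∫ b4, ∫ y, ∫ r,
      (farInd η ((α b4 - s * b4) - (α b1 - s * b1)) *
        farInd η (α (b4 + r) - α b4) * T b1 b4 y r +
      ((1 - farInd η ((α b4 - s * b4) - (α b1 - s * b1))) * T b1 b4 y r +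
      (1 - farInd η (α (b4 + r) - α b4)) *
        farInd η ((α b4 - s * b4) - (α b1 - s * b1)) * T b1 b4 y r)) := by
    unfold quadI
    congr 1; ext b1; congr 1; ext b4; congr 1; ext y; congr 1; ext r
    ring
  have n23 : Nice4 (fun b1 b4 y r => (1 - farInd η ((α b4 - s * b4) - (α b1 - s * b1))) *
      T b1 b4 y r + (1 - farInd η (α (b4 + r) - α b4)) *
      farInd η ((α b4 - s * b4) - (α b1 - s * b1)) * T b1 b4 y r) := Nice.add n2 n3
  rw [e, n1.integral_add n23, n2.integral_add n3]
  refine (abs_add_le _ _).trans ?_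
  refine (add_le_add g1 ((abs_add_le _ _).trans (add_le_add g2 g3))).trans (le_of_eq ?_)
  ring

end

theorem Nice2.self_mul {U : ℝ → ℝ → ℝ} (h : Nice2 U) : Nice3 (fun x b c => U x b * U x c) := by
  obtain ⟨hm, ⟨C, hC⟩, R, hR⟩ := h
  have hs : ∀ x b, U x b ≠ 0 → |x| ≤ R ∧ |b| ≤ R := fun x b hh => by
    have : ‖(x, b)‖ ≤ R := by by_contra h1; exact hh (hR (x, b) (not_le.1 h1))
    simpa [Prod.norm_def] using this
  have hm2 : Measurable (fun p : ℝ × ℝ × ℝ => U p.1 p.2.1) :=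
    hm.comp (g := fun p : ℝ × ℝ => U p.1 p.2) (f := fun p : ℝ × ℝ × ℝ => (p.1, p.2.1))
      (by fun_prop)
  have hm3 : Measurable (fun p : ℝ × ℝ × ℝ => U p.1 p.2.2) :=
    hm.comp (g := fun p : ℝ × ℝ => U p.1 p.2) (f := fun p : ℝ × ℝ × ℝ => (p.1, p.2.2))
      (by fun_prop)
  refine Nice3.mk (C := C * C) (R := R) (hm2.mul hm3) (fun a b c => ?_) (fun a b c hh => ?_)
  · rw [abs_mul]
    exact mul_le_mul (hC (a, b)) (hC (a, c)) (abs_nonneg _) ((abs_nonneg _).trans (hC (a, b)))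
  · obtain ⟨h1, h2⟩ := mul_ne_zero_iff.1 hh
    exact ⟨(hs _ _ h1).1, (hs _ _ h1).2, (hs _ _ h2).2⟩

theorem Nice3.self_mul {F : ℝ → ℝ → ℝ → ℝ} (h : Nice3 F) :
    Nice4 (fun w x b c => F w x b * F w x c) := by
  obtain ⟨hm, ⟨C, hC⟩, R, hR⟩ := h
  have hs : ∀ w x b, F w x b ≠ 0 → |w| ≤ R ∧ |x| ≤ R ∧ |b| ≤ R := fun w x b hh => by
    have : ‖(w, x, b)‖ ≤ R := by by_contra h1; exact hh (hR (w, x, b) (not_le.1 h1))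
    simpa [Prod.norm_def] using this
  have hm2 : Measurable (fun p : ℝ × ℝ × ℝ × ℝ => F p.1 p.2.1 p.2.2.1) :=
    hm.comp (g := fun p : ℝ × ℝ × ℝ => F p.1 p.2.1 p.2.2)
      (f := fun p : ℝ × ℝ × ℝ × ℝ => (p.1, p.2.1, p.2.2.1)) (by fun_prop)
  have hm3 : Measurable (fun p : ℝ × ℝ × ℝ × ℝ => F p.1 p.2.1 p.2.2.2) :=
    hm.comp (g := fun p : ℝ × ℝ × ℝ => F p.1 p.2.1 p.2.2)
      (f := fun p : ℝ × ℝ × ℝ × ℝ => (p.1, p.2.1, p.2.2.2)) (by fun_prop)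
  refine Nice4.mk (C := C * C) (R := R) (hm2.mul hm3) (fun a b c d => ?_) (fun a b c d hh => ?_)
  · rw [abs_mul]
    exact mul_le_mul (hC (a, b, c)) (hC (a, b, d)) (abs_nonneg _)
      ((abs_nonneg _).trans (hC (a, b, c)))
  · obtain ⟨h1, h2⟩ := mul_ne_zero_iff.1 hh
    exact ⟨(hs _ _ _ h1).1, (hs _ _ _ h1).2.1, (hs _ _ _ h1).2.2, (hs _ _ _ h2).2.2⟩

/-- Cauchy–Schwarz on a box of area at most one. -/
theorem integral_sq_le_of_box {Φ H : ℝ → ℝ → ℝ} (hΦ : Nice2 Φ)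
    (hH : Measurable (fun p : ℝ × ℝ => H p.1 p.2)) (hb : ∀ w x, |H w x| ≤ 1) {a b c d : ℝ}
    (hab : a ≤ b) (hcd : c ≤ d) (hone : (b - a) * (d - c) ≤ 1)
    (hs : ∀ w x, Φ w x ≠ 0 → w ∈ Icc a b ∧ x ∈ Icc c d) :
    (∫ w, ∫ x, H w x * Φ w x) ^ 2 ≤ ∫ w, ∫ x, Φ w x ^ 2 := by
  set u : ℝ × ℝ → ℝ := (Icc a b ×ˢ Icc c d).indicator (fun p => H p.1 p.2) with hu
  have hu1 : ∀ p, |u p| ≤ 1 := fun p => by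
    by_cases h : p ∈ Icc a b ×ˢ Icc c d
    · rw [hu, indicator_of_mem h]; exact hb _ _
    · rw [hu, indicator_of_notMem h]; simp
  have hun : Nice2 (fun w x => u (w, x)) := by
    refine Nice2.mk (C := 1) (R := max (|a| + |b|) (|c| + |d|))
      (hH.indicator (measurableSet_Icc.prod measurableSet_Icc)) (fun _ _ => hu1 _) fun w x h => ?_
    have : (w, x) ∈ Icc a b ×ˢ Icc c d := by
      by_contra h1; exact h (by rw [hu, indicator_of_notMem h1])
    exact ⟨le_max_of_le_left (abs_le_of_mem_Icc this.1), le_max_of_le_right (abs_le_of_mem_Icc this.2)⟩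
  have e1 : ∫ w, ∫ x, H w x * Φ w x = ∫ z : ℝ × ℝ, u z * Φ z.1 z.2 := by
    rw [Measure.volume_eq_prod, integral_prod _ ((Nice.mul hun hΦ).integrable _)]
    congr 1; ext w; congr 1; ext x
    by_cases h : Φ w x = 0
    · simp [h]
    · have : (w, x) ∈ Icc a b ×ˢ Icc c d := hs w x h
      change H w x * Φ w x = u (w, x) * Φ w x
      rw [hu, indicator_of_mem this]
  have e2 : ∫ w, ∫ x, Φ w x ^ 2 = l2 (fun z : ℝ × ℝ => Φ z.1 z.2) ^ 2 := by
    rw [l2_sq, Measure.volume_eq_prod, integral_prod _ ((Nice.sq hΦ).integrable _)]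
  have e3 : l2 u ^ 2 ≤ 1 := by
    rw [l2_sq, Measure.volume_eq_prod, integral_prod _ ((Nice.sq hun).integrable _)]
    refine (le_abs_self _).trans (le_trans ?_ hone)
    rw [mul_comm (b - a)]
    refine abs_integral_le_of_support hab (fun w => ?_) fun w h => ?_
    · have : ∀ x, |u (w, x) ^ 2| ≤ 1 := fun x => by
        rw [abs_pow]; exact pow_le_one₀ (abs_nonneg _) (hu1 _)
      have := abs_integral_le_of_support hcd this fun x h => by
        by_contra h1
        apply h
        rw [hu, indicator_of_notMem (fun hh => h1 hh.2)]; simp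
      simpa using this
    · by_contra h1
      apply h
      have : ∀ x, u (w, x) = 0 := fun x => by
        rw [hu, indicator_of_notMem (fun hh => h1 hh.1)]
      simp [this]
  rw [e1, e2]
  have cs := abs_integral_mul_le (E := ℝ × ℝ) hun hΦ
  calc _ = |∫ z : ℝ × ℝ, u z * Φ z.1 z.2| ^ 2 := (sq_abs _).symm
    _ ≤ (l2 u * l2 (fun z : ℝ × ℝ => Φ z.1 z.2)) ^ 2 := by
        have : |∫ z : ℝ × ℝ, u z * Φ z.1 z.2| ≤ l2 u * l2 (fun z : ℝ × ℝ => Φ z.1 z.2) := cs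
        gcongr
    _ = l2 u ^ 2 * l2 (fun z : ℝ × ℝ => Φ z.1 z.2) ^ 2 := mul_pow _ _ _
    _ ≤ 1 * l2 (fun z : ℝ × ℝ => Φ z.1 z.2) ^ 2 := by gcongr
    _ = _ := one_mul _

/-- The trilinear form along the curve `b ↦ (α b, s b)` with weight `om`. -/
noncomputable def curveForm (α om : ℝ → ℝ) (s : ℝ) (h f g : ℝ → ℝ) : ℝ :=
  ∫ x, h x * ∫ b, f (x - α b) * g (x - s * b) * om b

section
variable {α B B' B'' κ κ' : ℝ → ℝ} {m M lo hi s p q : ℝ} {ψ β : ℝ → ℝ}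

/-- The kernel of the two-point correlation. -/
noncomputable def corrK (f α om : ℝ → ℝ) (s w x b : ℝ) : ℝ :=
  f (x - α b) * f (x + s * w - α (b + w)) * (om b * om (b + w))

theorem CrvPiece.bounded_α (hc : CrvPiece α B B' B'' κ κ' m M lo hi s p q ψ β) {b : ℝ}
    (hb : b ∈ Icc p q) : |α b| ≤ |α p| + |α q| :=
  abs_le_of_mem_Icc ⟨hc.α_mono hb.1, hc.α_mono hb.2⟩

theorem CrvPiece.nice_corrK (hc : CrvPiece α B B' B'' κ κ' m M lo hi s p q ψ β) {f : ℝ → ℝ}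
    (hf : Nice f) : Nice3 (corrK f α (pieceW κ B p q) s) := by
  have hα := hc.cont.measurable
  have hw := hc.measurable_pieceW
  have hwb := hc.pieceW_le
  obtain ⟨hfm, ⟨C, hC⟩, R, hR⟩ := hf
  have hC0 : 0 ≤ C := (abs_nonneg _).trans (hC 0)
  refine Nice3.mk (C := C * C * (M / m * (M / m)))
    (R := max (R + (|α p| + |α q|)) (2 * (|p| + |q|))) ?_ ?_ ?_
  · unfold corrK; fun_prop
  · intro a b c
    have := (abs_nonneg _).trans (hwb 0)
    simp only [corrK, abs_mul]
    gcongr <;> first | exact hC _ | exact hwb _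
  · intro w x b h
    simp only [corrK, ne_eq, mul_eq_zero, not_or] at h
    obtain ⟨⟨h1, -⟩, h2, h3⟩ := h
    have e1 := pieceW_ne_zero h2
    have i1 := abs_le_of_mem_Icc e1
    have i2 := abs_le_of_mem_Icc (pieceW_ne_zero h3)
    have i3 := hc.bounded_α e1
    have i4 : |x - α b| ≤ R := by
      by_contra hh; exact h1 (hR _ (by rw [Real.norm_eq_abs]; linarith))
    have i5 : |w| ≤ |b + w| + |b| := by
      have := abs_sub (b + w) b; simpa using this
    have i6 : |x| ≤ |x - α b| + |α b| := by
      have := abs_add_le (x - α b) (α b); simpa using this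
    have := abs_nonneg p
    have := abs_nonneg q
    exact ⟨le_max_of_le_right (by linarith), le_max_of_le_left (by linarith),
      le_max_of_le_right (by linarith)⟩

theorem CrvPiece.integral_corrK_sq (hc : CrvPiece α B B' B'' κ κ' m M lo hi s p q ψ β)
    {f : ℝ → ℝ} (hf : Nice f) :
    ∫ w, ∫ x, (∫ b, corrK f α (pieceW κ B p q) s w x b) ^ 2
      = quadI f α (pieceW κ B p q) s := by
  set F := corrK f α (pieceW κ B p q) s with hF
  have hN := (hc.nice_corrK hf).self_mul
  have e1 : ∀ w x, (∫ b, F w x b) ^ 2 = ∫ b, ∫ c, F w x b * F w x c := fun w x => by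
    simp only [integral_const_mul, integral_mul_const, pow_two]
  simp only [e1]
  have e2 : ∀ w, ∫ x, ∫ b, ∫ c, F w x b * F w x c = ∫ b, ∫ x, ∫ c, F w x b * F w x c :=
    fun w => (hN.slice w).swap
  simp only [e2]
  rw [hN.comm_mid.swap, quadI]
  congr 1; ext b1
  rw [← integral_sub_right_eq_self _ b1]
  congr 1; ext b4
  rw [← integral_add_right_eq_self _ (α b1)]
  congr 1; ext y
  rw [← integral_add_right_eq_self _ b1]
  congr 1; ext r
  simp only [corrK, quadT]
  rw [show y + α b1 + s * (b4 - b1) - α (b1 + (b4 - b1)) = y + (α b1 - s * b1) - (α b4 - s * b4) by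
      rw [add_sub_cancel]; ring, add_sub_cancel_right, add_sub_cancel,
    show r + b1 + (b4 - b1) = b4 + r by ring, add_comm r b1,
    show y + α b1 + s * (b4 - b1) - α (b4 + r) = y + (α b1 - s * b1) + s * b4 - α (b4 + r) by ring]
  ring

theorem CrvPiece.corr_support (hc : CrvPiece α B B' B'' κ κ' m M lo hi s p q ψ β)
    {f : ℝ → ℝ} {a : ℝ} (hs : ∀ x, f x ≠ 0 → x ∈ Icc a (a + 1)) {w x : ℝ}
    (h : ∫ b, corrK f α (pieceW κ B p q) s w x b ≠ 0) :
    w ∈ Icc (-(q - p)) (q - p) ∧ x ∈ Icc (a + α p) (a + 1 + α q) := by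
  have : ∃ b, corrK f α (pieceW κ B p q) s w x b ≠ 0 := by
    by_contra h1
    push Not at h1
    simp [h1] at h
  obtain ⟨b, hb⟩ := this
  simp only [corrK, ne_eq, mul_eq_zero, not_or] at hb
  obtain ⟨⟨h1, -⟩, h2, h3⟩ := hb
  have e1 := pieceW_ne_zero h2
  have e2 := pieceW_ne_zero h3
  have e3 := hs _ h1
  have e4 := hc.α_mono e1.1
  have e5 := hc.α_mono e1.2
  have := e1.1; have := e1.2; have := e2.1; have := e2.2; have := e3.1; have := e3.2
  exact ⟨⟨by linarith, by linarith⟩, ⟨by linarith, by linarith⟩⟩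

/-- The function dual to `g` in the trilinear form. -/
noncomputable def dualV (α om : ℝ → ℝ) (s : ℝ) (h f : ℝ → ℝ) (X b : ℝ) : ℝ :=
  h (X + s * b) * f (X + s * b - α b) * om b

theorem CrvPiece.nice_dualV (hc : CrvPiece α B B' B'' κ κ' m M lo hi s p q ψ β) {h f : ℝ → ℝ}
    (hh : Nice h) (hf : Nice f) : Nice2 (dualV α (pieceW κ B p q) s h f) := by
  have hα := hc.cont.measurable
  have hw := hc.measurable_pieceW
  have hwb := hc.pieceW_le
  obtain ⟨hfm, ⟨C, hC⟩, -⟩ := hf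
  obtain ⟨hhm, ⟨D, hD⟩, R, hR⟩ := hh
  have hC0 : 0 ≤ C := (abs_nonneg _).trans (hC 0)
  have hD0 : 0 ≤ D := (abs_nonneg _).trans (hD 0)
  refine Nice2.mk (C := D * C * (M / m))
    (R := max (R + |s| * (|p| + |q|)) (|p| + |q|)) ?_ ?_ ?_
  · unfold dualV; fun_prop
  · intro a b
    have := (abs_nonneg _).trans (hwb 0)
    simp only [dualV, abs_mul]
    gcongr <;> first | exact hC _ | exact hwb _ | exact hD _
  · intro X b h
    simp only [dualV, ne_eq, mul_eq_zero, not_or] at h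
    obtain ⟨⟨h1, -⟩, h2⟩ := h
    have i1 := abs_le_of_mem_Icc (pieceW_ne_zero h2)
    have i4 : |X + s * b| ≤ R := by
      by_contra hh; exact h1 (hR _ (by rw [Real.norm_eq_abs]; linarith))
    have i6 : |X| ≤ |X + s * b| + |s| * |b| := by
      have := abs_sub (X + s * b) (s * b); rw [abs_mul] at this; simpa using this
    have i7 : |s| * |b| ≤ |s| * (|p| + |q|) := by gcongr
    exact ⟨le_max_of_le_left (by linarith), le_max_of_le_right i1⟩

theorem CrvPiece.curveForm_eq (hc : CrvPiece α B B' B'' κ κ' m M lo hi s p q ψ β) {h f g : ℝ → ℝ}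
    (hh : Nice h) (hf : Nice f) (hg : Nice g) :
    curveForm α (pieceW κ B p q) s h f g
      = ∫ X, g X * ∫ b, dualV α (pieceW κ B p q) s h f X b := by
  have hV := hc.nice_dualV hh hf
  have hα := hc.cont.measurable
  have hw := hc.measurable_pieceW
  have hwb := hc.pieceW_le
  have n1 : Nice2 (fun x b => h x * (f (x - α b) * g (x - s * b) * pieceW κ B p q b)) := by
    obtain ⟨hfm, ⟨C, hC⟩, -⟩ := hf
    obtain ⟨hgm, ⟨D, hD⟩, -⟩ := hg
    obtain ⟨hhm, ⟨E, hE⟩, R, hR⟩ := hh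
    have hC0 : 0 ≤ C := (abs_nonneg _).trans (hC 0)
    have hD0 : 0 ≤ D := (abs_nonneg _).trans (hD 0)
    have hE0 : 0 ≤ E := (abs_nonneg _).trans (hE 0)
    refine Nice2.mk (C := E * (C * D * (M / m))) (R := max R (|p| + |q|)) (by fun_prop) ?_ ?_
    · intro a b
      have := (abs_nonneg _).trans (hwb 0)
      simp only [abs_mul]
      gcongr <;> first | exact hC _ | exact hwb _ | exact hD _ | exact hE _
    · intro x b h
      simp only [ne_eq, mul_eq_zero, not_or] at h
      obtain ⟨h1, ⟨-, -⟩, h2⟩ := h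
      refine ⟨le_max_of_le_left ?_, le_max_of_le_right (abs_le_of_mem_Icc (pieceW_ne_zero h2))⟩
      by_contra hh; exact h1 (hR _ (by rw [Real.norm_eq_abs]; linarith))
  have n2 : Nice2 (fun X b => g X * dualV α (pieceW κ B p q) s h f X b) :=
    Nice.bdd_mul hV (hg.1.comp measurable_fst) (by
      obtain ⟨-, ⟨D, hD⟩, -⟩ := hg
      exact ⟨D, fun x => hD _⟩)
  unfold curveForm
  simp only [← integral_const_mul]
  rw [n1.swap, n2.swap]
  congr 1; ext b
  rw [← integral_add_right_eq_self _ (s * b)]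
  congr 1; ext X
  simp only [dualV, add_sub_cancel_right]
  ring

theorem CrvPiece.l2_dualV_sq (hc : CrvPiece α B B' B'' κ κ' m M lo hi s p q ψ β) {h f : ℝ → ℝ}
    (hh : Nice h) (hf : Nice f) :
    l2 (fun X => ∫ b, dualV α (pieceW κ B p q) s h f X b) ^ 2
      = ∫ w, ∫ x, h x * h (x + s * w) * ∫ b, corrK f α (pieceW κ B p q) s w x b := by
  set U := dualV α (pieceW κ B p q) s h f with hU
  have hV := (hc.nice_dualV hh hf).self_mul
  have e1 : ∀ X, (∫ b, U X b) ^ 2 = ∫ b, ∫ c, U X b * U X c := fun X => by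
    simp only [integral_const_mul, integral_mul_const, pow_two]
  rw [l2_sq]
  simp only [e1]
  rw [hV.rotate]
  have n1 : Nice3 (fun w x b => h x * h (x + s * w) * corrK f α (pieceW κ B p q) s w x b) := by
    obtain ⟨hhm, ⟨E, hE⟩, -⟩ := hh
    have hE0 : 0 ≤ E := (abs_nonneg _).trans (hE 0)
    refine Nice.bdd_mul (hc.nice_corrK hf)
      (g := fun p : ℝ × ℝ × ℝ => h p.2.1 * h (p.2.1 + s * p.1)) (by fun_prop) ⟨E * E, fun x => ?_⟩
    rw [abs_mul]
    gcongr <;> exact hE _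
  simp only [← integral_const_mul]
  rw [n1.rotate, Nice2.swap (T := fun x b => ∫ w, h x * h (x + s * w) *
    corrK f α (pieceW κ B p q) s w x b)]
  · congr 1; ext b
    rw [← integral_add_right_eq_self _ b]
    rw [show (∫ x, ∫ w, h x * h (x + s * w) * corrK f α (pieceW κ B p q) s w x b)
      = ∫ w, ∫ x, h x * h (x + s * w) * corrK f α (pieceW κ B p q) s w x b from ?_]
    · congr 1; ext w
      rw [← integral_add_right_eq_self
        (fun x => h x * h (x + s * w) * corrK f α (pieceW κ B p q) s w x b) (s * b)]
      congr 1; ext X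
      simp only [dualV, corrK]
      rw [show X + s * (w + b) = X + s * b + s * w by ring, add_comm w b]
      ring
    · refine Nice2.swap (T := fun x w => h x * h (x + s * w) *
        corrK f α (pieceW κ B p q) s w x b) ?_
      exact Nice.comp_of_norm_le (f := fun z : ℝ × ℝ × ℝ => h z.2.1 * h (z.2.1 + s * z.1) *
        corrK f α (pieceW κ B p q) s z.1 z.2.1 z.2.2) n1 (L := fun z : ℝ × ℝ => (z.2, z.1, b))
        (by fun_prop) fun z => by
          simp only [Prod.norm_def]
          exact max_le ((le_max_left _ _).trans (le_max_right _ _)) (le_max_left _ _)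
  · refine Nice3.int (T := fun x b w => h x * h (x + s * w) *
        corrK f α (pieceW κ B p q) s w x b) ?_
    exact Nice.comp_of_norm_le (f := fun z : ℝ × ℝ × ℝ => h z.2.1 * h (z.2.1 + s * z.1) *
        corrK f α (pieceW κ B p q) s z.1 z.2.1 z.2.2) n1
        (L := fun z : ℝ × ℝ × ℝ => (z.2.2, z.1, z.2.1))
        (by fun_prop) fun z => by simp only [Prod.norm_def]; exact le_of_eq (by ac_rfl)

theorem CrvPiece.curveForm_pow_le (hc : CrvPiece α B B' B'' κ κ' m M lo hi s p q ψ β) (hpq : p ≤ q)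
    {h f g : ℝ → ℝ} (hh : Nice h) (hh1 : ∀ x, |h x| ≤ 1) (hf : Nice f) {a : ℝ}
    (hs : ∀ x, f x ≠ 0 → x ∈ Icc a (a + 1)) (hg : Nice g) :
    curveForm α (pieceW κ B p q) s h f g ^ 4 ≤ l2 g ^ 4 * quadI f α (pieceW κ B p q) s := by
  have hm := hc.m_pos
  have hm1 := hc.m_le
  have hM1 := hc.le_M
  have hhm := hh.1
  set V := fun X => ∫ b, dualV α (pieceW κ B p q) s h f X b with hV
  have h1 : |curveForm α (pieceW κ B p q) s h f g| ≤ l2 g * l2 V := by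
    rw [hc.curveForm_eq hh hf hg]
    exact abs_integral_mul_le hg (hc.nice_dualV hh hf).int
  have hqp : q - p ≤ 1 / 6 := by
    refine hc.short.trans ?_
    rw [div_le_div_iff₀ (by positivity) (by norm_num)]; nlinarith
  have hα : α q - α p ≤ 1 := by
    have i1 := hc.α_lip (hc.mem (right_mem_Icc.2 hpq)) (hc.mem (left_mem_Icc.2 hpq))
    rw [abs_of_nonneg (sub_nonneg.2 hpq)] at i1
    refine (le_abs_self _).trans (i1.trans ?_)
    calc m⁻¹ * (q - p) ≤ m⁻¹ * (m / (6 * M)) := by gcongr; exact hc.short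
      _ = 1 / (6 * M) := by field_simp
      _ ≤ 1 := by rw [div_le_one (by positivity)]; linarith
  have hα0 := hc.α_mono hpq
  have h2 : (l2 V ^ 2) ^ 2 ≤ quadI f α (pieceW κ B p q) s := by
    rw [hc.l2_dualV_sq hh hf, ← hc.integral_corrK_sq hf]
    refine integral_sq_le_of_box (H := fun w x => h x * h (x + s * w)) (hc.nice_corrK hf).int
      (by fun_prop) (fun w x => ?_) (a := -(q - p)) (b := q - p) (c := a + α p) (d := a + 1 + α q)
      (by linarith) (by linarith) (by nlinarith) (fun w x hwx => hc.corr_support hs hwx)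
    rw [abs_mul]
    exact mul_le_one₀ (hh1 _) (abs_nonneg _) (hh1 _)
  calc curveForm α (pieceW κ B p q) s h f g ^ 4
      = |curveForm α (pieceW κ B p q) s h f g| ^ 4 := by rw [← abs_pow, abs_of_nonneg (by positivity)]
    _ ≤ (l2 g * l2 V) ^ 4 := by gcongr
    _ = l2 g ^ 4 * (l2 V ^ 2) ^ 2 := by ring
    _ ≤ _ := by gcongr

end

theorem sum_l2_window_sq_le (K : Finset ℤ) (c : ℝ) (w : ℕ) {g : ℝ → ℝ} (hg : Nice g) :
    ∑ k ∈ K, l2 ((Ico (c + k) (c + k + w)).indicator g) ^ 2 ≤ w * l2 g ^ 2 := by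
  simp only [l2_sq]
  have hn : ∀ k ∈ K, Integrable (fun x => (Ico (c + k) (c + k + w)).indicator g x ^ 2) volume :=
    fun k _ => (hg.indicator measurableSet_Ico).sq.integrable _
  rw [← integral_finsetSum K hn, ← integral_const_mul]
  refine integral_mono (integrable_finsetSum K hn) ((hg.sq.const_mul _).integrable _) fun x => ?_
  have h1 : ∀ k ∈ K, (Ico (c + k) (c + k + w)).indicator g x ^ 2
      ≤ if k ∈ Finset.Ioc (⌊x - c⌋ - w) ⌊x - c⌋ then g x ^ 2 else 0 := fun k _ => by
    by_cases h : x ∈ Ico (c + k : ℝ) (c + k + w)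
    · rw [indicator_of_mem h, if_pos]
      rw [Finset.mem_Ioc]
      constructor
      · have : ⌊x - c⌋ < k + w := by
          rw [Int.floor_lt]; push_cast; linarith [h.2]
        linarith
      · rw [Int.le_floor]; linarith [h.1]
    · rw [indicator_of_notMem h, zero_pow two_ne_zero]
      split_ifs
      · exact sq_nonneg _
      · exact le_rfl
  refine (Finset.sum_le_sum h1).trans ?_
  rw [Finset.sum_ite_mem, Finset.sum_const, nsmul_eq_mul]
  refine mul_le_mul_of_nonneg_right ?_ (sq_nonneg _)
  have : (K ∩ Finset.Ioc (⌊x - c⌋ - w) ⌊x - c⌋).card ≤ w := by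
    refine (Finset.card_le_card Finset.inter_subset_right).trans ?_
    simp
  exact_mod_cast this

/-- A primitive of `f` vanishing at the integers and of size `ζ ^ 20` relative to `f`. -/
structure OscPrim (f P : ℝ → ℝ) (Z : Set ℝ) (ζ : ℝ) : Prop where
  nice : Nice f
  cont : Continuous P
  countable : Z.Countable
  deriv : ∀ y, y ∉ Z → HasDerivAt P (f y) y
  zero : ∀ k : ℤ, P k = 0
  bound : ∀ (k : ℤ), ∀ y ∈ Icc (k : ℝ) (k + 1), |P y| ≤ ζ ^ 20 * l2 ((Ico (k : ℝ) (k + 1)).indicator f)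

section
variable {α B B' B'' κ κ' : ℝ → ℝ} {m M lo hi s p q : ℝ} {ψ β : ℝ → ℝ}

/-- The constant in the estimate on one piece. -/
noncomputable def pieceC (m M : ℝ) : ℝ := 1000 * M ^ 6 / m ^ 7 + 8 * (M / m) ^ 4 * M ^ 2

theorem CrvPiece.one_le_pieceC (hc : CrvPiece α B B' B'' κ κ' m M lo hi s p q ψ β) :
    1 ≤ pieceC m M := by
  have hm := hc.m_pos
  have hm1 := hc.m_le
  have hM1 := hc.le_M
  have h1 : 1 ≤ M ^ 6 := one_le_pow₀ hM1
  have h2 : m ^ 7 ≤ 1 := pow_le_one₀ hm.le hm1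
  have h3 : (1 : ℝ) ≤ 1000 * M ^ 6 / m ^ 7 := by
    rw [le_div_iff₀ (by positivity)]; linarith
  have h4 : 0 ≤ 8 * (M / m) ^ 4 * M ^ 2 := by positivity
  unfold pieceC; linarith

theorem CrvPiece.local_le (hc : CrvPiece α B B' B'' κ κ' m M lo hi s p q ψ β) (hpq : p ≤ q)
    {h f g P : ℝ → ℝ} (hh : Nice h) (hh1 : ∀ x, |h x| ≤ 1) (hf : Nice f) {a : ℝ}
    (hs : ∀ x, f x ≠ 0 → x ∈ Icc a (a + 1)) (hg : Nice g)
    (hP : Continuous P) {Z : Set ℝ} (hZ : Z.Countable)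
    (hd : ∀ y, y ∉ Z → HasDerivAt P (f y) y) {ζ : ℝ} (hζ : 0 < ζ) (hζ1 : ζ ≤ 1)
    (hB : ∀ y, |P y| ≤ ζ ^ 20 * l2 f) :
    |curveForm α (pieceW κ B p q) s h f g| ≤ pieceC m M * ζ * (l2 f * l2 g) := by
  have hm := hc.m_pos
  have hM := hc.M_pos
  have hC := hc.one_le_pieceC
  have hl := l2_nonneg f
  have hl' := l2_nonneg g
  have h1 := hc.curveForm_pow_le hpq hh hh1 hf hs hg
  have h2 := (le_abs_self _).trans
    (hc.quadI_le hpq hf hs hP hZ hd hB (η := ζ ^ 4) (by positivity) (pow_le_one₀ hζ.le hζ1))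
  have h3 : ζ ^ 20 * l2 f * (1000 * M ^ 6 / m ^ 7 / (ζ ^ 4) ^ 4) * l2 f ^ 3
      + 8 * (M / m) ^ 4 * M ^ 2 * l2 f ^ 4 * ζ ^ 4 = pieceC m M * (ζ * l2 f) ^ 4 := by
    unfold pieceC; field_simp
  rw [h3] at h2
  refine le_of_pow_le_pow_left₀ (n := 4) (by norm_num) (by positivity) ?_
  calc |curveForm α (pieceW κ B p q) s h f g| ^ 4 = curveForm α (pieceW κ B p q) s h f g ^ 4 := by
        rw [← abs_pow, abs_of_nonneg (by positivity)]
    _ ≤ l2 g ^ 4 * (pieceC m M * (ζ * l2 f) ^ 4) := h1.trans (by gcongr)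
    _ = pieceC m M * (ζ * (l2 f * l2 g)) ^ 4 := by ring
    _ ≤ pieceC m M ^ 4 * (ζ * (l2 f * l2 g)) ^ 4 := by
        gcongr
        exact le_self_pow₀ hC (by norm_num)
    _ = _ := by ring

theorem OscPrim.local_continuous {f P : ℝ → ℝ} {Z : Set ℝ} {ζ : ℝ} (ho : OscPrim f P Z ζ) (k : ℤ) :
    Continuous ((Icc (k : ℝ) (k + 1)).indicator P) := by
  refine continuous_indicator (fun a ha => ?_) ho.cont.continuousOn
  rw [frontier_Icc (by linarith)] at ha
  rcases ha with rfl | ha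
  · exact ho.zero k
  · rw [mem_singleton_iff.1 ha]; exact_mod_cast ho.zero (k + 1)

theorem OscPrim.local_deriv {f P : ℝ → ℝ} {Z : Set ℝ} {ζ : ℝ} (ho : OscPrim f P Z ζ) (k : ℤ) (y : ℝ)
    (hy : y ∉ Z ∪ {(k : ℝ), (k : ℝ) + 1}) :
    HasDerivAt ((Icc (k : ℝ) (k + 1)).indicator P) ((Ico (k : ℝ) (k + 1)).indicator f y) y := by
  simp only [mem_union, mem_insert_iff, mem_singleton_iff, not_or] at hy
  obtain ⟨h1, h2, h3⟩ := hy
  have hD := ho.deriv y h1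
  by_cases h : y ∈ Icc (k : ℝ) (k + 1)
  · have h4 : y ∈ Ioo (k : ℝ) (k + 1) := ⟨lt_of_le_of_ne h.1 (Ne.symm h2), lt_of_le_of_ne h.2 h3⟩
    rw [indicator_of_mem (show y ∈ Ico (k : ℝ) (k + 1) from ⟨h.1, h4.2⟩)]
    refine hD.congr_of_eventuallyEq ?_
    filter_upwards [Ioo_mem_nhds h4.1 h4.2] with z hz
    exact indicator_of_mem (show z ∈ Icc (k : ℝ) (k + 1) from ⟨hz.1.le, hz.2.le⟩) _
  · rw [indicator_of_notMem (fun hh => h ⟨hh.1, hh.2.le⟩)]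
    refine (hasDerivAt_const y (0 : ℝ)).congr_of_eventuallyEq ?_
    filter_upwards [isClosed_Icc.isOpen_compl.mem_nhds h] with z hz
    exact indicator_of_notMem hz _

theorem Nice.sum_window {f : ℝ → ℝ} (hf : Nice f) :
    ∃ K : Finset ℤ, ∀ x, f x = ∑ k ∈ K, (Ico (k : ℝ) (k + 1)).indicator f x := by
  obtain ⟨-, -, R, hR⟩ := hf
  refine ⟨Finset.Icc ⌊-R⌋ ⌊R⌋, fun x => ?_⟩
  have h1 : ∀ k : ℤ, (Ico (k : ℝ) (k + 1)).indicator f x = if ⌊x⌋ = k then f x else 0 := fun k => by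
    by_cases h : x ∈ Ico (k : ℝ) (k + 1)
    · rw [indicator_of_mem h, if_pos (Int.floor_eq_iff.2 h)]
    · rw [indicator_of_notMem h, if_neg (fun hh => h (Int.floor_eq_iff.1 hh))]
  simp only [h1, Finset.sum_ite_eq]
  split_ifs with h
  · rfl
  · by_contra h2
    apply h
    have : |x| ≤ R := by by_contra h3; exact h2 (hR x (not_le.1 h3))
    rw [abs_le] at this
    exact Finset.mem_Icc.2 ⟨Int.floor_mono this.1, Int.floor_mono this.2⟩

theorem CrvPiece.curveForm_sum (hc : CrvPiece α B B' B'' κ κ' m M lo hi s p q ψ β) {h g : ℝ → ℝ}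
    (hh : Nice h) (hg : Nice g) (K : Finset ℤ) {f : ℤ → ℝ → ℝ} (hf : ∀ k ∈ K, Nice (f k)) :
    curveForm α (pieceW κ B p q) s h (fun x => ∑ k ∈ K, f k x) g
      = ∑ k ∈ K, curveForm α (pieceW κ B p q) s h (f k) g := by
  rw [hc.curveForm_eq hh (Nice.sum K hf) hg,
    Finset.sum_congr rfl fun k hk => hc.curveForm_eq hh (hf k hk) hg, ← integral_finsetSum]
  · congr 1; ext X
    rw [← Finset.mul_sum, ← integral_finsetSum]
    · congr 2; ext b
      simp only [dualV, Finset.mul_sum, Finset.sum_mul]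
    · exact fun k hk => ((hc.nice_dualV hh (hf k hk)).slice X).integrable _
  · exact fun k hk => (hg.mul (hc.nice_dualV hh (hf k hk)).int).integrable _

theorem CrvPiece.global_le (hc : CrvPiece α B B' B'' κ κ' m M lo hi s p q ψ β) (hpq : p ≤ q)
    {h f g P : ℝ → ℝ} (hh : Nice h) (hh1 : ∀ x, |h x| ≤ 1) {Z : Set ℝ} {ζ : ℝ}
    (ho : OscPrim f P Z ζ) (hg : Nice g) (hζ : 0 < ζ) (hζ1 : ζ ≤ 1) :
    |curveForm α (pieceW κ B p q) s h f g| ≤ 2 * pieceC m M * ζ * (l2 f * l2 g) := by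
  have hm := hc.m_pos
  have hm1 := hc.m_le
  have hM1 := hc.le_M
  have hf := ho.nice
  have hC := hc.one_le_pieceC
  obtain ⟨K, hK⟩ := hf.sum_window
  set fk : ℤ → ℝ → ℝ := fun k => (Ico (k : ℝ) (k + 1)).indicator f with hfk
  have hfn : ∀ k, Nice (fk k) := fun k => hf.indicator measurableSet_Ico
  set c := α p - s * p with hcd
  set gk : ℤ → ℝ → ℝ := fun k => (Ico (c + k) (c + k + (4 : ℕ))).indicator g with hgk
  have hgn : ∀ k, Nice (gk k) := fun k => hg.indicator measurableSet_Ico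
  have e1 : curveForm α (pieceW κ B p q) s h f g
      = ∑ k ∈ K, curveForm α (pieceW κ B p q) s h (fk k) g := by
    rw [← hc.curveForm_sum hh hg K fun k _ => hfn k]
    congr 1; ext x; exact hK x
  have hα : α q - α p ≤ 1 := by
    have i1 := hc.α_lip (hc.mem (right_mem_Icc.2 hpq)) (hc.mem (left_mem_Icc.2 hpq))
    rw [abs_of_nonneg (sub_nonneg.2 hpq)] at i1
    refine (le_abs_self _).trans (i1.trans ?_)
    calc m⁻¹ * (q - p) ≤ m⁻¹ * (m / (6 * M)) := by gcongr; exact hc.short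
      _ = 1 / (6 * M) := by field_simp
      _ ≤ 1 := by rw [div_le_one (by positivity)]; linarith
  have hqp : q - p ≤ 1 := by
    refine hc.short.trans ?_
    rw [div_le_one (by positivity)]; nlinarith
  have hs1 : |s| ≤ 1 := by nlinarith [hc.abs_s_mul, abs_nonneg s]
  have e2 : ∀ k, curveForm α (pieceW κ B p q) s h (fk k) g
      = curveForm α (pieceW κ B p q) s h (fk k) (gk k) := fun k => by
    unfold curveForm
    congr 1; ext x; congr 2; ext b
    by_cases hb : b ∈ Icc p q
    swap
    · simp [pieceW, hb]
    by_cases hx : x - α b ∈ Ico (k : ℝ) (k + 1)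
    swap
    · simp only [hfk, indicator_of_notMem hx, zero_mul]
    have i1 := hc.φ_strictMono.monotone hb.1
    have i2 := hc.φ_strictMono.monotone hb.2
    have i4 : (α q - s * q) - (α p - s * p) ≤ 2 := by
      have : |s * (q - p)| ≤ 1 * 1 := by
        rw [abs_mul, abs_of_nonneg (sub_nonneg.2 hpq)]
        exact mul_le_mul hs1 hqp (sub_nonneg.2 hpq) zero_le_one
      have := neg_abs_le (s * (q - p))
      nlinarith
    have i3 : x - s * b ∈ Ico (c + k) (c + k + (4 : ℕ)) := by
      push_cast
      have := hx.1; have := hx.2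
      constructor <;> linarith
    simp only [hgk, indicator_of_mem i3]
  have hloc : ∀ k, |curveForm α (pieceW κ B p q) s h (fk k) (gk k)|
      ≤ pieceC m M * ζ * (l2 (fk k) * l2 (gk k)) := fun k => by
    refine hc.local_le hpq hh hh1 (hfn k) (a := k) (fun x hx => ?_) (hgn k)
      (ho.local_continuous k) (Z := Z ∪ {(k : ℝ), (k : ℝ) + 1})
      (ho.countable.union ((Set.toFinite _).countable)) (ho.local_deriv k) hζ hζ1 fun y => ?_
    · have : x ∈ Ico (k : ℝ) (k + 1) := by
        by_contra h1; exact hx (indicator_of_notMem h1 _)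
      exact ⟨this.1, this.2.le⟩
    · by_cases hy : y ∈ Icc (k : ℝ) (k + 1)
      · rw [indicator_of_mem hy]; exact ho.bound k y hy
      · rw [indicator_of_notMem hy, abs_zero]
        have := l2_nonneg (fk k)
        positivity
  have cs : ∑ k ∈ K, l2 (fk k) * l2 (gk k) ≤ l2 f * (2 * l2 g) := by
    refine le_trans (Real.sum_mul_le_sqrt_mul_sqrt K _ _) ?_
    have s1 := sum_l2_window_sq_le K 0 1 hf
    have s2 := sum_l2_window_sq_le K c 4 hg
    simp only [zero_add, Nat.cast_one, one_mul] at s1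
    refine mul_le_mul (Real.sqrt_le_iff.2 ⟨l2_nonneg f, s1⟩) (Real.sqrt_le_iff.2 ⟨?_, ?_⟩)
      (Real.sqrt_nonneg _) (l2_nonneg f)
    · have := l2_nonneg g; positivity
    · refine s2.trans (le_of_eq ?_)
      push_cast; ring
  rw [e1]
  refine (Finset.abs_sum_le_sum_abs _ _).trans ?_
  calc _ ≤ ∑ k ∈ K, pieceC m M * ζ * (l2 (fk k) * l2 (gk k)) :=
        Finset.sum_le_sum fun k _ => by rw [e2]; exact hloc k
    _ = pieceC m M * ζ * ∑ k ∈ K, l2 (fk k) * l2 (gk k) := by rw [Finset.mul_sum]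
    _ ≤ pieceC m M * ζ * (l2 f * (2 * l2 g)) := by gcongr
    _ = _ := by ring

end

theorem exists_rpow_bound (r c l : ℝ) (hl : 0 < l) : ∃ K, ∀ b ∈ Ioo l 2, |c * b ^ r| ≤ K := by
  have hc : ContinuousOn (fun b : ℝ => c * b ^ r) (Icc l 2) :=
    continuousOn_const.mul (continuousOn_id.rpow_const fun x hx => Or.inl (hl.trans_le hx.1).ne')
  obtain ⟨K, hK⟩ := isCompact_Icc.exists_bound_of_continuousOn hc
  exact ⟨K, fun b hb => hK b ⟨hb.1.le, hb.2.le⟩⟩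

theorem exists_rpow_lower (r c l : ℝ) (hl : 0 < l) (hc : 0 < c) :
    ∃ k, 0 < k ∧ ∀ b ∈ Ioo l 2, k ≤ c * b ^ r := by
  obtain ⟨K, hK⟩ := exists_rpow_bound (-r) c⁻¹ l hl
  refine ⟨(max K 1)⁻¹, by positivity, fun b hb => ?_⟩
  have hb0 : 0 < b := hl.trans hb.1
  have h1 := (le_abs_self _).trans (hK b hb)
  rw [Real.rpow_neg hb0.le, ← mul_inv] at h1
  have h2 : 0 < c * b ^ r := by positivity
  exact inv_le_of_inv_le₀ h2 (h1.trans (le_max_left _ _))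

/-- The truncation of `b` to `[l, 2]`. -/
noncomputable def clampTo (l b : ℝ) : ℝ := max l (min b 2)

theorem clampTo_eq {l b : ℝ} (h : b ∈ Icc l 2) : clampTo l b = b := by
  unfold clampTo; rw [min_eq_left h.2, max_eq_right h.1]

theorem clampTo_mem {l : ℝ} (hl : l ≤ 2) (b : ℝ) : clampTo l b ∈ Icc l 2 :=
  ⟨le_max_left _ _, max_le hl (min_le_right _ _)⟩

theorem clampTo_mono (l : ℝ) : Monotone (clampTo l) := fun _ _ h =>
  max_le_max le_rfl (min_le_min h le_rfl)

theorem clampTo_sub_le {l x y : ℝ} (h : x ≤ y) : clampTo l y - clampTo l x ≤ y - x := by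
  unfold clampTo
  rcases max_cases l (min y 2) with h1 | h1 <;> rcases max_cases l (min x 2) with h2 | h2 <;>
  rcases min_cases y 2 with h3 | h3 <;> rcases min_cases x 2 with h4 | h4 <;> linarith

theorem rpow_inv_expand {d : ℕ} (hd : 2 ≤ d) {x y : ℝ} (hx : 0 < x) (hxy : x ≤ y) (hy : y ≤ 2) :
    ((d : ℝ) * 2 ^ d)⁻¹ * (y - x) ≤ y ^ (d : ℝ)⁻¹ - x ^ (d : ℝ)⁻¹ := by
  have hd0 : (0 : ℝ) < d := by positivity
  have hdn : d ≠ 0 := by omega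
  set u := x ^ (d : ℝ)⁻¹ with hu
  set v := y ^ (d : ℝ)⁻¹ with hv
  have hu0 : 0 ≤ u := by positivity
  have huv : u ≤ v := Real.rpow_le_rpow hx.le hxy (by positivity)
  have hv2 : v ≤ 2 := by
    calc v ≤ 2 ^ (d : ℝ)⁻¹ := Real.rpow_le_rpow (hx.le.trans hxy) hy (by positivity)
      _ ≤ 2 ^ (1 : ℝ) := Real.rpow_le_rpow_of_exponent_le (by norm_num)
          (inv_le_one_of_one_le₀ (by exact_mod_cast (by omega : 1 ≤ d)))
      _ = 2 := Real.rpow_one _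
  have e1 : u ^ d = x := Real.rpow_inv_natCast_pow hx.le hdn
  have e2 : v ^ d = y := Real.rpow_inv_natCast_pow (hx.le.trans hxy) hdn
  have h1 := abs_pow_sub_pow_le v u d
  rw [e1, e2, abs_of_nonneg (sub_nonneg.2 hxy), abs_of_nonneg (sub_nonneg.2 huv),
    abs_of_nonneg hu0, abs_of_nonneg (hu0.trans huv), max_eq_left huv] at h1
  rw [inv_mul_le_iff₀ (by positivity)]
  refine h1.trans ?_
  have h2 : v ^ (d - 1) ≤ 2 ^ d :=
    (pow_le_pow_left₀ (hu0.trans huv) hv2 _).trans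
      (pow_le_pow_right₀ (by norm_num) (by omega))
  have h3 : 0 ≤ (v - u) * d := mul_nonneg (sub_nonneg.2 huv) hd0.le
  calc (v - u) * d * v ^ (d - 1) ≤ (v - u) * d * 2 ^ d := mul_le_mul_of_nonneg_left h2 h3
    _ = _ := by ring

theorem exists_crv {d : ℕ} (hd : 2 ≤ d) : ∃ (α B B' B'' κ κ' : ℝ → ℝ) (m M : ℝ),
    Crv α B B' B'' κ κ' m M (1 / 2 ^ d / 2) 2 ∧
    (∀ b ∈ Icc (1 / 2 ^ d : ℝ) 1, α b = b ^ (d : ℝ)⁻¹) ∧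
    ∀ b ∈ Icc (1 / 2 ^ d : ℝ) 1, κ b / B b = 1 / (d * b) := by
  set l : ℝ := 1 / 2 ^ d / 2 with hl
  have hl0 : 0 < l := by positivity
  have h2d : (1 : ℝ) ≤ 2 ^ d := one_le_pow₀ (by norm_num)
  have hl1 : (1 / 2 ^ d : ℝ) ≤ 1 := by rw [div_le_one (by positivity)]; exact h2d
  have hl2 : l ≤ 2 := by rw [hl]; linarith
  have hd0 : (0 : ℝ) < d := by positivity
  have hd2 : (2 : ℝ) ≤ d := by exact_mod_cast hd
  set e : ℝ := (d : ℝ)⁻¹ with he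
  have he0 : 0 < e := by positivity
  have he1 : e < 1 := by
    rw [he]; exact inv_lt_one_of_one_lt₀ (by linarith)
  have hde : (d : ℝ) * e = 1 := mul_inv_cancel₀ hd0.ne'
  obtain ⟨K1, hK1⟩ := exists_rpow_bound (1 - e) d l hl0
  obtain ⟨K2, hK2⟩ := exists_rpow_bound (1 - e - 1) (d * (1 - e)) l hl0
  obtain ⟨K3, hK3⟩ := exists_rpow_bound (-e) 1 l hl0
  obtain ⟨K4, hK4⟩ := exists_rpow_bound (-e - 1) (-e) l hl0
  obtain ⟨k1, hk1, hk1'⟩ := exists_rpow_lower (1 - e) d l hl0 hd0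
  obtain ⟨k2, hk2, hk2'⟩ := exists_rpow_lower (1 - e - 1 - 1) (d * (1 - e) * e) l hl0
    (mul_pos (mul_pos hd0 (by linarith)) he0)
  set M := max ((d : ℝ) * 2 ^ d) (max (max K1 K2) (max K3 K4)) with hM
  set m := min 1 (min k1 k2) with hm
  have M1 : (d : ℝ) * 2 ^ d ≤ M := le_max_left _ _
  have M2 : max K1 K2 ≤ M := (le_max_left _ _).trans (le_max_right _ _)
  have M3 : max K3 K4 ≤ M := (le_max_right _ _).trans (le_max_right _ _)
  have hM1 : 1 ≤ M := le_trans (by nlinarith) M1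
  have m1 : m ≤ k1 := (min_le_right _ _).trans (min_le_left _ _)
  have m2 : m ≤ k2 := (min_le_right _ _).trans (min_le_right _ _)
  refine ⟨fun b => clampTo l b ^ e + (b - clampTo l b), fun b => d * b ^ (1 - e),
    fun b => d * (1 - e) * b ^ (1 - e - 1), fun b => d * (1 - e) * ((1 - e - 1) * b ^ (1 - e - 1 - 1)),
    fun b => b ^ (-e), fun b => -e * b ^ (-e - 1), m, M, ?_, ?_, ?_⟩
  · constructor
    · exact lt_min one_pos (lt_min hk1 hk2)
    · exact min_le_left _ _
    · exact hM1
    · have : Continuous (clampTo l) := by unfold clampTo; fun_prop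
      exact (this.rpow_const fun _ => Or.inr he0.le).add (continuous_id.sub this)
    · intro x y hxy
      have c1 := clampTo_mem hl2 x
      have c2 := clampTo_mem hl2 y
      have c3 := rpow_inv_expand hd (hl0.trans_le c1.1) (clampTo_mono l hxy) c2.2
      have c4 := clampTo_sub_le (l := l) hxy
      have c5 := clampTo_mono l hxy
      have c6 : M⁻¹ ≤ ((d : ℝ) * 2 ^ d)⁻¹ := inv_anti₀ (by positivity) M1
      have c7 : M⁻¹ ≤ 1 := inv_le_one_of_one_le₀ hM1
      have c8 : M⁻¹ * (clampTo l y - clampTo l x)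
          ≤ ((d : ℝ) * 2 ^ d)⁻¹ * (clampTo l y - clampTo l x) :=
        mul_le_mul_of_nonneg_right c6 (sub_nonneg.2 c5)
      have c9 : M⁻¹ * ((y - x) - (clampTo l y - clampTo l x))
          ≤ 1 * ((y - x) - (clampTo l y - clampTo l x)) :=
        mul_le_mul_of_nonneg_right c7 (by linarith)
      linarith
    · fun_prop
    · fun_prop
    · intro b hb
      have hb0 : 0 < b := hl0.trans hb.1
      have h1 : HasDerivAt (fun b : ℝ => b ^ e) (e * b ^ (e - 1)) b :=
        Real.hasDerivAt_rpow_const (Or.inl hb0.ne')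
      have h2 : e * b ^ (e - 1) = ((d : ℝ) * b ^ (1 - e))⁻¹ := by
        rw [mul_inv, ← Real.rpow_neg hb0.le, neg_sub]
      rw [← h2]
      refine h1.congr_of_eventuallyEq ?_
      filter_upwards [Ioo_mem_nhds hb.1 hb.2] with z hz
      rw [clampTo_eq ⟨hz.1.le, hz.2.le⟩, sub_self, add_zero]
    · intro b hb
      have hb0 : 0 < b := hl0.trans hb.1
      exact ((Real.hasDerivAt_rpow_const (p := 1 - e) (Or.inl hb0.ne')).const_mul (d : ℝ)).congr_deriv
        (by ring)
    · intro b hb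
      have hb0 : 0 < b := hl0.trans hb.1
      exact (Real.hasDerivAt_rpow_const (p := 1 - e - 1) (Or.inl hb0.ne')).const_mul _
    · intro b hb
      have hb0 : 0 < b := hl0.trans hb.1
      exact Real.hasDerivAt_rpow_const (p := -e) (Or.inl hb0.ne')
    · exact fun b hb => m1.trans (hk1' b hb)
    · exact fun b hb => (le_abs_self _).trans ((hK1 b hb).trans ((le_max_left _ _).trans M2))
    · exact fun b hb => (hK2 b hb).trans ((le_max_right _ _).trans M2)
    · intro b hb
      have := m2.trans (hk2' b hb)
      linarith
    · intro b hb
      have := hK3 b hb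
      rw [one_mul] at this
      exact this.trans ((le_max_left _ _).trans M3)
    · exact fun b hb => (hK4 b hb).trans ((le_max_right _ _).trans M3)
  · intro b hb
    have : b ∈ Icc l 2 := ⟨le_trans (by rw [hl]; linarith [show (0:ℝ) < 1 / 2 ^ d by positivity]) hb.1,
      hb.2.trans (by norm_num)⟩
    simp only [clampTo_eq this, sub_self, add_zero]
  · intro b hb
    have hb0 : 0 < b := lt_of_lt_of_le (by positivity) hb.1
    have h1 : b ^ (1 - e) = b * b ^ (-e) := by
      rw [sub_eq_add_neg, Real.rpow_add hb0, Real.rpow_one]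
    have h2 : 0 < b ^ (-e) := Real.rpow_pos_of_pos hb0 _
    simp only [h1]
    field_simp

theorem curveForm_nice2 {α om h f g : ℝ → ℝ} {s : ℝ} (hα : Measurable α) (hh : Nice h) (hf : Nice f)
    (hg : Nice g) (ho : Nice om) :
    Nice2 (fun x b => h x * (f (x - α b) * g (x - s * b) * om b)) := by
  obtain ⟨h1, ⟨C1, h2⟩, R1, h3⟩ := hh
  obtain ⟨f1, ⟨C2, f2⟩, -⟩ := hf
  obtain ⟨g1, ⟨C3, g2⟩, -⟩ := hg
  obtain ⟨o1, ⟨C4, o2⟩, R4, o3⟩ := ho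
  refine Nice2.mk (C := C1 * (C2 * C3 * C4)) (R := max R1 R4) (by fun_prop) (fun x b => ?_)
    fun x b hn => ?_
  · rw [abs_mul, abs_mul, abs_mul]
    have := (abs_nonneg _).trans (h2 0)
    have := (abs_nonneg _).trans (f2 0)
    have := (abs_nonneg _).trans (g2 0)
    have a1 := h2 x
    have a2 := f2 (x - α b)
    have a3 := g2 (x - s * b)
    have a4 := o2 b
    gcongr
  · constructor
    · by_contra hx
      rw [not_le] at hx
      exact hn (by rw [h3 x ((le_max_left _ _).trans_lt hx), zero_mul])
    · by_contra hx
      rw [not_le] at hx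
      exact hn (by rw [o3 b ((le_max_right _ _).trans_lt hx), mul_zero, mul_zero])

theorem curveForm_add_weight {α om om1 om2 h f g : ℝ → ℝ} {s : ℝ} (hα : Measurable α) (hh : Nice h)
    (hf : Nice f) (hg : Nice g) (ho1 : Nice om1) (ho2 : Nice om2)
    (he : om =ᵐ[volume] fun b => om1 b + om2 b) :
    curveForm α om s h f g = curveForm α om1 s h f g + curveForm α om2 s h f g := by
  have n1 := curveForm_nice2 (s := s) hα hh hf hg ho1
  have n2 := curveForm_nice2 (s := s) hα hh hf hg ho2
  simp only [curveForm, ← integral_const_mul]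
  rw [← integral_add (n1.int.integrable _) (n2.int.integrable _)]
  congr 1; ext x
  rw [← integral_add ((n1.slice x).integrable _) ((n2.slice x).integrable _)]
  refine integral_congr_ae ?_
  filter_upwards [he] with b hb
  rw [hb]; ring

section
variable {α B B' B'' κ κ' : ℝ → ℝ} {m M lo hi s p q : ℝ}

theorem Crv.nice_pieceW (hc : Crv α B B' B'' κ κ' m M lo hi) (hp : lo < p) (hq : q < hi) :
    Nice (pieceW κ B p q) := by
  refine ⟨(hc.meas_κ.div hc.meas_B).indicator measurableSet_Icc, ⟨M / m, fun b => ?_⟩,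
    |p| + |q|, fun b hb => ?_⟩
  · have hm := hc.m_pos
    have hM : 0 < M := one_pos.trans_le hc.le_M
    unfold pieceW
    by_cases h : b ∈ Icc p q
    · have h1 : b ∈ Ioo lo hi := ⟨hp.trans_le h.1, h.2.trans_lt hq⟩
      have hB := hc.B_ge b h1
      rw [indicator_of_mem h, abs_div, abs_of_pos (hm.trans_le hB)]
      exact div_le_div₀ hM.le (hc.κ_le b h1) hm hB
    · rw [indicator_of_notMem h, abs_zero]; positivity
  · by_contra h
    exact absurd (abs_le_of_mem_Icc (pieceW_ne_zero h)) (not_le.2 hb)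

theorem pieceW_split {r : ℝ} (hpr : p ≤ r) (hrq : r ≤ q) :
    pieceW κ B p q =ᵐ[volume] fun b => pieceW κ B p r b + pieceW κ B r q b := by
  have h0 : ∀ᵐ b : ℝ, b ≠ r := by simp [ae_iff]
  filter_upwards [h0] with b hb
  simp only [pieceW, indicator, mem_Icc]
  rcases lt_or_gt_of_ne hb with h | h
  · simp [not_le.2 h, h.le, (h.le.trans hrq)]
  · simp [not_le.2 h, h.le, (hpr.trans h.le)]

theorem Crv.exists_piece (hc : Crv α B B' B'' κ κ' m M lo hi) (hs : |s| * (M + M ^ 2 / m) ≤ 1 / 2)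
    (hp : lo < p) (hq : q < hi) (hpq : q - p ≤ m / (6 * M)) :
    ∃ ψ β, CrvPiece α B B' B'' κ κ' m M lo hi s p q ψ β := by
  have hm := hc.m_pos
  have hM : 0 < M := one_pos.trans_le hc.le_M
  obtain ⟨β, hβ⟩ := exists_smoothInv hc.cont (inv_pos.2 hM) hc.expand
  have h1 : |s| ≤ (2 * M ^ 2)⁻¹ := by
    have h2 : |s| * M ^ 2 ≤ 1 / 2 := by
      refine le_trans (mul_le_mul_of_nonneg_left ?_ (abs_nonneg s)) hs
      have : M ^ 2 ≤ M ^ 2 / m := by rw [le_div_iff₀ hm]; nlinarith [hc.m_le, sq_nonneg M]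
      linarith
    rw [← one_div, le_div_iff₀ (by positivity)]; linarith
  have h3 : (2 * M ^ 2)⁻¹ ≤ (2 * M)⁻¹ := by
    apply inv_anti₀ (by positivity); nlinarith [hc.le_M]
  obtain ⟨ψ, hψ⟩ := exists_smoothInv (θ := fun b => α b - s * b) (by have := hc.cont; fun_prop)
    (c := (2 * M)⁻¹) (by positivity) fun x y hxy => by
      have h4 := hc.expand x y hxy
      have h5 : s * (y - x) ≤ (2 * M)⁻¹ * (y - x) :=
        mul_le_mul_of_nonneg_right ((le_abs_self s).trans (h1.trans h3)) (sub_nonneg.2 hxy)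
      have h6 : M⁻¹ = (2 * M)⁻¹ + (2 * M)⁻¹ := by field_simp; norm_num
      rw [h6] at h4
      linarith
  exact ⟨ψ, β, { hc with
    s_le := hs
    lo_lt := hp
    lt_hi := hq
    short := hpq
    invψ := hψ
    invβ := hβ }⟩

theorem Crv.long_le (hc : Crv α B B' B'' κ κ' m M lo hi) (hs : |s| * (M + M ^ 2 / m) ≤ 1 / 2)
    {h f g P : ℝ → ℝ} (hh : Nice h) (hh1 : ∀ x, |h x| ≤ 1) {Z : Set ℝ} {ζ : ℝ}
    (ho : OscPrim f P Z ζ) (hg : Nice g) (hζ : 0 < ζ) (hζ1 : ζ ≤ 1) (n : ℕ) :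
    ∀ p q, lo < p → q < hi → p ≤ q → q - p ≤ (n + 1 : ℕ) * (m / (6 * M)) →
    |curveForm α (pieceW κ B p q) s h f g| ≤ (n + 1 : ℕ) * (2 * pieceC m M * ζ * (l2 f * l2 g)) := by
  have hm := hc.m_pos
  have hM : 0 < M := one_pos.trans_le hc.le_M
  have one : ∀ p q, lo < p → q < hi → p ≤ q → q - p ≤ m / (6 * M) →
      |curveForm α (pieceW κ B p q) s h f g| ≤ 2 * pieceC m M * ζ * (l2 f * l2 g) := by
    intro p q hp hq hpq hl
    obtain ⟨ψ, β, hP⟩ := hc.exists_piece hs hp hq hl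
    exact hP.global_le hpq hh hh1 ho hg hζ hζ1
  induction n with
  | zero =>
    intro p q hp hq hpq hl
    simp only [zero_add, Nat.cast_one, one_mul] at hl ⊢
    exact one p q hp hq hpq hl
  | succ n ih =>
    intro p q hp hq hpq hl
    set r := min q (p + m / (6 * M)) with hr
    have hδ : 0 < m / (6 * M) := by positivity
    have hpr : p ≤ r := le_min hpq (by linarith)
    have hrq : r ≤ q := min_le_left _ _
    have hr1 : r - p ≤ m / (6 * M) := by linarith [min_le_right q (p + m / (6 * M))]
    have hr2 : q - r ≤ (n + 1 : ℕ) * (m / (6 * M)) := by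
      rcases min_cases q (p + m / (6 * M)) with h1 | h1
      · rw [hr, h1.1, sub_self]; positivity
      · rw [hr, h1.1]; push_cast at hl ⊢; linarith
    rw [curveForm_add_weight hc.cont.measurable hh ho.nice hg
      (hc.nice_pieceW hp (hrq.trans_lt hq)) (hc.nice_pieceW (hp.trans_le hpr) hq)
      (pieceW_split hpr hrq)]
    have i1 := one p r hp (hrq.trans_lt hq) hpr hr1
    have i2 := ih r q (hp.trans_le hpr) hq hrq hr2
    refine (abs_add_le _ _).trans ((add_le_add i1 i2).trans (le_of_eq ?_))
    push_cast; ring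

end

/-- The weight `1 / (d b)` on `[2⁻ᵈ, 1]`. -/
noncomputable def invW (d : ℕ) : ℝ → ℝ := (Icc (1 / 2 ^ d : ℝ) 1).indicator fun b => 1 / (d * b)

theorem exists_rootForm_le {d : ℕ} (hd : 2 ≤ d) : ∃ C s₀ : ℝ, 0 < C ∧ 0 < s₀ ∧
    ∀ (s : ℝ), |s| ≤ s₀ → ∀ (h f g P : ℝ → ℝ) (Z : Set ℝ) (ζ : ℝ), Nice h → (∀ x, |h x| ≤ 1) →
      OscPrim f P Z ζ → Nice g → 0 < ζ → ζ ≤ 1 →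
      |curveForm (fun b => b ^ (d : ℝ)⁻¹) (invW d) s h f g| ≤ C * ζ * (l2 f * l2 g) := by
  obtain ⟨α, B, B', B'', κ, κ', m, M, hc, hα, hκ⟩ := exists_crv hd
  have hm := hc.m_pos
  have hM : 0 < M := one_pos.trans_le hc.le_M
  obtain ⟨n, hn⟩ := exists_nat_ge (1 / (m / (6 * M)))
  have hlen : (1 : ℝ) - 1 / 2 ^ d ≤ (n + 1 : ℕ) * (m / (6 * M)) := by
    rw [div_le_iff₀ (by positivity)] at hn
    have h1 : (0 : ℝ) < 1 / 2 ^ d := by positivity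
    have h2 : 0 < m / (6 * M) := by positivity
    push_cast; nlinarith
  have hl1 : (1 / 2 ^ d : ℝ) ≤ 1 := by
    rw [div_le_one (by positivity)]; exact one_le_pow₀ (by norm_num)
  refine ⟨(n + 1 : ℕ) * (2 * pieceC m M), 1 / (2 * (M + M ^ 2 / m)), ?_, by positivity, ?_⟩
  · unfold pieceC; positivity
  intro s hs h f g P Z ζ hh hh1 ho hg hζ hζ1
  have hs' : |s| * (M + M ^ 2 / m) ≤ 1 / 2 := by
    rw [le_div_iff₀ (by positivity)] at hs; linarith
  have e : curveForm (fun b => b ^ (d : ℝ)⁻¹) (invW d) s h f g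
      = curveForm α (pieceW κ B (1 / 2 ^ d) 1) s h f g := by
    unfold curveForm
    congr 1; ext x; congr 2; ext b
    by_cases hb : b ∈ Icc (1 / 2 ^ d : ℝ) 1
    · simp only [invW, pieceW, indicator_of_mem hb, hα b hb, hκ b hb]
    · simp only [invW, pieceW, indicator_of_notMem hb, mul_zero]
  rw [e]
  refine (hc.long_le hs' hh hh1 ho hg hζ hζ1 n (1 / 2 ^ d) 1 ?_ (by norm_num) hl1 hlen).trans
    (le_of_eq (by ring))
  have : (0 : ℝ) < 1 / 2 ^ d := by positivity
  linarith

/-- The decay rate of the oscillatory estimate: `xi ^ 40 = 1 / 2`. -/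
noncomputable def xi : ℝ := (1 / 2 : ℝ) ^ (40 : ℝ)⁻¹

theorem xi_pow : xi ^ 40 = 1 / 2 := by
  have := Real.rpow_inv_natCast_pow (x := 1 / 2) (n := 40) (by norm_num) (by norm_num)
  exact_mod_cast this

theorem xi_pos : 0 < xi := Real.rpow_pos_of_pos (by norm_num) _

theorem xi_lt_one : xi < 1 := Real.rpow_lt_one (by norm_num) (by norm_num) (by norm_num)

theorem l2_indicator_Ico {z y : ℝ} (h : z ≤ y) : l2 ((Ico z y).indicator fun _ => (1 : ℝ)) = √(y - z) := by
  have h1 : (fun x => (Ico z y).indicator (fun _ => (1 : ℝ)) x ^ 2)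
      = (Ico z y).indicator fun _ => (1 : ℝ) := by
    ext x; by_cases hx : x ∈ Ico z y <;> simp [hx]
  rw [l2, h1, integral_indicator measurableSet_Ico]
  simp [h]

theorem nice_indicator_Ico (z y : ℝ) : Nice ((Ico z y).indicator fun _ => (1 : ℝ)) := by
  refine ⟨measurable_const.indicator measurableSet_Ico, ⟨1, fun x => ?_⟩, |z| + |y|, fun x hx => ?_⟩
  · by_cases h : x ∈ Ico z y <;> simp [h]
  · refine indicator_of_notMem (fun h => absurd (abs_le_of_mem_Icc (Ico_subset_Icc_self h)) ?_) _
    exact not_le.2 hx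

theorem abs_setIntegral_Ico_le {f : ℝ → ℝ} (hf : Nice f) {z y : ℝ} (h : z ≤ y) :
    |∫ x in Ico z y, f x| ≤ √(y - z) * l2 f := by
  have h1 : ∫ x in Ico z y, f x = ∫ x, (Ico z y).indicator (fun _ => (1 : ℝ)) x * f x := by
    rw [← integral_indicator measurableSet_Ico]
    congr 1; ext x
    by_cases hx : x ∈ Ico z y <;> simp [hx]
  rw [h1, ← l2_indicator_Ico h]
  exact abs_integral_mul_le (nice_indicator_Ico z y) hf

theorem oscPrim_of_integral_eq_zero {f : ℝ → ℝ} (hf : Nice f) {Z : Set ℝ} (hZ : Z.Countable)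
    (hc : ∀ y, y ∉ Z → ContinuousAt f y) (n : ℕ)
    (hz : ∀ k : ℤ, ∫ x in (k / 2 ^ n : ℝ)..((k + 1) / 2 ^ n), f x = 0) :
    OscPrim f (fun y => ∫ x in (0 : ℝ)..y, f x) Z (xi ^ n) := by
  have hi : Integrable f := hf.integrable _
  have hii : ∀ a b, IntervalIntegrable f volume a b := fun a b => hi.intervalIntegrable
  have h2n : (0 : ℝ) < 2 ^ n := by positivity
  have step : ∀ k : ℤ, ∫ x in (0 : ℝ)..((k + 1 : ℤ) / 2 ^ n), f x = ∫ x in (0 : ℝ)..(k / 2 ^ n), f x := by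
    intro k
    rw [← intervalIntegral.integral_add_adjacent_intervals (hii 0 (k / 2 ^ n)) (hii _ _)]
    push_cast
    rw [hz k, add_zero]
  have grid : ∀ k : ℤ, ∫ x in (0 : ℝ)..(k / 2 ^ n), f x = 0 := by
    intro k
    induction k using Int.induction_on with
    | zero => simp
    | succ i ih => rw [step]; exact ih
    | pred i ih =>
      rw [← step, sub_add_cancel]; exact ih
  refine ⟨hf, ?_, hZ, fun y hy => ?_, fun k => ?_, fun k y hy => ?_⟩
  · exact intervalIntegral.continuous_primitive hii 0
  · exact intervalIntegral.integral_hasDerivAt_right (hii 0 y)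
      hf.1.stronglyMeasurable.stronglyMeasurableAtFilter (hc y hy)
  · have := grid (k * 2 ^ n)
    push_cast at this
    rwa [mul_div_cancel_right₀ _ h2n.ne'] at this
  · set i := ⌊(2 : ℝ) ^ n * y⌋ with hi
    set z : ℝ := i / 2 ^ n with hzd
    have z1 : z ≤ y := by
      rw [hzd, div_le_iff₀ h2n, mul_comm]; exact Int.floor_le _
    have z2 : y - z ≤ (1 / 2) ^ n := by
      have := (Int.lt_floor_add_one ((2 : ℝ) ^ n * y)).le
      rw [one_div, inv_pow, hzd, sub_le_iff_le_add, ← one_div, ← add_div, le_div_iff₀ h2n]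
      linarith
    have z3 : (k : ℝ) ≤ z := by
      rw [hzd, le_div_iff₀ h2n]
      have : ((k * 2 ^ n : ℤ) : ℝ) ≤ (i : ℝ) := by
        rw [Int.cast_le, hi, Int.le_floor]
        push_cast
        nlinarith [hy.1]
      push_cast at this
      exact this
    have e1 : ∫ x in (0 : ℝ)..y, f x = ∫ x in Ico z y, (Ico (k : ℝ) (k + 1)).indicator f x := by
      rw [← intervalIntegral.integral_add_adjacent_intervals (hii 0 z) (hii z y), grid i, zero_add,
        intervalIntegral.integral_of_le z1, ← integral_Ico_eq_integral_Ioc]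
      refine setIntegral_congr_fun measurableSet_Ico fun x hx => ?_
      exact (indicator_of_mem (show x ∈ Ico (k : ℝ) (k + 1) from
        ⟨z3.trans hx.1, hx.2.trans_le hy.2⟩) f).symm
    rw [e1]
    refine (abs_setIntegral_Ico_le (hf.indicator measurableSet_Ico) z1).trans
      (mul_le_mul_of_nonneg_right ?_ (l2_nonneg _))
    refine Real.sqrt_le_iff.2 ⟨pow_nonneg (pow_nonneg xi_pos.le _) _, z2.trans (le_of_eq ?_)⟩
    rw [← xi_pow]; ring

theorem Lvl.continuousAt {N : ℕ} {F : ℝ → ℝ} (h : Lvl N F) {y : ℝ}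
    (hy : y ∉ range fun k : ℤ => (k / 2 ^ N : ℝ)) : ContinuousAt F y := by
  have h2 : (0 : ℝ) < 2 ^ N := by positivity
  have h1 : F =ᶠ[nhds y] fun _ => F y := by
    have hlt : (⌊(2 : ℝ) ^ N * y⌋ : ℝ) < 2 ^ N * y := by
      refine lt_of_le_of_ne (Int.floor_le _) fun hh => hy ⟨⌊(2 : ℝ) ^ N * y⌋, ?_⟩
      simp only []
      rw [hh, mul_div_cancel_left₀ _ h2.ne']
    have hgt := Int.lt_floor_add_one ((2 : ℝ) ^ N * y)
    have hcont : Continuous fun z : ℝ => (2 : ℝ) ^ N * z := by fun_prop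
    filter_upwards [hcont.continuousAt.preimage_mem_nhds (Ioo_mem_nhds hlt hgt)] with z hz
    exact h z y (Int.floor_eq_iff.2 ⟨(mem_preimage.1 hz).1.le, (mem_preimage.1 hz).2⟩)
  exact (continuousAt_const).congr h1.symm

theorem integral_dyadic_eq_zero {i : ℕ} {F : ℝ → ℝ} (hz : ∀ x, dyE i F x = 0) (k : ℤ) :
    ∫ x in (k / 2 ^ i : ℝ)..((k + 1) / 2 ^ i), F x = 0 := by
  have h2 : (0 : ℝ) < 2 ^ i := by positivity
  have hle : (k / 2 ^ i : ℝ) ≤ (k + 1) / 2 ^ i := by gcongr; linarith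
  have h1 := hz (k / 2 ^ i)
  have h3 : (fun y => dyKer i (k / 2 ^ i) y * F y)
      = (Ico (k / 2 ^ i : ℝ) ((k + 1) / 2 ^ i)).indicator fun y => 2 ^ i * F y := by
    ext y
    have h4 : y ∈ Ico (k / 2 ^ i : ℝ) ((k + 1) / 2 ^ i)
        ↔ ⌊(2 : ℝ) ^ i * (k / 2 ^ i)⌋ = ⌊(2 : ℝ) ^ i * y⌋ := by
      rw [mul_div_cancel₀ _ h2.ne', Int.floor_intCast, eq_comm, Int.floor_eq_iff, mem_Ico,
        div_le_iff₀ h2, lt_div_iff₀ h2, mul_comm y]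
    by_cases hy : y ∈ Ico (k / 2 ^ i : ℝ) ((k + 1) / 2 ^ i)
    · rw [indicator_of_mem hy, dyKer, if_pos (h4.1 hy)]
    · rw [indicator_of_notMem hy, dyKer, if_neg (fun hh => hy (h4.2 hh)), zero_mul]
  rw [dyE, h3, integral_indicator measurableSet_Ico, integral_const_mul] at h1
  rw [intervalIntegral.integral_of_le hle, ← integral_Ico_eq_integral_Ioc]
  exact (mul_eq_zero.1 h1).resolve_left (ne_of_gt h2)

/-- The kernel `1 / τ` on `[1/2, 1]`. -/
noncomputable def tauK : ℝ → ℝ := (Icc (1 / 2 : ℝ) 1).indicator fun τ => 1 / τ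

theorem integral_tauK {d : ℕ} (hd : d ≠ 0) (u : ℝ → ℝ) :
    ∫ τ, u τ * tauK τ = ∫ b, u (b ^ (d : ℝ)⁻¹) * invW d b := by
  have hd0 : (0 : ℝ) < d := by positivity
  have e1 : ∫ τ, u τ * tauK τ = ∫ τ in Ioi (0 : ℝ), u τ * tauK τ := by
    refine (setIntegral_eq_integral_of_forall_compl_eq_zero fun τ hτ => ?_).symm
    rw [tauK, indicator_of_notMem, mul_zero]
    intro h
    exact hτ (lt_of_lt_of_le (by norm_num) h.1)
  have e2 : ∫ b, u (b ^ (d : ℝ)⁻¹) * invW d b = ∫ b in Ioi (0 : ℝ), u (b ^ (d : ℝ)⁻¹) * invW d b := by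
    refine (setIntegral_eq_integral_of_forall_compl_eq_zero fun τ hτ => ?_).symm
    rw [invW, indicator_of_notMem, mul_zero]
    intro h
    exact hτ (lt_of_lt_of_le (by positivity) h.1)
  rw [e1, e2, ← integral_comp_rpow_Ioi (fun b => u (b ^ (d : ℝ)⁻¹) * invW d b) hd0.ne']
  refine setIntegral_congr_fun measurableSet_Ioi fun x hx => ?_
  have hx0 : (0 : ℝ) < x := hx
  have h1 : (x ^ (d : ℝ)) ^ (d : ℝ)⁻¹ = x := by
    rw [← Real.rpow_mul hx0.le, mul_inv_cancel₀ hd0.ne', Real.rpow_one]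
  have h2 : x ^ (d : ℝ) ∈ Icc (1 / 2 ^ d : ℝ) 1 ↔ x ∈ Icc (1 / 2 : ℝ) 1 := by
    rw [mem_Icc, mem_Icc, Real.rpow_natCast, ← one_div_pow,
      pow_le_pow_iff_left₀ (by norm_num) hx0.le hd, pow_le_one_iff_of_nonneg hx0.le hd]
  simp only [smul_eq_mul, h1, abs_of_pos hd0]
  by_cases hm : x ∈ Icc (1 / 2 : ℝ) 1
  · rw [tauK, invW, indicator_of_mem hm, indicator_of_mem (h2.2 hm),
      Real.rpow_sub hx0, Real.rpow_one]
    have : 0 < x ^ (d : ℝ) := Real.rpow_pos_of_pos hx0 _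
    field_simp
  · rw [tauK, invW, indicator_of_notMem hm, indicator_of_notMem fun h => hm (h2.1 h)]
    simp

/-- The trilinear form along the curve `(a τ, c τ ^ d)`, `1/2 ≤ τ ≤ 1`. -/
noncomputable def tauForm (d : ℕ) (a c : ℝ) (h F G : ℝ → ℝ) : ℝ :=
  ∫ x, h x * ∫ τ, F (x - a * τ) * G (x - c * τ ^ d) * tauK τ

theorem tauForm_eq_curveForm {d : ℕ} (hd : d ≠ 0) {a : ℝ} (ha : a ≠ 0) (c : ℝ) (h F G : ℝ → ℝ) :
    tauForm d a c h F G = |a| * curveForm (fun b => b ^ (d : ℝ)⁻¹) (invW d) (c / a)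
      (fun x => h (a * x)) (fun x => F (a * x)) (fun x => G (a * x)) := by
  have e1 : tauForm d a c h F G
      = |a| * ∫ x, h (a * x) * ∫ τ, F (a * x - a * τ) * G (a * x - c * τ ^ d) * tauK τ := by
    have := Measure.integral_comp_mul_left
      (fun x => h x * ∫ τ, F (x - a * τ) * G (x - c * τ ^ d) * tauK τ) a
    rw [this, smul_eq_mul, abs_inv, ← mul_assoc, mul_inv_cancel₀ (abs_pos.2 ha).ne', one_mul]
    rfl
  rw [e1, curveForm]
  congr 2; ext x; congr 1
  rw [integral_tauK hd]
  congr 1; ext b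
  by_cases hb : b ∈ Icc (1 / 2 ^ d : ℝ) 1
  · have hb0 : 0 < b := lt_of_lt_of_le (by positivity) hb.1
    have h1 : (b ^ (d : ℝ)⁻¹) ^ d = b := Real.rpow_inv_natCast_pow hb0.le hd
    have h2 : a * (x - c / a * b) = a * x - c * b := by field_simp
    rw [h1, mul_sub, h2]
  · rw [invW, indicator_of_notMem hb, mul_zero, mul_zero]

theorem oscPrim_dilate {j n N : ℕ} {a : ℝ} (ha : |a| = (1 / 2) ^ j) {F : ℝ → ℝ} (hF : Nice F)
    (hN : Lvl N F) (hz : ∀ x, dyE (j + n) F x = 0) :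
    ∃ P Z, OscPrim (fun x => F (a * x)) P Z (xi ^ n) := by
  have ha0 : a ≠ 0 := abs_pos.1 (by rw [ha]; positivity)
  refine ⟨_, (fun x => a * x) ⁻¹' (range fun k : ℤ => (k / 2 ^ N : ℝ)),
    oscPrim_of_integral_eq_zero (hF.comp_mul ha0)
      ((countable_range _).preimage (mul_right_injective₀ ha0)) (fun y hy => ?_) n fun k => ?_⟩
  · exact ContinuousAt.comp (f := fun x => a * x) (hN.continuousAt hy) (by fun_prop)
  · rw [intervalIntegral.integral_comp_mul_left F ha0, smul_eq_mul, mul_eq_zero]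
    right
    have h2 : (2 : ℝ) ^ (j + n) = 2 ^ j * 2 ^ n := pow_add _ _ _
    rw [one_div_pow] at ha
    rcases abs_choice a with h | h
    · rw [h] at ha
      have h3 := integral_dyadic_eq_zero hz k
      convert h3 using 2 <;> rw [ha, h2] <;> field_simp
    · rw [h] at ha
      have ha' : a = -(1 / 2 ^ j) := by linarith
      have h3 := integral_dyadic_eq_zero hz (-(k + 1))
      rw [intervalIntegral.integral_symm, neg_eq_zero]
      convert h3 using 2
      · rw [ha', h2]; push_cast; field_simp
      · rw [ha', h2]; push_cast; field_simp; ring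

/-- Decay of the form when the first function oscillates at a scale below `2⁻ʲ`. -/
theorem exists_tauForm_le {d : ℕ} (hd : 2 ≤ d) : ∃ (C : ℝ) (j₀ : ℕ), 0 < C ∧
    ∀ (j n N : ℕ) (a c : ℝ) (h F G : ℝ → ℝ), j₀ ≤ j → |a| = (1 / 2) ^ j → |c| = (1 / 2) ^ (d * j) →
      Nice h → (∀ x, |h x| ≤ 1) → Nice F → Lvl N F → (∀ x, dyE (j + n) F x = 0) → Nice G →
      |tauForm d a c h F G| ≤ C * xi ^ n * (l2 F * l2 G) := by
  obtain ⟨C, s₀, hC, hs₀, H⟩ := exists_rootForm_le hd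
  obtain ⟨j₀, hj₀⟩ := exists_pow_lt_of_lt_one hs₀ (by norm_num : (1 / 2 : ℝ) < 1)
  refine ⟨C, j₀, hC, fun j n N a c h F G hj ha hc hh hh1 hF hN hz hG => ?_⟩
  have ha0 : a ≠ 0 := abs_pos.1 (by rw [ha]; positivity)
  have hap := abs_pos.2 ha0
  obtain ⟨P, Z, ho⟩ := oscPrim_dilate ha hF hN hz
  have hs : |c / a| ≤ s₀ := by
    rw [abs_div, ha, hc, div_le_iff₀ (by positivity)]
    calc (1 / 2 : ℝ) ^ (d * j) ≤ (1 / 2) ^ (j₀ + j) := by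
          refine pow_le_pow_of_le_one (by norm_num) (by norm_num) ?_
          nlinarith
      _ = (1 / 2) ^ j₀ * (1 / 2) ^ j := pow_add _ _ _
      _ ≤ s₀ * (1 / 2) ^ j := by gcongr
  have key := H (c / a) hs _ _ _ P Z (xi ^ n) (hh.comp_mul ha0) (fun x => hh1 (a * x)) ho
    (hG.comp_mul ha0) (pow_pos xi_pos n) (pow_le_one₀ xi_pos.le xi_lt_one.le)
  rw [l2_comp_mul, l2_comp_mul] at key
  rw [tauForm_eq_curveForm (by omega) ha0, abs_mul, abs_abs]
  refine (mul_le_mul_of_nonneg_left key (abs_nonneg a)).trans (le_of_eq ?_)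
  have hsq : √(|a|⁻¹) * √(|a|⁻¹) = |a|⁻¹ := Real.mul_self_sqrt (by positivity)
  calc |a| * (C * xi ^ n * (√(|a|⁻¹) * l2 F * (√(|a|⁻¹) * l2 G)))
      = |a| * (√(|a|⁻¹) * √(|a|⁻¹)) * (C * xi ^ n * (l2 F * l2 G)) := by ring
    _ = C * xi ^ n * (l2 F * l2 G) := by rw [hsq, mul_inv_cancel₀ hap.ne', one_mul]

theorem abs_indicator_Icc_sub_le {a b : ℝ} (v τ : ℝ) :
    |(Icc a b).indicator (fun _ => (1 : ℝ)) (τ + v) - (Icc a b).indicator (fun _ => (1 : ℝ)) τ|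
      ≤ (Icc (a - |v|) (a + |v|)).indicator (fun _ => (1 : ℝ)) τ
        + (Icc (b - |v|) (b + |v|)).indicator (fun _ => (1 : ℝ)) τ := by
  have h1 := neg_abs_le v
  have h2 := le_abs_self v
  simp only [indicator, mem_Icc]
  split_ifs <;> first | (norm_num; done) | skip
  all_goals exfalso; grind

theorem integral_indicator_Icc_one {a b : ℝ} (h : a ≤ b) :
    ∫ τ, (Icc a b).indicator (fun _ => (1 : ℝ)) τ = b - a := by
  rw [integral_indicator measurableSet_Icc]; simp [h]

theorem nice_indicator_Icc (a b : ℝ) : Nice ((Icc a b).indicator fun _ => (1 : ℝ)) := by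
  refine ⟨measurable_const.indicator measurableSet_Icc, ⟨1, fun x => ?_⟩, |a| + |b|, fun x hx => ?_⟩
  · by_cases h : x ∈ Icc a b <;> simp [h]
  · exact indicator_of_notMem (fun h => absurd (abs_le_of_mem_Icc h) (not_le.2 hx)) _

theorem Nice.comp_add {f : ℝ → ℝ} (hf : Nice f) (v : ℝ) : Nice (fun x => f (x + v)) := by
  simpa only [sub_neg_eq_add] using hf.comp_sub (-v)

theorem ker_indicator_mul {a b P L : ℝ} (ha : 0 ≤ a) (hab : a ≤ b) (hb : b ≤ 1) {φ : ℝ → ℝ}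
    (hm : Measurable φ) (hP : ∀ τ, |φ τ| ≤ P) (hL : ∀ x y, |φ x - φ y| ≤ L * |x - y|) :
    Ker (L + 4 * P) ((Icc a b).indicator φ) := by
  have hP0 : 0 ≤ P := (abs_nonneg _).trans (hP 0)
  have hL0 : 0 ≤ L := by have := (abs_nonneg _).trans (hL 1 0); simpa using this
  have e : ∀ τ, (Icc a b).indicator φ τ = (Icc a b).indicator (fun _ => (1 : ℝ)) τ * φ τ := fun τ => by
    by_cases h : τ ∈ Icc a b <;> simp [h]
  have n1 := nice_indicator_Icc a b
  refine ⟨hm.indicator measurableSet_Icc, fun τ => ?_, fun τ hτ => ?_, fun v => ?_⟩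
  · by_cases h : τ ∈ Icc a b
    · rw [indicator_of_mem h]; linarith [hP τ]
    · rw [indicator_of_notMem h, abs_zero]; positivity
  · refine indicator_of_notMem (fun h => ?_) _
    rw [abs_of_nonneg (ha.trans h.1)] at hτ
    linarith [h.2]
  · have n2 := n1.comp_add v
    have nk : Nice ((Icc a b).indicator φ) := by
      have : (Icc a b).indicator φ = fun τ => (Icc a b).indicator (fun _ => (1 : ℝ)) τ * φ τ :=
        funext e
      rw [this]; exact n1.mul_bdd hm ⟨P, hP⟩
    have n3 := nice_indicator_Icc (a - |v|) (a + |v|)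
    have n4 := nice_indicator_Icc (b - |v|) (b + |v|)
    have nr := (n2.const_mul (L * |v|)).add ((n3.add n4).const_mul P)
    have hle : ∫ τ, |(Icc a b).indicator φ (τ + v) - (Icc a b).indicator φ τ|
        ≤ ∫ τ, (L * |v| * (Icc a b).indicator (fun _ => (1 : ℝ)) (τ + v)
          + P * ((Icc (a - |v|) (a + |v|)).indicator (fun _ => (1 : ℝ)) τ
            + (Icc (b - |v|) (b + |v|)).indicator (fun _ => (1 : ℝ)) τ)) := by
      refine integral_mono (((nk.comp_add v).sub nk).abs.integrable _) (nr.integrable _) fun τ => ?_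
      simp only []
      rw [e, e]
      set i1 := (Icc a b).indicator (fun _ => (1 : ℝ)) (τ + v)
      set i0 := (Icc a b).indicator (fun _ => (1 : ℝ)) τ
      have p1 : 0 ≤ i1 := indicator_nonneg (fun _ _ => zero_le_one) _
      have h1 : i1 * φ (τ + v) - i0 * φ τ = i1 * (φ (τ + v) - φ τ) + (i1 - i0) * φ τ := by ring
      rw [h1]
      refine (abs_add_le _ _).trans (add_le_add ?_ ?_)
      · rw [abs_mul, abs_of_nonneg p1, mul_comm]
        have := hL (τ + v) τ
        rw [add_sub_cancel_left] at this
        exact mul_le_mul_of_nonneg_right this p1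
      · rw [abs_mul, mul_comm]
        exact mul_le_mul (hP τ) (abs_indicator_Icc_sub_le v τ) (abs_nonneg _) hP0
    refine hle.trans ?_
    rw [integral_add ((n2.const_mul _).integrable _) (((n3.add n4).const_mul P).integrable _),
      integral_const_mul, integral_const_mul, integral_add (n3.integrable _) (n4.integrable _),
      integral_add_right_eq_self (fun τ => (Icc a b).indicator (fun _ => (1 : ℝ)) τ) v,
      integral_indicator_Icc_one hab, integral_indicator_Icc_one (by linarith [abs_nonneg v]),
      integral_indicator_Icc_one (by linarith [abs_nonneg v])]
    have := abs_nonneg v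
    have h5 : L * |v| * (b - a) ≤ L * |v| * 1 :=
      mul_le_mul_of_nonneg_left (by linarith) (by positivity)
    nlinarith

theorem ker_inv {a c : ℝ} (ha : 0 < a) (ha1 : a ≤ 1) (hc : 0 ≤ c) :
    ∃ A, Ker A ((Icc a 1).indicator fun τ => c / τ) := by
  have e : (Icc a 1).indicator (fun τ => c / τ) = (Icc a 1).indicator fun τ => c / max τ a := by
    ext τ
    by_cases h : τ ∈ Icc a 1
    · rw [indicator_of_mem h, indicator_of_mem h, max_eq_left h.1]
    · rw [indicator_of_notMem h, indicator_of_notMem h]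
  rw [e]
  refine ⟨_, ker_indicator_mul (P := c / a) (L := c / a ^ 2) ha.le ha1 le_rfl (by fun_prop)
    (fun τ => ?_) fun x y => ?_⟩
  · have : a ≤ max τ a := le_max_right _ _
    rw [abs_of_nonneg (div_nonneg hc (ha.le.trans this))]
    exact div_le_div_of_nonneg_left hc ha this
  · have hx : a ≤ max x a := le_max_right _ _
    have hy : a ≤ max y a := le_max_right _ _
    have hx0 := ha.trans_le hx
    have hy0 := ha.trans_le hy
    have h1 : c / max x a - c / max y a = c * (max y a - max x a) / (max x a * max y a) := by
      field_simp
    have h2 : |max y a - max x a| ≤ |x - y| := by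
      rw [abs_sub_comm x y]; exact abs_max_sub_max_le_abs y x a
    rw [h1, abs_div, abs_mul, abs_of_nonneg hc, abs_of_pos (mul_pos hx0 hy0), div_mul_eq_mul_div]
    refine div_le_div₀ (by positivity) (mul_le_mul_of_nonneg_left h2 hc) (by positivity) ?_
    rw [sq]; exact mul_le_mul hx hy ha.le hx0.le

theorem ker_tauK : ∃ A, Ker A tauK := ker_inv (by norm_num) (by norm_num) zero_le_one

theorem ker_invW (d : ℕ) : ∃ A, Ker A (invW d) := by
  have h1 : (1 / 2 ^ d : ℝ) ≤ 1 := by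
    rw [div_le_one (by positivity)]; exact one_le_pow₀ (by norm_num)
  have e : invW d = (Icc (1 / 2 ^ d : ℝ) 1).indicator fun b => (1 / d) / b := by
    unfold invW; congr 1; ext b; rw [div_div]
  rw [e]
  exact ker_inv (by positivity) h1 (by positivity)

/-- The uniform density on `[0, 1]`. -/
noncomputable def unitK : ℝ → ℝ := (Icc (0 : ℝ) 1).indicator fun _ => 1

theorem ker_unitK : Ker 4 unitK := by
  have := ker_indicator_mul (a := 0) (b := 1) (P := 1) (L := 0) (φ := fun _ => 1) le_rfl zero_le_one
    le_rfl measurable_const (by simp) (by simp)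
  simpa [unitK] using this

/-- The `d`-th root, extended to a Lipschitz function. -/
noncomputable def root (d : ℕ) (b : ℝ) : ℝ := max b (1 / 2 ^ d) ^ (d : ℝ)⁻¹

theorem continuous_root (d : ℕ) : Continuous (root d) :=
  (continuous_id.max continuous_const).rpow_const fun _ => Or.inr (by positivity)

theorem root_pow {d : ℕ} (hd : d ≠ 0) (b : ℝ) : root d b ^ d = max b (1 / 2 ^ d) :=
  Real.rpow_inv_natCast_pow (le_trans (by positivity) (le_max_right _ _)) hd

theorem half_le_root {d : ℕ} (hd : d ≠ 0) (b : ℝ) : 1 / 2 ≤ root d b := by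
  refine le_of_pow_le_pow_left₀ hd (Real.rpow_nonneg (le_trans (by positivity) (le_max_right _ _)) _) ?_
  rw [root_pow hd, one_div_pow]
  exact le_max_right _ _

theorem root_le_one {d : ℕ} (hd : d ≠ 0) {b : ℝ} (hb : b ≤ 1) : root d b ≤ 1 := by
  refine le_of_pow_le_pow_left₀ hd zero_le_one ?_
  rw [root_pow hd, one_pow]
  exact max_le hb (by rw [div_le_one (by positivity)]; exact one_le_pow₀ (by norm_num))

theorem root_lip {d : ℕ} (hd : d ≠ 0) (x y : ℝ) : |root d x - root d y| ≤ 2 ^ d * |x - y| := by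
  wlog h : root d y ≤ root d x generalizing x y
  · rw [abs_sub_comm, abs_sub_comm x y]; exact this y x (le_of_not_ge h)
  have h1 := root_pow hd x
  have h2 := root_pow hd y
  have hy := half_le_root hd y
  set u := root d x
  set v := root d y
  have hv0 : 0 < v := by linarith
  have e : d = (d - 1) + 1 := by omega
  have h3 : (u - v) * v ^ (d - 1) ≤ u ^ d - v ^ d := by
    have h4 : v ^ (d - 1) ≤ u ^ (d - 1) := pow_le_pow_left₀ hv0.le h _
    have h5 : u ^ d = u * u ^ (d - 1) := by conv_lhs => rw [e, pow_succ, mul_comm]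
    have h6 : v ^ d = v * v ^ (d - 1) := by conv_lhs => rw [e, pow_succ, mul_comm]
    rw [h5, h6]
    nlinarith
  have h7 : (1 / 2 : ℝ) ^ d ≤ v ^ (d - 1) := by
    calc (1 / 2 : ℝ) ^ d ≤ (1 / 2) ^ (d - 1) :=
          pow_le_pow_of_le_one (by norm_num) (by norm_num) (by omega)
      _ ≤ v ^ (d - 1) := pow_le_pow_left₀ (by norm_num) hy _
  have h8 : u ^ d - v ^ d ≤ |x - y| := by
    rw [h1, h2]; exact (le_abs_self _).trans (abs_max_sub_max_le_abs x y _)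
  rw [abs_of_nonneg (sub_nonneg.2 h)]
  have h9 : (u - v) * (1 / 2) ^ d ≤ |x - y| :=
    (mul_le_mul_of_nonneg_left h7 (sub_nonneg.2 h)).trans (h3.trans h8)
  rw [one_div_pow, mul_one_div, div_le_iff₀ (by positivity)] at h9
  linarith

theorem Nice.intble {f : ℝ → ℝ} (hf : Nice f) : Integrable f := hf.integrable _

/-- Bounded measurable functions of two variables whose slices in the first one are `Nice`. -/
structure Slc (P : ℝ → ℝ → ℝ) : Prop where
  meas : Measurable (fun p : ℝ × ℝ => P p.1 p.2)
  bdd : ∃ C, ∀ x b, |P x b| ≤ C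
  nice : ∀ b, Nice (fun x => P x b)

theorem Slc.sub {P Q : ℝ → ℝ → ℝ} (hP : Slc P) (hQ : Slc Q) : Slc (fun x b => P x b - Q x b) := by
  obtain ⟨C, hC⟩ := hP.bdd
  obtain ⟨D, hD⟩ := hQ.bdd
  exact ⟨hP.meas.sub hQ.meas, ⟨C + D, fun x b => (abs_sub _ _).trans (add_le_add (hC _ _) (hD _ _))⟩,
    fun b => (hP.nice b).sub (hQ.nice b)⟩

theorem Nice.slc_translate {F r : ℝ → ℝ} (hF : Nice F) (hr : Measurable r) (a : ℝ) :
    Slc (fun x b => F (x - a * r b)) := by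
  obtain ⟨C, hC⟩ := hF.2.1
  have hm := hF.1
  exact ⟨by fun_prop, ⟨C, fun x b => hC _⟩, fun b => hF.comp_sub _⟩

theorem Nice.slc_const {F : ℝ → ℝ} (hF : Nice F) : Slc (fun x _ => F x) := by
  obtain ⟨C, hC⟩ := hF.2.1
  have hm := hF.1
  exact ⟨by fun_prop, ⟨C, fun x b => hC _⟩, fun b => hF⟩

/-- The trilinear form `∫ h(x) ∫ P(x, b) Q(x, b) w(b) db dx`. -/
noncomputable def biForm (w h : ℝ → ℝ) (P Q : ℝ → ℝ → ℝ) : ℝ :=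
  ∫ x, h x * ∫ b, P x b * Q x b * w b

section biForm

variable {w h : ℝ → ℝ} {P P' Q Q' : ℝ → ℝ → ℝ}

theorem nice2_biForm (hw : Nice w) (hh : Nice h) (hP : Slc P) (hQ : Slc Q) :
    Nice2 (fun x b => h x * (P x b * Q x b * w b)) := by
  obtain ⟨C, hC⟩ := hP.bdd
  obtain ⟨D, hD⟩ := hQ.bdd
  obtain ⟨hwm, ⟨A, hA⟩, R, hR⟩ := hw
  obtain ⟨hhm, ⟨B, hB⟩, S, hS⟩ := hh
  have m1 := hP.meas
  have m2 := hQ.meas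
  have hC0 : 0 ≤ C := (abs_nonneg _).trans (hC 0 0)
  have hD0 : 0 ≤ D := (abs_nonneg _).trans (hD 0 0)
  have hB0 : 0 ≤ B := (abs_nonneg _).trans (hB 0)
  refine Nice2.mk (C := B * (C * D * A)) (R := max R S) (by fun_prop) (fun x b => ?_) fun x b hne => ?_
  · rw [abs_mul, abs_mul, abs_mul]
    exact mul_le_mul (hB _) (mul_le_mul (mul_le_mul (hC _ _) (hD _ _) (abs_nonneg _) hC0) (hA _)
      (abs_nonneg _) (mul_nonneg hC0 hD0)) (by positivity) hB0
  · constructor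
    · by_contra hlt
      rw [not_le, max_lt_iff] at hlt
      exact hne (by rw [hS x hlt.2, zero_mul])
    · by_contra hlt
      rw [not_le, max_lt_iff] at hlt
      exact hne (by rw [hR b hlt.1, mul_zero, mul_zero])

theorem biForm_eq (w h : ℝ → ℝ) (P Q : ℝ → ℝ → ℝ) :
    biForm w h P Q = ∫ x, ∫ b, h x * (P x b * Q x b * w b) := by
  simp only [biForm, integral_const_mul]

theorem biForm_sub_left (hw : Nice w) (hh : Nice h) (hP : Slc P) (hP' : Slc P') (hQ : Slc Q) :
    biForm w h (fun x b => P x b - P' x b) Q = biForm w h P Q - biForm w h P' Q := by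
  have n1 := nice2_biForm hw hh hP hQ
  have n2 := nice2_biForm hw hh hP' hQ
  rw [biForm_eq, biForm_eq, biForm_eq, ← integral_sub n1.int.intble n2.int.intble]
  congr 1; ext x
  rw [← integral_sub (n1.slice x).intble (n2.slice x).intble]
  congr 1; ext b; ring

theorem biForm_comm (w h : ℝ → ℝ) (P Q : ℝ → ℝ → ℝ) : biForm w h P Q = biForm w h Q P := by
  simp only [biForm, mul_comm (P _ _)]

theorem biForm_sub_right (hw : Nice w) (hh : Nice h) (hP : Slc P) (hQ : Slc Q) (hQ' : Slc Q') :
    biForm w h P (fun x b => Q x b - Q' x b) = biForm w h P Q - biForm w h P Q' := by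
  rw [biForm_comm, biForm_sub_left hw hh hQ hQ' hP, biForm_comm w h P Q, biForm_comm w h P]

/-- Cauchy–Schwarz in the first variable. -/
theorem abs_biForm_le (hw : Nice w) (hh : Nice h) (hh1 : ∀ x, |h x| ≤ 1) (hP : Slc P) (hQ : Slc Q)
    {p q : ℝ} (hp : ∀ b, w b ≠ 0 → l2 (fun x => P x b) ≤ p)
    (hq : ∀ b, w b ≠ 0 → l2 (fun x => Q x b) ≤ q) :
    |biForm w h P Q| ≤ (∫ b, |w b|) * (p * q) := by
  rw [biForm_eq, (nice2_biForm hw hh hP hQ).swap, ← integral_mul_const, ← Real.norm_eq_abs]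
  refine norm_integral_le_of_norm_le (hw.abs.intble.mul_const _) (Filter.Eventually.of_forall fun b => ?_)
  have e : ∫ x, h x * (P x b * Q x b * w b) = w b * ∫ x, (h x * P x b) * Q x b := by
    rw [← integral_const_mul]; congr 1; ext x; ring
  rw [e, Real.norm_eq_abs, abs_mul]
  by_cases hb : w b = 0
  · simp [hb]
  refine mul_le_mul_of_nonneg_left ?_ (abs_nonneg _)
  refine (abs_integral_mul_le (hh.mul (hP.nice b)) (hQ.nice b)).trans ?_
  refine mul_le_mul (le_trans (l2_mono (hP.nice b) fun x => ?_) (hp b hb)) (hq b hb) (l2_nonneg _)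
    ((l2_nonneg _).trans (hp b hb))
  rw [abs_mul]
  exact mul_le_of_le_one_left (abs_nonneg _) (hh1 x)

end biForm

theorem cnv_eq_biForm {w h : ℝ → ℝ} (c : ℝ) (F G : ℝ → ℝ) :
    biForm w h (fun x _ => F x) (fun x b => G (x - c * b)) = ∫ x, h x * (F x * cnv c w G x) := by
  rw [biForm]
  congr 1; ext x
  rw [cnv, ← integral_const_mul (F x)]
  congr 2; ext b; ring

theorem tauForm_eq_biForm {d : ℕ} (hd : d ≠ 0) (a c : ℝ) (h F G : ℝ → ℝ) :
    tauForm d a c h F G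
      = biForm (invW d) h (fun x b => F (x - a * root d b)) (fun x b => G (x - c * b)) := by
  rw [tauForm, biForm]
  congr 1; ext x
  rw [integral_tauK hd]
  congr 2; ext b
  by_cases hb : b ∈ Icc (1 / 2 ^ d : ℝ) 1
  · have hb0 : 0 < b := lt_of_lt_of_le (by positivity) hb.1
    have h1 : (b ^ (d : ℝ)⁻¹) ^ d = b := Real.rpow_inv_natCast_pow hb0.le hd
    rw [h1, root, max_eq_left hb.1]
  · rw [invW, indicator_of_notMem hb, mul_zero, mul_zero]

theorem cnv_tauK_eq {d : ℕ} (hd : d ≠ 0) (a : ℝ) (F : ℝ → ℝ) (x : ℝ) :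
    cnv a tauK F x = ∫ b, F (x - a * root d b) * invW d b := by
  rw [cnv, integral_tauK hd]
  congr 1; ext b
  by_cases hb : b ∈ Icc (1 / 2 ^ d : ℝ) 1
  · rw [root, max_eq_left hb.1]
  · rw [invW, indicator_of_notMem hb, mul_zero, mul_zero]

theorem integral_unitK : ∫ τ, unitK τ = 1 := by
  rw [unitK, integral_indicator_Icc_one zero_le_one, sub_zero]

section freeze

variable {w h r F G : ℝ → ℝ} {A L a c : ℝ}

theorem nice2_shear_weight (hw : Nice w) (hh : Nice h) (hF : Nice F) (hr : Measurable r) (a c : ℝ) :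
    Nice2 (fun X b => h (X + c * b) * (F (X + c * b - a * r b) * w b)) := by
  obtain ⟨hwm, ⟨A, hA⟩, R, hR⟩ := hw
  obtain ⟨hhm, ⟨B, hB⟩, S, hS⟩ := hh
  obtain ⟨hFm, ⟨D, hD⟩, -⟩ := hF
  have hD0 : 0 ≤ D := (abs_nonneg _).trans (hD 0)
  have hB0 : 0 ≤ B := (abs_nonneg _).trans (hB 0)
  refine Nice2.mk (C := B * (D * A)) (R := max R (S + |c| * R)) (by fun_prop) (fun x b => ?_)
    fun x b hne => ?_
  · rw [abs_mul, abs_mul]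
    exact mul_le_mul (hB _) (mul_le_mul (hD _) (hA _) (abs_nonneg _) hD0) (by positivity) hB0
  · have h1 : |b| ≤ R := by
      by_contra hlt
      exact hne (by rw [hR b (not_le.1 hlt), mul_zero, mul_zero])
    have h2 : |x + c * b| ≤ S := by
      by_contra hlt
      exact hne (by rw [hS _ (not_le.1 hlt), zero_mul])
    refine ⟨le_max_of_le_right ?_, le_max_of_le_left h1⟩
    calc |x| = |(x + c * b) - c * b| := by ring_nf
      _ ≤ |x + c * b| + |c * b| := abs_sub _ _
      _ ≤ S + |c| * R := by rw [abs_mul]; gcongr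

theorem l2_shear_le (hF : Nice F) (hh1 : ∀ x, |h x| ≤ 1) (u : ℝ) :
    l2 (fun X => h (X + u) * F (X + u)) ≤ l2 F := by
  have := l2_comp_sub (fun X => h X * F X) (-u)
  simp only [sub_neg_eq_add] at this
  rw [this]
  refine l2_mono hF fun x => ?_
  rw [abs_mul]
  exact mul_le_of_le_one_left (abs_nonneg _) (hh1 x)

/-- If `F` is constant at scale `2⁻ⁱ`, the form only sees averages of `G` over length `|c| δ`. -/
theorem abs_biForm_freeze_le (hw : Ker A w) (hh : Nice h) (hh1 : ∀ x, |h x| ≤ 1) (hr : Measurable r)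
    (hrL : ∀ x y, |r x - r y| ≤ L * |x - y|) (hF : Nice F) {i : ℕ} (hi : Lvl i F) (hG : Nice G)
    (a c : ℝ) {δ : ℝ} (hδ : 0 ≤ δ) :
    |biForm w h (fun x b => F (x - a * r b)) (fun x b => G (x - c * b))|
      ≤ 2 * A * l2 F * l2 (cnv (c * δ) unitK G)
        + (2 * A * √(4 * (2 ^ i * (|a| * (L * δ)))) + A * δ) * l2 F * l2 G := by
  have hA := hw.nonneg
  have hL : 0 ≤ L := by have := (abs_nonneg _).trans (hrL 1 0); simpa using this
  set D : ℝ → ℝ := fun X => ∫ b, h (X + c * b) * (F (X + c * b - a * r b) * w b) with hD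
  have nK := nice2_shear_weight hw.nice hh hF hr a c
  have nD : Nice D := nK.int
  have eT : biForm w h (fun x b => F (x - a * r b)) (fun x b => G (x - c * b)) = ∫ X, G X * D X := by
    have n1 : Nice2 (fun x b => h x * (F (x - a * r b) * G (x - c * b) * w b)) :=
      nice2_biForm hw.nice hh (hF.slc_translate hr a) (hG.slc_translate measurable_id c)
    rw [biForm_eq, n1.swap]
    have n2 : Nice2 (fun X b => G X * (h (X + c * b) * (F (X + c * b - a * r b) * w b))) :=
      Nice.bdd_mul nK (hG.1.comp measurable_fst) ⟨_, fun p => hG.2.1.choose_spec p.1⟩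
    have e2 : ∫ X, G X * D X = ∫ X, ∫ b, G X * (h (X + c * b) * (F (X + c * b - a * r b) * w b)) := by
      simp only [integral_const_mul, hD]
    rw [e2, n2.swap]
    congr 1; ext b
    rw [← integral_add_right_eq_self _ (c * b)]
    congr 1; ext X
    rw [add_sub_cancel_right]; ring
  have lD : l2 D ≤ 2 * A * l2 F := by
    refine (l2_integral_le (K := fun X b => h (X + c * b) * (F (X + c * b - a * r b) * w b)) nK (w := fun b => |w b| * l2 F) (hw.nice.abs.intble.mul_const _)
      fun b => ?_).trans ?_
    · have e : (fun X => h (X + c * b) * (F (X + c * b - a * r b) * w b))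
          = fun X => w b * (h (X + c * b) * (fun y => F (y - a * r b)) (X + c * b)) := by
        ext X; ring
      rw [e, l2_const_mul]
      refine mul_le_mul_of_nonneg_left ?_ (abs_nonneg _)
      refine (l2_shear_le (hF.comp_sub _) hh1 _).trans (l2_comp_sub F _).le
    · rw [integral_mul_const]
      exact mul_le_mul_of_nonneg_right hw.integral_abs_le (l2_nonneg _)
  have trans : ∀ v, 0 ≤ v → v ≤ δ → l2 (fun X => D X - D (X + c * v))
      ≤ (2 * A * √(4 * (2 ^ i * (|a| * (L * δ)))) + A * δ) * l2 F := by
    intro v hv0 hv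
    have nK' : Nice2 (fun X b => h (X + c * b) * (F (X + c * b - a * r (b - v)) * w (b - v))) :=
      nice2_shear_weight (hw.nice.comp_sub v) hh hF (r := fun b => r (b - v)) (by fun_prop) a c
    have e1 : ∀ X, D (X + c * v)
        = ∫ b, h (X + c * b) * (F (X + c * b - a * r (b - v)) * w (b - v)) := by
      intro X
      rw [hD]; dsimp only
      rw [← integral_add_right_eq_self
        (fun b => h (X + c * b) * (F (X + c * b - a * r (b - v)) * w (b - v))) v]
      congr 1; ext b
      rw [add_sub_cancel_right, mul_add, add_assoc, add_comm (c * v)]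
    have e2 : (fun X => D X - D (X + c * v)) = fun X => ∫ b,
        (h (X + c * b) * (F (X + c * b - a * r b) * w b)
          - h (X + c * b) * (F (X + c * b - a * r (b - v)) * w (b - v))) := by
      ext X
      rw [e1, integral_sub (nK.slice X).intble (nK'.slice X).intble]
    rw [e2]
    have ni : Integrable (fun b => |w b| * (√(4 * (2 ^ i * (|a| * (L * δ)))) * l2 F)
        + |w b - w (b - v)| * l2 F) :=
      (hw.nice.abs.intble.mul_const _).add
        ((hw.nice.sub (hw.nice.comp_sub v)).abs.intble.mul_const _)
    refine (l2_integral_le (K := fun X b => h (X + c * b) * (F (X + c * b - a * r b) * w b)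
          - h (X + c * b) * (F (X + c * b - a * r (b - v)) * w (b - v))) (Nice.sub nK nK') ni
      fun b => ?_).trans ?_
    · set U : ℝ → ℝ := fun y => F (y - a * r b) - F (y - a * r (b - v))
      set V : ℝ → ℝ := fun y => F (y - a * r (b - v))
      have nU : Nice U := (hF.comp_sub _).sub (hF.comp_sub _)
      have nV : Nice V := hF.comp_sub _
      have e : (fun X => h (X + c * b) * (F (X + c * b - a * r b) * w b)
          - h (X + c * b) * (F (X + c * b - a * r (b - v)) * w (b - v)))
          = fun X => w b * (h (X + c * b) * U (X + c * b))
            + (w b - w (b - v)) * (h (X + c * b) * V (X + c * b)) := by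
        ext X; simp only [U, V]; ring
      have nhU : Nice (fun X => h (X + c * b) * U (X + c * b)) := (hh.mul nU).comp_add _
      have nhV : Nice (fun X => h (X + c * b) * V (X + c * b)) := (hh.mul nV).comp_add _
      rw [e]
      refine (l2_add_le (nhU.const_mul _) (nhV.const_mul _)).trans ?_
      rw [l2_const_mul, l2_const_mul]
      refine add_le_add (mul_le_mul_of_nonneg_left ?_ (abs_nonneg _))
        (mul_le_mul_of_nonneg_left ?_ (abs_nonneg _))
      · refine (l2_shear_le nU hh1 _).trans ?_
        have e3 : l2 U = l2 (fun y => F (y - (a * r b - a * r (b - v))) - F y) := by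
          rw [← l2_comp_sub (fun y => F (y - (a * r b - a * r (b - v))) - F y) (a * r (b - v))]
          congr 1; ext y
          simp only [U]; congr 2; ring
        rw [e3]
        refine abs_le_of_sq_le_sq' ?_ (by positivity [l2_nonneg F]) |>.2
        refine (l2_translate_sub_sq_le hF hi _).trans ?_
        rw [mul_pow, Real.sq_sqrt (by positivity)]
        refine mul_le_mul_of_nonneg_right ?_ (sq_nonneg _)
        refine mul_le_mul_of_nonneg_left ?_ (by norm_num)
        refine mul_le_mul_of_nonneg_left ?_ (by positivity)
        rw [← mul_sub, abs_mul]
        refine mul_le_mul_of_nonneg_left ?_ (abs_nonneg _)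
        refine (hrL _ _).trans (mul_le_mul_of_nonneg_left ?_ hL)
        rw [sub_sub_cancel, abs_of_nonneg hv0]; exact hv
      · exact (l2_shear_le nV hh1 _).trans (l2_comp_sub F _).le
    · rw [integral_add (hw.nice.abs.intble.mul_const _)
        ((hw.nice.sub (hw.nice.comp_sub v)).abs.intble.mul_const _), integral_mul_const,
        integral_mul_const]
      have h3 : ∫ b, |w b - w (b - v)| ≤ A * δ := by
        have := hw.var (-v)
        simp only [abs_neg, ← sub_eq_add_neg] at this
        simp only [abs_sub_comm (w _) (w (_ - v))]
        refine this.trans (mul_le_mul_of_nonneg_left ?_ hA)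
        rw [abs_of_nonneg hv0]; exact hv
      have h4 := hw.integral_abs_le
      have hF0 := l2_nonneg F
      calc _ ≤ 2 * A * (√(4 * (2 ^ i * (|a| * (L * δ)))) * l2 F) + A * δ * l2 F := by gcongr
        _ = _ := by ring
  have nu : Nice unitK := ker_unitK.nice
  have nC : Nice (cnv (-(c * δ)) unitK D) := nD.cnv nu _
  have eD : (fun X => D X - cnv (-(c * δ)) unitK D X)
      = fun X => ∫ τ, (D X - D (X + c * (δ * τ))) * unitK τ := by
    ext X
    have i1 : Integrable (fun τ => D X * unitK τ) := nu.intble.const_mul _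
    have i2 := integrable_cnv nu nD (-(c * δ)) X
    have : D X = ∫ τ, D X * unitK τ := by rw [integral_const_mul, integral_unitK, mul_one]
    rw [cnv]
    nth_rewrite 1 [this]
    rw [← integral_sub i1 i2]
    congr 1; ext τ
    rw [show X - -(c * δ) * τ = X + c * (δ * τ) by ring]; ring
  have lDC : l2 (fun X => D X - cnv (-(c * δ)) unitK D X)
      ≤ (2 * A * √(4 * (2 ^ i * (|a| * (L * δ)))) + A * δ) * l2 F := by
    rw [eD]
    set M := (2 * A * √(4 * (2 ^ i * (|a| * (L * δ)))) + A * δ) * l2 F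
    have n1 : Nice2 (fun X τ => D X * unitK τ) := by
      have := nice_shear_ker nu nD 0
      simpa [Nice2] using this
    have n2 : Nice2 (fun X τ => D (X - -(c * δ) * τ) * unitK τ) := nice_shear_ker nu nD _
    have n3 : Nice2 (fun X τ => (D X - D (X + c * (δ * τ))) * unitK τ) := by
      refine (congrArg Nice (funext fun p => ?_)).mp (Nice.sub n1 n2)
      dsimp only
      rw [show p.1 - -(c * δ) * p.2 = p.1 + c * (δ * p.2) by ring]; ring
    refine (l2_integral_le (K := fun X τ => (D X - D (X + c * (δ * τ))) * unitK τ) n3 (w := fun τ => M * unitK τ) (nu.intble.const_mul _)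
      fun τ => ?_).trans ?_
    · have e : (fun X => (D X - D (X + c * (δ * τ))) * unitK τ)
          = fun X => unitK τ * (D X - D (X + c * (δ * τ))) := by ext X; ring
      rw [e, l2_const_mul]
      by_cases hτ : τ ∈ Icc (0:ℝ) 1
      · have : unitK τ = 1 := by rw [unitK, indicator_of_mem hτ]
        rw [this, abs_one, one_mul, mul_one]
        exact trans _ (mul_nonneg hδ hτ.1) (mul_le_of_le_one_right hδ hτ.2)
      · have : unitK τ = 0 := by rw [unitK, indicator_of_notMem hτ]
        rw [this]; simp
    · rw [integral_const_mul, integral_unitK, mul_one]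
  have nCG : Nice (cnv (c * δ) unitK G) := hG.cnv nu _
  have split : ∫ X, G X * D X = (∫ X, cnv (c * δ) unitK G X * D X)
      + ∫ X, G X * (D X - cnv (-(c * δ)) unitK D X) := by
    rw [cnv_adj nu hG nD, ← integral_add (hG.mul nC).intble (hG.mul (nD.sub nC)).intble]
    congr 1; ext X; ring
  rw [eT, split]
  refine (abs_add_le _ _).trans (add_le_add ?_ ?_)
  · refine (abs_integral_mul_le nCG nD).trans ?_
    rw [mul_comm]
    exact mul_le_mul_of_nonneg_right lD (l2_nonneg _)
  · refine (abs_integral_mul_le hG (nD.sub nC)).trans ?_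
    rw [mul_comm]
    exact mul_le_mul_of_nonneg_right lDC (l2_nonneg _)

end freeze

theorem rho_eq_xi_pow : rho = xi ^ 20 := by
  rw [rho, show (1 / 2 : ℝ) = (xi ^ 20) ^ 2 by rw [← pow_mul, ← xi_pow], Real.sqrt_sq]
  exact pow_nonneg xi_pos.le _

theorem rho_le_xi : rho ≤ xi := by
  rw [rho_eq_xi_pow]
  exact pow_le_of_le_one xi_pos.le xi_lt_one.le (by norm_num)

theorem half_le_xi_pow {n : ℕ} (hn : n ≤ 40) : 1 / 2 ≤ xi ^ n := by
  rw [← xi_pow]; exact pow_le_pow_of_le_one xi_pos.le xi_lt_one.le hn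

theorem xi_pow_le_of_le_add {m n p : ℕ} (hp : p ≤ 40) (h : n ≤ m + p) : xi ^ m ≤ 2 * xi ^ n := by
  have h1 : xi ^ m * xi ^ p ≤ xi ^ n := by
    rw [← pow_add]; exact pow_le_pow_of_le_one xi_pos.le xi_lt_one.le h
  have h2 := half_le_xi_pow hp
  have h3 := pow_pos xi_pos m
  nlinarith

theorem half_pow_le_xi_pow (n : ℕ) : (1 / 2 : ℝ) ^ n ≤ xi ^ n :=
  (half_pow_le_rho_pow n).trans (pow_le_pow_left₀ rho_pos.le rho_le_xi n)

/-- The trilinear form along the curve with averages at scale `2⁻ʲ` and `2⁻ᵈʲ` subtracted. -/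
noncomputable def errForm (d j : ℕ) (a c : ℝ) (h F G : ℝ → ℝ) : ℝ :=
  biForm (invW d) h (fun x b => F (x - a * root d b) - dyE j F x)
    (fun x b => G (x - c * b) - dyE (d * j) G x)

section errForm

variable {d j : ℕ} {a c : ℝ} {h F G : ℝ → ℝ}

theorem nice_invW (d : ℕ) : Nice (invW d) := (ker_invW d).choose_spec.nice

theorem measurable_root (d : ℕ) : Measurable (root d) := (continuous_root d).measurable

theorem errForm_eq (hd : d ≠ 0) (hh : Nice h) (hF : Nice F) (hG : Nice G) (a c : ℝ) :
    errForm d j a c h F G = tauForm d a c h F G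
      - (∫ x, h x * (dyE j F x * cnv c (invW d) G x))
      - (∫ x, h x * (dyE (d * j) G x * cnv a tauK F x))
      + (∫ b, invW d b) * ∫ x, h x * (dyE j F x * dyE (d * j) G x) := by
  have hw := nice_invW d
  have s1 := hF.slc_translate (measurable_root d) a
  have s2 := (hF.dyE j).slc_const
  have s3 : Slc (fun x b => G (x - c * b)) := hG.slc_translate measurable_id c
  have s4 := (hG.dyE (d * j)).slc_const
  have e1 : biForm (invW d) h (fun x b => F (x - a * root d b)) (fun x _ => dyE (d * j) G x)
      = ∫ x, h x * (dyE (d * j) G x * cnv a tauK F x) := by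
    rw [biForm]
    congr 1; ext x
    rw [cnv_tauK_eq hd, ← integral_const_mul (dyE (d * j) G x)]
    congr 2; ext b; ring
  have e2 : biForm (invW d) h (fun x _ => dyE j F x) (fun x _ => dyE (d * j) G x)
      = (∫ b, invW d b) * ∫ x, h x * (dyE j F x * dyE (d * j) G x) := by
    rw [biForm, ← integral_const_mul]
    congr 1; ext x
    rw [integral_const_mul]; ring
  rw [errForm, biForm_sub_left hw hh s1 s2 (s3.sub s4), biForm_sub_right hw hh s1 s3 s4,
    biForm_sub_right hw hh s2 s3 s4, ← tauForm_eq_biForm hd, cnv_eq_biForm, e1, e2]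
  ring

theorem abs_integral_mul_mul_le {P Q : ℝ → ℝ} (hh : Nice h) (hh1 : ∀ x, |h x| ≤ 1) (hP : Nice P) (hQ : Nice Q) :
    |∫ x, h x * (P x * Q x)| ≤ l2 P * l2 Q := by
  have e : ∫ x, h x * (P x * Q x) = ∫ x, (h x * P x) * Q x := by congr 1; ext x; ring
  rw [e]
  refine (abs_integral_mul_le (hh.mul hP) hQ).trans ?_
  refine mul_le_mul_of_nonneg_right (l2_mono hP fun x => ?_) (l2_nonneg _)
  rw [abs_mul]
  exact mul_le_of_le_one_left (abs_nonneg _) (hh1 x)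

theorem mem_of_invW_ne_zero {b : ℝ} (hb : invW d b ≠ 0) : b ∈ Icc (1 / 2 ^ d : ℝ) 1 := by
  by_contra h
  exact hb (by rw [invW, indicator_of_notMem h])

theorem l2_sub_dyE_le_two (hF : Nice F) (u : ℝ) :
    l2 (fun x => F (x - u) - dyE j F x) ≤ 2 * l2 F := by
  refine (l2_sub_le (hF.comp_sub u) (hF.dyE j)).trans ?_
  rw [l2_comp_sub]
  linarith [l2_dyE_le hF j]

theorem abs_errForm_le_of_coarse_left (hd : d ≠ 0) {i : ℕ} (hij : i ≤ j) (ha : |a| = (2 ^ j)⁻¹)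
    (hh : Nice h) (hh1 : ∀ x, |h x| ≤ 1) (hF : Nice F) (hi : Lvl i F) (hG : Nice G) {A : ℝ}
    (hw : Ker A (invW d)) :
    |errForm d j a c h F G| ≤ 8 * A * rho ^ (j - i) * (l2 F * l2 G) := by
  have hF0 := l2_nonneg F
  have hG0 := l2_nonneg G
  have hr := rho_pos
  have := abs_biForm_le hw.nice hh hh1
    ((hF.slc_translate (measurable_root d) a).sub (hF.dyE j).slc_const)
    ((hG.slc_translate measurable_id c).sub (hG.dyE (d * j)).slc_const)
    (p := 2 * rho ^ (j - i) * l2 F) (q := 2 * l2 G) (fun b hb => ?_)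
    (fun b _ => l2_sub_dyE_le_two hG _)
  · refine this.trans ?_
    refine (mul_le_mul_of_nonneg_right hw.integral_abs_le (by positivity)).trans (le_of_eq (by ring))
  · rw [dyE_eq_of_lvl (hi.mono hij)]
    refine l2_translate_sub_le hij hF hi ?_
    have h1 := half_le_root hd b
    rw [abs_mul, ha, abs_of_nonneg (by linarith)]
    exact mul_le_of_le_one_right (by positivity) (root_le_one hd (mem_of_invW_ne_zero hb).2)

theorem abs_errForm_le_of_coarse_right {l : ℕ} (hlj : l ≤ d * j) (hc : |c| = (2 ^ (d * j))⁻¹)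
    (hh : Nice h) (hh1 : ∀ x, |h x| ≤ 1) (hF : Nice F) (hl : Lvl l G) (hG : Nice G) {A : ℝ}
    (hw : Ker A (invW d)) :
    |errForm d j a c h F G| ≤ 8 * A * rho ^ (d * j - l) * (l2 F * l2 G) := by
  have hF0 := l2_nonneg F
  have hG0 := l2_nonneg G
  have hr := rho_pos
  have := abs_biForm_le hw.nice hh hh1
    ((hF.slc_translate (measurable_root d) a).sub (hF.dyE j).slc_const)
    ((hG.slc_translate measurable_id c).sub (hG.dyE (d * j)).slc_const)
    (p := 2 * l2 F) (q := 2 * rho ^ (d * j - l) * l2 G) (fun b hb => l2_sub_dyE_le_two hF _)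
    (fun b hb => ?_)
  · refine this.trans ?_
    refine (mul_le_mul_of_nonneg_right hw.integral_abs_le (by positivity)).trans (le_of_eq (by ring))
  · rw [dyE_eq_of_lvl (hl.mono hlj)]
    refine l2_translate_sub_le hlj hG hl ?_
    have h1 := mem_of_invW_ne_zero hb
    have h0 : 0 ≤ b := le_trans (by positivity) h1.1
    rw [abs_mul, hc, id, abs_of_nonneg h0]
    exact mul_le_of_le_one_right (by positivity) h1.2

/-- Decay of the error form in the frequency of the first function. -/
theorem exists_errForm_le_left (hd : 2 ≤ d) : ∃ (C : ℝ) (j₀ : ℕ), 0 < C ∧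
    ∀ (j i : ℕ) (a c : ℝ) (h f G : ℝ → ℝ), j₀ ≤ j → |a| = (2 ^ j)⁻¹ → |c| = (2 ^ (d * j))⁻¹ →
      Nice h → (∀ x, |h x| ≤ 1) → Nice f → Nice G →
      |errForm d j a c h (dyD i f) G| ≤ C * xi ^ dd i j * (l2 (dyD i f) * l2 G) := by
  obtain ⟨C, j₀, hC, H⟩ := exists_tauForm_le hd
  obtain ⟨A, hw⟩ := ker_invW d
  obtain ⟨A', hk⟩ := ker_tauK
  have hA := hw.nonneg
  have hA' := hk.nonneg
  have hx := xi_pos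
  refine ⟨8 * A + 2 * C + 4 * A' + 1, j₀, by positivity, fun j i a c h f G hj ha hc hh hh1 hf hG => ?_⟩
  have hF := hf.dyD i
  have hF0 := l2_nonneg (dyD i f)
  have hG0 := l2_nonneg G
  rcases le_or_gt i j with hij | hij
  · refine (abs_errForm_le_of_coarse_left (by omega) hij ha hh hh1 hF (lvl_dyD i f) hG hw).trans ?_
    refine mul_le_mul_of_nonneg_right ?_ (by positivity)
    have e : dd i j = j - i := by unfold dd; omega
    rw [e]
    refine mul_le_mul ?_ (pow_le_pow_left₀ rho_pos.le rho_le_xi _) (pow_nonneg rho_pos.le _)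
      (by positivity)
    linarith
  · have z1 : dyE j (dyD i f) = fun _ => 0 := dyE_dyD_of_lt hij hf
    have z2 : dyE (i - 1) (dyD i f) = fun _ => 0 := dyE_dyD_of_lt (by omega) hf
    have e : j + (i - 1 - j) = i - 1 := by omega
    have b1 := H j (i - 1 - j) i a c h (dyD i f) G hj (by rw [ha, one_div_pow, one_div])
      (by rw [hc, one_div_pow, one_div]) hh hh1 hF (lvl_dyD i f) (fun x => by rw [e, z2]) hG
    have b2 := l2_cnv_le_of_dyE_eq_zero hk hF (ne_zero_of_abs ha) z2
    rw [inv_two_pow_div (by omega) ha] at b2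
    have b3 := abs_integral_mul_mul_le hh hh1 (hG.dyE (d * j)) (hF.cnv hk.nice a)
    have b4 := l2_dyE_le hG (d * j)
    have p1 : xi ^ (i - 1 - j) ≤ 2 * xi ^ dd i j :=
      xi_pow_le_of_le_add (p := 1) (by norm_num) (by unfold dd; omega)
    have p2 := half_pow_le_xi_pow (i - 1 - j)
    rw [errForm_eq (by omega) hh hF hG, z1]
    simp only [zero_mul, mul_zero, integral_zero, sub_zero, add_zero]
    refine (abs_sub _ _).trans ?_
    have hX := pow_pos hx (dd i j)
    have hz := l2_nonneg (cnv a tauK (dyD i f))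
    calc |tauForm d a c h (dyD i f) G| + |∫ x, h x * (dyE (d * j) G x * cnv a tauK (dyD i f) x)|
        ≤ C * xi ^ (i - 1 - j) * (l2 (dyD i f) * l2 G)
          + l2 G * (2 * (A' * xi ^ (i - 1 - j)) * l2 (dyD i f)) := by
          refine add_le_add b1 (b3.trans (mul_le_mul b4 (b2.trans ?_) hz hG0))
          gcongr
      _ = (C + 2 * A') * xi ^ (i - 1 - j) * (l2 (dyD i f) * l2 G) := by ring
      _ ≤ (C + 2 * A') * (2 * xi ^ dd i j) * (l2 (dyD i f) * l2 G) := by gcongr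
      _ = (2 * C + 4 * A') * xi ^ dd i j * (l2 (dyD i f) * l2 G) := by ring
      _ ≤ _ := by
        refine mul_le_mul_of_nonneg_right (mul_le_mul_of_nonneg_right ?_ hX.le) (by positivity)
        linarith

theorem abs_tauForm_freeze_le (hd : d ≠ 0) {A : ℝ} (hw : Ker A (invW d)) (hh : Nice h)
    (hh1 : ∀ x, |h x| ≤ 1) {i s k q m : ℕ} (ha : |a| = (2 ^ j)⁻¹) (hc : |c| = (2 ^ s)⁻¹)
    (hF : Nice F) (hi : Lvl i F) (hG : Nice G) (hz : dyE (s + k) G = fun _ => 0) (him : i ≤ j + m)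
    (hm : m + 2 * q ≤ k) :
    |tauForm d a c h F G| ≤ (17 * A + 4 * A * √(2 ^ d)) * rho ^ q * (l2 F * l2 G) := by
  have hA := hw.nonneg
  have hF0 := l2_nonneg F
  have hG0 := l2_nonneg G
  have hr := pow_pos rho_pos q
  set p := k - q with hp
  have key := abs_biForm_freeze_le hw hh hh1 (measurable_root d) (root_lip hd) hF hi hG a c
    (δ := (2 ^ p)⁻¹) (by positivity)
  rw [← tauForm_eq_biForm hd] at key
  have hcp : |c * (2 ^ p)⁻¹| = (2 ^ (s + p))⁻¹ := by
    rw [abs_mul, hc, abs_of_nonneg (by positivity : (0:ℝ) ≤ (2 ^ p)⁻¹), pow_add, mul_inv]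
  have b1 := l2_cnv_le_of_dyE_eq_zero ker_unitK hG (ne_zero_of_abs hcp) hz
  rw [inv_two_pow_div (by omega) hcp, show s + k - (s + p) = q by omega] at b1
  have b2 := half_pow_le_rho_pow q
  have b3 : √(4 * (2 ^ i * (|a| * (2 ^ d * (2 ^ p)⁻¹)))) ≤ 2 * √(2 ^ d) * rho ^ q := by
    refine Real.sqrt_le_iff.2 ⟨by positivity, ?_⟩
    rw [mul_pow, mul_pow, Real.sq_sqrt (by positivity), ← pow_mul, mul_comm q, pow_mul, rho_sq, ha]
    have h1 : (2:ℝ) ^ i * ((2 ^ j)⁻¹ * (2 ^ p)⁻¹) ≤ (1 / 2) ^ q := by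
      rw [← mul_inv, ← pow_add, one_div, inv_pow, ← div_eq_mul_inv, div_le_iff₀ (by positivity),
        inv_mul_eq_div, le_div_iff₀ (by positivity), ← pow_add]
      exact pow_le_pow_right₀ (by norm_num) (by omega)
    have h2 : (0:ℝ) < 2 ^ d := by positivity
    nlinarith
  have b4 : ((2:ℝ) ^ p)⁻¹ ≤ rho ^ q := by
    refine le_trans ?_ b2
    rw [one_div, inv_pow]
    exact inv_anti₀ (by positivity) (pow_le_pow_right₀ (by norm_num) (by omega))
  refine key.trans ?_
  calc _ ≤ 2 * A * l2 F * (2 * (4 * rho ^ q) * l2 G)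
        + (2 * A * (2 * √(2 ^ d) * rho ^ q) + A * rho ^ q) * l2 F * l2 G := by
        refine add_le_add (mul_le_mul_of_nonneg_left (b1.trans ?_) (by positivity)) ?_
        · gcongr
        · gcongr
    _ = _ := by ring

/-- Decay of the error form in the frequency of the second function. -/
theorem exists_errForm_le_right (hd : 2 ≤ d) : ∃ (C : ℝ) (j₀ : ℕ), 0 < C ∧
    ∀ (j i l : ℕ) (a c : ℝ) (h f g : ℝ → ℝ), j₀ ≤ j → |a| = (2 ^ j)⁻¹ → |c| = (2 ^ (d * j))⁻¹ →
      Nice h → (∀ x, |h x| ≤ 1) → Nice f → Nice g →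
      |errForm d j a c h (dyD i f) (dyD l g)|
        ≤ C * √xi ^ dd l (d * j) * (l2 (dyD i f) * l2 (dyD l g)) := by
  obtain ⟨C, j₀, hC, H⟩ := exists_errForm_le_left hd
  obtain ⟨A, hw⟩ := ker_invW d
  have hA := hw.nonneg
  have hx := xi_pos
  have hs0 : 0 < √xi := Real.sqrt_pos.2 hx
  have hs1 : √xi ≤ 1 := Real.sqrt_le_one.2 xi_lt_one.le
  have hs2 : √xi ^ 2 = xi := Real.sq_sqrt hx.le
  have hxs : xi ≤ √xi := by
    have : √xi ^ 2 ≤ √xi := pow_le_of_le_one hs0.le hs1 (by norm_num)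
    rwa [hs2] at this
  refine ⟨8 * A + C + 2 * (17 * A + 4 * A * √(2 ^ d)) + 4 * A + 1, j₀, by positivity,
    fun j i l a c h f g hj ha hc hh hh1 hf hg => ?_⟩
  have hF := hf.dyD i
  have hG := hg.dyD l
  have hF0 := l2_nonneg (dyD i f)
  have hG0 := l2_nonneg (dyD l g)
  have hX := pow_pos hs0 (dd l (d * j))
  rcases le_or_gt l (d * j) with hlj | hlj
  · refine (abs_errForm_le_of_coarse_right hlj hc hh hh1 hF (lvl_dyD l g) hG hw).trans ?_
    refine mul_le_mul_of_nonneg_right ?_ (by positivity)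
    have e : dd l (d * j) = d * j - l := by unfold dd; omega
    rw [e]
    refine mul_le_mul ?_ (pow_le_pow_left₀ rho_pos.le (rho_le_xi.trans hxs) _)
      (pow_nonneg rho_pos.le _) (by positivity)
    have := Real.sqrt_nonneg (2 ^ d)
    nlinarith [mul_nonneg hA this]
  have ek : dd l (d * j) = l - d * j := by unfold dd; omega
  rcases lt_or_ge (l - d * j) (2 * (i - j)) with hk | hk
  · refine (H j i a c h f (dyD l g) hj ha hc hh hh1 hf hG).trans ?_
    refine mul_le_mul_of_nonneg_right ?_ (by positivity)
    refine mul_le_mul ?_ ?_ (by positivity) (by positivity)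
    · nlinarith [mul_nonneg hA (Real.sqrt_nonneg (2 ^ d))]
    · have e : xi ^ dd i j = √xi ^ (2 * dd i j) := by rw [pow_mul, hs2]
      rw [e]
      refine pow_le_pow_of_le_one hs0.le hs1 ?_
      unfold dd; omega
  · have z1 : dyE (d * j) (dyD l g) = fun _ => 0 := dyE_dyD_of_lt hlj hg
    have z2 : dyE (l - 1) (dyD l g) = fun _ => 0 := dyE_dyD_of_lt (by omega) hg
    set k := l - 1 - d * j with hkdef
    have e : d * j + k = l - 1 := by omega
    have b1 := abs_tauForm_freeze_le (k := k) (q := k / 4) (m := i - j) (by omega : d ≠ 0) hw hh hh1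
      ha hc hF (lvl_dyD i f) hG (by rw [e, z2]) (by omega) (by omega)
    have b2 := l2_cnv_le_of_dyE_eq_zero hw hG (ne_zero_of_abs hc) z2
    rw [inv_two_pow_div (by omega) hc] at b2
    have b3 := abs_integral_mul_mul_le hh hh1 (hF.dyE j) (hG.cnv hw.nice c)
    have b4 := l2_dyE_le hF j
    have p0 : xi ^ (l - d * j) ≤ √xi ^ dd l (d * j) := by
      rw [ek]; exact pow_le_pow_left₀ hx.le hxs _
    have p1 : rho ^ (k / 4) ≤ 2 * √xi ^ dd l (d * j) := by
      rw [rho_eq_xi_pow, ← pow_mul]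
      exact (xi_pow_le_of_le_add (p := 4) (n := l - d * j) (by norm_num) (by omega)).trans (by linarith)
    have p2 : (1 / 2 : ℝ) ^ (l - 1 - d * j) ≤ 2 * √xi ^ dd l (d * j) :=
      (half_pow_le_xi_pow _).trans ((xi_pow_le_of_le_add (p := 1) (n := l - d * j)
        (by norm_num) (by omega)).trans (by linarith))
    rw [errForm_eq (by omega) hh hF hG, z1]
    simp only [zero_mul, mul_zero, integral_zero, sub_zero, add_zero]
    refine (abs_sub _ _).trans ?_
    have hz := l2_nonneg (cnv c (invW d) (dyD l g))
    set X := √xi ^ dd l (d * j)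
    calc _ ≤ (17 * A + 4 * A * √(2 ^ d)) * (2 * X) * (l2 (dyD i f) * l2 (dyD l g))
          + l2 (dyD i f) * (2 * (A * (2 * X)) * l2 (dyD l g)) := by
          refine add_le_add (b1.trans ?_) (b3.trans (mul_le_mul b4 (b2.trans ?_) hz hF0))
          · gcongr
          · gcongr
      _ = (2 * (17 * A + 4 * A * √(2 ^ d)) + 4 * A) * X * (l2 (dyD i f) * l2 (dyD l g)) := by ring
      _ ≤ _ := by
        refine mul_le_mul_of_nonneg_right (mul_le_mul_of_nonneg_right ?_ hX.le) (by positivity)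
        linarith

/-- Almost orthogonality of the error form. -/
theorem exists_errForm_le (hd : 2 ≤ d) : ∃ (C θ : ℝ) (j₀ : ℕ), 0 < C ∧ 0 < θ ∧ θ < 1 ∧
    ∀ (j i l : ℕ) (a c : ℝ) (h f g : ℝ → ℝ), j₀ ≤ j → |a| = (2 ^ j)⁻¹ → |c| = (2 ^ (d * j))⁻¹ →
      Nice h → (∀ x, |h x| ≤ 1) → Nice f → Nice g →
      |errForm d j a c h (dyD i f) (dyD l g)|
        ≤ C * ((θ ^ dd i j * l2 (dyD i f)) * (θ ^ dd l (d * j) * l2 (dyD l g))) := by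
  obtain ⟨C₁, j₁, hC₁, H₁⟩ := exists_errForm_le_left hd
  obtain ⟨C₂, j₂, hC₂, H₂⟩ := exists_errForm_le_right hd
  have hs0 : 0 < √xi := Real.sqrt_pos.2 xi_pos
  have hs1 : √xi < 1 := by rw [Real.sqrt_lt' one_pos]; simpa using xi_lt_one
  have hs2 : √xi ^ 2 = xi := Real.sq_sqrt xi_pos.le
  have hxs : xi ≤ √xi := by
    have : √xi ^ 2 ≤ √xi := pow_le_of_le_one hs0.le hs1.le (by norm_num)
    rwa [hs2] at this
  have ht0 : 0 < √(√xi) := Real.sqrt_pos.2 hs0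
  have ht1 : √(√xi) < 1 := by rw [Real.sqrt_lt' one_pos]; simpa using hs1
  have ht2 : ∀ n, (√(√xi) ^ n) ^ 2 = √xi ^ n := fun n => by
    rw [← pow_mul, mul_comm, pow_mul, Real.sq_sqrt hs0.le]
  refine ⟨max C₁ C₂, √(√xi), max j₁ j₂, lt_max_of_lt_left hC₁, ht0, ht1,
    fun j i l a c h f g hj ha hc hh hh1 hf hg => ?_⟩
  have hF0 := l2_nonneg (dyD i f)
  have hG0 := l2_nonneg (dyD l g)
  have hM : 0 ≤ max C₁ C₂ := le_max_of_le_left hC₁.le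
  have h1 := H₁ j i a c h f (dyD l g) (le_of_max_le_left hj) ha hc hh hh1 hf (hg.dyD l)
  have h2 := H₂ j i l a c h f g (le_of_max_le_right hj) ha hc hh hh1 hf hg
  have := le_mul_of_le_sq (C := max C₁ C₂ * (l2 (dyD i f) * l2 (dyD l g)))
    (x := |errForm d j a c h (dyD i f) (dyD l g)|) (a := √(√xi) ^ dd i j)
    (b := √(√xi) ^ dd l (d * j)) (by positivity) (by positivity) (by positivity) ?_ ?_
  · exact this.trans (le_of_eq (by ring))
  · rw [ht2]
    refine h1.trans ?_
    have q1 : xi ^ dd i j ≤ √xi ^ dd i j := pow_le_pow_left₀ xi_pos.le hxs _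
    calc C₁ * xi ^ dd i j * (l2 (dyD i f) * l2 (dyD l g))
        ≤ max C₁ C₂ * √xi ^ dd i j * (l2 (dyD i f) * l2 (dyD l g)) := by
          refine mul_le_mul_of_nonneg_right (mul_le_mul (le_max_left _ _) q1
            (pow_nonneg xi_pos.le _) hM) (by positivity)
      _ = _ := by ring
  · rw [ht2]
    refine h2.trans ?_
    calc C₂ * √xi ^ dd l (d * j) * (l2 (dyD i f) * l2 (dyD l g))
        ≤ max C₁ C₂ * √xi ^ dd l (d * j) * (l2 (dyD i f) * l2 (dyD l g)) := by
          refine mul_le_mul_of_nonneg_right (mul_le_mul_of_nonneg_right (le_max_right _ _)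
            (by positivity)) (by positivity)
      _ = _ := by ring

end errForm

theorem sum_mul_le_of_sum_sq_le {ι : Type*} (s : Finset ι) {u v : ι → ℝ} {U V : ℝ} (hU : 0 ≤ U)
    (hV : 0 ≤ V) (hu : ∑ i ∈ s, u i ^ 2 ≤ U ^ 2) (hv : ∑ i ∈ s, v i ^ 2 ≤ V ^ 2) :
    ∑ i ∈ s, u i * v i ≤ U * V :=
  (Real.sum_mul_le_sqrt_mul_sqrt s u v).trans (mul_le_mul (Real.sqrt_le_iff.2 ⟨hU, hu⟩)
    (Real.sqrt_le_iff.2 ⟨hV, hv⟩) (Real.sqrt_nonneg _) hU)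

theorem biForm_sum_left {ι : Type*} (s : Finset ι) {w h : ℝ → ℝ} {P : ι → ℝ → ℝ → ℝ}
    {Q : ℝ → ℝ → ℝ} (hw : Nice w) (hh : Nice h) (hP : ∀ i ∈ s, Slc (P i)) (hQ : Slc Q) :
    biForm w h (fun x b => ∑ i ∈ s, P i x b) Q = ∑ i ∈ s, biForm w h (P i) Q := by
  have n := fun i hi => nice2_biForm hw hh (hP i hi) hQ
  simp only [biForm_eq]
  rw [← integral_finsetSum s fun i hi => (n i hi).int.intble]
  congr 1; ext x
  rw [← integral_finsetSum s fun i hi => ((n i hi).slice x).intble]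
  congr 1; ext b
  rw [Finset.sum_mul, Finset.sum_mul, Finset.mul_sum]

section

variable {d j : ℕ} {a c : ℝ} {h F G : ℝ → ℝ}

theorem errForm_sum_left {ι : Type*} (s : Finset ι) {f : ι → ℝ → ℝ} (hh : Nice h)
    (hf : ∀ i ∈ s, Nice (f i)) (hG : Nice G) (a c : ℝ) :
    errForm d j a c h (fun x => ∑ i ∈ s, f i x) G = ∑ i ∈ s, errForm d j a c h (f i) G := by
  have n2 : Slc (fun x b => G (x - c * b) - dyE (d * j) G x) :=
    (hG.slc_translate measurable_id c).sub (hG.dyE (d * j)).slc_const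
  unfold errForm
  rw [← biForm_sum_left s (nice_invW d) hh
    (fun i hi => ((hf i hi).slc_translate (measurable_root d) a).sub ((hf i hi).dyE j).slc_const) n2]
  congr 1; ext x b
  rw [dyE_sum s hf, Finset.sum_sub_distrib]

theorem errForm_sum_right {ι : Type*} (s : Finset ι) {g : ι → ℝ → ℝ} (hh : Nice h)
    (hg : ∀ i ∈ s, Nice (g i)) (hF : Nice F) (a c : ℝ) :
    errForm d j a c h F (fun x => ∑ i ∈ s, g i x) = ∑ i ∈ s, errForm d j a c h F (g i) := by
  have n2 : ∀ i ∈ s, Slc (fun x b => g i (x - c * b) - dyE (d * j) (g i) x) := fun i hi =>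
    ((hg i hi).slc_translate measurable_id c).sub ((hg i hi).dyE (d * j)).slc_const
  unfold errForm
  simp only [biForm_comm (invW d) h (fun x b => F (x - a * root d b) - dyE j F x)]
  rw [← biForm_sum_left s (nice_invW d) hh n2
    ((hF.slc_translate (measurable_root d) a).sub (hF.dyE j).slc_const)]
  congr 1; ext x b
  rw [dyE_sum s hg, Finset.sum_sub_distrib]

theorem eq_sum_dyD {N : ℕ} {f : ℝ → ℝ} (hN : Lvl N f) :
    f = fun x => ∑ i ∈ Finset.range (N + 1), dyD i f x := by
  ext x; rw [sum_dyD, dyE_eq_of_lvl hN]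

theorem sum_l2_dyD_sq_of_lvl {N : ℕ} {f : ℝ → ℝ} (hf : Nice f) (hN : Lvl N f) :
    ∑ i ∈ Finset.range (N + 1), l2 (dyD i f) ^ 2 = l2 f ^ 2 := by
  rw [sum_l2_dyD_sq hf, dyE_eq_of_lvl hN]

/-- The error forms are summable over the scales. -/
theorem exists_sum_errForm_le (hd : 2 ≤ d) : ∃ (C : ℝ) (j₀ : ℕ), 0 < C ∧
    ∀ (N J : ℕ) (a c : ℕ → ℝ) (h f g : ℝ → ℝ), (∀ j, |a j| = (2 ^ j)⁻¹) →
      (∀ j, |c j| = (2 ^ (d * j))⁻¹) → Nice h → (∀ x, |h x| ≤ 1) → Nice f → Nice g →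
      Lvl N f → Lvl N g →
      ∑ j ∈ Finset.Ico j₀ J, |errForm d j (a j) (c j) h f g| ≤ C * (l2 f * l2 g) := by
  obtain ⟨C, θ, j₀, hC, hθ0, hθ1, H⟩ := exists_errForm_le hd
  have hS : 0 < 2 / (1 - θ) := div_pos two_pos (by linarith)
  refine ⟨C * (2 / (1 - θ)) ^ 2, j₀, by positivity,
    fun N J a c h f g ha hc hh hh1 hf hg hNf hNg => ?_⟩
  have key : ∀ j ∈ Finset.Ico j₀ J, |errForm d j (a j) (c j) h f g|
      ≤ C * ((∑ i ∈ Finset.range (N + 1), θ ^ dd i j * l2 (dyD i f))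
        * ∑ l ∈ Finset.range (N + 1), θ ^ dd l (d * j) * l2 (dyD l g)) := by
    intro j hj
    have e : errForm d j (a j) (c j) h f g = ∑ i ∈ Finset.range (N + 1), ∑ l ∈ Finset.range (N + 1),
        errForm d j (a j) (c j) h (dyD i f) (dyD l g) := by
      conv_lhs => rw [eq_sum_dyD hNf, eq_sum_dyD hNg]
      rw [errForm_sum_left _ hh (fun i _ => hf.dyD i) (Nice.sum _ fun l _ => hg.dyD l)]
      exact Finset.sum_congr rfl fun i _ => errForm_sum_right _ hh (fun l _ => hg.dyD l) (hf.dyD i) _ _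
    rw [e, Finset.sum_mul_sum, Finset.mul_sum]
    refine (Finset.abs_sum_le_sum_abs _ _).trans (Finset.sum_le_sum fun i _ => ?_)
    rw [Finset.mul_sum]
    refine (Finset.abs_sum_le_sum_abs _ _).trans (Finset.sum_le_sum fun l _ => ?_)
    exact H j i l _ _ h f g (Finset.mem_Ico.1 hj).1 (ha j) (hc j) hh hh1 hf hg
  refine (Finset.sum_le_sum key).trans ?_
  rw [← Finset.mul_sum]
  have s1 := schur_dd hθ0.le hθ1 (Finset.range (N + 1)) (Finset.Ico j₀ J) id id
    (injOn_id _) (injOn_id _) fun i => l2 (dyD i f)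
  have s2 := schur_dd hθ0.le hθ1 (Finset.range (N + 1)) (Finset.Ico j₀ J) id (fun j => d * j)
    (injOn_id _) (fun x _ y _ hxy => Nat.eq_of_mul_eq_mul_left (by omega) hxy) fun i => l2 (dyD i g)
  rw [sum_l2_dyD_sq_of_lvl hf hNf, ← mul_pow] at s1
  rw [sum_l2_dyD_sq_of_lvl hg hNg, ← mul_pow] at s2
  have := sum_mul_le_of_sum_sq_le _ (mul_nonneg hS.le (l2_nonneg f)) (mul_nonneg hS.le (l2_nonneg g))
    s1 s2
  calc _ ≤ C * (2 / (1 - θ) * l2 f * (2 / (1 - θ) * l2 g)) := mul_le_mul_of_nonneg_left this hC.le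
    _ = _ := by ring

end

/-- Pairing with a martingale difference moves the difference operator onto `h`. -/
theorem abs_integral_mul_mul_dyD_le {h U M Y : ℝ → ℝ} {r : ℕ} (hh : Nice h) (hU : Nice U)
    (hl : Lvl r U) (hM : Nice M) (hUM : ∀ x, |U x| ≤ M x) (hY : Nice Y) :
    |∫ x, h x * (U x * dyD (r + 1) Y x)|
      ≤ l2 (fun x => M x * dyD (r + 1) h x) * l2 (dyD (r + 1) Y) := by
  have hD := hY.dyD (r + 1)
  have e : ∫ x, h x * (U x * dyD (r + 1) Y x) = ∫ x, (U x * dyD (r + 1) h x) * dyD (r + 1) Y x := by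
    calc ∫ x, h x * (U x * dyD (r + 1) Y x)
        = ∫ x, (U x * h x) * dyD (r + 1) (dyD (r + 1) Y) x := by
          rw [dyD_dyD hY]; congr 1; ext x; ring
      _ = ∫ x, dyD (r + 1) (fun y => U y * h y) x * dyD (r + 1) Y x := by
          rw [dyD_selfadj (hU.mul hh) hD]
      _ = _ := by congr 1; ext x; rw [dyD_mul_of_lvl hl]
  rw [e]
  refine (abs_integral_mul_le (hU.mul (hh.dyD (r + 1))) hD).trans ?_
  refine mul_le_mul_of_nonneg_right (l2_mono (hM.mul (hh.dyD (r + 1))) fun x => ?_) (l2_nonneg _)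
  rw [abs_mul, abs_mul]
  exact mul_le_mul_of_nonneg_right ((hUM x).trans (le_abs_self _)) (abs_nonneg _)

theorem sum_l2_dyM_mul_dyD_sq_le {h f : ℝ → ℝ} (hh : Nice h) (hh1 : ∀ x, |h x| ≤ 1) (hf : Nice f)
    (R : ℕ) : ∑ r ∈ Finset.range R, l2 (fun x => dyM f r x * dyD (r + 1) h x) ^ 2
      ≤ (2 * l2 f) ^ 2 :=
  (sum_l2_mul_dyD_sq_le hh hh1 (fun r => hf.dyM r) (lvl_dyM f) (dyM_nonneg f)
    (fun r x => dyM_mono f (Nat.le_succ r) x) R).trans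
    (pow_le_pow_left₀ (l2_nonneg _) (l2_dyM_le hf R) 2)

theorem sum_l2_dyD_succ_sq_le {g : ℝ → ℝ} (hg : Nice g) (R : ℕ) :
    ∑ r ∈ Finset.range R, l2 (dyD (r + 1) g) ^ 2 ≤ l2 g ^ 2 := by
  have h1 := sum_l2_dyD_sq hg R
  rw [Finset.sum_range_succ'] at h1
  have h2 := pow_le_pow_left₀ (l2_nonneg _) (l2_dyE_le hg R) 2
  nlinarith [sq_nonneg (l2 (dyD 0 g))]

theorem dyD_sum {ι : Type*} (s : Finset ι) (r : ℕ) {f : ι → ℝ → ℝ} (hf : ∀ a ∈ s, Nice (f a)) :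
    dyD r (fun y => ∑ a ∈ s, f a y) = fun x => ∑ a ∈ s, dyD r (f a) x := by
  ext x
  cases r with
  | zero => exact dyE_sum s hf x
  | succ r => simp only [dyD, dyE_sum s hf, Finset.sum_sub_distrib]

/-- The constant in Schur's test with rate `vth`. -/
noncomputable def schurC : ℝ := 2 / (1 - vth)

theorem schurC_pos : 0 < schurC := div_pos two_pos (by linarith [vth_lt_one])

section

variable {A : ℝ} {k F : ℝ → ℝ} {N : ℕ} {c c' : ℕ → ℝ} {s : ℕ → ℕ}

theorem dif_eq_sum (hk : Ker A k) (hF : Nice F) (hN : Lvl N F) (c c' : ℝ) :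
    dif c c' k F = fun x => ∑ l ∈ Finset.range (N + 1), dif c c' k (dyD l F) x := by
  ext x
  conv_lhs => rw [eq_sum_dyD hN]
  exact dif_sum hk.nice _ (fun l _ => hF.dyD l) _ _ x

/-- The part of `F` seen at scale `2⁻ⁿ`. -/
noncomputable def tail (N : ℕ) (F : ℝ → ℝ) (n : ℕ) : ℝ :=
  ∑ l ∈ Finset.range (N + 1), vth ^ dd l n * l2 (dyD l F)

theorem l2_dyD_dif_le_tail (hk : Ker A k) (hF : Nice F) (hN : Lvl N F) {c c' : ℝ} {j : ℕ}
    (hc : |c| = (2 ^ j)⁻¹) (hc' : |c'| = (2 ^ j)⁻¹) (r : ℕ) :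
    l2 (dyD r (dif c c' k F)) ≤ 8 * A * (vth ^ dd j r * tail N F j) := by
  have n : ∀ l ∈ Finset.range (N + 1), Nice (dif c c' k (dyD l F)) :=
    fun l _ => (hF.dyD l).dif hk.nice c c'
  rw [dif_eq_sum hk hF hN, dyD_sum _ _ n, tail, Finset.mul_sum, Finset.mul_sum]
  refine (l2_sum_le _ fun l hl => (n l hl).dyD r).trans (Finset.sum_le_sum fun l _ => ?_)
  refine (l2_dyD_dif_dyD_le hk r l j hF hc hc').trans (le_of_eq ?_)
  rw [dd_comm r j]; ring

theorem sum_tail_sq_le (hF : Nice F) (hN : Lvl N F) (T : Finset ℕ) (hs : InjOn s T) :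
    ∑ j ∈ T, tail N F (s j) ^ 2 ≤ schurC ^ 2 * l2 F ^ 2 := by
  have := schur_dd vth_pos.le vth_lt_one (Finset.range (N + 1)) T id s (injOn_id _) hs
    fun l => l2 (dyD l F)
  rwa [sum_l2_dyD_sq_of_lvl hF hN] at this

theorem sum_sum_tail_sq_le (hF : Nice F) (hN : Lvl N F) (T : Finset ℕ) (hs : InjOn s T)
    (P : Finset ℕ) : ∑ r ∈ P, (∑ j ∈ T, vth ^ dd (s j) r * tail N F (s j)) ^ 2
      ≤ (schurC ^ 2 * l2 F) ^ 2 := by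
  have h1 := schur_dd vth_pos.le vth_lt_one T P s id hs (injOn_id _) fun j => tail N F (s j)
  have h2 := sum_tail_sq_le hF hN T hs
  refine h1.trans ((mul_le_mul_of_nonneg_left h2 (sq_nonneg _)).trans (le_of_eq ?_))
  rw [schurC]; ring

/-- Square function estimate for differences of averages. -/
theorem sum_sum_l2_dyD_dif_sq_le (hk : Ker A k) (hF : Nice F) (hN : Lvl N F) (T : Finset ℕ)
    (hs : InjOn s T) (hc : ∀ j, |c j| = (2 ^ s j)⁻¹) (hc' : ∀ j, |c' j| = (2 ^ s j)⁻¹)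
    (P : Finset ℕ) : ∑ r ∈ P, (∑ j ∈ T, l2 (dyD r (dif (c j) (c' j) k F))) ^ 2
      ≤ (8 * A * schurC ^ 2 * l2 F) ^ 2 := by
  have hA := hk.nonneg
  calc _ ≤ ∑ r ∈ P, (8 * A * ∑ j ∈ T, vth ^ dd (s j) r * tail N F (s j)) ^ 2 := by
        refine Finset.sum_le_sum fun r _ => pow_le_pow_left₀ (Finset.sum_nonneg fun j _ =>
          l2_nonneg _) ?_ 2
        rw [Finset.mul_sum]
        exact Finset.sum_le_sum fun j _ => l2_dyD_dif_le_tail hk hF hN (hc j) (hc' j) r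
    _ = (8 * A) ^ 2 * ∑ r ∈ P, (∑ j ∈ T, vth ^ dd (s j) r * tail N F (s j)) ^ 2 := by
        rw [Finset.mul_sum]; exact Finset.sum_congr rfl fun r _ => mul_pow _ _ _
    _ ≤ (8 * A) ^ 2 * (schurC ^ 2 * l2 F) ^ 2 :=
        mul_le_mul_of_nonneg_left (sum_sum_tail_sq_le hF hN T hs P) (sq_nonneg _)
    _ = _ := by ring

end

theorem sub_eq_sum_dyD {i n : ℕ} (h : i ≤ n) (f : ℝ → ℝ) (x : ℝ) :
    dyE n f x - dyE i f x = ∑ r ∈ Finset.Ico i n, dyD (r + 1) f x := by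
  simp only [dyD]
  exact (Finset.sum_Ico_sub (fun r => dyE r f x) h).symm

/-- The paraproduct with averages of `f` and differences of `g` at much finer scales. -/
theorem exists_low_high_le {d : ℕ} (hd : 2 ≤ d) : ∃ C : ℝ, 0 < C ∧
    ∀ (N j₀ J : ℕ) (c c' : ℕ → ℝ) (h f g : ℝ → ℝ), (∀ j, |c j| = (2 ^ (d * j))⁻¹) →
      (∀ j, |c' j| = (2 ^ (d * j))⁻¹) → Nice h → (∀ x, |h x| ≤ 1) → Nice f → Nice g → Lvl N g →
      |∑ j ∈ Finset.Ico j₀ J, ∫ x, h x * (dyE j f x * dif (c j) (c' j) (invW d) g x)|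
        ≤ C * (l2 f * l2 g) := by
  obtain ⟨A, hk⟩ := ker_invW d
  have hA := hk.nonneg
  have hr0 := rho_pos
  have hr1 := rho_lt_one
  have hS := schurC_pos
  have hr2 : 0 < (1 - rho)⁻¹ := inv_pos.2 (by linarith)
  refine ⟨8 * A + 8 * A * (1 - rho)⁻¹ + 16 * A * schurC ^ 2 + 1, by positivity,
    fun N j₀ J c c' h f g hc hc' hh hh1 hf hg hN => ?_⟩
  have hf0 := l2_nonneg f
  have hg0 := l2_nonneg g
  set T := Finset.Ico j₀ J with hT
  set W : ℕ → ℝ → ℝ := fun j => dif (c j) (c' j) (invW d) g with hW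
  have nW : ∀ j, Nice (W j) := fun j => hg.dif hk.nice _ _
  set R := d * J with hR
  have inj1 : InjOn (fun j => d * j) (T : Set ℕ) :=
    fun x _ y _ hxy => Nat.eq_of_mul_eq_mul_left (by omega) hxy
  have split : ∀ j ∈ T, ∫ x, h x * (dyE j f x * W j x)
      = (∫ x, h x * (dyE j f x * (W j x - dyE R (W j) x)))
        + (∫ x, h x * (dyE j f x * dyE j (W j) x))
        + ∑ r ∈ Finset.Ico j R, ∫ x, h x * (dyE j f x * dyD (r + 1) (W j) x) := by
    intro j hj
    have hjJ := (Finset.mem_Ico.1 hj).2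
    have hjR : j ≤ R := by nlinarith
    have n1 := (hh.mul ((hf.dyE j).mul ((nW j).sub ((nW j).dyE R)))).intble
    have n2 := (hh.mul ((hf.dyE j).mul ((nW j).dyE j))).intble
    have n3 : ∀ r ∈ Finset.Ico j R,
        Integrable (fun x => h x * (dyE j f x * dyD (r + 1) (W j) x)) := fun r _ =>
      (hh.mul ((hf.dyE j).mul ((nW j).dyD (r + 1)))).intble
    have n12 : Integrable (fun x => h x * (dyE j f x * (W j x - dyE R (W j) x))
        + h x * (dyE j f x * dyE j (W j) x)) := n1.add n2
    rw [← integral_finsetSum _ n3, ← integral_add n1 n2,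
      ← integral_add n12 (integrable_finsetSum _ n3)]
    congr 1; ext x
    rw [← Finset.mul_sum, ← Finset.mul_sum, ← sub_eq_sum_dyD hjR]
    ring
  have b1 : ∀ j ∈ T, |∫ x, h x * (dyE j f x * (W j x - dyE R (W j) x))|
      ≤ 4 * A * (l2 f * l2 g) * (1 / 2) ^ (R - d * j) := by
    intro j hj
    have hjJ := (Finset.mem_Ico.1 hj).2
    refine (abs_integral_mul_mul_le hh hh1 (hf.dyE j) ((nW j).sub ((nW j).dyE R))).trans ?_
    refine (mul_le_mul (l2_dyE_le hf j) (l2_dif_sub_dyE_le hk (Nat.mul_le_mul_left d hjJ.le) hg (hc j)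
      (hc' j)) (l2_nonneg _) hf0).trans (le_of_eq (by ring))
  have b2 : ∀ j ∈ T, |∫ x, h x * (dyE j f x * dyE j (W j) x)|
      ≤ 8 * A * (l2 f * l2 g) * rho ^ (d * j - j) := by
    intro j hj
    refine (abs_integral_mul_mul_le hh hh1 (hf.dyE j) ((nW j).dyE j)).trans ?_
    refine (mul_le_mul (l2_dyE_le hf j) (l2_dyE_dif_le hk (by nlinarith) hg (hc j)
      (hc' j)) (l2_nonneg _) hf0).trans (le_of_eq (by ring))
  have b3 : ∀ j ∈ T, |∑ r ∈ Finset.Ico j R, ∫ x, h x * (dyE j f x * dyD (r + 1) (W j) x)|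
      ≤ ∑ r ∈ Finset.range R, l2 (fun x => dyM f r x * dyD (r + 1) h x) * l2 (dyD (r + 1) (W j)) := by
    intro j hj
    refine (Finset.abs_sum_le_sum_abs _ _).trans ((Finset.sum_le_sum fun r hr =>
      abs_integral_mul_mul_dyD_le hh (hf.dyE j) ((lvl_dyE j f).mono (Finset.mem_Ico.1 hr).1)
        (hf.dyM r) (fun x => abs_dyE_le_dyM f (Finset.mem_Ico.1 hr).1 x) (nW j)).trans ?_)
    refine Finset.sum_le_sum_of_subset_of_nonneg (fun r hr => ?_) fun r _ _ =>
      mul_nonneg (l2_nonneg _) (l2_nonneg _)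
    exact Finset.mem_range.2 (Finset.mem_Ico.1 hr).2
  have s1 : ∑ j ∈ T, (1 / 2 : ℝ) ^ (R - d * j) ≤ 2 := by
    refine (sum_pow_le_of_injOn (by norm_num) (by norm_num) T (fun j => R - d * j) ?_).trans
      (by norm_num)
    intro x hx y hy hxy
    have hxJ := (Finset.mem_Ico.1 hx).2
    have hyJ := (Finset.mem_Ico.1 hy).2
    have p1 := Nat.mul_le_mul_left d hxJ.le
    have p2 := Nat.mul_le_mul_left d hyJ.le
    refine Nat.eq_of_mul_eq_mul_left (by omega : 0 < d) ?_
    dsimp only at hxy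
    omega
  have s2 : ∑ j ∈ T, rho ^ (d * j - j) ≤ (1 - rho)⁻¹ := by
    refine sum_pow_le_of_injOn hr0.le hr1 T (fun j => d * j - j) ?_
    intro x _ y _ hxy
    dsimp only at hxy
    rw [← Nat.sub_one_mul, ← Nat.sub_one_mul] at hxy
    exact Nat.eq_of_mul_eq_mul_left (by omega) hxy
  have s3 : ∑ j ∈ T, ∑ r ∈ Finset.range R,
      l2 (fun x => dyM f r x * dyD (r + 1) h x) * l2 (dyD (r + 1) (W j))
      ≤ 2 * l2 f * (8 * A * schurC ^ 2 * l2 g) := by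
    rw [Finset.sum_comm]
    simp only [← Finset.mul_sum]
    refine sum_mul_le_of_sum_sq_le _ (by positivity) (by positivity)
      (sum_l2_dyM_mul_dyD_sq_le hh hh1 hf R) ?_
    have := sum_sum_l2_dyD_dif_sq_le hk hg hN T inj1 hc hc' (Finset.range (R + 1))
    rw [Finset.sum_range_succ'] at this
    exact le_trans (le_add_of_nonneg_right (sq_nonneg _)) this
  rw [Finset.sum_congr rfl split]
  refine (Finset.abs_sum_le_sum_abs _ _).trans ?_
  have hfg : 0 ≤ l2 f * l2 g := mul_nonneg hf0 hg0
  calc _ ≤ ∑ j ∈ T, (4 * A * (l2 f * l2 g) * (1 / 2) ^ (R - d * j)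
          + 8 * A * (l2 f * l2 g) * rho ^ (d * j - j)
          + ∑ r ∈ Finset.range R,
            l2 (fun x => dyM f r x * dyD (r + 1) h x) * l2 (dyD (r + 1) (W j))) := by
        refine Finset.sum_le_sum fun j hj => (abs_add_three _ _ _).trans ?_
        exact add_le_add (add_le_add (b1 j hj) (b2 j hj)) (b3 j hj)
    _ = 4 * A * (l2 f * l2 g) * ∑ j ∈ T, (1 / 2 : ℝ) ^ (R - d * j)
        + 8 * A * (l2 f * l2 g) * ∑ j ∈ T, rho ^ (d * j - j) + ∑ j ∈ T, ∑ r ∈ Finset.range R,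
          l2 (fun x => dyM f r x * dyD (r + 1) h x) * l2 (dyD (r + 1) (W j)) := by
        rw [Finset.sum_add_distrib, Finset.sum_add_distrib, Finset.mul_sum, Finset.mul_sum]
    _ ≤ 4 * A * (l2 f * l2 g) * 2 + 8 * A * (l2 f * l2 g) * (1 - rho)⁻¹
        + 2 * l2 f * (8 * A * schurC ^ 2 * l2 g) := by gcongr
    _ ≤ _ := by nlinarith

/-- The error in replacing the cutoff `j ≤ m` by the averaging operator of level `m`. -/
noncomputable def cutErr (m j : ℕ) (V : ℝ → ℝ) (x : ℝ) : ℝ :=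
  (if j ≤ m then V x else 0) - dyE m V x

theorem nice_cutErr {V : ℝ → ℝ} (hV : Nice V) (m j : ℕ) : Nice (cutErr m j V) := by
  by_cases h : j ≤ m
  · have : cutErr m j V = fun x => V x - dyE m V x := by ext x; simp [cutErr, h]
    rw [this]; exact hV.sub (hV.dyE m)
  · have : cutErr m j V = fun x => -dyE m V x := by ext x; simp [cutErr, h]
    rw [this]; exact (hV.dyE m).neg

theorem l2_neg (f : ℝ → ℝ) : l2 (fun x => -f x) = l2 f := by simp [l2]

theorem l2_cutErr_le {V : ℝ → ℝ} (hV : Nice V) (m j : ℕ) : l2 (cutErr m j V) ≤ l2 V := by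
  by_cases h : j ≤ m
  · have : cutErr m j V = fun x => V x - dyE m V x := by ext x; simp [cutErr, h]
    rw [this]; exact l2_sub_dyE_le hV m
  · have : cutErr m j V = fun x => -dyE m V x := by ext x; simp [cutErr, h]
    rw [this, l2_neg]; exact l2_dyE_le hV m

section

variable {A : ℝ} {k F : ℝ → ℝ} {N : ℕ}

theorem l2_cutErr_dif_le (hk : Ker A k) (hF : Nice F) {c c' : ℝ} {j : ℕ}
    (hc : |c| = (2 ^ j)⁻¹) (hc' : |c'| = (2 ^ j)⁻¹) (m : ℕ) :
    l2 (cutErr m j (dif c c' k F)) ≤ 8 * A * rho ^ dd j m * l2 F := by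
  have hA := hk.nonneg
  have hF0 := l2_nonneg F
  by_cases h : j ≤ m
  · have : cutErr m j (dif c c' k F)
        = fun x => dif c c' k F x - dyE m (dif c c' k F) x := by
      ext x; simp [cutErr, h]
    have e : dd j m = m - j := by unfold dd; omega
    rw [this, e]
    refine (l2_dif_sub_dyE_le hk h hF hc hc').trans ?_
    have h1 := half_pow_le_rho_pow (m - j)
    have h2 : (0 : ℝ) ≤ (1 / 2) ^ (m - j) := by positivity
    have h3 : A * l2 F * (1 / 2) ^ (m - j) ≤ A * l2 F * rho ^ (m - j) :=
      mul_le_mul_of_nonneg_left h1 (by positivity)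
    have h4 : 0 ≤ A * l2 F * (1 / 2) ^ (m - j) := by positivity
    nlinarith
  · have : cutErr m j (dif c c' k F) = fun x => -dyE m (dif c c' k F) x := by
      ext x; simp [cutErr, h]
    have e : dd j m = j - m := by unfold dd; omega
    rw [this, l2_neg, e]
    exact l2_dyE_dif_le hk (by omega) hF hc hc'

theorem l2_cutErr_dif_le_tail (hk : Ker A k) (hF : Nice F) (hN : Lvl N F) {c c' : ℝ} {j : ℕ}
    (hc : |c| = (2 ^ j)⁻¹) (hc' : |c'| = (2 ^ j)⁻¹) (m : ℕ) :
    l2 (cutErr m j (dif c c' k F)) ≤ 8 * A * (vth ^ dd j m * tail N F j) := by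
  have hA := hk.nonneg
  have hv := vth_pos
  have ev : ∀ n, (vth ^ n) ^ 2 = rho ^ n := fun n => by rw [← pow_mul, mul_comm, pow_mul, vth_sq]
  have n : ∀ l ∈ Finset.range (N + 1), Nice (dif c c' k (dyD l F)) :=
    fun l _ => (hF.dyD l).dif hk.nice c c'
  have e : cutErr m j (dif c c' k F)
      = fun x => ∑ l ∈ Finset.range (N + 1), cutErr m j (dif c c' k (dyD l F)) x := by
    rw [dif_eq_sum hk hF hN]
    ext x
    simp only [cutErr, dyE_sum _ n, Finset.sum_sub_distrib]
    congr 1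
    split_ifs <;> simp
  rw [e, tail, Finset.mul_sum, Finset.mul_sum]
  refine (l2_sum_le _ fun l hl => nice_cutErr (n l hl) m j).trans (Finset.sum_le_sum fun l hl => ?_)
  have hF0 := l2_nonneg (dyD l F)
  have := le_mul_of_le_sq (x := l2 (cutErr m j (dif c c' k (dyD l F)))) (a := vth ^ dd j m)
    (b := vth ^ dd l j) (C := 8 * A * l2 (dyD l F)) (by positivity) (by positivity)
    (by positivity) ?_ ?_
  · refine this.trans (le_of_eq (by ring))
  · rw [ev]
    exact (l2_cutErr_dif_le hk (hF.dyD l) hc hc' m).trans (le_of_eq (by ring))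
  · rw [ev]
    exact ((l2_cutErr_le (n l hl) m j).trans (l2_dif_dyD_le hk l j hF hc hc')).trans
      (le_of_eq (by ring))

theorem l2_sum_dif_le (hk : Ker A k) (hF : Nice F) (hN : Lvl N F) {c c' : ℕ → ℝ}
    (hc : ∀ j, |c j| = (2 ^ j)⁻¹) (hc' : ∀ j, |c' j| = (2 ^ j)⁻¹) (i J : ℕ) :
    l2 (fun x => ∑ j ∈ Finset.Ico i J, dif (c j) (c' j) k F x)
      ≤ (8 * A * schurC ^ 2 + 8 * A) * l2 F := by
  have hA := hk.nonneg
  have hF0 := l2_nonneg F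
  have hS := schurC_pos
  set T := Finset.Ico i J with hT
  set V : ℕ → ℝ → ℝ := fun j => dif (c j) (c' j) k F with hV
  have nV : ∀ j ∈ T, Nice (V j) := fun j _ => hF.dif hk.nice _ _
  set H : ℝ → ℝ := fun x => ∑ j ∈ T, V j x with hH
  have nH : Nice H := Nice.sum _ nV
  have b1 : l2 (dyE J H) ≤ 8 * A * schurC ^ 2 * l2 F := by
    refine le_of_sq_le_sq ?_ (by positivity)
    rw [← sum_l2_dyD_sq nH]
    refine le_trans (Finset.sum_le_sum fun r _ => pow_le_pow_left₀ (l2_nonneg _) ?_ 2)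
      (sum_sum_l2_dyD_dif_sq_le hk hF hN T (s := id) (injOn_id _) hc hc' _)
    rw [hH, dyD_sum _ _ nV]
    exact l2_sum_le _ fun j hj => (nV j hj).dyD r
  have b2 : l2 (fun x => H x - dyE J H x) ≤ 8 * A * l2 F := by
    have e : (fun x => H x - dyE J H x) = fun x => ∑ j ∈ T, (V j x - dyE J (V j) x) := by
      ext x
      rw [hH, dyE_sum _ nV, Finset.sum_sub_distrib]
    have s1 : ∑ j ∈ T, (1 / 2 : ℝ) ^ (J - j) ≤ 2 := by
      refine (sum_pow_le_of_injOn (by norm_num) (by norm_num) T (fun j => J - j) ?_).trans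
        (by norm_num)
      intro x hx y hy hxy
      have hxJ := (Finset.mem_Ico.1 hx).2
      have hyJ := (Finset.mem_Ico.1 hy).2
      dsimp only at hxy
      omega
    rw [e]
    refine (l2_sum_le _ fun j hj => (nV j hj).sub ((nV j hj).dyE J)).trans ?_
    calc _ ≤ ∑ j ∈ T, 4 * A * l2 F * (1 / 2) ^ (J - j) := Finset.sum_le_sum fun j hj =>
          (l2_dif_sub_dyE_le hk (Finset.mem_Ico.1 hj).2.le hF (hc j) (hc' j)).trans
            (le_of_eq (by ring))
      _ = 4 * A * l2 F * ∑ j ∈ T, (1 / 2 : ℝ) ^ (J - j) := (Finset.mul_sum _ _ _).symm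
      _ ≤ 4 * A * l2 F * 2 := mul_le_mul_of_nonneg_left s1 (by positivity)
      _ = _ := by ring
  have e : H = fun x => dyE J H x + (H x - dyE J H x) := by ext x; ring
  have := l2_add_le (nH.dyE J) (nH.sub (nH.dyE J))
  rw [← e] at this
  linarith

end

theorem sum_range_mul_div (d J : ℕ) (hd : 0 < d) (u : ℕ → ℝ) :
    ∑ r ∈ Finset.range (d * J), u (r / d) = d * ∑ m ∈ Finset.range J, u m := by
  induction J with
  | zero => simp
  | succ J ih =>
    rw [Nat.mul_succ, Finset.sum_range_add, ih, Finset.sum_range_succ, mul_add]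
    congr 1
    rw [Finset.sum_congr rfl fun r hr => by
      rw [Nat.mul_add_div hd, Nat.div_eq_of_lt (Finset.mem_range.1 hr), add_zero]]
    simp

/-- The paraproduct with averages of `g` and differences of `f` at much coarser scales. -/
theorem exists_high_low_le {d : ℕ} (hd : 2 ≤ d) : ∃ C : ℝ, 0 < C ∧
    ∀ (N j₀ J : ℕ) (c c' : ℕ → ℝ) (h f g : ℝ → ℝ), (∀ j, |c j| = (2 ^ j)⁻¹) →
      (∀ j, |c' j| = (2 ^ j)⁻¹) → Nice h → (∀ x, |h x| ≤ 1) → Nice f → Nice g → Lvl N f →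
      |∑ j ∈ Finset.Ico j₀ J, ∫ x, h x * (dyE (d * j) g x * dif (c j) (c' j) tauK f x)|
        ≤ C * (l2 f * l2 g) := by
  obtain ⟨A, hk⟩ := ker_tauK
  have hA := hk.nonneg
  have hS := schurC_pos
  refine ⟨3 * (8 * A * schurC ^ 2 + 8 * A) + d * (8 * A * schurC ^ 2) + 1, by positivity,
    fun N j₀ J c c' h f g hc hc' hh hh1 hf hg hN => ?_⟩
  have hf0 := l2_nonneg f
  have hg0 := l2_nonneg g
  set T := Finset.Ico j₀ J with hT
  set V : ℕ → ℝ → ℝ := fun j => dif (c j) (c' j) tauK f with hV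
  have nV : ∀ j, Nice (V j) := fun j => hf.dif hk.nice _ _
  set H : ℝ → ℝ := fun x => ∑ j ∈ T, V j x with hH
  have nH : Nice H := Nice.sum _ fun j _ => nV j
  have bH : l2 H ≤ (8 * A * schurC ^ 2 + 8 * A) * l2 f := l2_sum_dif_le hk hf hN hc hc' _ _
  set R := d * J with hR
  set Q : ℕ → ℝ → ℝ := fun m x => ∑ j ∈ T, cutErr m j (V j) x with hQ
  have nQ : ∀ m, Nice (Q m) := fun m => Nice.sum _ fun j _ => nice_cutErr (nV j) m j
  have bQ : ∑ m ∈ Finset.range J, l2 (Q m) ^ 2 ≤ (8 * A * schurC ^ 2 * l2 f) ^ 2 := by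
    calc _ ≤ ∑ m ∈ Finset.range J, (8 * A * ∑ j ∈ T, vth ^ dd j m * tail N f j) ^ 2 := by
          refine Finset.sum_le_sum fun m _ => pow_le_pow_left₀ (l2_nonneg _) ?_ 2
          refine (l2_sum_le _ fun j _ => nice_cutErr (nV j) m j).trans ?_
          rw [Finset.mul_sum]
          exact Finset.sum_le_sum fun j _ => l2_cutErr_dif_le_tail hk hf hN (hc j) (hc' j) m
      _ = (8 * A) ^ 2 * ∑ m ∈ Finset.range J, (∑ j ∈ T, vth ^ dd j m * tail N f j) ^ 2 := by
          rw [Finset.mul_sum]; exact Finset.sum_congr rfl fun r _ => mul_pow _ _ _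
      _ ≤ (8 * A) ^ 2 * (schurC ^ 2 * l2 f) ^ 2 :=
          mul_le_mul_of_nonneg_left (sum_sum_tail_sq_le hf hN T (s := id) (injOn_id _) _)
            (sq_nonneg _)
      _ = _ := by ring
  have bQ2 : ∑ r ∈ Finset.range R, l2 (Q (r / d)) ^ 2 ≤ (d * (8 * A * schurC ^ 2 * l2 f)) ^ 2 := by
    rw [hR, sum_range_mul_div d J (by omega) fun m => l2 (Q m) ^ 2, mul_pow]
    have hd1 : (1 : ℝ) ≤ d := by exact_mod_cast (by omega : 1 ≤ d)
    have : (d : ℝ) ≤ (d : ℝ) ^ 2 := by nlinarith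
    exact mul_le_mul this bQ (Finset.sum_nonneg fun _ _ => sq_nonneg _) (by positivity)
  have point : ∀ x, ∑ j ∈ T, dyE (d * j) g x * V j x = dyE R g x * H x
      - (∑ r ∈ Finset.range R, dyE (r / d) H x * dyD (r + 1) g x)
      - ∑ r ∈ Finset.range R, Q (r / d) x * dyD (r + 1) g x := by
    intro x
    have e1 : ∀ m, dyE m H x + Q m x = ∑ j ∈ T, if j ≤ m then V j x else 0 := by
      intro m
      rw [hH, dyE_sum _ fun j _ => nV j, hQ]
      dsimp only
      rw [← Finset.sum_add_distrib]
      exact Finset.sum_congr rfl fun j _ => by rw [cutErr]; ring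
    have e2 : ∀ j ∈ T, dyE (d * j) g x = dyE R g x
        - ∑ r ∈ Finset.range R, if j ≤ r / d then dyD (r + 1) g x else 0 := by
      intro j hj
      have hjR : d * j ≤ R := Nat.mul_le_mul_left d (Finset.mem_Ico.1 hj).2.le
      have := sub_eq_sum_dyD hjR g x
      rw [← Finset.sum_filter]
      have e3 : (Finset.range R).filter (fun r => j ≤ r / d) = Finset.Ico (d * j) R := by
        ext r
        simp only [Finset.mem_filter, Finset.mem_range, Finset.mem_Ico,
          Nat.le_div_iff_mul_le (by omega : 0 < d), mul_comm j d]
        tauto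
      rw [e3]; linarith
    rw [sub_sub, ← Finset.sum_add_distrib, Finset.sum_congr rfl fun j hj => by rw [e2 j hj]]
    have e4 : ∀ r, dyE (r / d) H x * dyD (r + 1) g x + Q (r / d) x * dyD (r + 1) g x
        = ∑ j ∈ T, (if j ≤ r / d then dyD (r + 1) g x else 0) * V j x := by
      intro r
      rw [← add_mul, e1, Finset.sum_mul]
      exact Finset.sum_congr rfl fun j _ => by split_ifs <;> ring
    rw [Finset.sum_congr rfl fun r _ => e4 r]
    simp only [sub_mul, Finset.sum_sub_distrib, Finset.sum_mul, hH, Finset.mul_sum]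
    rw [Finset.sum_comm]
  have i1 := (hh.mul ((hg.dyE R).mul nH)).intble
  have i2 : ∀ r ∈ Finset.range R,
      Integrable (fun x => h x * (dyE (r / d) H x * dyD (r + 1) g x)) := fun r _ =>
    (hh.mul ((nH.dyE (r / d)).mul (hg.dyD (r + 1)))).intble
  have i3 : ∀ r ∈ Finset.range R,
      Integrable (fun x => h x * (Q (r / d) x * dyD (r + 1) g x)) := fun r _ =>
    (hh.mul ((nQ (r / d)).mul (hg.dyD (r + 1)))).intble
  have total : ∑ j ∈ T, ∫ x, h x * (dyE (d * j) g x * V j x)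
      = (∫ x, h x * (dyE R g x * H x))
        - (∑ r ∈ Finset.range R, ∫ x, h x * (dyE (r / d) H x * dyD (r + 1) g x))
        - ∑ r ∈ Finset.range R, ∫ x, h x * (Q (r / d) x * dyD (r + 1) g x) := by
    have i12 : Integrable (fun x => h x * (dyE R g x * H x)
        - ∑ r ∈ Finset.range R, h x * (dyE (r / d) H x * dyD (r + 1) g x)) :=
      i1.sub (integrable_finsetSum _ i2)
    rw [← integral_finsetSum _ fun j _ => (hh.mul ((hg.dyE (d * j)).mul (nV j))).intble,
      ← integral_finsetSum _ i2, ← integral_finsetSum _ i3,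
      ← integral_sub i1 (integrable_finsetSum _ i2),
      ← integral_sub i12 (integrable_finsetSum _ i3)]
    congr 1; ext x
    simp only [← Finset.mul_sum]
    rw [point]; ring
  have b1 : |∫ x, h x * (dyE R g x * H x)| ≤ l2 g * l2 H :=
    (abs_integral_mul_mul_le hh hh1 (hg.dyE R) nH).trans
      (mul_le_mul_of_nonneg_right (l2_dyE_le hg R) (l2_nonneg _))
  have b2 : |∑ r ∈ Finset.range R, ∫ x, h x * (dyE (r / d) H x * dyD (r + 1) g x)|
      ≤ 2 * l2 H * l2 g := by
    refine (Finset.abs_sum_le_sum_abs _ _).trans ((Finset.sum_le_sum fun r _ =>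
      abs_integral_mul_mul_dyD_le hh (nH.dyE (r / d))
        ((lvl_dyE (r / d) H).mono (Nat.div_le_self r d)) (nH.dyM r)
        (fun x => abs_dyE_le_dyM H (Nat.div_le_self r d) x) hg).trans ?_)
    exact sum_mul_le_of_sum_sq_le _ (mul_nonneg two_pos.le (l2_nonneg _)) hg0
      (sum_l2_dyM_mul_dyD_sq_le hh hh1 nH R) (sum_l2_dyD_succ_sq_le hg R)
  have b3 : |∑ r ∈ Finset.range R, ∫ x, h x * (Q (r / d) x * dyD (r + 1) g x)|
      ≤ d * (8 * A * schurC ^ 2 * l2 f) * l2 g := by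
    refine (Finset.abs_sum_le_sum_abs _ _).trans ((Finset.sum_le_sum fun r _ =>
      abs_integral_mul_mul_le hh hh1 (nQ (r / d)) (hg.dyD (r + 1))).trans ?_)
    exact sum_mul_le_of_sum_sq_le _ (by positivity) hg0 bQ2 (sum_l2_dyD_succ_sq_le hg R)
  rw [total]
  have hfg : 0 ≤ l2 f * l2 g := mul_nonneg hf0 hg0
  have bHg := mul_le_mul_of_nonneg_right bH hg0
  refine ((abs_sub _ _).trans (add_le_add_left (abs_sub _ _) _)).trans ?_
  nlinarith

/-- The piece of the form at scale `2⁻ʲ`. -/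
noncomputable def shellForm (d j : ℕ) (h F G : ℝ → ℝ) : ℝ :=
  tauForm d (2 ^ j)⁻¹ (2 ^ (d * j))⁻¹ h F G
    - tauForm d (-(2 ^ j)⁻¹) ((-1) ^ d * (2 ^ (d * j))⁻¹) h F G

theorem abs_tauForm_le {d : ℕ} (hd : d ≠ 0) {h F G : ℝ → ℝ} (hh : Nice h) (hh1 : ∀ x, |h x| ≤ 1)
    (hF : Nice F) (hG : Nice G) (a c : ℝ) :
    |tauForm d a c h F G| ≤ (∫ b, |invW d b|) * (l2 F * l2 G) := by
  rw [tauForm_eq_biForm hd]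
  have s3 : Slc (fun x b => G (x - c * b)) := hG.slc_translate measurable_id c
  exact abs_biForm_le (nice_invW d) hh hh1 (hF.slc_translate (measurable_root d) a) s3
    (fun b _ => (l2_comp_sub F _).le) fun b _ => (l2_comp_sub G _).le

theorem integral_mul_dif {h U k F : ℝ → ℝ} (hh : Nice h) (hU : Nice U) (hk : Nice k) (hF : Nice F)
    (c c' : ℝ) : ∫ x, h x * (U x * dif c c' k F x)
      = (∫ x, h x * (U x * cnv c k F x)) - ∫ x, h x * (U x * cnv c' k F x) := by
  rw [← integral_sub (hh.mul (hU.mul (hF.cnv hk c))).intble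
    (hh.mul (hU.mul (hF.cnv hk c'))).intble]
  congr 1; ext x
  rw [dif]; ring

theorem shellForm_eq {d : ℕ} (hd : d ≠ 0) (j : ℕ) {h F G : ℝ → ℝ} (hh : Nice h) (hF : Nice F)
    (hG : Nice G) : shellForm d j h F G
      = errForm d j (2 ^ j)⁻¹ (2 ^ (d * j))⁻¹ h F G
        - errForm d j (-(2 ^ j)⁻¹) ((-1) ^ d * (2 ^ (d * j))⁻¹) h F G
        + (∫ x, h x * (dyE j F x
          * dif (2 ^ (d * j))⁻¹ ((-1) ^ d * (2 ^ (d * j))⁻¹) (invW d) G x))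
        + ∫ x, h x * (dyE (d * j) G x * dif (2 ^ j)⁻¹ (-(2 ^ j)⁻¹) tauK F x) := by
  obtain ⟨A, hk⟩ := ker_tauK
  rw [errForm_eq hd hh hF hG, errForm_eq hd hh hF hG,
    integral_mul_dif hh (hF.dyE j) (nice_invW d) hG,
    integral_mul_dif hh (hG.dyE (d * j)) hk.nice hF, shellForm]
  ring

/-- Uniform bound for the multi-scale form on dyadic step functions. -/
theorem exists_sum_shellForm_le {d : ℕ} (hd : 2 ≤ d) : ∃ C : ℝ, 0 < C ∧
    ∀ (N J : ℕ) (h f g : ℝ → ℝ), Nice h → (∀ x, |h x| ≤ 1) → Nice f → Nice g → Lvl N f → Lvl N g →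
      |∑ j ∈ Finset.range J, shellForm d j h f g| ≤ C * (l2 f * l2 g) := by
  obtain ⟨C₁, j₀, hC₁, H₁⟩ := exists_sum_errForm_le hd
  obtain ⟨C₂, hC₂, H₂⟩ := exists_low_high_le hd
  obtain ⟨C₃, hC₃, H₃⟩ := exists_high_low_le hd
  have hd0 : d ≠ 0 := by omega
  set w := ∫ b, |invW d b| with hw
  have hw0 : 0 ≤ w := integral_nonneg fun _ => abs_nonneg _
  refine ⟨j₀ * (2 * w) + (2 * C₁ + C₂ + C₃), by positivity,
    fun N J h f g hh hh1 hf hg hNf hNg => ?_⟩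
  have hfg : 0 ≤ l2 f * l2 g := mul_nonneg (l2_nonneg _) (l2_nonneg _)
  have a1 : ∀ j : ℕ, |((2 : ℝ) ^ j)⁻¹| = (2 ^ j)⁻¹ := fun j => abs_of_pos (by positivity)
  have a2 : ∀ j : ℕ, |-((2 : ℝ) ^ j)⁻¹| = (2 ^ j)⁻¹ := fun j => by rw [abs_neg, a1]
  have a3 : ∀ j : ℕ, |((2 : ℝ) ^ (d * j))⁻¹| = (2 ^ (d * j))⁻¹ := fun j => a1 _
  have a4 : ∀ j : ℕ, |(-1) ^ d * ((2 : ℝ) ^ (d * j))⁻¹| = (2 ^ (d * j))⁻¹ := fun j => by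
    rw [abs_mul, abs_pow, abs_neg, abs_one, one_pow, one_mul, a3]
  have triv : ∀ j, |shellForm d j h f g| ≤ 2 * w * (l2 f * l2 g) := fun j => by
    have h1 := abs_tauForm_le hd0 hh hh1 hf hg (2 ^ j)⁻¹ (2 ^ (d * j))⁻¹
    have h2 := abs_tauForm_le hd0 hh hh1 hf hg (-(2 ^ j)⁻¹) ((-1) ^ d * (2 ^ (d * j))⁻¹)
    refine (abs_sub _ _).trans ?_
    linarith
  have low : ∀ n, |∑ j ∈ Finset.range n, shellForm d j h f g| ≤ n * (2 * w * (l2 f * l2 g)) := by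
    intro n
    refine (Finset.abs_sum_le_sum_abs _ _).trans ((Finset.sum_le_sum fun j _ => triv j).trans ?_)
    simp
  have high : |∑ j ∈ Finset.Ico j₀ J, shellForm d j h f g| ≤ (2 * C₁ + C₂ + C₃) * (l2 f * l2 g) := by
    rw [Finset.sum_congr rfl fun j _ => shellForm_eq hd0 j hh hf hg, Finset.sum_add_distrib,
      Finset.sum_add_distrib, Finset.sum_sub_distrib]
    have h1 := (Finset.abs_sum_le_sum_abs _ _).trans
      (H₁ N J (fun j => (2 ^ j)⁻¹) (fun j => (2 ^ (d * j))⁻¹) h f g a1 a3 hh hh1 hf hg hNf hNg)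
    have h2 := (Finset.abs_sum_le_sum_abs _ _).trans
      (H₁ N J (fun j => -(2 ^ j)⁻¹) (fun j => (-1) ^ d * (2 ^ (d * j))⁻¹) h f g a2 a4 hh hh1 hf hg
        hNf hNg)
    have h3 := H₂ N j₀ J (fun j => (2 ^ (d * j))⁻¹) (fun j => (-1) ^ d * (2 ^ (d * j))⁻¹) h f g a3 a4
      hh hh1 hf hg hNg
    have h4 := H₃ N j₀ J (fun j => (2 ^ j)⁻¹) (fun j => -(2 ^ j)⁻¹) h f g a1 a2 hh hh1 hf hg hNf
    refine (abs_add_three _ _ _).trans ?_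
    have := abs_sub (∑ j ∈ Finset.Ico j₀ J, errForm d j (2 ^ j)⁻¹ (2 ^ (d * j))⁻¹ h f g)
      (∑ j ∈ Finset.Ico j₀ J, errForm d j (-(2 ^ j)⁻¹) ((-1) ^ d * (2 ^ (d * j))⁻¹) h f g)
    linarith
  rcases le_total J j₀ with hJ | hJ
  · refine (low J).trans ?_
    have : (J : ℝ) ≤ j₀ := by exact_mod_cast hJ
    have h1 := mul_le_mul_of_nonneg_right this (by positivity : 0 ≤ 2 * w * (l2 f * l2 g))
    have h2 : 0 ≤ (2 * C₁ + C₂ + C₃) * (l2 f * l2 g) := by positivity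
    linarith
  · rw [← Finset.sum_range_add_sum_Ico _ hJ]
    refine (abs_add_le _ _).trans ?_
    linarith [low j₀]

/-- The inner integral of `tauForm`. -/
noncomputable def tauOp (d : ℕ) (a c : ℝ) (F G : ℝ → ℝ) (x : ℝ) : ℝ :=
  ∫ τ, F (x - a * τ) * G (x - c * τ ^ d) * tauK τ

theorem nice_tauK : Nice tauK := ker_tauK.choose_spec.nice

theorem nice_tauOp {F G : ℝ → ℝ} (hF : Nice F) (hG : Nice G) (d : ℕ) (a c : ℝ) :
    Nice (tauOp d a c F G) := by
  obtain ⟨A, hk⟩ := ker_tauK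
  have hm := hG.1
  obtain ⟨B, hB⟩ := hG.2.1
  have n1 : Nice (fun p : ℝ × ℝ => F (p.1 - a * p.2) * tauK p.2) := by
    refine hF.shear hk.nice (c := fun τ => a * τ) (by fun_prop) (B := |a|) fun τ hτ => ?_
    have : |τ| ≤ 1 := not_lt.1 fun h => hτ (hk.supp τ h)
    rw [abs_mul]
    exact mul_le_of_le_one_right (abs_nonneg _) this
  have n2 := (n1.mul_bdd (g := fun p => G (p.1 - c * p.2 ^ d)) (by fun_prop)
    ⟨B, fun p => hB _⟩).integral_right (μ := volume)
  have : tauOp d a c F G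
      = fun x => ∫ τ, F (x - a * τ) * tauK τ * G (x - c * τ ^ d) := by
    ext x; rw [tauOp]; congr 1; ext τ; ring
  rw [this]; exact n2

/-- The part of the bilinear operator living at scale `2⁻ʲ`. -/
noncomputable def shellOp (d j : ℕ) (F G : ℝ → ℝ) (x : ℝ) : ℝ :=
  tauOp d (2 ^ j)⁻¹ (2 ^ (d * j))⁻¹ F G x
    - tauOp d (-(2 ^ j)⁻¹) ((-1) ^ d * (2 ^ (d * j))⁻¹) F G x

theorem nice_shellOp {F G : ℝ → ℝ} (hF : Nice F) (hG : Nice G) (d j : ℕ) :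
    Nice (shellOp d j F G) := (nice_tauOp hF hG _ _ _).sub (nice_tauOp hF hG _ _ _)

theorem integral_mul_shellOp {h F G : ℝ → ℝ} (hh : Nice h) (hF : Nice F) (hG : Nice G) (d j : ℕ) :
    ∫ x, h x * shellOp d j F G x = shellForm d j h F G := by
  simp only [shellOp, mul_sub]
  rw [integral_sub (hh.mul (nice_tauOp hF hG _ _ _)).intble (hh.mul (nice_tauOp hF hG _ _ _)).intble]
  rfl

theorem exists_nice_sign {U : ℝ → ℝ} (hU : Nice U) :
    ∃ h : ℝ → ℝ, Nice h ∧ (∀ x, |h x| ≤ 1) ∧ ∀ x, h x * U x = |U x| := by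
  obtain ⟨hm, -, R, hR⟩ := hU
  refine ⟨fun x => if 0 < U x then 1 else if U x < 0 then -1 else 0, ⟨?_, ⟨1, fun x => ?_⟩, R,
    fun x hx => by simp [hR x hx]⟩, fun x => ?_, fun x => ?_⟩
  · exact Measurable.ite (measurableSet_lt measurable_const hm) measurable_const
      (Measurable.ite (measurableSet_lt hm measurable_const) measurable_const measurable_const)
  · dsimp only; split_ifs <;> simp
  · dsimp only; split_ifs <;> simp
  · dsimp only
    split_ifs with h1 h2
    · rw [abs_of_pos h1, one_mul]
    · rw [abs_of_neg h2]; ring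
    · rw [le_antisymm (not_lt.1 h1) (not_lt.1 h2)]; simp

theorem eLpNorm_one_eq_of_nice {U : ℝ → ℝ} (hU : Nice U) :
    eLpNorm U 1 volume = ENNReal.ofReal (∫ x, |U x|) := by
  rw [eLpNorm_one_eq_lintegral_enorm, ← ofReal_integral_norm_eq_lintegral_enorm hU.intble]
  rfl

theorem eLpNorm_two_eq_of_nice {F : ℝ → ℝ} (hF : Nice F) :
    eLpNorm F 2 volume = ENNReal.ofReal (l2 F) := by
  have hm : MemLp F 2 volume :=
    (memLp_two_iff_integrable_sq hF.1.aestronglyMeasurable).2 hF.sq.intble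
  rw [hm.eLpNorm_eq_integral_rpow_norm (by norm_num) (by norm_num), l2, Real.sqrt_eq_rpow]
  simp

theorem exists_eLpNorm_sum_shellOp_le {d : ℕ} (hd : 2 ≤ d) : ∃ C : ℝ, 0 < C ∧
    ∀ (N J : ℕ) (F G : ℝ → ℝ), Nice F → Nice G → Lvl N F → Lvl N G →
      eLpNorm (fun x => ∑ j ∈ Finset.range J, shellOp d j F G x) 1 volume
        ≤ ENNReal.ofReal C * eLpNorm F 2 volume * eLpNorm G 2 volume := by
  obtain ⟨C, hC, H⟩ := exists_sum_shellForm_le hd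
  refine ⟨C, hC, fun N J F G hF hG hNF hNG => ?_⟩
  set U : ℝ → ℝ := fun x => ∑ j ∈ Finset.range J, shellOp d j F G x with hU
  have nU : Nice U := Nice.sum _ fun j _ => nice_shellOp hF hG d j
  obtain ⟨h, hh, hh1, hhU⟩ := exists_nice_sign nU
  rw [eLpNorm_one_eq_of_nice nU, eLpNorm_two_eq_of_nice hF, eLpNorm_two_eq_of_nice hG,
    ← ENNReal.ofReal_mul hC.le, ← ENNReal.ofReal_mul (mul_nonneg hC.le (l2_nonneg _)), mul_assoc]
  refine ENNReal.ofReal_le_ofReal ?_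
  have e : ∫ x, |U x| = ∑ j ∈ Finset.range J, shellForm d j h F G := by
    rw [← Finset.sum_congr rfl fun j _ => integral_mul_shellOp hh hF hG d j,
      ← integral_finsetSum _ fun j _ => (hh.mul (nice_shellOp hF hG d j)).intble]
    congr 1; ext x
    rw [← hhU, hU, Finset.mul_sum]
  rw [e]
  exact (le_abs_self _).trans (H N J h F G hh hh1 hF hG hNF hNG)

/-- The bilinear operator along `(t, t ^ d)` with parameters restricted to `S`. -/
noncomputable def curveOp (d : ℕ) (S : Set ℝ) (F G : ℝ → ℝ) (x : ℝ) : ℝ :=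
  ∫ t in S, F (x - t) * G (x - t ^ d) / t

theorem eLpNorm_comp_sub_right {F : ℝ → ℝ} (hF : Measurable F) (p : ENNReal) (a : ℝ) :
    eLpNorm (fun x => F (x - a)) p volume = eLpNorm F p volume :=
  eLpNorm_comp_measurePreserving (f := fun x => x - a) hF.aestronglyMeasurable
    (measurePreserving_sub_right volume a)

theorem eLpNorm_curveOp_le {F G : ℝ → ℝ} (hF : Measurable F) (hG : Measurable G) (d : ℕ)
    (S : Set ℝ) : eLpNorm (curveOp d S F G) 1 volume
      ≤ (∫⁻ t in S, ‖t⁻¹‖ₑ) * eLpNorm F 2 volume * eLpNorm G 2 volume := by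
  rw [eLpNorm_one_eq_lintegral_enorm]
  calc ∫⁻ x, ‖curveOp d S F G x‖ₑ
      ≤ ∫⁻ x, ∫⁻ t in S, ‖F (x - t) * G (x - t ^ d) / t‖ₑ :=
        lintegral_mono fun x => enorm_integral_le_lintegral_enorm _
    _ = ∫⁻ t in S, ∫⁻ x, ‖F (x - t) * G (x - t ^ d) / t‖ₑ := by
        refine lintegral_lintegral_swap (Measurable.aemeasurable ?_)
        unfold Function.uncurry
        fun_prop
    _ ≤ ∫⁻ t in S, ‖t⁻¹‖ₑ * (eLpNorm F 2 volume * eLpNorm G 2 volume) := by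
        refine lintegral_mono fun t => ?_
        have e : ∀ x, ‖F (x - t) * G (x - t ^ d) / t‖ₑ
            = ‖t⁻¹‖ₑ * ‖F (x - t) * G (x - t ^ d)‖ₑ := fun x => by
          rw [div_eq_mul_inv, enorm_mul, mul_comm]
        simp only [e]
        rw [lintegral_const_mul _ (by fun_prop)]
        refine mul_le_mul_right ?_ _
        have := eLpNorm_smul_le_mul_eLpNorm (p := 2) (q := 2) (r := 1) (μ := volume)
          (φ := fun x => F (x - t)) (f := fun x => G (x - t ^ d))
          (hG.comp (measurable_id.sub_const _)).aestronglyMeasurable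
          (hF.comp (measurable_id.sub_const _)).aestronglyMeasurable
        rwa [eLpNorm_comp_sub_right hF, eLpNorm_comp_sub_right hG,
          eLpNorm_one_eq_lintegral_enorm] at this
    _ = _ := by
        rw [lintegral_mul_const _ (by fun_prop), mul_assoc]

/-- The annulus `a < |t| ≤ b`. -/
def annulus (a b : ℝ) : Set ℝ := {t | a < |t| ∧ |t| ≤ b}

theorem measurableSet_annulus (a b : ℝ) : MeasurableSet (annulus a b) :=
  (measurableSet_lt measurable_const measurable_abs).inter
    (measurableSet_le measurable_abs measurable_const)

theorem volume_annulus_lt_top (a b : ℝ) : volume (annulus a b) < ⊤ :=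
  (measure_mono fun _ ht => abs_le.1 ht.2 : volume (annulus a b) ≤ volume (Icc (-b) b)).trans_lt
    measure_Icc_lt_top

theorem integrableOn_div_annulus {φ : ℝ → ℝ} (hm : Measurable φ) {C : ℝ} (hC : ∀ t, |φ t| ≤ C)
    {a : ℝ} (ha : 0 < a) (b : ℝ) : IntegrableOn (fun t => φ t / t) (annulus a b) := by
  refine Measure.integrableOn_of_bounded (M := C / a) (volume_annulus_lt_top a b).ne
    (hm.div measurable_id).aestronglyMeasurable
    ((ae_restrict_iff' (measurableSet_annulus a b)).2 (Filter.Eventually.of_forall fun t ht => ?_))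
  rw [norm_div, Real.norm_eq_abs, Real.norm_eq_abs]
  exact div_le_div₀ ((abs_nonneg _).trans (hC 0)) (hC t) ha ht.1.le

theorem integral_comp_mul_tauK (φ : ℝ → ℝ) {a : ℝ} (ha : a ≠ 0) :
    ∫ τ, φ (a * τ) * tauK τ = ∫ t, φ t * (|a|⁻¹ * tauK (a⁻¹ * t)) := by
  have := Measure.integral_comp_mul_left (fun t => φ t * tauK (a⁻¹ * t)) a
  simp only [inv_mul_cancel_left₀ ha] at this
  rw [this, abs_inv, smul_eq_mul, ← integral_const_mul]
  congr 1; ext t; ring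

theorem tauK_of_neg {τ : ℝ} (h : τ ≤ 0) : tauK τ = 0 :=
  indicator_of_notMem (fun h' => by linarith [h'.1]) _

theorem tauK_of_mem {τ : ℝ} (h : τ ∈ Icc (1 / 2 : ℝ) 1) : tauK τ = 1 / τ :=
  indicator_of_mem h _

theorem tauK_sub_eq {b t : ℝ} (hb : 0 < b) (h1 : t ≠ b / 2) (h2 : t ≠ -(b / 2)) :
    b⁻¹ * tauK (b⁻¹ * t) - b⁻¹ * tauK (-(b⁻¹ * t)) = (annulus (b / 2) b).indicator (fun t => 1 / t) t := by
  have key : ∀ s, 0 < s → s ≠ b / 2 →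
      b⁻¹ * tauK (b⁻¹ * s) = (annulus (b / 2) b).indicator (fun t => 1 / t) s := by
    intro s hs hs1
    by_cases h : s ∈ annulus (b / 2) b
    · rw [indicator_of_mem h, tauK_of_mem]
      · field_simp
      · obtain ⟨h3, h4⟩ := h
        rw [abs_of_pos hs] at h3 h4
        rw [mem_Icc, inv_mul_eq_div, le_div_iff₀ hb, div_le_one hb]
        constructor <;> linarith
    · rw [indicator_of_notMem h, tauK, indicator_of_notMem, mul_zero]
      rintro ⟨h3, h4⟩
      rw [inv_mul_eq_div, le_div_iff₀ hb] at h3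
      rw [inv_mul_eq_div, div_le_one hb] at h4
      refine h ⟨?_, ?_⟩ <;> rw [abs_of_pos hs]
      · exact lt_of_le_of_ne (by linarith) hs1.symm
      · exact h4
  have hb' : 0 < b⁻¹ := inv_pos.2 hb
  rcases lt_trichotomy t 0 with h | h | h
  · have e := key (-t) (by linarith) fun h' => h2 (by linarith)
    rw [tauK_of_neg (mul_nonpos_of_nonneg_of_nonpos hb'.le h.le), ← mul_neg, e]
    have : (-t) ∈ annulus (b / 2) b ↔ t ∈ annulus (b / 2) b := by simp [annulus]
    by_cases h' : t ∈ annulus (b / 2) b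
    · rw [indicator_of_mem h', indicator_of_mem (this.2 h')]; simp
    · rw [indicator_of_notMem h', indicator_of_notMem (mt this.1 h')]; simp
  · subst h
    rw [indicator_of_notMem]
    · simp
    · rintro ⟨h3, -⟩
      rw [abs_zero] at h3
      linarith
  · rw [key t h h1, tauK_of_neg (τ := -(b⁻¹ * t)) (by have := mul_pos hb' h; linarith)]
    simp

theorem setIntegral_annulus_half {φ : ℝ → ℝ} (hm : Measurable φ) {C : ℝ} (hC : ∀ t, |φ t| ≤ C)
    {b : ℝ} (hb : 0 < b) : ∫ t in annulus (b / 2) b, φ t / t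
      = (∫ τ, φ (b * τ) * tauK τ) - ∫ τ, φ (-b * τ) * tauK τ := by
  have n : ∀ a : ℝ, a ≠ 0 → Integrable (fun t => φ t * (|a|⁻¹ * tauK (a⁻¹ * t))) := fun a ha =>
    (((nice_tauK.comp_mul (inv_ne_zero ha)).const_mul |a|⁻¹).bdd_mul hm ⟨C, hC⟩).intble
  rw [integral_comp_mul_tauK φ hb.ne', integral_comp_mul_tauK φ (neg_ne_zero.2 hb.ne'),
    ← integral_sub (n b hb.ne') (n (-b) (neg_ne_zero.2 hb.ne')),
    ← integral_indicator (measurableSet_annulus _ _)]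
  refine integral_congr_ae ?_
  have h1 : ∀ᵐ t : ℝ, t ≠ b / 2 := by simp [ae_iff]
  have h2 : ∀ᵐ t : ℝ, t ≠ -(b / 2) := by simp [ae_iff]
  filter_upwards [h1, h2] with t ht1 ht2
  have := tauK_sub_eq hb ht1 ht2
  rw [abs_neg, abs_of_pos hb, inv_neg, neg_mul, ← mul_sub, this]
  by_cases h' : t ∈ annulus (b / 2) b
  · rw [indicator_of_mem h', indicator_of_mem h', mul_one_div]
  · rw [indicator_of_notMem h', indicator_of_notMem h', mul_zero]

section curveOp

variable {F G : ℝ → ℝ} {A B : ℝ}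

theorem integrableOn_curveOp (hF : Measurable F) (hG : Measurable G) (hA : ∀ x, |F x| ≤ A)
    (hB : ∀ x, |G x| ≤ B) (d : ℕ) {a : ℝ} (ha : 0 < a) (b x : ℝ) :
    IntegrableOn (fun t => F (x - t) * G (x - t ^ d) / t) (annulus a b) := by
  refine integrableOn_div_annulus (φ := fun t => F (x - t) * G (x - t ^ d)) (C := A * B)
    (by fun_prop) (fun t => ?_) ha b
  rw [abs_mul]
  exact mul_le_mul (hA _) (hB _) (abs_nonneg _) ((abs_nonneg _).trans (hA 0))

theorem curveOp_annulus_half (hF : Measurable F) (hG : Measurable G) (hA : ∀ x, |F x| ≤ A)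
    (hB : ∀ x, |G x| ≤ B) (d j : ℕ) (x : ℝ) :
    curveOp d (annulus (2 ^ (j + 1))⁻¹ (2 ^ j)⁻¹) F G x = shellOp d j F G x := by
  have e : ((2 : ℝ) ^ (j + 1))⁻¹ = (2 ^ j)⁻¹ / 2 := by rw [pow_succ]; field_simp
  rw [curveOp, e, setIntegral_annulus_half (φ := fun t => F (x - t) * G (x - t ^ d)) (C := A * B)
    (by fun_prop) (fun t => ?_) (by positivity), shellOp, tauOp, tauOp]
  · have e2 : (2 : ℝ) ^ (d * j) = (2 ^ j) ^ d := by rw [mul_comm, pow_mul]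
    simp only [mul_pow, e2, inv_pow, neg_pow ((2 : ℝ) ^ j)⁻¹]
  · rw [abs_mul]
    exact mul_le_mul (hA _) (hB _) (abs_nonneg _) ((abs_nonneg _).trans (hA 0))

theorem curveOp_annulus_add (hF : Measurable F) (hG : Measurable G) (hA : ∀ x, |F x| ≤ A)
    (hB : ∀ x, |G x| ≤ B) (d : ℕ) {a b c : ℝ} (ha : 0 < a) (hab : a ≤ b) (hbc : b ≤ c) (x : ℝ) :
    curveOp d (annulus a c) F G x
      = curveOp d (annulus b c) F G x + curveOp d (annulus a b) F G x := by
  have e : annulus a c = annulus b c ∪ annulus a b := by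
    ext t
    simp only [annulus, mem_union, mem_ofPred_eq]
    constructor
    · rintro ⟨h1, h2⟩
      rcases lt_or_ge b |t| with h | h
      · exact Or.inl ⟨h, h2⟩
      · exact Or.inr ⟨h1, h⟩
    · rintro (⟨h1, h2⟩ | ⟨h1, h2⟩)
      · exact ⟨by linarith, h2⟩
      · exact ⟨h1, by linarith⟩
  have hdis : Disjoint (annulus b c) (annulus a b) :=
    Set.disjoint_left.2 fun t h1 h2 => not_lt.2 h2.2 h1.1
  rw [curveOp, e, setIntegral_union hdis (measurableSet_annulus _ _)
    (integrableOn_curveOp hF hG hA hB d (by linarith) c x)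
    (integrableOn_curveOp hF hG hA hB d ha b x)]
  rfl

theorem curveOp_annulus_eq_sum (hF : Measurable F) (hG : Measurable G) (hA : ∀ x, |F x| ≤ A)
    (hB : ∀ x, |G x| ≤ B) (d J : ℕ) (x : ℝ) :
    curveOp d (annulus (2 ^ J)⁻¹ 1) F G x = ∑ j ∈ Finset.range J, shellOp d j F G x := by
  induction J with
  | zero =>
    have : annulus ((2 : ℝ) ^ 0)⁻¹ 1 = ∅ := by
      ext t; simp [annulus]
    rw [this]; simp [curveOp]
  | succ J ih =>
    rw [Finset.sum_range_succ, ← ih, ← curveOp_annulus_half hF hG hA hB d J x]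
    refine curveOp_annulus_add hF hG hA hB d (by positivity) ?_ ?_ x
    · exact inv_anti₀ (by positivity) (pow_le_pow_right₀ (by norm_num) (Nat.le_succ J))
    · exact inv_le_one_of_one_le₀ (one_le_pow₀ (by norm_num))

end curveOp

theorem lintegral_annulus_inv_le (a b : ℝ) (ha : 0 < a) :
    ∫⁻ t in annulus a b, ‖t⁻¹‖ₑ ≤ ENNReal.ofReal (2 * b / a) := by
  calc ∫⁻ t in annulus a b, ‖t⁻¹‖ₑ ≤ ∫⁻ _ in annulus a b, ENNReal.ofReal a⁻¹ := by
        refine setLIntegral_mono measurable_const fun t ht => ?_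
        rw [← ofReal_norm, norm_inv, Real.norm_eq_abs]
        exact ENNReal.ofReal_le_ofReal (inv_anti₀ ha ht.1.le)
    _ = ENNReal.ofReal a⁻¹ * volume (annulus a b) := by rw [setLIntegral_const]
    _ ≤ ENNReal.ofReal a⁻¹ * ENNReal.ofReal (2 * b) := by
        refine mul_le_mul_right ?_ _
        refine (measure_mono fun _ ht => abs_le.1 ht.2 :
          volume (annulus a b) ≤ volume (Icc (-b) b)).trans (le_of_eq ?_)
        rw [Real.volume_Icc]; congr 1; ring
    _ = _ := by
        rw [← ENNReal.ofReal_mul (inv_nonneg.2 ha.le)]; congr 1; field_simp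

theorem exists_pow_inv_between {a : ℝ} (h0 : 0 < a) (h1 : a < 1) :
    ∃ J : ℕ, a ≤ (2 ^ J)⁻¹ ∧ (2 ^ J)⁻¹ ≤ 2 * a := by
  obtain ⟨n, hn1, hn2⟩ := exists_nat_pow_near_of_lt_one h0 h1.le (y := (1 / 2 : ℝ))
    (by norm_num) (by norm_num)
  refine ⟨n, ?_, ?_⟩
  · rw [← inv_pow, ← one_div]; exact hn2
  · rw [pow_succ] at hn1
    rw [← inv_pow, ← one_div]; linarith

theorem aestronglyMeasurable_curveOp {F G : ℝ → ℝ} (hF : Measurable F) (hG : Measurable G) (d : ℕ)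
    (S : Set ℝ) : AEStronglyMeasurable (curveOp d S F G) volume := by
  refine StronglyMeasurable.aestronglyMeasurable ?_
  refine StronglyMeasurable.integral_prod_right
    (f := fun x t : ℝ => F (x - t) * G (x - t ^ d) / t) (Measurable.stronglyMeasurable ?_)
  unfold Function.uncurry
  fun_prop

theorem exists_eLpNorm_curveOp_step_le {d : ℕ} (hd : 2 ≤ d) : ∃ C : ℝ, 0 < C ∧
    ∀ (a : ℝ) (N : ℕ) (F G : ℝ → ℝ), 0 < a → a < 1 → Nice F → Nice G → Lvl N F → Lvl N G →
      eLpNorm (curveOp d (annulus a 1) F G) 1 volume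
        ≤ ENNReal.ofReal C * eLpNorm F 2 volume * eLpNorm G 2 volume := by
  obtain ⟨C, hC, H⟩ := exists_eLpNorm_sum_shellOp_le hd
  refine ⟨C + 4, by positivity, fun a N F G ha ha1 hF hG hNF hNG => ?_⟩
  obtain ⟨J, hJ1, hJ2⟩ := exists_pow_inv_between ha ha1
  obtain ⟨A, hA⟩ := hF.2.1
  obtain ⟨B, hB⟩ := hG.2.1
  set U : ℝ → ℝ := fun x => ∑ j ∈ Finset.range J, shellOp d j F G x with hU
  have nU : Nice U := Nice.sum _ fun j _ => nice_shellOp hF hG d j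
  have e : curveOp d (annulus a 1) F G = U + curveOp d (annulus a (2 ^ J)⁻¹) F G := by
    ext x
    rw [Pi.add_apply, hU, curveOp_annulus_add hF.1 hG.1 hA hB d ha hJ1
      (inv_le_one_of_one_le₀ (one_le_pow₀ (by norm_num))) x,
      curveOp_annulus_eq_sum hF.1 hG.1 hA hB]
  rw [e]
  refine (eLpNorm_add_le nU.1.aestronglyMeasurable
    (aestronglyMeasurable_curveOp hF.1 hG.1 _ _) le_rfl).trans ?_
  rw [ENNReal.ofReal_add hC.le (by norm_num), add_mul, add_mul]
  refine add_le_add (H N J F G hF hG hNF hNG) ((eLpNorm_curveOp_le hF.1 hG.1 d _).trans ?_)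
  refine mul_le_mul_left (mul_le_mul_left ((lintegral_annulus_inv_le _ _ ha).trans
    (ENNReal.ofReal_le_ofReal ?_)) _) _
  rw [div_le_iff₀ ha]; linarith

/-- Dyadic step functions are dense in `L²`. -/
theorem exists_lvl_eLpNorm_sub_le {F : ℝ → ℝ} (hF : MemLp F 2 volume) {δ : ℝ} (hδ : 0 < δ) :
    ∃ (N : ℕ) (G : ℝ → ℝ), Nice G ∧ Lvl N G ∧ eLpNorm (F - G) 2 volume ≤ ENNReal.ofReal δ := by
  obtain ⟨g, hgs, hFg, hgc, hg2⟩ := hF.exists_hasCompactSupport_eLpNorm_sub_le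
    (by norm_num) (ε := ENNReal.ofReal (δ / 2)) (by simpa using hδ)
  obtain ⟨R, hR0, hR⟩ := hgs.isCompact.isBounded.subset_closedBall_lt 0 0
  have hgR : ∀ x, R < |x| → g x = 0 := fun x hx => by
    by_contra h
    have := hR (subset_tsupport g h)
    rw [mem_closedBall_zero_iff, Real.norm_eq_abs] at this
    linarith
  obtain ⟨M, hM⟩ := hgs.exists_bound_of_continuous hgc
  have hgn : Nice g := ⟨hgc.measurable, ⟨M, hM⟩, R, hgR⟩
  set L := 2 * (R + 1) with hL
  have hL1 : 1 ≤ L := by linarith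
  set η := δ / 2 / L with hη
  have hη0 : 0 < η := by positivity
  obtain ⟨w, hw0, hw⟩ := Metric.uniformContinuous_iff.1
    (hgs.uniformContinuous_of_continuous hgc) η hη0
  obtain ⟨N, hN⟩ := exists_pow_lt_of_lt_one hw0 (by norm_num : (1 / 2 : ℝ) < 1)
  have h2N : (0 : ℝ) < 2 ^ N := by positivity
  have hdist : ∀ x : ℝ, |x - ⌊(2 : ℝ) ^ N * x⌋ / 2 ^ N| ≤ (1 / 2) ^ N := fun x => by
    have h1 := Int.floor_le ((2 : ℝ) ^ N * x)
    have h2 := Int.lt_floor_add_one ((2 : ℝ) ^ N * x)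
    have e : x - ⌊(2 : ℝ) ^ N * x⌋ / 2 ^ N = (2 ^ N * x - ⌊(2 : ℝ) ^ N * x⌋) * (1 / 2) ^ N := by
      rw [one_div, inv_pow]; field_simp
    rw [e, abs_mul, abs_of_pos (by positivity : (0 : ℝ) < (1 / 2) ^ N)]
    exact mul_le_of_le_one_left (by positivity) (abs_le.2 ⟨by linarith, by linarith⟩)
  have hhalf : (1 / 2 : ℝ) ^ N ≤ 1 := pow_le_one₀ (by norm_num) (by norm_num)
  set s : ℝ → ℝ := fun x => g (⌊(2 : ℝ) ^ N * x⌋ / 2 ^ N) with hs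
  have hsR : ∀ x, R + 1 < |x| → s x = 0 := fun x hx => hgR _ (by
    have := abs_sub_abs_le_abs_sub x (⌊(2 : ℝ) ^ N * x⌋ / 2 ^ N)
    have := hdist x
    linarith)
  have hsm : Measurable s := hgc.measurable.comp (by fun_prop)
  have hsn : Nice s := ⟨hsm, ⟨M, fun x => hM _⟩, R + 1, hsR⟩
  refine ⟨N, s, hsn, fun x y hxy => by simp only [hs, hxy], ?_⟩
  have hdiff := hgn.sub hsn
  have hb : ∀ x, (g x - s x) ^ 2 ≤ (Icc (-(R + 1)) (R + 1)).indicator (fun _ => η ^ 2) x := by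
    intro x
    by_cases hx : x ∈ Icc (-(R + 1)) (R + 1)
    · rw [indicator_of_mem hx]
      have := hw (a := x) (b := ⌊(2 : ℝ) ^ N * x⌋ / 2 ^ N)
        (by rw [Real.dist_eq]; exact (hdist x).trans_lt hN)
      rw [Real.dist_eq] at this
      exact sq_le_sq' (by linarith [(abs_lt.1 this).1]) (abs_lt.1 this).2.le
    · rw [indicator_of_notMem hx]
      have : R + 1 < |x| := not_le.1 fun h => hx (abs_le.1 h)
      rw [hsR x this, hgR x (by linarith)]; simp
  have hl : l2 (fun x => g x - s x) ≤ δ / 2 := by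
    rw [l2, Real.sqrt_le_left (by positivity)]
    refine (integral_mono hdiff.sq.intble ?_ hb).trans ?_
    · exact (continuous_const.integrableOn_Icc).integrable_indicator measurableSet_Icc
    · rw [integral_indicator measurableSet_Icc, setIntegral_const, smul_eq_mul]
      have : volume.real (Icc (-(R + 1)) (R + 1)) = L := by
        rw [Real.volume_real_Icc_of_le (by linarith)]; ring
      rw [this, hη]
      have e : L * (δ / 2 / L) ^ 2 = (δ / 2) ^ 2 / L := by field_simp
      rw [e]
      exact div_le_self (sq_nonneg _) hL1
  have e : F - s = (F - g) + fun x => g x - s x := by ext x; simp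
  rw [e]
  refine (eLpNorm_add_le (hF.1.sub hg2.1) hdiff.1.aestronglyMeasurable (by norm_num)).trans ?_
  rw [eLpNorm_two_eq_of_nice hdiff]
  refine (add_le_add hFg (ENNReal.ofReal_le_ofReal hl)).trans (le_of_eq ?_)
  rw [← ENNReal.ofReal_add (by positivity) (by positivity)]; congr 1; ring

theorem curveOp_eq_add {F F' G G' : ℝ → ℝ} (hF : Measurable F) (hF' : Measurable F')
    (hG : Measurable G) (hG' : Measurable G') {A A' B B' : ℝ} (hA : ∀ x, |F x| ≤ A)
    (hA' : ∀ x, |F' x| ≤ A') (hB : ∀ x, |G x| ≤ B) (hB' : ∀ x, |G' x| ≤ B') (d : ℕ) {a : ℝ}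
    (ha : 0 < a) (b : ℝ) : curveOp d (annulus a b) F G = curveOp d (annulus a b) (F - F') G
      + (curveOp d (annulus a b) F' (G - G') + curveOp d (annulus a b) F' G') := by
  ext x
  have i1 := integrableOn_curveOp (hF.sub hF') hG (fun x => (abs_sub _ _).trans
    (add_le_add (hA x) (hA' x))) hB d ha b x
  have i2 := integrableOn_curveOp hF' (hG.sub hG') hA' (fun x => (abs_sub _ _).trans
    (add_le_add (hB x) (hB' x))) d ha b x
  have i3 := integrableOn_curveOp hF' hG' hA' hB' d ha b x
  have i23 : IntegrableOn (fun t => F' (x - t) * (G - G') (x - t ^ d) / t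
    + F' (x - t) * G' (x - t ^ d) / t) (annulus a b) := i2.add i3
  rw [Pi.add_apply, Pi.add_apply, curveOp, curveOp, curveOp, curveOp, ← integral_add i2 i3,
    ← integral_add i1 i23]
  congr 1; ext t
  simp only [Pi.sub_apply]; ring

/-- The real-valued estimate. -/
theorem exists_eLpNorm_curveOp_le {d : ℕ} (hd : 2 ≤ d) : ∃ C : ℝ, 0 < C ∧
    ∀ (a A B : ℝ) (F G : ℝ → ℝ), 0 < a → a < 1 → Measurable F → Measurable G →
      (∀ x, |F x| ≤ A) → (∀ x, |G x| ≤ B) → MemLp F 2 volume → MemLp G 2 volume →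
      eLpNorm (curveOp d (annulus a 1) F G) 1 volume
        ≤ ENNReal.ofReal C * eLpNorm F 2 volume * eLpNorm G 2 volume := by
  obtain ⟨C, hC, H⟩ := exists_eLpNorm_curveOp_step_le hd
  refine ⟨C, hC, fun a A B F G ha ha1 hF hG hA hB hF2 hG2 => ?_⟩
  set p := (eLpNorm F 2 volume).toReal with hp
  set q := (eLpNorm G 2 volume).toReal with hq
  have hp0 : 0 ≤ p := ENNReal.toReal_nonneg
  have hq0 : 0 ≤ q := ENNReal.toReal_nonneg
  have ep : eLpNorm F 2 volume = ENNReal.ofReal p := (ENNReal.ofReal_toReal hF2.2.ne).symm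
  have eq : eLpNorm G 2 volume = ENNReal.ofReal q := (ENNReal.ofReal_toReal hG2.2.ne).symm
  set M := 2 * 1 / a with hM
  have hM0 : 0 ≤ M := by positivity
  have key : ∀ δ : ℝ, 0 < δ → eLpNorm (curveOp d (annulus a 1) F G) 1 volume
      ≤ ENNReal.ofReal (M * δ * q + (M * (p + δ) * δ + C * (p + δ) * (q + δ))) := by
    intro δ hδ
    obtain ⟨N₁, F', nF, lF, hFF⟩ := exists_lvl_eLpNorm_sub_le hF2 hδ
    obtain ⟨N₂, G', nG, lG, hGG⟩ := exists_lvl_eLpNorm_sub_le hG2 hδ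
    obtain ⟨A', hA'⟩ := nF.2.1
    obtain ⟨B', hB'⟩ := nG.2.1
    have bF : eLpNorm F' 2 volume ≤ ENNReal.ofReal (p + δ) := by
      have e : F' = F - (F - F') := by ext x; simp
      rw [e, ENNReal.ofReal_add hp0 hδ.le, ← ep]
      exact (eLpNorm_sub_le hF2.1 (hF.sub nF.1).aestronglyMeasurable (by norm_num)).trans
        (add_le_add le_rfl hFF)
    have bG : eLpNorm G' 2 volume ≤ ENNReal.ofReal (q + δ) := by
      have e : G' = G - (G - G') := by ext x; simp
      rw [e, ENNReal.ofReal_add hq0 hδ.le, ← eq]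
      exact (eLpNorm_sub_le hG2.1 (hG.sub nG.1).aestronglyMeasurable (by norm_num)).trans
        (add_le_add le_rfl hGG)
    have hMl := lintegral_annulus_inv_le a 1 ha
    rw [curveOp_eq_add hF nF.1 hG nG.1 hA hA' hB hB' d ha 1,
      ENNReal.ofReal_add (by positivity) (by positivity),
      ENNReal.ofReal_add (by positivity) (by positivity)]
    refine (eLpNorm_add_le (aestronglyMeasurable_curveOp (hF.sub nF.1) hG _ _)
      ((aestronglyMeasurable_curveOp nF.1 (hG.sub nG.1) _ _).add
        (aestronglyMeasurable_curveOp nF.1 nG.1 _ _)) le_rfl).trans (add_le_add ?_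
      ((eLpNorm_add_le (aestronglyMeasurable_curveOp nF.1 (hG.sub nG.1) _ _)
        (aestronglyMeasurable_curveOp nF.1 nG.1 _ _) le_rfl).trans (add_le_add ?_ ?_)))
    · rw [ENNReal.ofReal_mul (by positivity), ENNReal.ofReal_mul hM0]
      exact (eLpNorm_curveOp_le (hF.sub nF.1) hG d _).trans
        (mul_le_mul' (mul_le_mul' hMl hFF) eq.le)
    · rw [ENNReal.ofReal_mul (by positivity), ENNReal.ofReal_mul hM0]
      exact (eLpNorm_curveOp_le nF.1 (hG.sub nG.1) d _).trans
        (mul_le_mul' (mul_le_mul' hMl bF) hGG)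
    · rw [ENNReal.ofReal_mul (by positivity), ENNReal.ofReal_mul hC.le]
      exact (H a (max N₁ N₂) F' G' ha ha1 nF nG (lF.mono (le_max_left _ _))
        (lG.mono (le_max_right _ _))).trans (mul_le_mul' (mul_le_mul' le_rfl bF) bG)
  have lim : Filter.Tendsto
      (fun δ : ℝ => ENNReal.ofReal (M * δ * q + (M * (p + δ) * δ + C * (p + δ) * (q + δ))))
      (nhdsWithin 0 (Ioi 0)) (nhds (ENNReal.ofReal (C * p * q))) := by
    have hc : Continuous (fun δ : ℝ =>
        ENNReal.ofReal (M * δ * q + (M * (p + δ) * δ + C * (p + δ) * (q + δ)))) :=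
      ENNReal.continuous_ofReal.comp (by fun_prop)
    have := (hc.tendsto 0).mono_left (nhdsWithin_le_nhds (s := Ioi 0))
    simpa using this
  rw [ep, eq, ← ENNReal.ofReal_mul hC.le, ← ENNReal.ofReal_mul (by positivity)]
  exact ge_of_tendsto lim (by filter_upwards [self_mem_nhdsWithin] with δ hδ using key δ hδ)

theorem setOf_abs_lt_ae_eq_annulus (a : ℝ) :
    {t : ℝ | a < |t| ∧ |t| < 1} =ᵐ[volume] annulus a 1 := by
  have h1 : ∀ᵐ t : ℝ, t ≠ 1 := Measure.ae_ne volume 1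
  have h2 : ∀ᵐ t : ℝ, t ≠ -1 := Measure.ae_ne volume (-1)
  filter_upwards [h1, h2] with t ht1 ht2
  have h : |t| ≠ 1 := fun h => (eq_or_eq_neg_of_abs_eq h).elim ht1 ht2
  exact propext ⟨fun h' => ⟨h'.1, h'.2.le⟩, fun h' => ⟨h'.1, lt_of_le_of_ne h'.2 h⟩⟩

/-- Splitting a complex-valued integral along the curve into real and imaginary parts. -/
theorem setIntegral_annulus_complex_eq {f g : ℝ → ℂ} (hf : Measurable f) (hg : Measurable g)
    {A B : ℝ} (hA : ∀ x, ‖f x‖ ≤ A) (hB : ∀ x, ‖g x‖ ≤ B) (d : ℕ) {a : ℝ} (ha : 0 < a) (b x : ℝ) :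
    ∫ t in annulus a b, f (x - t) * g (x - t ^ d) / (t : ℂ)
      = ((curveOp d (annulus a b) (fun y => (f y).re) (fun y => (g y).re) x
          - curveOp d (annulus a b) (fun y => (f y).im) (fun y => (g y).im) x : ℝ) : ℂ)
        + ((curveOp d (annulus a b) (fun y => (f y).re) (fun y => (g y).im) x
          + curveOp d (annulus a b) (fun y => (f y).im) (fun y => (g y).re) x : ℝ) : ℂ)
          * Complex.I := by
  have hfr : Measurable fun y => (f y).re := Complex.measurable_re.comp hf
  have hfi : Measurable fun y => (f y).im := Complex.measurable_im.comp hf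
  have hgr : Measurable fun y => (g y).re := Complex.measurable_re.comp hg
  have hgi : Measurable fun y => (g y).im := Complex.measurable_im.comp hg
  have bfr : ∀ y, |(f y).re| ≤ A := fun y => (Complex.abs_re_le_norm _).trans (hA y)
  have bfi : ∀ y, |(f y).im| ≤ A := fun y => (Complex.abs_im_le_norm _).trans (hA y)
  have bgr : ∀ y, |(g y).re| ≤ B := fun y => (Complex.abs_re_le_norm _).trans (hB y)
  have bgi : ∀ y, |(g y).im| ≤ B := fun y => (Complex.abs_im_le_norm _).trans (hB y)
  have irr := integrableOn_curveOp hfr hgr bfr bgr d ha b x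
  have iii := integrableOn_curveOp hfi hgi bfi bgi d ha b x
  have iri := integrableOn_curveOp hfr hgi bfr bgi d ha b x
  have iir := integrableOn_curveOp hfi hgr bfi bgr d ha b x
  simp only [curveOp]
  rw [← integral_sub irr iii, ← integral_add iri iir, ← integral_complex_ofReal,
    ← integral_complex_ofReal, ← integral_mul_const, ← integral_add]
  · congr 1; ext t
    conv_lhs => rw [← Complex.re_add_im (f (x - t)), ← Complex.re_add_im (g (x - t ^ d))]
    push_cast
    linear_combination ((f (x - t)).im * (g (x - t ^ d)).im / t : ℂ) * Complex.I_mul_I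
  · exact (irr.sub iii).ofReal
  · exact (iri.add iir).ofReal.mul_const _

theorem norm_sub_add_mul_I_le (p q r s : ℝ) :
    ‖((p - q : ℝ) : ℂ) + ((r + s : ℝ) : ℂ) * Complex.I‖ ≤ |p| + |q| + (|r| + |s|) := by
  refine (norm_add_le _ _).trans ?_
  rw [norm_mul, Complex.norm_I, mul_one, Complex.norm_real, Complex.norm_real]
  exact add_le_add (abs_sub _ _) (abs_add_le _ _)

/-- The truncated bilinear Hilbert transform along the curve `(t, t^d)`,
`d ≥ 2` an integer, is bounded from L²(ℝ) × L²(ℝ) to L¹(ℝ), uniformly in the truncation. -/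
theorem bilinear_hilbert_monomial_bounded (d : ℕ) (hd : 2 ≤ d) :
    ∃ C : ℝ, 0 < C ∧ ∀ (f g : SchwartzMap ℝ ℂ) (ε : ℝ), 0 < ε → ε < 1 →
      eLpNorm (fun x : ℝ =>
          ∫ t in {t : ℝ | ε < |t| ∧ |t| < 1}, f (x - t) * g (x - t ^ d) / (t : ℂ)) 1 volume ≤
        ENNReal.ofReal C * eLpNorm (⇑f) 2 volume * eLpNorm (⇑g) 2 volume := by
  obtain ⟨C, hC, H⟩ := exists_eLpNorm_curveOp_le hd
  refine ⟨4 * C, by positivity, fun f g ε hε hε1 => ?_⟩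
  have hre : ∀ h : SchwartzMap ℝ ℂ, Measurable fun y => (h y).re :=
    fun h => Complex.measurable_re.comp h.continuous.measurable
  have him : ∀ h : SchwartzMap ℝ ℂ, Measurable fun y => (h y).im :=
    fun h => Complex.measurable_im.comp h.continuous.measurable
  have hb : ∀ (h : SchwartzMap ℝ ℂ) y, ‖h y‖ ≤ SchwartzMap.seminorm ℝ 0 0 h :=
    fun h y => h.norm_le_seminorm ℝ y
  have bre : ∀ (h : SchwartzMap ℝ ℂ) y, |(h y).re| ≤ SchwartzMap.seminorm ℝ 0 0 h :=
    fun h y => (Complex.abs_re_le_norm _).trans (hb h y)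
  have bim : ∀ (h : SchwartzMap ℝ ℂ) y, |(h y).im| ≤ SchwartzMap.seminorm ℝ 0 0 h :=
    fun h y => (Complex.abs_im_le_norm _).trans (hb h y)
  have mem : ∀ h : SchwartzMap ℝ ℂ, MemLp h 2 volume := fun h => h.memLp 2 volume
  have mre : ∀ h : SchwartzMap ℝ ℂ, MemLp (fun y => (h y).re) 2 volume := fun h => (mem h).re
  have mim : ∀ h : SchwartzMap ℝ ℂ, MemLp (fun y => (h y).im) 2 volume := fun h => (mem h).im
  have nre : ∀ h : SchwartzMap ℝ ℂ, eLpNorm (fun y => (h y).re) 2 volume ≤ eLpNorm h 2 volume :=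
    fun h => eLpNorm_mono fun y => Complex.abs_re_le_norm _
  have nim : ∀ h : SchwartzMap ℝ ℂ, eLpNorm (fun y => (h y).im) 2 volume ≤ eLpNorm h 2 volume :=
    fun h => eLpNorm_mono fun y => Complex.abs_im_le_norm _
  set P := curveOp d (annulus ε 1) (fun y => (f y).re) (fun y => (g y).re) with hP
  set Q := curveOp d (annulus ε 1) (fun y => (f y).im) (fun y => (g y).im) with hQ
  set R := curveOp d (annulus ε 1) (fun y => (f y).re) (fun y => (g y).im) with hR
  set S := curveOp d (annulus ε 1) (fun y => (f y).im) (fun y => (g y).re) with hS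
  have aP := (aestronglyMeasurable_curveOp (hre f) (hre g) d (annulus ε 1)).norm
  have aQ := (aestronglyMeasurable_curveOp (him f) (him g) d (annulus ε 1)).norm
  have aR := (aestronglyMeasurable_curveOp (hre f) (him g) d (annulus ε 1)).norm
  have aS := (aestronglyMeasurable_curveOp (him f) (hre g) d (annulus ε 1)).norm
  set K := ENNReal.ofReal C * eLpNorm f 2 volume * eLpNorm g 2 volume with hK
  have eP : eLpNorm (fun x => ‖P x‖) 1 volume ≤ K := (eLpNorm_norm P).trans_le
    ((H ε _ _ _ _ hε hε1 (hre f) (hre g) (bre f) (bre g) (mre f) (mre g)).trans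
      (mul_le_mul' (mul_le_mul' le_rfl (nre f)) (nre g)))
  have eQ : eLpNorm (fun x => ‖Q x‖) 1 volume ≤ K := (eLpNorm_norm Q).trans_le
    ((H ε _ _ _ _ hε hε1 (him f) (him g) (bim f) (bim g) (mim f) (mim g)).trans
      (mul_le_mul' (mul_le_mul' le_rfl (nim f)) (nim g)))
  have eR : eLpNorm (fun x => ‖R x‖) 1 volume ≤ K := (eLpNorm_norm R).trans_le
    ((H ε _ _ _ _ hε hε1 (hre f) (him g) (bre f) (bim g) (mre f) (mim g)).trans
      (mul_le_mul' (mul_le_mul' le_rfl (nre f)) (nim g)))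
  have eS : eLpNorm (fun x => ‖S x‖) 1 volume ≤ K := (eLpNorm_norm S).trans_le
    ((H ε _ _ _ _ hε hε1 (him f) (hre g) (bim f) (bre g) (mim f) (mre g)).trans
      (mul_le_mul' (mul_le_mul' le_rfl (nim f)) (nre g)))
  calc _ ≤ eLpNorm ((fun x => ‖P x‖) + (fun x => ‖Q x‖) + ((fun x => ‖R x‖) + fun x => ‖S x‖))
        1 volume := eLpNorm_mono_real fun x => by
          rw [setIntegral_congr_set (setOf_abs_lt_ae_eq_annulus ε),
            setIntegral_annulus_complex_eq f.continuous.measurable g.continuous.measurable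
              (hb f) (hb g) d hε 1 x]
          exact norm_sub_add_mul_I_le _ _ _ _
    _ ≤ K + K + (K + K) := (eLpNorm_add_le (aP.add aQ) (aR.add aS) le_rfl).trans
        (add_le_add ((eLpNorm_add_le aP aQ le_rfl).trans (add_le_add eP eQ))
          ((eLpNorm_add_le aR aS le_rfl).trans (add_le_add eR eS)))
    _ = _ := by
        rw [ENNReal.ofReal_mul (by norm_num), mul_assoc, mul_assoc, ← mul_assoc (ENNReal.ofReal C),
          ← hK, ENNReal.ofReal_ofNat]
        ring
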